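/- Boundary value problem (C), solvable variant, for 2D magnetohydrostatics: Let Ω = 𝕊¹ × (0,L), α ∈ (0,1), and suppose (B₀,p₀) ∈ C^{2,α}(Ω;ℝ²) × C^{2,α}(Ω) solves the MHS equations with B̄₀² := inf_{Ω̄} |B₀²| > 0 and curl B₀ = 0; set J₀ := ∫_𝒞 B₀·n dS. There exist ε > 0, M > 0 sufficiently small and K > 0 (depending only on α, L, B̄₀²) such that: if ‖B₀¹‖_{C^{2,α}(Ω)} ≤ ε and h⁻ ∈ C^{2,α}(∂Ω₋), h⁺ ∈ C^{2,α}(∂Ω₊), f⁻ ∈ C^{2,α}(∂Ω₋), J ∈ ℝ satisfy ‖h⁻‖_{C^{2,α}(∂Ω₋)} + ‖h⁺‖_{C^{2,α}(∂Ω₊)} + ‖f⁻‖_{C^{2,α}(∂Ω₋)} + |J − J₀| ≤ KM, then there exists a unique (B,p) ∈ C^{2,α}(Ω;ℝ²) × C^{2,α}(Ω) solving the MHS equations with ‖B − B₀‖_{C^{2,α}(Ω)} ≤ M, p + |B|²/2 = p₀ + |B₀|²/2 + h⁻ on ∂Ω₋, ∂ₓ(p + |B|²/2) = ∂ₓ(p₀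 + |B₀|²/2) + ∂ₓh⁺ on ∂Ω₊, B·n = B₀·n + f⁻ on ∂Ω₋, and ∫_𝒞 B·n dS = J. -/

import Mathlib

open Set
open scoped ENNReal

noncomputable section

namespace EulerBVP

/-- The closed strip `Ω̄ = ℝ × [0, L]`, modelling `𝕊¹ × [0,L]`
(functions on it are required to be 1-periodic in the first variable). -/
def strip (L : ℝ) : Set (ℝ × ℝ) := Set.univ ×ˢ Set.Icc 0 L

/-- Uniform α-Hölder seminorm of `f` on `s`, valued in `ℝ≥0∞`. -/
def hSemi {E F : Type*} [NormedAddCommGroup E] [NormedAddCommGroup F]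
    (a : ℝ) (s : Set E) (f : E → F) : ℝ≥0∞ :=
  ⨆ x ∈ s, ⨆ y ∈ s, ENNReal.ofReal (‖f x - f y‖ / ‖x - y‖ ^ a)

/-- `C^{k,α}` norm of `f` on `s`: sup norms of the derivatives (within `s`) up to
order `k`, plus the `α`-Hölder seminorm of the order-`k` derivative. -/
def hNorm {E F : Type*} [NormedAddCommGroup E] [NormedSpace ℝ E]
    [NormedAddCommGroup F] [NormedSpace ℝ F]
    (k : ℕ) (a : ℝ) (s : Set E) (f : E → F) : ℝ≥0∞ :=
  (Finset.range (k + 1)).sum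
      (fun i => ⨆ x ∈ s, (‖iteratedFDerivWithin ℝ i f s x‖₊ : ℝ≥0∞))
    + hSemi a s (iteratedFDerivWithin ℝ k f s)

/-- Membership in the Hölder space `C^{k,α}(s)`. -/
def MemC {E F : Type*} [NormedAddCommGroup E] [NormedSpace ℝ E]
    [NormedAddCommGroup F] [NormedSpace ℝ F]
    (k : ℕ) (a : ℝ) (s : Set E) (f : E → F) : Prop :=
  ContDiffOn ℝ k f s ∧ hNorm k a s f < ⊤

/-- 1-periodicity in the first (circle) variable. -/
def PerX {F : Type*} (f : ℝ × ℝ → F) : Prop := ∀ x y, f (x + 1, y) = f (x, y)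

/-- 1-periodicity for functions on the boundary circle. -/
def Per {F : Type*} (f : ℝ → F) : Prop := ∀ x, f (x + 1) = f x

/-- Partial derivative in the first variable (within the strip). -/
def pdx (L : ℝ) (f : ℝ × ℝ → ℝ) (z : ℝ × ℝ) : ℝ := fderivWithin ℝ f (strip L) z (1, 0)

/-- Partial derivative in the second variable (within the strip). -/
def pdy (L : ℝ) (f : ℝ × ℝ → ℝ) (z : ℝ × ℝ) : ℝ := fderivWithin ℝ f (strip L) z (0, 1)

/-- First component of a planar vector field. -/
def c1 (v : ℝ × ℝ → ℝ × ℝ) : ℝ × ℝ → ℝ := fun z => (v z).1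

/-- Second component of a planar vector field. -/
def c2 (v : ℝ × ℝ → ℝ × ℝ) : ℝ × ℝ → ℝ := fun z => (v z).2

/-- Divergence `∂ₓ v¹ + ∂_y v²`. -/
def divF (L : ℝ) (v : ℝ × ℝ → ℝ × ℝ) (z : ℝ × ℝ) : ℝ := pdx L (c1 v) z + pdy L (c2 v) z

/-- Scalar curl `∂ₓ v² − ∂_y v¹`. -/
def curlF (L : ℝ) (v : ℝ × ℝ → ℝ × ℝ) (z : ℝ × ℝ) : ℝ := pdx L (c2 v) z - pdy L (c1 v) z

/-- Squared Euclidean length `|v|²` of a planar vector field. -/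
def sq (v : ℝ × ℝ → ℝ × ℝ) (z : ℝ × ℝ) : ℝ := (v z).1 ^ 2 + (v z).2 ^ 2

/-- The steady incompressible Euler equations `v·∇v = −∇p`, `div v = 0` on the strip. -/
def Euler (L : ℝ) (v : ℝ × ℝ → ℝ × ℝ) (p : ℝ × ℝ → ℝ) : Prop :=
  ∀ z ∈ strip L,
    ((v z).1 * pdx L (c1 v) z + (v z).2 * pdy L (c1 v) z = - pdx L p z) ∧
    ((v z).1 * pdx L (c2 v) z + (v z).2 * pdy L (c2 v) z = - pdy L p z) ∧
    divF L v z = 0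

/-- The magnetohydrostatic equations `B × j = −∇p`, `j = curl B`, `div B = 0` on the strip;
in 2D, `B × j = (−B² j, B¹ j)`. -/
def MHS (L : ℝ) (B : ℝ × ℝ → ℝ × ℝ) (p : ℝ × ℝ → ℝ) : Prop :=
  ∀ z ∈ strip L,
    (-(B z).2 * curlF L B z = - pdx L p z) ∧
    ((B z).1 * curlF L B z = - pdy L p z) ∧
    divF L B z = 0

/-- Flux across the segment `𝒞 = {0} × [0,L]`:  `∫_𝒞 w·n dS = −∫₀^L w¹(0,y) dy`. -/
def fluxC (L : ℝ) (w : ℝ × ℝ → ℝ × ℝ) : ℝ := - ∫ y in (0:ℝ)..L, (w (0, y)).1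

/-- A velocity/pressure pair of class `C^{k,α}` on the strip, periodic in `x`. -/
def VP (L : ℝ) (k : ℕ) (a : ℝ) (v : ℝ × ℝ → ℝ × ℝ) (p : ℝ × ℝ → ℝ) : Prop :=
  PerX v ∧ PerX p ∧ MemC k a (strip L) v ∧ MemC k a (strip L) p

/-- Boundary data of class `C^{k,α}(𝕊¹)`: a 1-periodic function in `C^{k,α}(ℝ)`. -/
def BData (k : ℕ) (a : ℝ) (f : ℝ → ℝ) : Prop := Per f ∧ MemC k a (Set.univ : Set ℝ) f

/-- A magnetic field/pressure pair of class `C^{k,α}` on the strip, periodic in `x`. -/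
def BP (L : ℝ) (k : ℕ) (a : ℝ) (B : ℝ × ℝ → ℝ × ℝ) (p : ℝ × ℝ → ℝ) : Prop :=
  PerX B ∧ PerX p ∧ MemC k a (strip L) B ∧ MemC k a (strip L) p

/-- Solution of the MHS equations with the solvable-variant boundary conditions of
problem (C): `p + |B|²/2 = p₀ + |B₀|²/2 + h⁻` on `∂Ω₋`,
`∂ₓ(p + |B|²/2) = ∂ₓ(p₀ + |B₀|²/2) + ∂ₓh⁺` on `∂Ω₊`, `B·n = B₀·n + f⁻` on `∂Ω₋`,
flux `J`, within `C^{2,α}`-distance `M` of `B₀`. -/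
def SolMCmod (L a M : ℝ) (B₀ : ℝ × ℝ → ℝ × ℝ) (p₀ : ℝ × ℝ → ℝ) (hm hp fm : ℝ → ℝ) (J : ℝ)
    (B : ℝ × ℝ → ℝ × ℝ) (p : ℝ × ℝ → ℝ) : Prop :=
  BP L 2 a B p ∧ MHS L B p ∧
  hNorm 2 a (strip L) (fun z => B z - B₀ z) ≤ ENNReal.ofReal M ∧
  (∀ x, p (x, 0) + sq B (x, 0) / 2 = p₀ (x, 0) + sq B₀ (x, 0) / 2 + hm x) ∧
  (∀ x, deriv (fun t => p (t, L) + sq B (t, L) / 2) x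
      = deriv (fun t => p₀ (t, L) + sq B₀ (t, L) / 2) x + deriv hp x) ∧
  (∀ x, -(B (x, 0)).2 = -(B₀ (x, 0)).2 + fm x) ∧
  fluxC L B = J

/-- `g` is bounded by `C` and `a`-Hölder continuous with constant `C`. -/
def HB (a C : ℝ) (g : ℝ → ℝ) : Prop :=
  (∀ x, |g x| ≤ C) ∧ ∀ x y, |g x - g y| ≤ C * |x - y| ^ a

/-- All first differences of `g` are Hölder functions of size proportional to the increment:
`C^{1,a}` regularity phrased through translations. -/
def LH (a K : ℝ) (g : ℝ → ℝ) : Prop := ∀ h, HB a (K * |h|) (fun x => g (x + h) - g x)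

theorem le_rpow_of_le_one {a t : ℝ} (ha1 : a ≤ 1) (ht : 0 ≤ t) (ht1 : t ≤ 1) (ha0 : 0 < a) :
    t ≤ t ^ a := by
  rcases ht.eq_or_lt with h | h
  · subst h; simp [Real.zero_rpow ha0.ne']
  · calc t = t ^ (1:ℝ) := (Real.rpow_one t).symm
      _ ≤ t ^ a := Real.rpow_le_rpow_of_exponent_ge h ht1 ha1

theorem mul_rpow_abs_nonneg {a C : ℝ} (hC : 0 ≤ C) (t : ℝ) : 0 ≤ C * |t| ^ a :=
  mul_nonneg hC (Real.rpow_nonneg (abs_nonneg _) _)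

namespace HB
variable {a C D : ℝ} {f g : ℝ → ℝ}

theorem nonneg (h : HB a C g) : 0 ≤ C := (abs_nonneg _).trans (h.1 0)

theorem mono (h : HB a C g) (hCD : C ≤ D) : HB a D g :=
  ⟨fun x => (h.1 x).trans hCD, fun x x' => (h.2 x x').trans
    (mul_le_mul_of_nonneg_right hCD (Real.rpow_nonneg (abs_nonneg _) _))⟩

theorem congr (h : HB a C f) (hfg : ∀ x, f x = g x) : HB a C g := by
  have : f = g := funext hfg
  exact this ▸ h

theorem add (hf : HB a C f) (hg : HB a D g) : HB a (C + D) (fun x => f x + g x) := by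
  refine ⟨fun x => (abs_add_le _ _).trans (add_le_add (hf.1 x) (hg.1 x)), fun x x' => ?_⟩
  have h1 := hf.2 x x'
  have h2 := hg.2 x x'
  calc |f x + g x - (f x' + g x')| = |(f x - f x') + (g x - g x')| := by ring_nf
    _ ≤ _ := abs_add_le _ _
    _ ≤ _ := by rw [add_mul]; exact add_le_add h1 h2

theorem neg (hf : HB a C f) : HB a C (fun x => -f x) := by
  refine ⟨fun x => by rw [abs_neg]; exact hf.1 x, fun x x' => ?_⟩
  rw [← abs_neg]; convert hf.2 x x' using 2; ring

theorem sub (hf : HB a C f) (hg : HB a D g) : HB a (C + D) (fun x => f x - g x) :=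
  (hf.add hg.neg).congr fun x => by ring

theorem const_mul (hf : HB a C f) (c : ℝ) : HB a (|c| * C) (fun x => c * f x) := by
  refine ⟨fun x => by
    rw [abs_mul]; exact mul_le_mul_of_nonneg_left (hf.1 x) (abs_nonneg _), fun x x' => ?_⟩
  rw [← mul_sub, abs_mul, mul_assoc]
  exact mul_le_mul_of_nonneg_left (hf.2 x x') (abs_nonneg _)

theorem mul (hf : HB a C f) (hg : HB a D g) : HB a (2 * C * D) (fun x => f x * g x) := by
  have hC := hf.nonneg
  have hD := hg.nonneg
  refine ⟨fun x => ?_, fun x x' => ?_⟩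
  · rw [abs_mul]
    calc |f x| * |g x| ≤ C * D := mul_le_mul (hf.1 x) (hg.1 x) (abs_nonneg _) hC
      _ ≤ 2 * C * D := by nlinarith [mul_nonneg hC hD]
  · have h1 := hf.2 x x'
    have h2 := hg.2 x x'
    calc |f x * g x - f x' * g x'| = |f x * (g x - g x') + (f x - f x') * g x'| := by ring_nf
      _ ≤ |f x| * |g x - g x'| + |f x - f x'| * |g x'| := by
          rw [← abs_mul, ← abs_mul]; exact abs_add_le _ _
      _ ≤ C * (D * |x - x'| ^ a) + (C * |x - x'| ^ a) * D :=
          add_le_add (mul_le_mul (hf.1 x) h2 (abs_nonneg _) hC)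
            (mul_le_mul h1 (hg.1 x') (abs_nonneg _) (mul_rpow_abs_nonneg hC _))
      _ = _ := by ring

theorem const (c : ℝ) : HB a |c| (fun _ => c) :=
  ⟨fun _ => le_rfl, fun x x' => by
    simp only [sub_self, abs_zero]; exact mul_rpow_abs_nonneg (abs_nonneg _) _⟩

theorem shift (hf : HB a C f) (h : ℝ) : HB a C (fun x => f (x + h)) :=
  ⟨fun x => hf.1 _, fun x x' => by
    convert hf.2 (x + h) (x' + h) using 4; ring⟩

theorem comp {Λ : ℝ} {σ : ℝ → ℝ} (ha0 : 0 < a) (ha1 : a ≤ 1) (hΛ : 1 ≤ Λ) (hf : HB a C f)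
    (hσ : ∀ x x', |σ x - σ x'| ≤ Λ * |x - x'|) : HB a (Λ * C) (fun x => f (σ x)) := by
  have hC := hf.nonneg
  refine ⟨fun x => (hf.1 _).trans (by nlinarith), fun x x' => (hf.2 _ _).trans ?_⟩
  have h1 : |σ x - σ x'| ^ a ≤ Λ * |x - x'| ^ a := by
    calc |σ x - σ x'| ^ a ≤ (Λ * |x - x'|) ^ a :=
          Real.rpow_le_rpow (abs_nonneg _) (hσ x x') ha0.le
      _ = Λ ^ a * |x - x'| ^ a := Real.mul_rpow (by linarith) (abs_nonneg _)
      _ ≤ Λ ^ (1:ℝ) * |x - x'| ^ a := by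
          gcongr
      _ = _ := by rw [Real.rpow_one]
  calc C * |σ x - σ x'| ^ a ≤ C * (Λ * |x - x'| ^ a) := mul_le_mul_of_nonneg_left h1 hC
    _ = _ := by ring

theorem of_lipschitz (ha0 : 0 < a) (ha1 : a ≤ 1) (h0 : ∀ x, |g x| ≤ C)
    (h1 : ∀ x x', |g x - g x'| ≤ C * |x - x'|) : HB a (2 * C) g := by
  have hC : 0 ≤ C := (abs_nonneg _).trans (h0 0)
  refine ⟨fun x => (h0 x).trans (by linarith), fun x x' => ?_⟩
  rcases le_total (|x - x'|) 1 with h | h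
  · have := le_rpow_of_le_one ha1 (abs_nonneg _) h ha0
    calc _ ≤ C * |x - x'| := h1 x x'
      _ ≤ 2 * C * |x - x'| ^ a := by
        have := Real.rpow_nonneg (abs_nonneg (x - x')) a
        nlinarith
  · have : 1 ≤ |x - x'| ^ a := Real.one_le_rpow h ha0.le
    calc _ ≤ |g x| + |g x'| := abs_sub _ _
      _ ≤ 2 * C * 1 := by linarith [h0 x, h0 x']
      _ ≤ _ := by gcongr

theorem of_deriv {g' : ℝ → ℝ} (ha0 : 0 < a) (ha1 : a ≤ 1) (h0 : ∀ x, |g x| ≤ C)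
    (hd : ∀ x, HasDerivAt g (g' x) x) (h1 : ∀ x, |g' x| ≤ C) : HB a (2 * C) g := by
  refine of_lipschitz ha0 ha1 h0 fun x x' => ?_
  have := (convex_univ (𝕜 := ℝ) (E := ℝ)).norm_image_sub_le_of_norm_hasDerivWithin_le
    (f := g) (f' := g') (C := C) (fun x _ => (hd x).hasDerivWithinAt)
    (fun x _ => h1 x) (mem_univ x') (mem_univ x)
  simpa [Real.norm_eq_abs] using this

theorem continuous (ha0 : 0 < a) (h : HB a C g) : Continuous g := by
  rw [continuous_iff_continuousAt]
  intro x
  have h2 : Filter.Tendsto (fun x' => C * |x' - x| ^ a) (nhds x) (nhds 0) := by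
    have : Continuous fun x' => C * |x' - x| ^ a :=
      continuous_const.mul ((continuous_abs.comp (continuous_id.sub continuous_const)).rpow_const
        (fun _ => Or.inr ha0.le))
    have h3 := this.tendsto x
    simpa [Real.zero_rpow ha0.ne'] using h3
  rw [ContinuousAt, tendsto_iff_dist_tendsto_zero]
  exact squeeze_zero (fun _ => dist_nonneg) (fun x' => h.2 x' x) h2

theorem of_tendsto {u : ℕ → ℝ → ℝ} (h : ∀ n, HB a C (u n))
    (hu : ∀ x, Filter.Tendsto (fun n => u n x) Filter.atTop (nhds (g x))) : HB a C g :=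
  ⟨fun x => le_of_tendsto (hu x).abs (Filter.Eventually.of_forall fun n => (h n).1 x),
   fun x x' => le_of_tendsto ((hu x).sub (hu x')).abs
    (Filter.Eventually.of_forall fun n => (h n).2 x x')⟩

end HB

namespace LH
variable {a K : ℝ} {f g : ℝ → ℝ}

theorem lip (h : LH a K g) (x x' : ℝ) : |g x - g x'| ≤ K * |x - x'| := by
  have := (h (x - x')).1 x'
  simpa using this

theorem nonneg (h : LH a K g) : 0 ≤ K := by
  have := (h 1).nonneg; simpa using this

theorem mono {K' : ℝ} (h : LH a K g) (hK : K ≤ K') : LH a K' g :=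
  fun t => (h t).mono (mul_le_mul_of_nonneg_right hK (abs_nonneg _))

theorem congr (h : LH a K f) (hfg : ∀ x, f x = g x) : LH a K g := by
  have : f = g := funext hfg
  exact this ▸ h

theorem add {K' : ℝ} (hf : LH a K f) (hg : LH a K' g) : LH a (K + K') (fun x => f x + g x) :=
  fun t => (((hf t).add (hg t)).mono (by rw [add_mul])).congr fun x => by ring

theorem neg (hf : LH a K f) : LH a K (fun x => -f x) :=
  fun t => (hf t).neg.congr fun x => by ring

theorem sub {K' : ℝ} (hf : LH a K f) (hg : LH a K' g) : LH a (K + K') (fun x => f x - g x) :=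
  (hf.add hg.neg).congr fun x => by ring

theorem const_mul (hf : LH a K f) (c : ℝ) : LH a (|c| * K) (fun x => c * f x) :=
  fun t => (((hf t).const_mul c).mono (by rw [mul_assoc])).congr fun x => by ring

theorem of_deriv {g' : ℝ → ℝ} (hd : ∀ x, HasDerivAt g (g' x) x) (h1 : HB a K g') :
    LH a K g := by
  intro h
  have key : ∀ E E' : ℝ → ℝ, (∀ t, HasDerivAt E (E' t) t) → ∀ B, (∀ t, |E' t| ≤ B) →
      |E h - E 0| ≤ B * |h| := by
    intro E E' hE B hB
    have := (convex_univ (𝕜 := ℝ) (E := ℝ)).norm_image_sub_le_of_norm_hasDerivWithin_le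
      (f := E) (f' := E') (C := B) (fun x _ => (hE x).hasDerivWithinAt)
      (fun x _ => hB x) (mem_univ 0) (mem_univ h)
    simpa [Real.norm_eq_abs] using this
  have hs : ∀ x t, HasDerivAt (fun t => g (x + t)) (g' (x + t)) t := fun x t => by
    simpa using (hd (x + t)).comp_const_add x t
  refine ⟨fun x => ?_, fun x x' => ?_⟩
  · simpa using key (fun t => g (x + t)) (fun t => g' (x + t)) (hs x) K (fun t => h1.1 _)
  · have := key (fun t => g (x + t) - g (x' + t)) (fun t => g' (x + t) - g' (x' + t))
      (fun t => (hs x t).sub (hs x' t)) (K * |x - x'| ^ a) (fun t => by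
        convert h1.2 (x + t) (x' + t) using 4; ring)
    simp only [add_zero] at this
    calc _ = |g (x + h) - g (x' + h) - (g x - g x')| := by ring_nf
      _ ≤ _ := this
      _ = _ := by ring

theorem comp_diff {δ Λ : ℝ} {k s1 s2 : ℝ → ℝ} (ha0 : 0 < a) (ha1 : a ≤ 1) (hΛ : 1 ≤ Λ)
    (hk : LH a K k) (hs : ∀ x x', |s2 x - s2 x'| ≤ Λ * |x - x'|)
    (hd : HB a δ (fun x => s1 x - s2 x)) :
    HB a ((Λ + 1) * (K * δ)) (fun x => k (s1 x) - k (s2 x)) := by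
  have hK := hk.nonneg
  have hδ := hd.nonneg
  refine ⟨fun x => ?_, fun x x' => ?_⟩
  · calc _ ≤ K * |s1 x - s2 x| := hk.lip _ _
      _ ≤ K * δ := mul_le_mul_of_nonneg_left (hd.1 x) hK
      _ ≤ _ := by nlinarith [mul_nonneg hK hδ]
  · have h1 := (hk (s1 x - s2 x)).2 (s2 x) (s2 x')
    have h2 := hk.lip (s2 x' + (s1 x - s2 x)) (s1 x')
    have h3 := hd.1 x
    have h4 := hd.2 x x'
    have h5 : |s2 x - s2 x'| ^ a ≤ Λ * |x - x'| ^ a := by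
      calc |s2 x - s2 x'| ^ a ≤ (Λ * |x - x'|) ^ a :=
            Real.rpow_le_rpow (abs_nonneg _) (hs x x') ha0.le
        _ = Λ ^ a * |x - x'| ^ a := Real.mul_rpow (by linarith) (abs_nonneg _)
        _ ≤ Λ ^ (1:ℝ) * |x - x'| ^ a := by
            gcongr
        _ = _ := by rw [Real.rpow_one]
    have h6 : s2 x' + (s1 x - s2 x) - s1 x' = s1 x - s2 x - (s1 x' - s2 x') := by ring
    rw [h6] at h2
    have h7 : s2 x + (s1 x - s2 x) = s1 x := by ring
    simp only [h7] at h1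
    calc |k (s1 x) - k (s2 x) - (k (s1 x') - k (s2 x'))|
        = |(k (s1 x) - k (s2 x) - (k (s2 x' + (s1 x - s2 x)) - k (s2 x')))
            + (k (s2 x' + (s1 x - s2 x)) - k (s1 x'))| := by ring_nf
      _ ≤ _ := abs_add_le _ _
      _ ≤ K * |s1 x - s2 x| * |s2 x - s2 x'| ^ a + K * |s1 x - s2 x - (s1 x' - s2 x')| :=
          add_le_add h1 h2
      _ ≤ K * δ * (Λ * |x - x'| ^ a) + K * (δ * |x - x'| ^ a) := by
          have := Real.rpow_nonneg (abs_nonneg (s2 x - s2 x')) a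
          gcongr
      _ = _ := by ring

theorem exists_deriv (ha0 : 0 < a) (h : LH a K g) : ∃ g' : ℝ → ℝ, ∀ x, HasDerivAt g (g' x) x := by
  have hK := h.nonneg
  have hlip : LipschitzWith K.toNNReal g := LipschitzWith.of_dist_le_mul fun x y => by
    rw [Real.coe_toNNReal _ hK]; exact h.lip x y
  have hae := hlip.ae_differentiableAt_real
  suffices ∀ x, ∃ l, HasDerivAt g l x by
    choose g' hg' using this; exact ⟨g', hg'⟩
  intro x
  have hq : Cauchy (Filter.map (slope g x) (nhdsWithin x {x}ᶜ)) := by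
    rw [Metric.cauchy_iff]
    refine ⟨Filter.map_neBot, fun ε hε => ?_⟩
    -- choose a nearby point of differentiability
    have hcont : Filter.Tendsto (fun x' => K * |x' - x| ^ a) (nhds x) (nhds 0) := by
      have : Continuous fun x' => K * |x' - x| ^ a :=
        continuous_const.mul ((continuous_abs.comp
          (continuous_id.sub continuous_const)).rpow_const (fun _ => Or.inr ha0.le))
      have h3 := this.tendsto x
      simpa [Real.zero_rpow ha0.ne'] using h3
    have hev : ∀ᶠ x' in nhds x, K * |x' - x| ^ a < ε / 4 :=
      hcont.eventually_lt_const (by positivity)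
    obtain ⟨U, hU, hUo, hxU⟩ := eventually_nhds_iff.1 hev
    have hdense := MeasureTheory.Measure.dense_of_ae hae
    obtain ⟨z, hzU, hz⟩ := hdense.inter_open_nonempty U hUo ⟨x, hxU⟩
    have hzd : HasDerivAt g (deriv g z) z := DifferentiableAt.hasDerivAt hz
    rw [hasDerivAt_iff_tendsto_slope_zero] at hzd
    have hz4 := hU z hzU
    have e1 : ∀ᶠ t in nhdsWithin (0:ℝ) {0}ᶜ,
        |t⁻¹ • (g (z + t) - g z) - deriv g z| < ε / 4 := by
      have := Metric.tendsto_nhds.1 hzd (ε / 4) (by positivity)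
      simpa [Real.dist_eq] using this
    have hmap : Filter.Tendsto (fun y => y - x) (nhdsWithin x {x}ᶜ) (nhdsWithin 0 {0}ᶜ) := by
      refine tendsto_nhdsWithin_iff.2 ⟨?_, ?_⟩
      · have : Continuous fun y : ℝ => y - x := by fun_prop
        have h2 := this.tendsto x
        simp only [sub_self] at h2
        exact h2.mono_left nhdsWithin_le_nhds
      · filter_upwards [self_mem_nhdsWithin] with y hy
        simpa [sub_eq_zero] using hy
    have e2 := hmap.eventually e1
    refine ⟨slope g x '' {y | y ∈ ({x}ᶜ : Set ℝ) ∧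
      |(y - x)⁻¹ • (g (z + (y - x)) - g z) - deriv g z| < ε / 4}, ?_, ?_⟩
    · exact Filter.image_mem_map (Filter.inter_mem self_mem_nhdsWithin e2)
    · have hpt : ∀ y, y ∈ ({x}ᶜ : Set ℝ) →
          |(y - x)⁻¹ • (g (z + (y - x)) - g z) - deriv g z| < ε / 4 →
          |slope g x y - deriv g z| < ε / 2 := by
        intro y hy h2
        have hyx : y - x ≠ 0 := sub_ne_zero.2 hy
        have h1 := (h (y - x)).2 z x
        simp only [smul_eq_mul] at h2
        rw [slope_def_field]
        have h3 : |(y - x)⁻¹ * (g (z + (y - x)) - g z) - (g y - g x) / (y - x)| < ε / 4 := by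
          have : (y - x)⁻¹ * (g (z + (y - x)) - g z) - (g y - g x) / (y - x)
            = (g (z + (y - x)) - g z - (g (x + (y - x)) - g x)) / (y - x) := by
              rw [show x + (y - x) = y by ring]; field_simp
          rw [this, abs_div, div_lt_iff₀ (abs_pos.2 hyx)]
          calc _ ≤ _ := h1
            _ = (K * |z - x| ^ a) * |y - x| := by ring
            _ < _ := mul_lt_mul_of_pos_right hz4 (abs_pos.2 hyx)
        rw [abs_lt] at *
        constructor <;> linarith [h2.1, h2.2, h3.1, h3.2]
      rintro _ ⟨y, ⟨hy, h2⟩, rfl⟩ _ ⟨y', ⟨hy', h2'⟩, rfl⟩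
      have p1 := hpt y hy h2
      have p2 := hpt y' hy' h2'
      rw [Real.dist_eq]
      rw [abs_lt] at *
      constructor <;> linarith [p1.1, p1.2, p2.1, p2.2]
  obtain ⟨l, hl⟩ := CompleteSpace.complete hq
  exact ⟨l, hasDerivAt_iff_tendsto_slope.2 hl⟩

end LH

/-- Limits of difference quotients inherit bounds. -/
theorem deriv_sub_le_of_diff {g1 g2 : ℝ → ℝ} {d1 d2 x1 x2 B : ℝ} (h1 : HasDerivAt g1 d1 x1)
    (h2 : HasDerivAt g2 d2 x2)
    (hB : ∀ h, |(g1 (x1 + h) - g1 x1) - (g2 (x2 + h) - g2 x2)| ≤ B * |h|) : |d1 - d2| ≤ B := by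
  rw [hasDerivAt_iff_tendsto_slope_zero] at h1 h2
  refine le_of_tendsto (h1.sub h2).abs ?_
  filter_upwards [self_mem_nhdsWithin] with t ht
  have ht' : t ≠ 0 := ht
  rw [← smul_sub, smul_eq_mul, abs_mul, abs_inv, inv_mul_le_iff₀ (abs_pos.2 ht')]
  linarith [hB t]

theorem LH.deriv_HB {a K : ℝ} {g g' : ℝ → ℝ} (h : LH a K g)
    (hd : ∀ x, HasDerivAt g (g' x) x) : HB a K g' := by
  refine ⟨fun x => ?_, fun x x' => ?_⟩
  · have := deriv_sub_le_of_diff (hd x) (hasDerivAt_const x (0:ℝ)) (B := K) (fun t => by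
      simpa using (h t).1 x)
    simpa using this
  · exact deriv_sub_le_of_diff (hd x) (hd x') (fun t => by
      have := (h t).2 x x'
      linarith)

/-- The family `S = (u, uₓ, u_y, uₓₓ, uₓ_y)` of a periodic solution `u` of `Δ u = f`
on the strip. -/
structure Sol (L : ℝ) (S : Fin 5 → ℝ → ℝ → ℝ) (f : ℝ → ℝ → ℝ) : Prop where
  dx0 : ∀ y ∈ Icc 0 L, ∀ x, HasDerivAt (fun t => S 0 t y) (S 1 x y) x
  dx1 : ∀ y ∈ Icc 0 L, ∀ x, HasDerivAt (fun t => S 1 t y) (S 3 x y) x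
  dx2 : ∀ y ∈ Icc 0 L, ∀ x, HasDerivAt (fun t => S 2 t y) (S 4 x y) x
  dy0 : ∀ y ∈ Icc 0 L, ∀ x, HasDerivWithinAt (fun t => S 0 x t) (S 2 x y) (Icc 0 L) y
  dy1 : ∀ y ∈ Icc 0 L, ∀ x, HasDerivWithinAt (fun t => S 1 x t) (S 4 x y) (Icc 0 L) y
  dy2 : ∀ y ∈ Icc 0 L, ∀ x, HasDerivWithinAt (fun t => S 2 x t) (f x y - S 3 x y) (Icc 0 L) y
  per : ∀ i, ∀ y ∈ Icc 0 L, ∀ x, S i (x + 1) y = S i x y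
  cont : ∀ i, ContinuousOn (fun z : ℝ × ℝ => S i z.1 z.2) (strip L)

theorem Sol.add {L : ℝ} {S T : Fin 5 → ℝ → ℝ → ℝ} {f g : ℝ → ℝ → ℝ} (hS : Sol L S f)
    (hT : Sol L T g) : Sol L (fun i x y => S i x y + T i x y) (fun x y => f x y + g x y) where
  dx0 y hy x := (hS.dx0 y hy x).add (hT.dx0 y hy x)
  dx1 y hy x := (hS.dx1 y hy x).add (hT.dx1 y hy x)
  dx2 y hy x := (hS.dx2 y hy x).add (hT.dx2 y hy x)
  dy0 y hy x := (hS.dy0 y hy x).add (hT.dy0 y hy x)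
  dy1 y hy x := (hS.dy1 y hy x).add (hT.dy1 y hy x)
  dy2 y hy x := ((hS.dy2 y hy x).add (hT.dy2 y hy x)).congr_deriv (by ring)
  per i y hy x := by rw [hS.per i y hy x, hT.per i y hy x]
  cont i := (hS.cont i).add (hT.cont i)

theorem Sol.neg {L : ℝ} {S : Fin 5 → ℝ → ℝ → ℝ} {f : ℝ → ℝ → ℝ} (hS : Sol L S f) :
    Sol L (fun i x y => -S i x y) (fun x y => -f x y) where
  dx0 y hy x := (hS.dx0 y hy x).neg
  dx1 y hy x := (hS.dx1 y hy x).neg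
  dx2 y hy x := (hS.dx2 y hy x).neg
  dy0 y hy x := (hS.dy0 y hy x).neg
  dy1 y hy x := (hS.dy1 y hy x).neg
  dy2 y hy x := ((hS.dy2 y hy x).neg).congr_deriv (by ring)
  per i y hy x := by rw [hS.per i y hy x]
  cont i := (hS.cont i).neg

theorem Sol.congr_rhs {L : ℝ} {S : Fin 5 → ℝ → ℝ → ℝ} {f g : ℝ → ℝ → ℝ} (hS : Sol L S f)
    (h : ∀ x, ∀ y ∈ Icc 0 L, f x y = g x y) : Sol L S g :=
  { hS with dy2 := fun y hy x => h x y hy ▸ hS.dy2 y hy x }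

theorem Sol.sub {L : ℝ} {S T : Fin 5 → ℝ → ℝ → ℝ} {f g : ℝ → ℝ → ℝ} (hS : Sol L S f)
    (hT : Sol L T g) : Sol L (fun i x y => S i x y - T i x y) (fun x y => f x y - g x y) := by
  simpa only [sub_eq_add_neg] using hS.add hT.neg

theorem Sol.shift {L : ℝ} {S : Fin 5 → ℝ → ℝ → ℝ} {f : ℝ → ℝ → ℝ} (hS : Sol L S f) (h : ℝ) :
    Sol L (fun i x y => S i (x + h) y) (fun x y => f (x + h) y) where
  dx0 y hy x := (hS.dx0 y hy (x + h)).comp_add_const x h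
  dx1 y hy x := (hS.dx1 y hy (x + h)).comp_add_const x h
  dx2 y hy x := (hS.dx2 y hy (x + h)).comp_add_const x h
  dy0 y hy x := hS.dy0 y hy (x + h)
  dy1 y hy x := hS.dy1 y hy (x + h)
  dy2 y hy x := hS.dy2 y hy (x + h)
  per i y hy x := by rw [← hS.per i y hy (x + h)]; ring_nf
  cont i := by
    have : (fun z : ℝ × ℝ => S i (z.1 + h) z.2) =
      (fun z : ℝ × ℝ => S i z.1 z.2) ∘ (fun z : ℝ × ℝ => (z.1 + h, z.2)) := rfl
    rw [this]
    refine (hS.cont i).comp (by fun_prop) fun z hz => ?_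
    exact ⟨mem_univ _, hz.2⟩

theorem IsLocalMax.second_deriv_nonpos {g g' : ℝ → ℝ} {d t : ℝ} (hm : IsLocalMax g t)
    (h1 : ∀ᶠ s in nhds t, HasDerivAt g (g' s) s) (h2 : HasDerivAt g' d t) : d ≤ 0 := by
  by_contra! hd
  have e1 : deriv g =ᶠ[nhds t] g' := h1.mono fun s hs => hs.deriv
  have e2 : deriv (deriv g) t = d := (e1.deriv_eq).trans h2.deriv
  have hmin : IsLocalMin g t := isLocalMin_of_deriv_deriv_pos (by rw [e2]; exact hd)
    hm.deriv_eq_zero h1.self_of_nhds.continuousAt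
  have hc : g =ᶠ[nhds t] fun _ => g t := by
    filter_upwards [hm, hmin] with s hs hs'
    exact le_antisymm hs hs'
  have h3 : deriv (deriv g) t = 0 := by
    have : deriv g =ᶠ[nhds t] deriv (fun _ => g t) := hc.deriv
    rw [this.deriv_eq]; simp
  linarith

theorem fract_of_per {S : ℝ → ℝ} (h : ∀ x, S (x + 1) = S x) (x : ℝ) : S (Int.fract x) = S x := by
  have hp : Function.Periodic S 1 := h
  have h2 := hp.sub_int_mul_eq (x := x) ⌊x⌋
  rwa [mul_one] at h2

theorem Sol.nonpos {L : ℝ} (hL : 0 < L) {S : Fin 5 → ℝ → ℝ → ℝ} (hS : Sol L S fun _ _ => 0)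
    (h0 : ∀ x, S 0 x 0 = 0) (h1 : ∀ x, S 0 x L = 0) (x : ℝ) (y : ℝ) (hy : y ∈ Icc 0 L) :
    S 0 x y ≤ 0 := by
  by_contra! hpos
  set ε := S 0 x y / (2 * L ^ 2) with hε
  have hεpos : 0 < ε := by positivity
  let v : ℝ × ℝ → ℝ := fun z => S 0 z.1 z.2 + ε * z.2 ^ 2
  have hvc : ContinuousOn v (strip L) := (hS.cont 0).add (by fun_prop)
  have hcomp : IsCompact (Icc (0:ℝ) 1 ×ˢ Icc (0:ℝ) L) := isCompact_Icc.prod isCompact_Icc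
  have hsub : Icc (0:ℝ) 1 ×ˢ Icc (0:ℝ) L ⊆ strip L := fun z hz => ⟨mem_univ _, hz.2⟩
  obtain ⟨⟨xs, ys⟩, hz, hmax⟩ := hcomp.exists_isMaxOn
    ⟨(0, 0), ⟨⟨le_rfl, zero_le_one⟩, ⟨le_rfl, hL.le⟩⟩⟩ (hvc.mono hsub)
  have hmax' : ∀ x', ∀ y' ∈ Icc 0 L, v (x', y') ≤ v (xs, ys) := by
    intro x' y' hy'
    have h2 := hmax (show (Int.fract x', y') ∈ Icc (0:ℝ) 1 ×ˢ Icc (0:ℝ) L from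
      ⟨⟨Int.fract_nonneg _, (Int.fract_lt_one _).le⟩, hy'⟩)
    have h3 := fract_of_per (S := fun t => S 0 t y') (fun t => hS.per 0 y' hy' t) x'
    change S 0 x' y' + ε * y' ^ 2 ≤ _
    rw [← h3]; exact h2
  have hys : ys ∈ Icc 0 L := hz.2
  have hval : ε * L ^ 2 < v (xs, ys) := by
    have := hmax' x y hy
    have h3 : ε * L ^ 2 = S 0 x y / 2 := by rw [hε]; field_simp
    have h4 : S 0 x y ≤ v (x, y) := by simp only [v]; nlinarith [sq_nonneg y]
    linarith
  have hys0 : 0 < ys := by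
    rcases hys.1.eq_or_lt with h | h
    · exfalso; simp only [v, ← h, h0] at hval; nlinarith [sq_nonneg L]
    · exact h
  have hysL : ys < L := by
    rcases hys.2.eq_or_lt with h | h
    · exfalso; simp only [v, h, h1] at hval; linarith
    · exact h
  have hnb : ∀ᶠ s in nhds ys, s ∈ Ioo 0 L := Ioo_mem_nhds hys0 hysL
  have d1 : S 3 xs ys ≤ 0 := by
    refine IsLocalMax.second_deriv_nonpos (g := fun t => S 0 t ys) (g' := fun t => S 1 t ys)
      ?_ (Filter.Eventually.of_forall fun s => hS.dx0 ys hys s) (hS.dx1 ys hys xs)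
    refine Filter.Eventually.of_forall fun s => ?_
    have := hmax' s ys hys
    simp only [v] at this
    linarith
  have d2 : 0 - S 3 xs ys + 2 * ε ≤ 0 := by
    refine IsLocalMax.second_deriv_nonpos (g := fun t => S 0 xs t + ε * t ^ 2)
      (g' := fun t => S 2 xs t + ε * (2 * t)) (t := ys) ?_ ?_ ?_
    · filter_upwards [hnb] with s hs
      exact hmax' xs s (Ioo_subset_Icc_self hs)
    · filter_upwards [hnb] with s hs
      have := (hS.dy0 s (Ioo_subset_Icc_self hs) xs).hasDerivAt (Icc_mem_nhds hs.1 hs.2)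
      refine this.add ?_
      simpa using (hasDerivAt_pow 2 s).const_mul ε
    · have := (hS.dy2 ys hys xs).hasDerivAt (Icc_mem_nhds hys0 hysL)
      refine (this.add (((hasDerivAt_id ys).const_mul 2).const_mul ε)).congr_deriv ?_
      ring
  linarith

theorem Sol.eq_zero {L : ℝ} (hL : 0 < L) {S : Fin 5 → ℝ → ℝ → ℝ} (hS : Sol L S fun _ _ => 0)
    (h0 : ∀ x, S 0 x 0 = 0) (h1 : ∀ x, S 0 x L = 0) (i : Fin 5) (x : ℝ) (y : ℝ)
    (hy : y ∈ Icc 0 L) : S i x y = 0 := by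
  have z0 : ∀ x, ∀ y ∈ Icc 0 L, S 0 x y = 0 := by
    intro x y hy
    refine le_antisymm (hS.nonpos hL h0 h1 x y hy) ?_
    have h := hS.neg.congr_rhs (g := fun _ _ => 0) (by simp)
    have := h.nonpos hL (by simpa using h0) (by simpa using h1) x y hy
    linarith
  have z1 : ∀ x, ∀ y ∈ Icc 0 L, S 1 x y = 0 := by
    intro x y hy
    have := (hS.dx0 y hy x).deriv
    rw [← this]
    have : (fun t => S 0 t y) = fun _ => 0 := funext fun t => z0 t y hy
    rw [this]; simp
  have z2 : ∀ x, ∀ y ∈ Icc 0 L, S 2 x y = 0 := by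
    intro x y hy
    have h := hS.dy0 y hy x
    have h' : HasDerivWithinAt (fun t => S 0 x t) 0 (Icc 0 L) y :=
      (hasDerivWithinAt_const y (Icc 0 L) (0:ℝ)).congr (fun t ht => z0 x t ht) (z0 x y hy)
    exact ((uniqueDiffOn_Icc hL) y hy).eq_deriv _ h h'
  fin_cases i
  · exact z0 x y hy
  · exact z1 x y hy
  · exact z2 x y hy
  · have := (hS.dx1 y hy x).deriv
    show S 3 x y = 0
    rw [← this]
    have : (fun t => S 1 t y) = fun _ => 0 := funext fun t => z1 t y hy
    rw [this]; simp
  · have := (hS.dx2 y hy x).deriv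
    show S 4 x y = 0
    rw [← this]
    have : (fun t => S 2 t y) = fun _ => 0 := funext fun t => z2 t y hy
    rw [this]; simp

theorem Sol.unique {L : ℝ} (hL : 0 < L) {S T : Fin 5 → ℝ → ℝ → ℝ} {f : ℝ → ℝ → ℝ}
    (hS : Sol L S f) (hT : Sol L T f) (h0 : ∀ x, S 0 x 0 = T 0 x 0)
    (h1 : ∀ x, S 0 x L = T 0 x L) (i : Fin 5) (x : ℝ) (y : ℝ) (hy : y ∈ Icc 0 L) :
    S i x y = T i x y := by
  have h := (hS.sub hT).congr_rhs (g := fun _ _ => 0) (by simp)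
  have := h.eq_zero hL (by simpa [sub_eq_zero] using h0) (by simpa [sub_eq_zero] using h1) i x y hy
  linarith

/-- The positive frequencies of 1-periodic functions. -/
def kap (n : ℕ) : ℝ := 2 * Real.pi * (n + 1)

theorem kap_pos (n : ℕ) : 0 < kap n := by unfold kap; positivity

theorem kap_ge (n : ℕ) : 2 * Real.pi ≤ kap n := by
  unfold kap
  have : (0:ℝ) ≤ n := n.cast_nonneg
  nlinarith [Real.pi_pos]

/-- Duhamel integral `∫_b^y e^{lam (y - t) + mu} c(t) dt`. -/
def duh (b lam mu : ℝ) (c : ℝ → ℂ) (y : ℝ) : ℂ :=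
  ∫ t in b..y, (Real.exp (lam * (y - t) + mu) : ℂ) * c t

theorem duh_hasDerivAt {b lam mu : ℝ} {c : ℝ → ℂ} (hc : Continuous c) (y : ℝ) :
    HasDerivAt (duh b lam mu c) (lam * duh b lam mu c y + (Real.exp mu : ℂ) * c y) y := by
  have h1 : duh b lam mu c = fun y => (Real.exp (lam * y + mu) : ℂ) *
      ∫ t in b..y, (Real.exp (-lam * t) : ℂ) * c t := by
    funext y
    rw [duh, ← intervalIntegral.integral_const_mul]
    congr 1
    funext t
    rw [← mul_assoc, ← Complex.ofReal_mul, ← Real.exp_add]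
    ring_nf
  have hcont : Continuous fun t => (Real.exp (-lam * t) : ℂ) * c t := by fun_prop
  have d1 : HasDerivAt (fun y => ∫ t in b..y, (Real.exp (-lam * t) : ℂ) * c t)
      ((Real.exp (-lam * y) : ℂ) * c y) y :=
    intervalIntegral.integral_hasDerivAt_right (hcont.intervalIntegrable _ _)
      (hcont.stronglyMeasurableAtFilter _ _) hcont.continuousAt
  have d2 : HasDerivAt (fun y => (Real.exp (lam * y + mu) : ℂ))
      ((Real.exp (lam * y + mu) * lam : ℝ) : ℂ) y := by
    apply HasDerivAt.ofReal_comp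
    have : HasDerivAt (fun y : ℝ => lam * y + mu) lam y := by
      simpa using ((hasDerivAt_id y).const_mul lam).add_const mu
    exact this.exp
  rw [h1]
  refine (d2.mul d1).congr_deriv ?_
  have h3 : (Real.exp (lam * y + mu) : ℂ) * (Real.exp (-lam * y) : ℂ) = (Real.exp mu : ℂ) := by
    rw [← Complex.ofReal_mul, ← Real.exp_add]; congr 2; ring
  rw [← mul_assoc, h3, Complex.ofReal_mul]
  ring

/-- The four phases of the Dirichlet Green function of the strip. -/
def phs (L : ℝ) (j : Fin 4) (y t : ℝ) : ℝ :=
  ![|y - t|, 2 * L - |y - t|, y + t, 2 * L - y - t] j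

theorem phs_ge {L : ℝ} (j : Fin 4) {y t : ℝ} (hy : y ∈ Icc 0 L) (ht : t ∈ Icc 0 L) :
    |y - t| ≤ phs L j y t := by
  obtain ⟨h1, h2⟩ := hy
  obtain ⟨h3, h4⟩ := ht
  have h5 : |y - t| ≤ L := abs_le.2 ⟨by linarith, by linarith⟩
  fin_cases j
  · exact le_rfl
  · change |y - t| ≤ 2 * L - |y - t|; linarith
  · change |y - t| ≤ y + t; exact abs_le.2 ⟨by linarith, by linarith⟩
  · change |y - t| ≤ 2 * L - y - t; exact abs_le.2 ⟨by linarith, by linarith⟩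

theorem phs_le {L : ℝ} (j : Fin 4) {y t : ℝ} (hy : y ∈ Icc 0 L) (ht : t ∈ Icc 0 L) :
    phs L j y t ≤ 2 * L := by
  obtain ⟨h1, h2⟩ := hy
  obtain ⟨h3, h4⟩ := ht
  fin_cases j <;> simp [phs, abs_le]
  · constructor <;> linarith
  · linarith
  · linarith

theorem phs_lip {L : ℝ} (j : Fin 4) (y y' t : ℝ) :
    |phs L j y t - phs L j y' t| ≤ |y - y'| := by
  fin_cases j <;> simp [phs]
  · have := abs_abs_sub_abs_le_abs_sub (y - t) (y' - t)
    simpa using this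
  · have := abs_abs_sub_abs_le_abs_sub (y' - t) (y - t)
    simpa [abs_sub_comm y y'] using this
  · exact (abs_sub_comm _ _).le

theorem phs_cont (L : ℝ) (j : Fin 4) (y : ℝ) : Continuous (phs L j y) := by
  fin_cases j
  · change Continuous fun t => |y - t|; fun_prop
  · change Continuous fun t => 2 * L - |y - t|; fun_prop
  · change Continuous fun t => y + t; fun_prop
  · change Continuous fun t => 2 * L - y - t; fun_prop

/-- Kernel integral of the mode `n` with phase `j` and sign factor `sg`. -/
def ker (L : ℝ) (j : Fin 4) (sg : ℝ → ℝ) (k : ℝ) (c : ℝ → ℂ) (y : ℝ) : ℂ :=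
  ∫ t in (0:ℝ)..L, (sg (y - t) * Real.exp (-k * phs L j y t) : ℝ) * c t

/-- The admissible sign factors. -/
def SgOK (sg : ℝ → ℝ) : Prop :=
  Measurable sg ∧ (∀ t, |sg t| ≤ 1) ∧ (∀ s t, 0 < s → 0 < t → sg s = sg t) ∧
    ∀ s t, s < 0 → t < 0 → sg s = sg t

theorem sgOK_one : SgOK (fun _ => 1) := ⟨measurable_const, by simp, by simp, by simp⟩

theorem sgOK_sign : SgOK Real.sign := by
  refine ⟨?_, fun t => ?_, fun s t hs ht => ?_, fun s t hs ht => ?_⟩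
  · unfold Real.sign
    exact Measurable.ite measurableSet_Iio measurable_const
      (Measurable.ite measurableSet_Ioi measurable_const measurable_const)
  · rcases Real.sign_apply_eq t with h | h | h <;> simp [h]
  · rw [Real.sign_of_pos hs, Real.sign_of_pos ht]
  · rw [Real.sign_of_neg hs, Real.sign_of_neg ht]

theorem ker_integrable {L : ℝ} (j : Fin 4) {sg : ℝ → ℝ} (hsg : SgOK sg) (k : ℝ) {c : ℝ → ℂ}
    (hc : Continuous c) (y b b' : ℝ) : IntervalIntegrable
      (fun t => ((sg (y - t) * Real.exp (-k * phs L j y t) : ℝ) : ℂ) * c t)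
      MeasureTheory.volume b b' := by
  have h1 : Continuous fun t => ((Real.exp (-k * phs L j y t) : ℝ) : ℂ) * c t := by
    have := phs_cont L j y
    fun_prop
  refine (h1.intervalIntegrable b b').mono_fun ?_ ?_
  · refine Measurable.aestronglyMeasurable ?_
    have h2 : Measurable fun t => sg (y - t) := hsg.1.comp (by fun_prop)
    have h3 : Measurable fun t => Real.exp (-k * phs L j y t) := by
      have := (phs_cont L j y).measurable; fun_prop
    exact (Complex.measurable_ofReal.comp (h2.mul h3)).mul hc.measurable
  · refine Filter.Eventually.of_forall fun t => ?_
    simp only [Complex.ofReal_mul, norm_mul, Complex.norm_real, Real.norm_eq_abs]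
    have := hsg.2.1 (y - t)
    gcongr
    calc _ ≤ 1 * |Real.exp (-k * phs L j y t)| := by gcongr
      _ = _ := one_mul _

theorem ker_split {L : ℝ} (j : Fin 4) {sg : ℝ → ℝ} (hsg : SgOK sg) (k : ℝ) {c : ℝ → ℂ}
    (hc : Continuous c) {y : ℝ} (hy : y ∈ Icc 0 L) (lp mp lm mm : ℝ)
    (hp : ∀ t < y, -k * phs L j y t = lp * (y - t) + mp)
    (hm : ∀ t, y < t → -k * phs L j y t = lm * (y - t) + mm) :
    ker L j sg k c y = sg 1 * duh 0 lp mp c y - sg (-1) * duh L lm mm c y := by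
  have h1 : ∫ t in (0:ℝ)..y, ((sg (y - t) * Real.exp (-k * phs L j y t) : ℝ) : ℂ) * c t
      = sg 1 * duh 0 lp mp c y := by
    rw [duh, ← intervalIntegral.integral_const_mul]
    refine intervalIntegral.integral_congr_Ioo_of_le hy.1 fun t ht => ?_
    have e : sg (y - t) = sg 1 := hsg.2.2.1 _ _ (by linarith [ht.2]) one_pos
    rw [e, hp t ht.2, Complex.ofReal_mul, mul_assoc]
  have h2 : ∫ t in y..L, ((sg (y - t) * Real.exp (-k * phs L j y t) : ℝ) : ℂ) * c t
      = - (sg (-1) * duh L lm mm c y) := by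
    rw [duh, ← intervalIntegral.integral_const_mul, ← intervalIntegral.integral_symm]
    refine intervalIntegral.integral_congr_Ioo_of_le hy.2 fun t ht => ?_
    have e : sg (y - t) = sg (-1) := hsg.2.2.2 _ _ (by linarith [ht.1]) (by norm_num)
    rw [e, hm t ht.1, Complex.ofReal_mul, mul_assoc]
  rw [ker, ← intervalIntegral.integral_add_adjacent_intervals
    (ker_integrable j hsg k hc y 0 y) (ker_integrable j hsg k hc y y L), h1, h2, sub_eq_add_neg]

theorem integral_exp_abs_le {k y L : ℝ} (hk : 0 < k) (hy : y ∈ Icc 0 L) :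
    ∫ t in (0:ℝ)..L, Real.exp (-k * |y - t|) ≤ 2 / k := by
  have hc : Continuous fun t => Real.exp (-k * |y - t|) := by fun_prop
  rw [← intervalIntegral.integral_add_adjacent_intervals (hc.intervalIntegrable 0 y)
    (hc.intervalIntegrable y L)]
  have h1 : ∫ t in (0:ℝ)..y, Real.exp (-k * |y - t|) = (1 - Real.exp (-k * y)) / k := by
    have : ∫ t in (0:ℝ)..y, Real.exp (-k * |y - t|) = ∫ t in (0:ℝ)..y, Real.exp (-k * (y - t)) := by
      refine intervalIntegral.integral_congr_Ioo_of_le hy.1 fun t ht => ?_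
      rw [abs_of_pos (by linarith [ht.2] : 0 < y - t)]
    rw [this, intervalIntegral.integral_eq_sub_of_hasDerivAt
      (f := fun t => Real.exp (-k * (y - t)) / k)]
    · simp; ring
    · intro t _
      have : HasDerivAt (fun t : ℝ => -k * (y - t)) k t := by
        simpa using (((hasDerivAt_id t).const_sub y).const_mul (-k))
      exact (this.exp.div_const k).congr_deriv (by field_simp)
    · exact Continuous.intervalIntegrable (by fun_prop) _ _
  have h2 : ∫ t in y..L, Real.exp (-k * |y - t|) = (1 - Real.exp (-k * (L - y))) / k := by
    have : ∫ t in y..L, Real.exp (-k * |y - t|) = ∫ t in y..L, Real.exp (-k * (t - y)) := by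
      refine intervalIntegral.integral_congr_Ioo_of_le hy.2 fun t ht => ?_
      rw [abs_of_neg (by linarith [ht.1] : y - t < 0), neg_sub]
    rw [this, intervalIntegral.integral_eq_sub_of_hasDerivAt
      (f := fun t => -Real.exp (-k * (t - y)) / k)]
    · simp; ring
    · intro t _
      have : HasDerivAt (fun t : ℝ => -k * (t - y)) (-k) t := by
        simpa using (((hasDerivAt_id t).sub_const y).const_mul (-k))
      exact (this.exp.neg.div_const k).congr_deriv (by field_simp)
    · exact Continuous.intervalIntegrable (by fun_prop) _ _
  rw [h1, h2, ← add_div]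
  gcongr
  linarith [Real.exp_pos (-k * y), Real.exp_pos (-k * (L - y))]

theorem ker_norm_le {L : ℝ} (j : Fin 4) {sg : ℝ → ℝ} (hsg : SgOK sg) {k A : ℝ}
    (hk : 0 < k) {c : ℝ → ℂ} (hA : ∀ t, ‖c t‖ ≤ A) {y : ℝ} (hy : y ∈ Icc 0 L) :
    ‖ker L j sg k c y‖ ≤ 2 / k * A := by
  have hL : 0 ≤ L := hy.1.trans hy.2
  have hA0 : 0 ≤ A := (norm_nonneg _).trans (hA 0)
  have hc : Continuous fun t => Real.exp (-k * |y - t|) * A := by fun_prop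
  calc ‖ker L j sg k c y‖ ≤ ∫ t in (0:ℝ)..L, Real.exp (-k * |y - t|) * A := by
        refine intervalIntegral.norm_integral_le_of_norm_le hL
          (Filter.Eventually.of_forall fun t ht => ?_) (hc.intervalIntegrable _ _)
        rw [norm_mul, Complex.norm_real, Real.norm_eq_abs, abs_mul, Real.abs_exp]
        have h1 := phs_ge j hy ⟨ht.1.le, ht.2⟩
        have h2 : Real.exp (-k * phs L j y t) ≤ Real.exp (-k * |y - t|) :=
          Real.exp_le_exp.2 (by nlinarith)
        have h3 := hsg.2.1 (y - t)
        calc |sg (y - t)| * Real.exp (-k * phs L j y t) * ‖c t‖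
            ≤ 1 * Real.exp (-k * |y - t|) * A := by gcongr; exact hA t
          _ = _ := by rw [one_mul]
    _ = (∫ t in (0:ℝ)..L, Real.exp (-k * |y - t|)) * A := intervalIntegral.integral_mul_const _ _
    _ ≤ 2 / k * A := mul_le_mul_of_nonneg_right (integral_exp_abs_le hk hy) hA0

/-- The normalising factor of the Green function. -/
def wgt (L k : ℝ) : ℝ := 1 / (1 - Real.exp (-2 * k * L))

/-- The solution `U` of the mode equation with frequency `k` and source `c`, zero at `0` and `L`. -/
def modU (L k : ℝ) (c : ℝ → ℂ) (y : ℝ) : ℂ :=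
  (-(wgt L k) / (2 * k) : ℝ) * (ker L 0 (fun _ => 1) k c y + ker L 1 (fun _ => 1) k c y
    - ker L 2 (fun _ => 1) k c y - ker L 3 (fun _ => 1) k c y)

/-- Derivative of `modU`. -/
def modV (L k : ℝ) (c : ℝ → ℂ) (y : ℝ) : ℂ :=
  (-(wgt L k) / 2 : ℝ) * (-ker L 0 Real.sign k c y + ker L 1 Real.sign k c y
    + ker L 2 (fun _ => 1) k c y - ker L 3 (fun _ => 1) k c y)

section modes
variable {L k : ℝ} {c : ℝ → ℂ}

theorem ker0 {sg : ℝ → ℝ} (hsg : SgOK sg) (hc : Continuous c) {y : ℝ} (hy : y ∈ Icc 0 L) :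
    ker L 0 sg k c y = sg 1 * duh 0 (-k) 0 c y - sg (-1) * duh L k 0 c y := by
  refine ker_split 0 hsg k hc hy _ _ _ _ (fun t ht => ?_) (fun t ht => ?_)
  · simp [phs, abs_of_pos (sub_pos.2 ht)]
  · simp [phs, abs_of_neg (sub_neg.2 ht)]; ring

theorem ker1 {sg : ℝ → ℝ} (hsg : SgOK sg) (hc : Continuous c) {y : ℝ} (hy : y ∈ Icc 0 L) :
    ker L 1 sg k c y = sg 1 * duh 0 k (-2 * k * L) c y
      - sg (-1) * duh L (-k) (-2 * k * L) c y := by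
  refine ker_split 1 hsg k hc hy _ _ _ _ (fun t ht => ?_) (fun t ht => ?_)
  · simp [phs, abs_of_pos (sub_pos.2 ht)]; ring
  · simp [phs, abs_of_neg (sub_neg.2 ht)]; ring

theorem ker2 (y : ℝ) : ker L 2 (fun _ => 1) k c y
    = (Real.exp (-k * y) : ℝ) * ker L 2 (fun _ => 1) k c 0 := by
  simp only [ker, ← intervalIntegral.integral_const_mul, one_mul, ← mul_assoc,
    ← Complex.ofReal_mul, ← Real.exp_add]
  congr 1; funext t; congr 3; simp [phs]; ring

theorem ker3 (y : ℝ) : ker L 3 (fun _ => 1) k c y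
    = (Real.exp (k * y) : ℝ) * ker L 3 (fun _ => 1) k c 0 := by
  simp only [ker, ← intervalIntegral.integral_const_mul, one_mul, ← mul_assoc,
    ← Complex.ofReal_mul, ← Real.exp_add]
  congr 1; funext t; congr 3; simp [phs]; ring

theorem ker2_deriv (y : ℝ) : HasDerivAt (ker L 2 (fun _ => 1) k c)
    (-k * ker L 2 (fun _ => 1) k c y) y := by
  have : ker L 2 (fun _ => 1) k c = fun y =>
      (Real.exp (-k * y) : ℝ) * ker L 2 (fun _ => 1) k c 0 := funext ker2
  have d : HasDerivAt (fun y => ((Real.exp (-k * y) : ℝ) : ℂ))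
      ((Real.exp (-k * y) * -k : ℝ) : ℂ) y := by
    apply HasDerivAt.ofReal_comp
    have : HasDerivAt (fun y : ℝ => -k * y) (-k) y := by
      simpa using (hasDerivAt_id y).const_mul (-k)
    exact this.exp
  rw [this]
  refine (d.mul_const _).congr_deriv ?_
  push_cast; ring

theorem ker3_deriv (y : ℝ) : HasDerivAt (ker L 3 (fun _ => 1) k c)
    (k * ker L 3 (fun _ => 1) k c y) y := by
  have : ker L 3 (fun _ => 1) k c = fun y =>
      (Real.exp (k * y) : ℝ) * ker L 3 (fun _ => 1) k c 0 := funext ker3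
  have d : HasDerivAt (fun y => ((Real.exp (k * y) : ℝ) : ℂ))
      ((Real.exp (k * y) * k : ℝ) : ℂ) y := by
    apply HasDerivAt.ofReal_comp
    have : HasDerivAt (fun y : ℝ => k * y) k y := by
      simpa using (hasDerivAt_id y).const_mul k
    exact this.exp
  rw [this]
  refine (d.mul_const _).congr_deriv ?_
  push_cast; ring

theorem modU_deriv (hk : 0 < k) (hc : Continuous c) {y : ℝ} (hy : y ∈ Icc 0 L) :
    HasDerivWithinAt (modU L k c) (modV L k c y) (Icc 0 L) y := by
  have d := (((((duh_hasDerivAt (b := 0) (lam := -k) (mu := 0) hc y).sub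
    (duh_hasDerivAt (b := L) (lam := k) (mu := 0) hc y)).add
    ((duh_hasDerivAt (b := 0) (lam := k) (mu := -2 * k * L) hc y).sub
    (duh_hasDerivAt (b := L) (lam := -k) (mu := -2 * k * L) hc y))).sub
    (ker2_deriv (L := L) (k := k) (c := c) y)).sub (ker3_deriv (L := L) (k := k) (c := c) y)).const_mul
    (((-(wgt L k) / (2 * k) : ℝ)) : ℂ)
  refine (d.hasDerivWithinAt (s := Icc 0 L)).congr_deriv ?_ |>.congr (fun t ht => ?_) ?_
  · rw [modV, ker0 sgOK_sign hc hy, ker1 sgOK_sign hc hy]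
    rw [Real.sign_of_pos one_pos, Real.sign_of_neg (by norm_num : (-1:ℝ) < 0)]
    have : (k : ℂ) ≠ 0 := by exact_mod_cast hk.ne'
    push_cast
    field_simp
    ring
  · rw [modU, ker0 sgOK_one hc ht, ker1 sgOK_one hc ht]
    push_cast; simp only [one_mul]; rfl
  · rw [modU, ker0 sgOK_one hc hy, ker1 sgOK_one hc hy]
    push_cast; simp only [one_mul]; rfl

theorem modV_deriv (hL : 0 < L) (hk : 0 < k) (hc : Continuous c) {y : ℝ} (hy : y ∈ Icc 0 L) :
    HasDerivWithinAt (modV L k c) ((k ^ 2 : ℝ) * modU L k c y + c y) (Icc 0 L) y := by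
  have d := ((((((duh_hasDerivAt (b := 0) (lam := -k) (mu := 0) hc y).add
    (duh_hasDerivAt (b := L) (lam := k) (mu := 0) hc y)).neg).add
    ((duh_hasDerivAt (b := 0) (lam := k) (mu := -2 * k * L) hc y).add
    (duh_hasDerivAt (b := L) (lam := -k) (mu := -2 * k * L) hc y))).add
    (ker2_deriv (L := L) (k := k) (c := c) y)).sub (ker3_deriv (L := L) (k := k) (c := c) y)).const_mul
    (((-(wgt L k) / 2 : ℝ)) : ℂ)
  have e : ∀ t ∈ Icc 0 L, modV L k c t = (((-(wgt L k) / 2 : ℝ)) : ℂ) *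
      (-(duh 0 (-k) 0 c t + duh L k 0 c t) + (duh 0 k (-2 * k * L) c t
        + duh L (-k) (-2 * k * L) c t) + ker L 2 (fun _ => 1) k c t
        - ker L 3 (fun _ => 1) k c t) := by
    intro t ht
    rw [modV, ker0 sgOK_sign hc ht, ker1 sgOK_sign hc ht, Real.sign_of_pos one_pos,
      Real.sign_of_neg (by norm_num : (-1:ℝ) < 0)]
    push_cast; ring
  refine (d.hasDerivWithinAt (s := Icc 0 L)).congr_deriv ?_ |>.congr (fun t ht => e t ht) (e y hy)
  rw [modU, ker0 sgOK_one hc hy, ker1 sgOK_one hc hy]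
  have hk' : (k : ℂ) ≠ 0 := by exact_mod_cast hk.ne'
  have hw : (wgt L k : ℂ) * (1 - (Real.exp (-2 * k * L) : ℂ)) = 1 := by
    have h1 : Real.exp (-2 * k * L) < 1 := Real.exp_lt_one_iff.2 (by nlinarith [mul_pos hk hL])
    have h2 : wgt L k * (1 - Real.exp (-2 * k * L)) = 1 := by
      rw [wgt, one_div, inv_mul_cancel₀ (by linarith)]
    exact_mod_cast h2
  have hw2 : c y = (wgt L k : ℂ) * (1 - (Real.exp (-2 * k * L) : ℂ)) * c y := by rw [hw, one_mul]
  rw [Real.exp_zero]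
  generalize Real.exp (-2 * k * L) = E at *
  push_cast
  conv_rhs => rw [hw2]
  field_simp
  ring

theorem modU_zero (hL : 0 ≤ L) : modU L k c 0 = 0 := by
  have h : ∀ j j' : Fin 4, (∀ t ∈ Icc 0 L, phs L j 0 t = phs L j' 0 t) →
      ker L j (fun _ => 1) k c 0 = ker L j' (fun _ => 1) k c 0 := by
    intro j j' h
    refine intervalIntegral.integral_congr fun t ht => ?_
    rw [uIcc_of_le hL] at ht
    simp only [h t ht]
  rw [modU, h 0 2 (fun t ht => by simp [phs, abs_of_nonneg ht.1]),
    h 1 3 (fun t ht => by simp [phs, abs_of_nonneg ht.1])]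
  ring

theorem modU_L (hL : 0 ≤ L) : modU L k c L = 0 := by
  have h : ∀ j j' : Fin 4, (∀ t ∈ Icc 0 L, phs L j L t = phs L j' L t) →
      ker L j (fun _ => 1) k c L = ker L j' (fun _ => 1) k c L := by
    intro j j' h
    refine intervalIntegral.integral_congr fun t ht => ?_
    rw [uIcc_of_le hL] at ht
    simp only [h t ht]
  rw [modU, h 0 3 (fun t ht => by simp [phs, abs_of_nonneg (sub_nonneg.2 ht.2)]; ring),
    h 1 2 (fun t ht => by simp [phs, abs_of_nonneg (sub_nonneg.2 ht.2)]; ring)]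
  ring

end modes

theorem wgt_nonneg {L k : ℝ} (hL : 0 < L) (hk : 0 < k) : 0 ≤ wgt L k := by
  have h1 : Real.exp (-2 * k * L) < 1 := Real.exp_lt_one_iff.2 (by nlinarith [mul_pos hk hL])
  exact one_div_nonneg.2 (by linarith)

theorem wgt_le {L : ℝ} (hL : 0 < L) (n : ℕ) : wgt L (kap n) ≤ wgt L (2 * Real.pi) := by
  have h1 : Real.exp (-2 * (2 * Real.pi) * L) < 1 :=
    Real.exp_lt_one_iff.2 (by nlinarith [mul_pos Real.pi_pos hL])
  have h2 : Real.exp (-2 * kap n * L) ≤ Real.exp (-2 * (2 * Real.pi) * L) :=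
    Real.exp_le_exp.2 (by nlinarith [kap_ge n])
  unfold wgt
  exact one_div_le_one_div_of_le (by linarith) (by linarith)

theorem modU_norm {L k A W : ℝ} (hL : 0 < L) (hk : 0 < k) (hW : wgt L k ≤ W) {c : ℝ → ℂ}
    (hA : ∀ t, ‖c t‖ ≤ A) {y : ℝ} (hy : y ∈ Icc 0 L) :
    k ^ 2 * ‖modU L k c y‖ ≤ 4 * W * A := by
  have h := fun j => ker_norm_le j sgOK_one hk hA hy
  have hw := wgt_nonneg hL hk
  have hA0 : 0 ≤ A := (norm_nonneg _).trans (hA 0)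
  have hW0 : 0 ≤ W := hw.trans hW
  rw [modU, norm_mul, Complex.norm_real, Real.norm_eq_abs, abs_div, abs_neg, abs_of_nonneg hw,
    abs_of_pos (by positivity : 0 < 2 * k)]
  have h2 : ‖ker L 0 (fun _ => 1) k c y + ker L 1 (fun _ => 1) k c y
    - ker L 2 (fun _ => 1) k c y - ker L 3 (fun _ => 1) k c y‖ ≤ 4 * (2 / k * A) := by
    refine (norm_sub_le _ _).trans ?_
    have := (norm_sub_le (ker L 0 (fun _ => 1) k c y + ker L 1 (fun _ => 1) k c y)
      (ker L 2 (fun _ => 1) k c y)).trans (add_le_add (norm_add_le _ _) le_rfl)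
    linarith [h 0, h 1, h 2, h 3]
  calc _ ≤ k ^ 2 * (W / (2 * k) * (4 * (2 / k * A))) := by gcongr
    _ = _ := by field_simp

theorem modV_norm {L k A W : ℝ} (hL : 0 < L) (hk : 0 < k) (hW : wgt L k ≤ W) {c : ℝ → ℂ}
    (hA : ∀ t, ‖c t‖ ≤ A) {y : ℝ} (hy : y ∈ Icc 0 L) :
    k * ‖modV L k c y‖ ≤ 4 * W * A := by
  have h := fun j => ker_norm_le j sgOK_one hk hA hy
  have h' := fun j => ker_norm_le j sgOK_sign hk hA hy
  have hw := wgt_nonneg hL hk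
  have hA0 : 0 ≤ A := (norm_nonneg _).trans (hA 0)
  have hW0 : 0 ≤ W := hw.trans hW
  rw [modV, norm_mul, Complex.norm_real, Real.norm_eq_abs, abs_div, abs_neg, abs_of_nonneg hw,
    abs_of_pos (by positivity : (0:ℝ) < 2)]
  have h2 : ‖-ker L 0 Real.sign k c y + ker L 1 Real.sign k c y
    + ker L 2 (fun _ => 1) k c y - ker L 3 (fun _ => 1) k c y‖ ≤ 4 * (2 / k * A) := by
    refine (norm_sub_le _ _).trans ?_
    have := (norm_add_le (-ker L 0 Real.sign k c y + ker L 1 Real.sign k c y)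
      (ker L 2 (fun _ => 1) k c y)).trans (add_le_add (norm_add_le _ _) le_rfl)
    rw [norm_neg] at this
    linarith [h' 0, h' 1, h 2, h 3]
  calc _ ≤ k * (W / 2 * (4 * (2 / k * A))) := by gcongr
    _ = _ := by field_simp

theorem hasDerivWithinAt_tsum_Icc {L : ℝ} (hL : 0 < L) {g g' : ℕ → ℝ → ℝ} {u : ℕ → ℝ}
    (hu : Summable u) (hg : ∀ n, ∀ y ∈ Icc 0 L, HasDerivWithinAt (g n) (g' n y) (Icc 0 L) y)
    (hc : ∀ n, ContinuousOn (g' n) (Icc 0 L)) (hb : ∀ n, ∀ y ∈ Icc 0 L, |g' n y| ≤ u n)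
    (h0 : Summable fun n => g n 0) {y : ℝ} (hy : y ∈ Icc 0 L) :
    HasDerivWithinAt (fun t => ∑' n, g n t) (∑' n, g' n y) (Icc 0 L) y := by
  let p : ℝ → ℝ := fun t => projIcc 0 L hL.le t
  have hp : ∀ t, p t ∈ Icc 0 L := fun t => (projIcc 0 L hL.le t).2
  have hpe : ∀ t ∈ Icc 0 L, p t = t := fun t ht => by simp [p, projIcc_of_mem hL.le ht]
  have hpc : Continuous p := continuous_subtype_val.comp continuous_projIcc
  have hcc : ∀ n, Continuous fun t => g' n (p t) := fun n => (hc n).comp_continuous hpc hp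
  let G : ℕ → ℝ → ℝ := fun n t => g n 0 + ∫ s in (0:ℝ)..t, g' n (p s)
  have hG : ∀ n t, HasDerivAt (G n) (g' n (p t)) t := fun n t =>
    (intervalIntegral.integral_hasDerivAt_right ((hcc n).intervalIntegrable _ _)
      ((hcc n).stronglyMeasurableAtFilter _ _) (hcc n).continuousAt).const_add _
  have hGe : ∀ n, ∀ t ∈ Icc 0 L, G n t = g n t := by
    intro n t ht
    have h1 : ∫ s in (0:ℝ)..t, g' n (p s) = g n t - g n 0 := by
      refine intervalIntegral.integral_eq_sub_of_hasDeriv_right_of_le ht.1 ?_ ?_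
        ((hcc n).intervalIntegrable _ _)
      · intro s hs
        exact ((hg n s ⟨hs.1, hs.2.trans ht.2⟩).continuousWithinAt).mono
          (Icc_subset_Icc le_rfl ht.2)
      · intro s hs
        have hs' : s ∈ Icc 0 L := ⟨hs.1.le, hs.2.le.trans ht.2⟩
        rw [hpe s hs']
        exact ((hg n s hs').hasDerivAt (Icc_mem_nhds hs.1 (hs.2.trans_le ht.2))).hasDerivWithinAt
    simp only [G, h1]; ring
  have hs0 : Summable fun n => G n 0 := by simpa [G] using h0
  have key := hasDerivAt_tsum (y₀ := (0:ℝ)) hu hG (fun n t => by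
    rw [Real.norm_eq_abs]; exact hb n _ (hp t)) hs0 y
  rw [hpe y hy] at key
  refine key.hasDerivWithinAt.congr (fun t ht => ?_) ?_
  · exact tsum_congr fun n => (hGe n t ht).symm
  · exact tsum_congr fun n => (hGe n y hy).symm

/-- The exponential modes. -/
def ex (n : ℕ) (x : ℝ) : ℂ := Complex.exp ((kap n * x : ℝ) * Complex.I)

theorem ex_norm (n : ℕ) (x : ℝ) : ‖ex n x‖ = 1 := Complex.norm_exp_ofReal_mul_I _

theorem ex_cont (n : ℕ) : Continuous (ex n) := by unfold ex; fun_prop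

theorem ex_add (n : ℕ) (x y : ℝ) : ex n (x + y) = ex n x * ex n y := by
  unfold ex; rw [← Complex.exp_add]; congr 1; push_cast; ring

theorem ex_one (n : ℕ) : ex n 1 = 1 := by
  unfold ex kap
  rw [Complex.exp_eq_one_iff]
  exact ⟨n + 1, by push_cast; ring⟩

theorem ex_per (n : ℕ) (x : ℝ) : ex n (x + 1) = ex n x := by rw [ex_add, ex_one, mul_one]

theorem ex_deriv (n : ℕ) (x : ℝ) : HasDerivAt (ex n) (kap n * Complex.I * ex n x) x := by
  unfold ex
  have h1 : HasDerivAt (fun x : ℝ => ((kap n * x : ℝ) : ℂ) * Complex.I)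
      ((kap n : ℂ) * Complex.I) x := by
    have : HasDerivAt (fun x : ℝ => kap n * x) (kap n) x := by
      simpa using (hasDerivAt_id x).const_mul (kap n)
    exact this.ofReal_comp.mul_const _
  exact h1.cexp.congr_deriv (by ring)

/-- A real Fourier mode with complex amplitude. -/
def tm (z : ℂ) (n : ℕ) (x : ℝ) : ℝ := 2 * (z * ex n x).re

theorem tm_abs (z : ℂ) (n : ℕ) (x : ℝ) : |tm z n x| ≤ 2 * ‖z‖ := by
  have := Complex.abs_re_le_norm (z * ex n x)
  rw [norm_mul, ex_norm, mul_one] at this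
  rw [tm, abs_mul, abs_two]; linarith

theorem tm_dx (z : ℂ) (n : ℕ) (x : ℝ) :
    HasDerivAt (tm z n) (tm (kap n * Complex.I * z) n x) x := by
  have h := ((ex_deriv n x).const_mul z)
  have h2 := (Complex.reCLM.hasFDerivAt.comp_hasDerivAt x h).const_mul (2:ℝ)
  refine h2.congr_deriv ?_
  simp only [tm, Complex.reCLM_apply]; congr 2; ring

theorem tm_dy {Z : ℝ → ℂ} {Z' : ℂ} {s : Set ℝ} {y : ℝ} (h : HasDerivWithinAt Z Z' s y) (n : ℕ)
    (x : ℝ) : HasDerivWithinAt (fun t => tm (Z t) n x) (tm Z' n x) s y := by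
  have h2 := (Complex.reCLM.hasFDerivAt.comp_hasDerivWithinAt y (h.mul_const (ex n x))).const_mul
    (2:ℝ)
  exact h2

theorem tm_add (z w : ℂ) (n : ℕ) (x : ℝ) : tm (z + w) n x = tm z n x + tm w n x := by
  simp only [tm, add_mul, Complex.add_re]; ring

theorem tm_neg (z : ℂ) (n : ℕ) (x : ℝ) : tm (-z) n x = -tm z n x := by
  simp only [tm, neg_mul, Complex.neg_re]; ring

/-- Fourier data of `f` on the strip with summable amplitudes. -/
structure Coef (L : ℝ) (f : ℝ → ℝ → ℝ) (c0 : ℝ → ℝ) (c : ℕ → ℝ → ℂ) (A : ℕ → ℝ) : Prop where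
  c0_cont : Continuous c0
  c_cont : ∀ n, Continuous (c n)
  bd : ∀ n t, ‖c n t‖ ≤ A n
  summ : Summable A
  sum : ∀ y ∈ Icc 0 L, ∀ x, HasSum (fun n => tm (c n y) n x) (f x y - c0 y)

/-- The amplitudes of the five fields of the solution. -/
def amp (L : ℝ) (c : ℕ → ℝ → ℂ) (i : Fin 5) (n : ℕ) (y : ℝ) : ℂ :=
  ![modU L (kap n) (c n) y, kap n * Complex.I * modU L (kap n) (c n) y,
    modV L (kap n) (c n) y, -((kap n ^ 2 : ℝ) * modU L (kap n) (c n) y),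
    kap n * Complex.I * modV L (kap n) (c n) y] i

/-- The mean modes of the five fields of the solution. -/
def mean5 (L : ℝ) (c0 : ℝ → ℝ) (i : Fin 5) (y : ℝ) : ℝ :=
  ![(∫ s in (0:ℝ)..y, ∫ t in (0:ℝ)..s, c0 t) - (∫ s in (0:ℝ)..L, ∫ t in (0:ℝ)..s, c0 t) / L * y, 0,
    (∫ t in (0:ℝ)..y, c0 t) - (∫ s in (0:ℝ)..L, ∫ t in (0:ℝ)..s, c0 t) / L, 0, 0] i

/-- The Fourier series solution of the Dirichlet problem. -/
def fsol (L : ℝ) (c0 : ℝ → ℝ) (c : ℕ → ℝ → ℂ) (i : Fin 5) (x y : ℝ) : ℝ :=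
  mean5 L c0 i y + ∑' n, tm (amp L c i n y) n x

section fsol
variable {L : ℝ} {f : ℝ → ℝ → ℝ} {c0 : ℝ → ℝ} {c : ℕ → ℝ → ℂ} {A : ℕ → ℝ}

theorem amp_norm (hL : 0 < L) (h : Coef L f c0 c A) (i : Fin 5) (n : ℕ) {y : ℝ}
    (hy : y ∈ Icc 0 L) : ‖amp L c i n y‖ ≤ 4 * wgt L (2 * Real.pi) * A n := by
  have h1 := modU_norm hL (kap_pos n) (wgt_le hL n) (h.bd n) hy
  have h2 := modV_norm hL (kap_pos n) (wgt_le hL n) (h.bd n) hy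
  have hk : 1 ≤ kap n := by linarith [kap_ge n, Real.pi_gt_three]
  have hU := norm_nonneg (modU L (kap n) (c n) y)
  have hV := norm_nonneg (modV L (kap n) (c n) y)
  have hUU : kap n * ‖modU L (kap n) (c n) y‖ ≤ kap n ^ 2 * ‖modU L (kap n) (c n) y‖ := by
    gcongr; nlinarith
  have hUU' : ‖modU L (kap n) (c n) y‖ ≤ kap n * ‖modU L (kap n) (c n) y‖ := by nlinarith
  have hVV : ‖modV L (kap n) (c n) y‖ ≤ kap n * ‖modV L (kap n) (c n) y‖ := by nlinarith
  have hab : |kap n| = kap n := abs_of_pos (kap_pos n)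
  fin_cases i
  · change ‖modU L (kap n) (c n) y‖ ≤ _; linarith
  · change ‖kap n * Complex.I * modU L (kap n) (c n) y‖ ≤ _
    rw [norm_mul, norm_mul, Complex.norm_I, Complex.norm_real, Real.norm_eq_abs, hab, mul_one]
    linarith
  · change ‖modV L (kap n) (c n) y‖ ≤ _; linarith
  · change ‖-((kap n ^ 2 : ℝ) * modU L (kap n) (c n) y)‖ ≤ _
    rw [norm_neg, norm_mul, Complex.norm_real, Real.norm_eq_abs, abs_of_nonneg (sq_nonneg _)]
    linarith
  · change ‖kap n * Complex.I * modV L (kap n) (c n) y‖ ≤ _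
    rw [norm_mul, norm_mul, Complex.norm_I, Complex.norm_real, Real.norm_eq_abs, hab, mul_one]
    linarith

theorem amp_bd (hL : 0 < L) (h : Coef L f c0 c A) (i : Fin 5) (n : ℕ) (x : ℝ) {y : ℝ}
    (hy : y ∈ Icc 0 L) : |tm (amp L c i n y) n x| ≤ 8 * wgt L (2 * Real.pi) * A n :=
  (tm_abs _ _ _).trans (by linarith [amp_norm hL h i n hy])

theorem amp_summ (h : Coef L f c0 c A) : Summable fun n => 8 * wgt L (2 * Real.pi) * A n :=
  h.summ.mul_left _

theorem amp_summable (hL : 0 < L) (h : Coef L f c0 c A) (i : Fin 5) (x : ℝ) {y : ℝ}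
    (hy : y ∈ Icc 0 L) : Summable fun n => tm (amp L c i n y) n x :=
  (amp_summ (L := L) h).of_norm_bounded fun n => by
    rw [Real.norm_eq_abs]; exact amp_bd hL h i n x hy

theorem amp_contOn (hL : 0 < L) (h : Coef L f c0 c A) (i : Fin 5) (n : ℕ) :
    ContinuousOn (amp L c i n) (Icc 0 L) := by
  have hU : ContinuousOn (modU L (kap n) (c n)) (Icc 0 L) := fun y hy =>
    (modU_deriv (kap_pos n) (h.c_cont n) hy).continuousWithinAt
  have hV : ContinuousOn (modV L (kap n) (c n)) (Icc 0 L) := fun y hy =>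
    (modV_deriv hL (kap_pos n) (h.c_cont n) hy).continuousWithinAt
  fin_cases i
  · exact hU
  · exact continuousOn_const.mul hU
  · exact hV
  · exact (continuousOn_const.mul hU).neg
  · exact continuousOn_const.mul hV

theorem amp_dy0 (h : Coef L f c0 c A) (n : ℕ) {y : ℝ} (hy : y ∈ Icc 0 L) :
    HasDerivWithinAt (amp L c 0 n) (amp L c 2 n y) (Icc 0 L) y :=
  modU_deriv (kap_pos n) (h.c_cont n) hy

theorem amp_dy1 (h : Coef L f c0 c A) (n : ℕ) {y : ℝ} (hy : y ∈ Icc 0 L) :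
    HasDerivWithinAt (amp L c 1 n) (amp L c 4 n y) (Icc 0 L) y :=
  (modU_deriv (kap_pos n) (h.c_cont n) hy).const_mul _

theorem amp_dy2 (hL : 0 < L) (h : Coef L f c0 c A) (n : ℕ) {y : ℝ} (hy : y ∈ Icc 0 L) :
    HasDerivWithinAt (amp L c 2 n) (-amp L c 3 n y + c n y) (Icc 0 L) y :=
  (modV_deriv hL (kap_pos n) (h.c_cont n) hy).congr_deriv (by simp [amp])

theorem mean_dy0 (h : Coef L f c0 c A) (y : ℝ) :
    HasDerivAt (mean5 L c0 0) (mean5 L c0 2 y) y := by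
  have hc : Continuous fun s => ∫ t in (0:ℝ)..s, c0 t :=
    intervalIntegral.continuous_primitive (fun a b => h.c0_cont.intervalIntegrable a b) 0
  have h1 := intervalIntegral.integral_hasDerivAt_right (hc.intervalIntegrable 0 y)
      (hc.stronglyMeasurableAtFilter _ _) hc.continuousAt
  refine (h1.sub ((hasDerivAt_id y).const_mul
    ((∫ s in (0:ℝ)..L, ∫ t in (0:ℝ)..s, c0 t) / L))).congr_deriv ?_
  simp [mean5]

theorem mean_dy2 (h : Coef L f c0 c A) (y : ℝ) :
    HasDerivAt (mean5 L c0 2) (c0 y) y :=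
  (intervalIntegral.integral_hasDerivAt_right (h.c0_cont.intervalIntegrable 0 y)
      (h.c0_cont.stronglyMeasurableAtFilter _ _) h.c0_cont.continuousAt).sub_const _

theorem mean_cont (h : Coef L f c0 c A) (i : Fin 5) : Continuous (mean5 L c0 i) := by
  fin_cases i
  · exact continuous_iff_continuousAt.2 fun y => (mean_dy0 h y).continuousAt
  · exact continuous_const
  · exact continuous_iff_continuousAt.2 fun y => (mean_dy2 h y).continuousAt
  · exact continuous_const
  · exact continuous_const

theorem fsol_dx (hL : 0 < L) (h : Coef L f c0 c A) (i j : Fin 5)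
    (hij : ∀ n y, kap n * Complex.I * amp L c i n y = amp L c j n y)
    (hm : ∀ y, mean5 L c0 j y = 0) {y : ℝ} (hy : y ∈ Icc 0 L) (x : ℝ) :
    HasDerivAt (fun t => fsol L c0 c i t y) (fsol L c0 c j x y) x := by
  have key := hasDerivAt_tsum (y₀ := (0:ℝ)) (amp_summ (L := L) h)
    (g := fun n x => tm (amp L c i n y) n x) (g' := fun n x => tm (amp L c j n y) n x)
    (fun n x => by rw [← hij]; exact tm_dx _ n x)
    (fun n x => by rw [Real.norm_eq_abs]; exact amp_bd hL h j n x hy)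
    (amp_summable hL h i 0 hy) x
  refine (key.const_add (mean5 L c0 i y)).congr_deriv ?_
  simp [fsol, hm]

theorem fsol_sol (hL : 0 < L) (h : Coef L f c0 c A) : Sol L (fsol L c0 c) f where
  dx0 y hy x := fsol_dx hL h 0 1 (fun n y => rfl) (fun y => rfl) hy x
  dx1 y hy x := fsol_dx hL h 1 3 (fun n y => by
    change (kap n : ℂ) * Complex.I * (kap n * Complex.I * modU L (kap n) (c n) y)
      = -((kap n ^ 2 : ℝ) * modU L (kap n) (c n) y)
    push_cast; linear_combination (kap n : ℂ) ^ 2 * modU L (kap n) (c n) y * Complex.I_sq)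
    (fun y => rfl) hy x
  dx2 y hy x := fsol_dx hL h 2 4 (fun n y => rfl) (fun y => rfl) hy x
  dy0 y hy x := (mean_dy0 h y).hasDerivWithinAt.add
    (hasDerivWithinAt_tsum_Icc hL (amp_summ (L := L) h)
      (fun n y hy => tm_dy (amp_dy0 h n hy) n x)
      (fun n => by
        have := amp_contOn hL h 2 n
        unfold tm
        exact continuousOn_const.mul (Complex.continuous_re.comp_continuousOn
          (this.mul continuousOn_const)))
      (fun n y hy => amp_bd hL h 2 n x hy) (amp_summable hL h 0 x ⟨le_rfl, hL.le⟩) hy)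
  dy1 y hy x := by
    have := hasDerivWithinAt_tsum_Icc hL (amp_summ (L := L) h)
      (fun n y hy => tm_dy (amp_dy1 h n hy) n x)
      (fun n => by
        have := amp_contOn hL h 4 n
        unfold tm
        exact continuousOn_const.mul (Complex.continuous_re.comp_continuousOn
          (this.mul continuousOn_const)))
      (fun n y hy => amp_bd hL h 4 n x hy) (amp_summable hL h 1 x ⟨le_rfl, hL.le⟩) hy
    exact (this.const_add (0:ℝ)).congr_deriv (by simp [fsol, mean5])
  dy2 y hy x := by
    have key := hasDerivWithinAt_tsum_Icc hL
      ((amp_summ (L := L) h).add (h.summ.mul_left 2))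
      (fun n y hy => tm_dy (amp_dy2 hL h n hy) n x)
      (fun n => by
        have h3 := amp_contOn hL h 3 n
        have hc := (h.c_cont n).continuousOn (s := Icc 0 L)
        unfold tm
        exact continuousOn_const.mul (Complex.continuous_re.comp_continuousOn
          ((h3.neg.add hc).mul continuousOn_const)))
      (fun n y hy => by
        rw [tm_add, tm_neg]
        refine (abs_add_le _ _).trans (add_le_add ?_ ?_)
        · rw [abs_neg]; exact amp_bd hL h 3 n x hy
        · exact (tm_abs _ _ _).trans (by linarith [h.bd n y]))
      (amp_summable hL h 2 x ⟨le_rfl, hL.le⟩) hy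
    refine ((mean_dy2 h y).hasDerivWithinAt.add key).congr_deriv ?_
    have hs := h.sum y hy x
    have e : ∑' n, tm (-amp L c 3 n y + c n y) n x
        = -(∑' n, tm (amp L c 3 n y) n x) + (f x y - c0 y) := by
      simp only [tm_add, tm_neg]
      rw [(amp_summable hL h 3 x hy).neg.tsum_add hs.summable, tsum_neg, hs.tsum_eq]
    rw [e]
    simp [fsol, mean5]; ring
  per i y hy x := by simp only [fsol, tm, ex_per]
  cont i := by
    refine ContinuousOn.add ((mean_cont h i).comp continuous_snd).continuousOn ?_
    refine continuousOn_tsum (fun n => ?_) (amp_summ (L := L) h) (fun n z hz => ?_)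
    · have h1 : ContinuousOn (fun z : ℝ × ℝ => amp L c i n z.2) (strip L) :=
        (amp_contOn hL h i n).comp continuousOn_snd fun z hz => hz.2
      have h2 : Continuous fun z : ℝ × ℝ => ex n z.1 := (ex_cont n).comp continuous_fst
      unfold tm
      exact continuousOn_const.mul (Complex.continuous_re.comp_continuousOn
        (h1.mul h2.continuousOn))
    · rw [Real.norm_eq_abs]; exact amp_bd hL h i n z.1 hz.2

theorem fsol_bot (hL : 0 < L) (x : ℝ) : fsol L c0 c 0 x 0 = 0 := by
  have : ∀ n, amp L c 0 n 0 = 0 := fun n => modU_zero hL.le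
  simp [fsol, this, tm, mean5]

theorem fsol_top (hL : 0 < L) (x : ℝ) : fsol L c0 c 0 x L = 0 := by
  have : ∀ n, amp L c 0 n L = 0 := fun n => modU_L hL.le
  have hL' : L ≠ 0 := hL.ne'
  simp [fsol, this, tm, mean5, hL']

end fsol

/-- The Fourier coefficients of positive index. -/
def cf (g : ℝ → ℝ) (n : ℕ) : ℂ := ∫ x in (0:ℝ)..1, (g x : ℂ) * ex n (-x)

section cf
variable {a K : ℝ} {g : ℝ → ℝ}

theorem ex_neg_per (n : ℕ) (x : ℝ) : ex n (-(x + 1)) = ex n (-x) := by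
  rw [← ex_per n (-(x + 1))]; congr 1; ring

theorem cf_shift (hp : ∀ x, g (x + 1) = g x) (n : ℕ) (b : ℝ) :
    cf g n = ∫ x in b..(b + 1), (g x : ℂ) * ex n (-x) := by
  have : Function.Periodic (fun x => (g x : ℂ) * ex n (-x)) 1 := fun x => by
    simp only [hp, ex_neg_per]
  have h := this.intervalIntegral_add_eq 0 b
  rw [zero_add] at h
  exact h

theorem cf_cont_int (hc : Continuous g) (n : ℕ) : Continuous fun x => (g x : ℂ) * ex n (-x) := by
  have := ex_cont n
  fun_prop

theorem cf_translate (hp : ∀ x, g (x + 1) = g x) (n : ℕ) (h : ℝ) :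
    cf (fun x => g (x + h)) n = ex n h * cf g n := by
  rw [cf_shift hp n h, cf, ← intervalIntegral.integral_const_mul]
  have := intervalIntegral.integral_comp_add_right (a := 0) (b := 1)
    (fun x => (ex n h) * ((g x : ℂ) * ex n (-x))) h
  rw [zero_add, add_comm 1 h] at this
  rw [← this]
  congr 1; funext x
  have e : ex n (-x) = ex n h * ex n (-(x + h)) := by rw [← ex_add]; congr 1; ring
  rw [e]; ring

theorem ex_half (n : ℕ) : ex n (1 / (2 * (n + 1))) = -1 := by
  unfold ex kap
  have : 2 * Real.pi * ((n:ℝ) + 1) * (1 / (2 * (n + 1))) = Real.pi := by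
    have : (n:ℝ) + 1 ≠ 0 := by positivity
    field_simp
  rw [this, Complex.exp_pi_mul_I]

/-- Decay of the Fourier coefficients. -/
theorem cf_le (ha : 0 < a) (hc : Continuous g) (hp : ∀ x, g (x + 1) = g x) (h : LH a K g) (n : ℕ) :
    ‖cf g n‖ ≤ K * (1 / ((n:ℝ) + 1) ^ (1 + a)) := by
  have hK := h.nonneg
  set t : ℝ := 1 / (2 * (n + 1)) with ht
  have ht0 : 0 < t := by positivity
  have hsd : 4 * cf g n = ∫ x in (0:ℝ)..1,
      ((g (x + t + t) - g (x + t) - (g (x + t) - g x) : ℝ) : ℂ) * ex n (-x) := by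
    have h1 := cf_translate hp n t
    have h2 := cf_translate hp n (t + t)
    rw [ex_add, ex_half] at h2
    rw [ex_half] at h1
    have i0 := (cf_cont_int hc n).intervalIntegrable (μ := MeasureTheory.volume) 0 1
    have i1 := (cf_cont_int (g := fun x => g (x + t)) (by fun_prop) n).intervalIntegrable
      (μ := MeasureTheory.volume) 0 1
    have i2 := (cf_cont_int (g := fun x => g (x + (t + t))) (by fun_prop) n).intervalIntegrable
      (μ := MeasureTheory.volume) 0 1
    have : ∫ x in (0:ℝ)..1,
      ((g (x + t + t) - g (x + t) - (g (x + t) - g x) : ℝ) : ℂ) * ex n (-x)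
        = cf (fun x => g (x + (t + t))) n - cf (fun x => g (x + t)) n
          - (cf (fun x => g (x + t)) n - cf g n) := by
      unfold cf
      rw [← intervalIntegral.integral_sub i2 i1, ← intervalIntegral.integral_sub i1 i0,
        ← intervalIntegral.integral_sub (i2.sub i1) (i1.sub i0)]
      congr 1; funext x
      rw [add_assoc]; push_cast; ring
    rw [this, h1, h2]; ring
  have hb : ‖(4:ℂ) * cf g n‖ ≤ (K * |t| * |t| ^ a) * |(1:ℝ) - 0| := by
    rw [hsd]
    refine intervalIntegral.norm_integral_le_of_norm_le_const fun x _ => ?_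
    rw [norm_mul, ex_norm, mul_one, Complex.norm_real, Real.norm_eq_abs]
    have := (h t).2 (x + t) x
    simpa using this
  have e4 : ‖(4:ℂ)‖ = 4 := by simp
  rw [norm_mul, e4, abs_of_pos ht0, sub_zero, abs_one, mul_one] at hb
  have hm : t * t ^ a ≤ 1 / ((n:ℝ) + 1) ^ (1 + a) := by
    have h3 : t * t ^ a = t ^ (1 + a) := by rw [Real.rpow_add ht0, Real.rpow_one]
    rw [h3]
    have h4 : t ≤ 1 / ((n:ℝ) + 1) := by
      rw [ht]; exact one_div_le_one_div_of_le (by positivity) (by linarith [n.cast_nonneg (α := ℝ)])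
    calc t ^ (1 + a) ≤ (1 / ((n:ℝ) + 1)) ^ (1 + a) :=
          Real.rpow_le_rpow ht0.le h4 (by linarith)
      _ = _ := by rw [Real.div_rpow zero_le_one (by positivity), Real.one_rpow]
  have h5 : K * (t * t ^ a) ≤ K * (1 / ((n:ℝ) + 1) ^ (1 + a)) := by gcongr
  have h6 := norm_nonneg (cf g n)
  nlinarith

theorem cf_summable (ha : 0 < a) (K : ℝ) :
    Summable fun n : ℕ => K * (1 / ((n:ℝ) + 1) ^ (1 + a)) := by
  have h := (Real.summable_one_div_nat_rpow (p := 1 + a)).2 (by linarith)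
  have := ((summable_nat_add_iff 1).2 h).mul_left K
  simpa using this

theorem cf_hasSum (ha : 0 < a) (hc : Continuous g) (hp : ∀ x, g (x + 1) = g x) (h : LH a K g)
    (x : ℝ) : HasSum (fun n => tm (cf g n) n x) (g x - ∫ t in (0:ℝ)..1, g t) := by
  have : Fact ((0:ℝ) < 1) := ⟨one_pos⟩
  have hper : Function.Periodic (fun x => (g x : ℂ)) 1 := fun x => by simp only [hp]
  let F : C(AddCircle (1:ℝ), ℂ) := ⟨hper.lift, by
    refine continuous_coinduced_dom.2 ?_
    change Continuous fun x => (g x : ℂ)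
    fun_prop⟩
  have hF : ∀ x : ℝ, F (x : AddCircle (1:ℝ)) = g x := fun x => rfl
  have hco : ∀ m : ℤ, fourierCoeff F m = ∫ x in (0:ℝ)..1,
      Complex.exp (2 * Real.pi * Complex.I * (-m : ℤ) * x) * (g x : ℂ) := by
    intro m
    rw [fourierCoeff_eq_intervalIntegral F m 0]
    simp only [fourier_coe_apply, hF, smul_eq_mul]
    simp
  have hpos : ∀ n : ℕ, fourierCoeff F ((n + 1 : ℕ) : ℤ) = cf g n := by
    intro n
    rw [hco, cf]
    congr 1; funext x
    rw [mul_comm]; congr 1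
    unfold ex kap; congr 1; push_cast; ring
  have hconj : ∀ m : ℤ, fourierCoeff F (-m) = (starRingEnd ℂ) (fourierCoeff F m) := by
    intro m
    rw [hco, hco]
    rw [intervalIntegral.intervalIntegral_eq_integral_uIoc,
      intervalIntegral.intervalIntegral_eq_integral_uIoc]
    simp only [zero_le_one, if_true, one_smul]
    rw [← integral_conj]
    congr 1; funext x
    rw [map_mul, Complex.conj_ofReal, ← Complex.exp_conj]
    congr 2
    simp only [map_mul, Complex.conj_I, Complex.conj_ofReal, map_ofNat, map_intCast]
    push_cast; ring
  have hzero : fourierCoeff F 0 = ((∫ t in (0:ℝ)..1, g t : ℝ) : ℂ) := by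
    rw [hco, ← intervalIntegral.integral_ofReal]
    simp
  have hs1 : Summable fun n : ℕ => fourierCoeff F ((n + 1 : ℕ) : ℤ) := by
    refine (cf_summable ha K).of_norm_bounded fun n => ?_
    rw [hpos]; exact cf_le ha hc hp h n
  have hs : Summable (fourierCoeff F) := by
    refine Summable.of_nat_of_neg ((summable_nat_add_iff 1).1 hs1) ?_
    refine (summable_nat_add_iff 1).1 ?_
    refine (cf_summable ha K).of_norm_bounded fun n => ?_
    rw [hconj, RCLike.norm_conj, hpos]; exact cf_le ha hc hp h n
  have key := (has_pointwise_sum_fourier_series_of_summable hs (x : AddCircle (1:ℝ))).nat_add_neg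
  rw [← hasSum_nat_add_iff' 1] at key
  simp only [Finset.sum_range_one, hF] at key
  have key2 := Complex.hasSum_re key
  have ef : ∀ n : ℕ, fourier ((n + 1 : ℕ) : ℤ) (x : AddCircle (1:ℝ)) = ex n x := by
    intro n
    rw [fourier_coe_apply]; unfold ex kap; congr 1; push_cast; ring
  convert! key2 using 1
  · funext n
    rw [smul_eq_mul, smul_eq_mul, hconj, fourier_neg, hpos, ef, ← map_mul, Complex.add_re,
      Complex.conj_re, tm]
    ring
  · rw [Int.cast_ofNat_Int]
    simp [hzero]

end cf

/-- Projection onto `[0, L]`. -/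
def clamp (L y : ℝ) : ℝ := max 0 (min L y)

theorem clamp_mem {L : ℝ} (hL : 0 ≤ L) (y : ℝ) : clamp L y ∈ Icc 0 L :=
  ⟨le_max_left _ _, max_le hL (min_le_left _ _)⟩

theorem clamp_of_mem {L y : ℝ} (hy : y ∈ Icc 0 L) : clamp L y = y := by
  rw [clamp, min_eq_right hy.2, max_eq_right hy.1]

theorem clamp_cont (L : ℝ) : Continuous (clamp L) := by unfold clamp; fun_prop

theorem cf_coef {L a K : ℝ} {f : ℝ → ℝ → ℝ} (hL : 0 ≤ L) (ha : 0 < a)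
    (hc : ContinuousOn (fun z : ℝ × ℝ => f z.1 z.2) (strip L))
    (hp : ∀ y ∈ Icc 0 L, ∀ x, f (x + 1) y = f x y) (hK : ∀ y ∈ Icc 0 L, LH a K fun x => f x y) :
    Coef L f (fun y => ∫ x in (0:ℝ)..1, f x (clamp L y))
      (fun n y => cf (fun x => f x (clamp L y)) n) (fun n => K * (1 / ((n:ℝ) + 1) ^ (1 + a))) := by
  have hjc : Continuous fun z : ℝ × ℝ => f z.2 (clamp L z.1) := by
    have h1 : Continuous fun z : ℝ × ℝ => (z.2, clamp L z.1) := by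
      have := clamp_cont L
      fun_prop
    exact hc.comp_continuous h1 fun z => ⟨mem_univ _, clamp_mem hL _⟩
  have hyc : ∀ y, Continuous fun x => f x (clamp L y) := fun y =>
    hjc.comp (by fun_prop : Continuous fun x : ℝ => (y, x))
  refine ⟨?_, fun n => ?_, fun n y => ?_, cf_summable ha K, fun y hy x => ?_⟩
  · exact intervalIntegral.continuous_parametric_intervalIntegral_of_continuous' hjc 0 1
  · unfold cf
    refine intervalIntegral.continuous_parametric_intervalIntegral_of_continuous'
      (f := fun y x => (f x (clamp L y) : ℂ) * ex n (-x)) ?_ 0 1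
    exact (Complex.continuous_ofReal.comp hjc).mul ((ex_cont n).comp (by fun_prop))
  · exact cf_le ha (hyc y) (hp _ (clamp_mem hL y)) (hK _ (clamp_mem hL y)) n
  · have := cf_hasSum ha (hyc y) (hp _ (clamp_mem hL y)) (hK _ (clamp_mem hL y)) x
    rwa [clamp_of_mem hy] at this ⊢

section
open MeasureTheory

theorem integrable_near {a r : ℝ} (ha : 0 < a) (hr : 0 ≤ r) :
    Integrable ((Icc (-r) r).indicator fun t : ℝ => |t| ^ (a - 1)) ∧
    ∫ t, (Icc (-r) r).indicator (fun t : ℝ => |t| ^ (a - 1)) t = 2 * (r ^ a / a) := by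
  have h1 : IntervalIntegrable (fun t : ℝ => t ^ (a - 1)) volume 0 r :=
    intervalIntegral.intervalIntegrable_rpow' (by linarith)
  have h1' : IntervalIntegrable (fun t : ℝ => |t| ^ (a - 1)) volume 0 r := by
    refine h1.congr_uIoo fun t ht => ?_
    rw [uIoo_of_le hr] at ht
    simp only [abs_of_pos ht.1]
  have e1 : ∫ t in (0:ℝ)..r, |t| ^ (a - 1) = r ^ a / a := by
    rw [intervalIntegral.integral_congr_Ioo_of_le (g := fun t => t ^ (a - 1)) hr
      (fun t ht => by simp only [abs_of_pos ht.1]), integral_rpow (Or.inl (by linarith)),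
      Real.zero_rpow (by linarith)]
    simp
  have h2' : IntervalIntegrable (fun t : ℝ => |t| ^ (a - 1)) volume (-r) 0 := by
    have := h1'.comp_sub_left 0
    simpa using this.symm
  have e2 : ∫ t in (-r)..0, |t| ^ (a - 1) = r ^ a / a := by
    rw [← e1]
    have := intervalIntegral.integral_comp_neg (a := 0) (b := r) (fun t : ℝ => |t| ^ (a - 1))
    simp only [abs_neg, neg_zero] at this
    exact this.symm
  have h3 := h2'.trans h1'
  have e3 := intervalIntegral.integral_add_adjacent_intervals h2' h1'
  constructor
  · rw [integrable_indicator_iff measurableSet_Icc]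
    exact (intervalIntegrable_iff_integrableOn_Icc_of_le (by linarith)).1 h3
  · rw [integral_indicator measurableSet_Icc, integral_Icc_eq_integral_Ioc,
      ← intervalIntegral.integral_of_le (by linarith), ← e3, e1, e2]; ring

theorem integrable_far {a r : ℝ} (ha : a < 1) (hr : 0 < r) :
    Integrable (fun t : ℝ => (r + |t|) ^ (a - 2)) ∧
    ∫ t : ℝ, (r + |t|) ^ (a - 2) = 2 * (r ^ (a - 1) / (1 - a)) := by
  have hd : ∀ t ∈ Ici (0:ℝ), HasDerivAt (fun t : ℝ => (r + t) ^ (a - 1) / (a - 1))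
      ((r + t) ^ (a - 2)) t := by
    intro t ht
    have h0 : r + t ≠ 0 := by have : (0:ℝ) ≤ t := ht; positivity
    have h1 : HasDerivAt (fun t : ℝ => r + t) 1 t := by simpa using (hasDerivAt_id t).const_add r
    refine ((h1.rpow_const (p := a - 1) (Or.inl h0)).div_const (a - 1)).congr_deriv ?_
    have : a - 1 ≠ 0 := by linarith
    rw [show a - 1 - 1 = a - 2 by ring]
    field_simp
  have ht : Filter.Tendsto (fun t : ℝ => (r + t) ^ (a - 1) / (a - 1)) Filter.atTop (nhds 0) := by
    have h1 := (tendsto_rpow_neg_atTop (y := 1 - a) (by linarith)).comp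
      (Filter.tendsto_atTop_add_const_left _ r Filter.tendsto_id)
    have := h1.div_const (a - 1)
    simpa using this
  have hp : ∀ t ∈ Ioi (0:ℝ), 0 ≤ (r + t) ^ (a - 2) := fun t ht => by
    have : (0:ℝ) < t := ht
    positivity
  have e := integral_Ioi_of_hasDerivAt_of_nonneg' hd hp ht
  have h2 : ∫ t : ℝ, (r + |t|) ^ (a - 2) = 2 * (r ^ (a - 1) / (1 - a)) := by
    rw [integral_comp_abs (f := fun t : ℝ => (r + t) ^ (a - 2)), e, add_zero, zero_sub, ← div_neg,
      neg_sub]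
  refine ⟨?_, h2⟩
  by_contra h
  rw [integral_undef h] at h2
  have : 0 < r ^ (a - 1) := Real.rpow_pos_of_pos hr _
  have h3 : 0 < 1 - a := by linarith
  have : 0 < 2 * (r ^ (a - 1) / (1 - a)) := by positivity
  linarith

theorem kernel_lower {s t : ℝ} (hs : 0 ≤ s) (ht : |t| ≤ 1 / 2) {q : ℂ}
    (hq : q = Complex.exp ((-(2 * Real.pi * s) : ℝ) + (-(2 * Real.pi * t) : ℝ) * Complex.I)) :
    16 * (s ^ 2 + t ^ 2) * ‖q‖ ≤ ‖1 - q‖ ^ 2 := by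
  set r := Real.exp (-(2 * Real.pi * s)) with hr
  have hr0 : 0 < r := Real.exp_pos _
  have hnorm : ‖q‖ = r := by rw [hq, Complex.norm_exp]; simp [hr]
  have hre : q.re = r * Real.cos (2 * Real.pi * t) := by
    rw [hq, Complex.exp_re]; simp [hr]
  have him : q.im = -(r * Real.sin (2 * Real.pi * t)) := by
    rw [hq, Complex.exp_im]; simp [hr]
  have e1 : ‖1 - q‖ ^ 2 = 1 - 2 * r * Real.cos (2 * Real.pi * t) + r ^ 2 := by
    rw [← Complex.normSq_eq_norm_sq, Complex.normSq_apply]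
    simp only [Complex.sub_re, Complex.sub_im, Complex.one_re, Complex.one_im, hre, him]
    have := Real.sin_sq_add_cos_sq (2 * Real.pi * t)
    linear_combination r ^ 2 * this
  have h1 : Real.cos (2 * Real.pi * t) = 1 - 2 * Real.sin (Real.pi * t) ^ 2 := by
    rw [show 2 * Real.pi * t = 2 * (Real.pi * t) by ring, Real.cos_two_mul]
    linear_combination 2 * Real.sin_sq_add_cos_sq (Real.pi * t)
  have h2 : (2 * |t|) ^ 2 ≤ Real.sin (Real.pi * t) ^ 2 := by
    rw [← sq_abs (Real.sin _)]
    have hj := Real.mul_le_sin (x := Real.pi * |t|) (by positivity)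
      (by nlinarith [Real.pi_pos])
    have e : |Real.sin (Real.pi * t)| = Real.sin (Real.pi * |t|) := by
      rw [Real.abs_sin_eq_sin_abs_of_abs_le_pi, abs_mul, abs_of_pos Real.pi_pos]
      rw [abs_mul, abs_of_pos Real.pi_pos]; nlinarith [Real.pi_pos]
    rw [e]
    have e2 : 2 / Real.pi * (Real.pi * |t|) = 2 * |t| := by
      have := Real.pi_ne_zero
      field_simp
    rw [e2] at hj
    gcongr
  have h3 : 4 * Real.pi ^ 2 * s ^ 2 * r ≤ (1 - r) ^ 2 := by
    have hh : Real.exp (-(Real.pi * s)) ^ 2 = r := by rw [hr, ← Real.exp_nat_mul]; congr 1; push_cast; ring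
    have hsinh := Real.self_le_sinh_iff.2 (by positivity : 0 ≤ Real.pi * s)
    rw [Real.sinh_eq] at hsinh
    have hm : Real.exp (Real.pi * s) * Real.exp (-(Real.pi * s)) = 1 := by
      rw [← Real.exp_add]; simp
    set e := Real.exp (-(Real.pi * s))
    have he : 0 < e := Real.exp_pos _
    have h4 : 2 * (Real.pi * s) * e ≤ 1 - r := by
      rw [← hh]; nlinarith
    have h5 : 0 ≤ 2 * (Real.pi * s) * e := by positivity
    calc 4 * Real.pi ^ 2 * s ^ 2 * r = (2 * (Real.pi * s) * e) ^ 2 := by rw [← hh]; ring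
      _ ≤ (1 - r) ^ 2 := by gcongr
  rw [hnorm, e1, h1]
  have h6 : (2 * |t|) ^ 2 = 4 * t ^ 2 := by rw [mul_pow, sq_abs]; ring
  rw [h6] at h2
  have h7 : 16 * s ^ 2 * r ≤ 4 * Real.pi ^ 2 * s ^ 2 * r := by
    have : 4 ≤ Real.pi ^ 2 := by nlinarith [Real.pi_gt_three]
    have h8 : 0 ≤ s ^ 2 * r := by positivity
    nlinarith
  nlinarith

/-- The mode of frequency `kap n` evaluated at height `s`. -/
def qq (s t : ℝ) : ℂ := Complex.exp ((-(2 * Real.pi * s) : ℝ) + (-(2 * Real.pi * t) : ℝ) * Complex.I)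

theorem qq_norm (s t : ℝ) : ‖qq s t‖ = Real.exp (-(2 * Real.pi * s)) := by
  rw [qq, Complex.norm_exp]; simp

theorem qq_norm_lt {s : ℝ} (hs : 0 < s) (t : ℝ) : ‖qq s t‖ < 1 := by
  rw [qq_norm, Real.exp_lt_one_iff]; have := Real.pi_pos; simp only [Left.neg_neg_iff]; positivity

theorem qq_pow (s t : ℝ) (n : ℕ) :
    qq s t ^ (n + 1) = (Real.exp (-kap n * s) : ℂ) * ex n (-t) := by
  unfold qq ex kap
  rw [← Complex.exp_nat_mul, Complex.ofReal_exp, ← Complex.exp_add]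
  congr 1; push_cast; ring

theorem kap_exp_summable {s : ℝ} (hs : 0 < s) : Summable fun n => kap n * Real.exp (-kap n * s) := by
  have h := summable_pow_mul_geometric_of_norm_lt_one (R := ℝ) 1
    (r := Real.exp (-(2 * Real.pi * s))) (by
      rw [Real.norm_eq_abs, Real.abs_exp, ← qq_norm s 0]; exact qq_norm_lt hs 0)
  have h2 := ((summable_nat_add_iff 1).2 h).mul_left (2 * Real.pi)
  refine h2.congr fun n => ?_
  rw [← Real.exp_nat_mul, pow_one, kap]; push_cast; ring_nf

theorem kap_qq_hasSum {s : ℝ} (hs : 0 < s) (t : ℝ) :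
    HasSum (fun n => (kap n : ℂ) * qq s t ^ (n + 1)) (2 * Real.pi * (qq s t / (1 - qq s t) ^ 2)) := by
  have h := hasSum_coe_mul_geometric_of_norm_lt_one (qq_norm_lt hs t)
  rw [← hasSum_nat_add_iff' 1] at h
  have h2 := h.mul_left (2 * Real.pi : ℂ)
  simp only [Finset.sum_range_one, Nat.cast_zero, zero_mul, sub_zero] at h2
  refine h2.congr_fun fun n => ?_
  rw [kap]; push_cast; ring

theorem kap_qq_sum_norm {s t : ℝ} (hs : 0 < s) (ht : |t| ≤ 1 / 2) :
    ‖2 * Real.pi * (qq s t / (1 - qq s t) ^ 2)‖ ≤ 1 / (s + |t|) ^ 2 := by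
  have h1 := kernel_lower hs.le ht (q := qq s t) rfl
  have hq : 0 < ‖qq s t‖ := by rw [qq_norm]; exact Real.exp_pos _
  rw [norm_mul, norm_div, norm_pow, norm_mul, Complex.norm_real, Real.norm_eq_abs,
    abs_of_pos Real.pi_pos, Complex.norm_ofNat]
  have h2 : (s + |t|) ^ 2 ≤ 2 * (s ^ 2 + t ^ 2) := by
    nlinarith [sq_nonneg (s - |t|), sq_abs t]
  have h3 : 0 < ‖1 - qq s t‖ ^ 2 := lt_of_lt_of_le (by positivity) h1
  have h4 : 0 < (s + |t|) ^ 2 := by positivity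
  rw [← mul_div_assoc, div_le_div_iff₀ h3 h4, one_mul]
  have h5 : Real.pi ≤ 4 := Real.pi_le_four
  calc 2 * Real.pi * ‖qq s t‖ * (s + |t|) ^ 2 ≤ 2 * 4 * ‖qq s t‖ * (2 * (s ^ 2 + t ^ 2)) := by gcongr
    _ = 16 * (s ^ 2 + t ^ 2) * ‖qq s t‖ := by ring
    _ ≤ _ := h1

section
variable {g : ℝ → ℝ} {a H : ℝ}

theorem ex_int (n : ℕ) (b : ℝ) : ∫ t in b..(b + 1), ex n (-t) = 0 := by
  have h : ∀ t : ℝ, ex n (-t) = Complex.exp (-(kap n * Complex.I) * t) := fun t => by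
    unfold ex; congr 1; push_cast; ring
  have hk : (-(kap n * Complex.I) : ℂ) ≠ 0 := by
    have := (kap_pos n).ne'
    simp [this, Complex.I_ne_zero]
  simp_rw [h]
  rw [integral_exp_mul_complex hk, ← h, ← h, ex_neg_per, sub_self, zero_div]

theorem cf_local (hc : Continuous g) (hp : ∀ x, g (x + 1) = g x) (n : ℕ) (x : ℝ) :
    cf g n * ex n x = ∫ t in (-(1/2):ℝ)..(1/2), ((g (x + t) - g x : ℝ) : ℂ) * ex n (-t) := by
  have h1 := cf_translate hp n x
  have h2 := cf_shift (g := fun t => g (t + x)) (fun t => by rw [add_right_comm, hp]) n (-(1/2))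
  have h3 := ex_int n (-(1/2))
  rw [show (-(1/2) + 1 : ℝ) = 1/2 by norm_num] at h2 h3
  have i1 := (cf_cont_int (g := fun t => g (t + x)) (by fun_prop) n).intervalIntegrable
      (μ := MeasureTheory.volume) (-(1/2)) (1/2)
  have i2 := (cf_cont_int (g := fun t => g x) (by fun_prop) n).intervalIntegrable
      (μ := MeasureTheory.volume) (-(1/2)) (1/2)
  have e : ∫ t in (-(1/2):ℝ)..(1/2), ((g (x + t) - g x : ℝ) : ℂ) * ex n (-t)
      = (∫ t in (-(1/2):ℝ)..(1/2), (g (t + x) : ℂ) * ex n (-t))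
        - ∫ t in (-(1/2):ℝ)..(1/2), (g x : ℂ) * ex n (-t) := by
    rw [← intervalIntegral.integral_sub i1 i2]
    congr 1; funext t; rw [add_comm x t]; push_cast; ring
  rw [e, intervalIntegral.integral_const_mul, h3, ← h2, h1]; ring

theorem cf_le_holder (hc : Continuous g) (ha : 0 ≤ a) (hp : ∀ x, g (x + 1) = g x) (hH0 : 0 ≤ H)
    (hH : ∀ x x', |g x - g x'| ≤ H * |x - x'| ^ a) (n : ℕ) : ‖cf g n‖ ≤ H := by
  have h := cf_local hc hp n 0
  have e0 : ex n 0 = 1 := by simp [ex]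
  rw [e0, mul_one] at h
  rw [h]
  refine (intervalIntegral.norm_integral_le_of_norm_le_const (C := H) fun t ht => ?_).trans
    (by norm_num)
  rw [uIoc_of_le (by norm_num)] at ht
  rw [norm_mul, ex_norm, mul_one, Complex.norm_real, Real.norm_eq_abs]
  refine (hH _ _).trans ?_
  have : |0 + t - 0| ^ a ≤ 1 := Real.rpow_le_one (abs_nonneg _)
    (by rw [abs_le]; constructor <;> linarith [ht.1, ht.2]) ha
  calc _ ≤ H * 1 := by gcongr
    _ = H := mul_one _

theorem dsum_le (hc : Continuous g) (ha : a ∈ Ioo (0:ℝ) 1) (hp : ∀ x, g (x + 1) = g x)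
    (hH0 : 0 ≤ H) (hH : ∀ x x', |g x - g x'| ≤ H * |x - x'| ^ a) (x : ℝ) {s : ℝ} (hs : 0 < s) :
    ‖∑' n, (kap n * Real.exp (-kap n * s) : ℝ) * (cf g n * ex n x)‖
      ≤ 2 / (1 - a) * H * s ^ (a - 1) := by
  have hb : ∀ t ∈ uIoc (-(1/2):ℝ) (1/2), |t| ≤ 1 / 2 := fun t ht => by
    rw [uIoc_of_le (by norm_num)] at ht
    exact abs_le.2 ⟨by linarith [ht.1], ht.2⟩
  have hg1 : ∀ t ∈ uIoc (-(1/2):ℝ) (1/2), |g (x + t) - g x| ≤ H * |t| ^ a := fun t ht => by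
    simpa using hH (x + t) x
  have key : HasSum (fun n => ∫ t in (-(1/2):ℝ)..(1/2),
      (kap n : ℂ) * qq s t ^ (n + 1) * ((g (x + t) - g x : ℝ) : ℂ))
      (∫ t in (-(1/2):ℝ)..(1/2), 2 * Real.pi * (qq s t / (1 - qq s t) ^ 2) *
        ((g (x + t) - g x : ℝ) : ℂ)) := by
    refine intervalIntegral.hasSum_integral_of_dominated_convergence
      (fun n _ => kap n * Real.exp (-kap n * s) * H) (fun n => ?_) (fun n => ?_) ?_ ?_ ?_
    · refine Continuous.aestronglyMeasurable ?_
      have : Continuous (qq s) := by unfold qq; fun_prop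
      fun_prop
    · refine Filter.Eventually.of_forall fun t ht => ?_
      rw [qq_pow, norm_mul, norm_mul, norm_mul, ex_norm, mul_one, Complex.norm_real,
        Complex.norm_real, Complex.norm_real, Real.norm_eq_abs, Real.norm_eq_abs,
        Real.norm_eq_abs, Real.abs_exp, abs_of_pos (kap_pos n)]
      have := kap_pos n
      have h1 : |t| ^ a ≤ 1 := Real.rpow_le_one (abs_nonneg _) (by linarith [hb t ht]) ha.1.le
      gcongr
      exact (hg1 t ht).trans (by nlinarith)
    · exact Filter.Eventually.of_forall fun t ht => (kap_exp_summable hs).mul_right H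
    · exact intervalIntegrable_const
    · exact Filter.Eventually.of_forall fun t ht => (kap_qq_hasSum hs t).mul_right _
  have e : ∀ n, ∫ t in (-(1/2):ℝ)..(1/2),
      (kap n : ℂ) * qq s t ^ (n + 1) * ((g (x + t) - g x : ℝ) : ℂ)
      = (kap n * Real.exp (-kap n * s) : ℝ) * (cf g n * ex n x) := by
    intro n
    rw [cf_local hc hp, ← intervalIntegral.integral_const_mul]
    congr 1; funext t; rw [qq_pow]; push_cast; ring
  simp only [e] at key
  rw [key.tsum_eq]
  obtain ⟨f1, f2⟩ := integrable_far ha.2 hs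
  calc _ ≤ ∫ t in (-(1/2):ℝ)..(1/2), H * (s + |t|) ^ (a - 2) := by
        refine intervalIntegral.norm_integral_le_of_norm_le (by norm_num)
          (Filter.Eventually.of_forall fun t ht => ?_) ((f1.const_mul H).intervalIntegrable)
        rw [← uIoc_of_le (by norm_num)] at ht
        rw [norm_mul, Complex.norm_real, Real.norm_eq_abs]
        have hpos : 0 < s + |t| := by positivity
        calc _ ≤ 1 / (s + |t|) ^ 2 * (H * (s + |t|) ^ a) := by
              refine mul_le_mul (kap_qq_sum_norm hs (hb t ht)) ((hg1 t ht).trans ?_)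
                (abs_nonneg _) (by positivity)
              have := ha.1.le
              gcongr
              linarith
          _ = H * (s + |t|) ^ (a - 2) := by
              rw [Real.rpow_sub hpos, Real.rpow_two]; ring
    _ ≤ ∫ t, H * (s + |t|) ^ (a - 2) := by
        rw [intervalIntegral.integral_of_le (by norm_num)]
        exact setIntegral_le_integral (f1.const_mul H) (Filter.Eventually.of_forall fun t => by
          change 0 ≤ H * (s + |t|) ^ (a - 2); positivity)
    _ = _ := by rw [integral_const_mul, f2]; ring

end

end

section
open MeasureTheory

/-- The holomorphic generating function of the second derivatives. -/
def GG (L : ℝ) (g : ℝ → ℝ) (z : ℂ) : ℂ :=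
  ∑' n, (kap n * wgt L (kap n) : ℝ) * (cf g n * Complex.exp (kap n * Complex.I * z))

theorem mode_norm (n : ℕ) (z : ℂ) :
    ‖Complex.exp (kap n * Complex.I * z)‖ = Real.exp (-kap n * z.im) := by
  rw [Complex.norm_exp]; congr 1; simp

theorem mode_eq (n : ℕ) (x s : ℝ) :
    Complex.exp (kap n * Complex.I * (x + s * Complex.I)) = (Real.exp (-kap n * s) : ℝ) * ex n x := by
  unfold ex
  rw [Complex.ofReal_exp, ← Complex.exp_add]; congr 1
  push_cast
  linear_combination (kap n : ℂ) * s * Complex.I_sq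

theorem wgt_eq {L k : ℝ} (hL : 0 < L) (hk : 0 < k) :
    wgt L k = 1 + Real.exp (-2 * k * L) * wgt L k := by
  have h1 : Real.exp (-2 * k * L) < 1 := Real.exp_lt_one_iff.2 (by nlinarith [mul_pos hk hL])
  unfold wgt
  generalize Real.exp (-2 * k * L) = e at h1 ⊢
  have : 1 - e ≠ 0 := by linarith
  field_simp
  ring

/-- The constant in the estimates of the generating function. -/
def CG (L a : ℝ) : ℝ := 2 / (1 - a)
  + (∑' n, kap n * Real.exp (-kap n * (2 * L))) * wgt L (2 * Real.pi) * (3 * L) ^ (1 - a)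

theorem CG_nonneg {L a : ℝ} (hL : 0 < L) (ha : a < 1) : 0 ≤ CG L a := by
  unfold CG
  have h1 : 0 ≤ ∑' n, kap n * Real.exp (-kap n * (2 * L)) :=
    tsum_nonneg fun n => mul_nonneg (kap_pos n).le (Real.exp_pos _).le
  have h2 := wgt_nonneg hL (by positivity : 0 < 2 * Real.pi)
  have h3 : 0 < 1 - a := by linarith
  positivity

section GG
variable {g : ℝ → ℝ} {a H L : ℝ}

theorem GG_term_le (hL : 0 < L) (hb : ∀ n, ‖cf g n‖ ≤ H) (n : ℕ) {s : ℝ} {z : ℂ} (hs : s ≤ z.im) :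
    ‖((kap n * wgt L (kap n) : ℝ) : ℂ) * (cf g n * Complex.exp (kap n * Complex.I * z))‖
      ≤ kap n * Real.exp (-kap n * s) * (wgt L (2 * Real.pi) * H) := by
  have hk := kap_pos n
  have hw := wgt_nonneg hL hk
  have hw' := wgt_le hL n
  rw [norm_mul, norm_mul, mode_norm, Complex.norm_real, Real.norm_eq_abs,
    abs_of_nonneg (by positivity)]
  have h1 : Real.exp (-kap n * z.im) ≤ Real.exp (-kap n * s) := Real.exp_le_exp.2 (by nlinarith)
  have hH := (norm_nonneg _).trans (hb n)
  have hW := hw.trans hw'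
  calc kap n * wgt L (kap n) * (‖cf g n‖ * Real.exp (-kap n * z.im))
      ≤ kap n * wgt L (2 * Real.pi) * (H * Real.exp (-kap n * s)) := by
        gcongr
        exact hb n
    _ = _ := by ring

theorem GG_le (hL : 0 < L) (hc : Continuous g) (ha : a ∈ Ioo (0:ℝ) 1) (hp : ∀ x, g (x + 1) = g x)
    (hH0 : 0 ≤ H) (hH : ∀ x x', |g x - g x'| ≤ H * |x - x'| ^ a) {z : ℂ} (h0 : 0 < z.im)
    (h1 : z.im ≤ 3 * L) : ‖GG L g z‖ ≤ CG L a * H * z.im ^ (a - 1) := by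
  set s := z.im with hs
  set x := z.re with hx
  have hz : z = x + s * Complex.I := (Complex.re_add_im z).symm
  have hb := cf_le_holder hc ha.1.le hp hH0 hH
  have hd := dsum_le hc ha hp hH0 hH x h0
  have hW := wgt_nonneg hL (by positivity : 0 < 2 * Real.pi)
  have e : ∀ n, ((kap n * wgt L (kap n) : ℝ) : ℂ) * (cf g n * Complex.exp (kap n * Complex.I * z))
      = (kap n * Real.exp (-kap n * s) : ℝ) * (cf g n * ex n x)
      + (kap n * Real.exp (-kap n * (2 * L)) : ℝ) * ((Real.exp (-kap n * s) * wgt L (kap n) : ℝ) *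
        (cf g n * ex n x)) := by
    intro n
    rw [hz, mode_eq]
    have h2 : (wgt L (kap n) : ℂ) = 1 + (Real.exp (-kap n * (2 * L)) : ℝ) * wgt L (kap n) := by
      have := wgt_eq hL (kap_pos n)
      rw [show -2 * kap n * L = -kap n * (2 * L) by ring] at this
      exact_mod_cast this
    push_cast at h2 ⊢
    linear_combination (kap n * cf g n * Complex.exp (-kap n * s) * ex n x : ℂ) * h2
  have hs1 : Summable fun n => ((kap n * Real.exp (-kap n * s) : ℝ) : ℂ) * (cf g n * ex n x) := by
    refine ((kap_exp_summable h0).mul_right H).of_norm_bounded fun n => ?_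
    rw [norm_mul, norm_mul, ex_norm, mul_one, Complex.norm_real, Real.norm_eq_abs,
      abs_of_nonneg (mul_nonneg (kap_pos n).le (Real.exp_pos _).le)]
    have := kap_pos n
    gcongr
    exact hb n
  have hb2 : ∀ n, ‖((kap n * Real.exp (-kap n * (2 * L)) : ℝ) : ℂ) *
      ((Real.exp (-kap n * s) * wgt L (kap n) : ℝ) * (cf g n * ex n x))‖
      ≤ kap n * Real.exp (-kap n * (2 * L)) * (wgt L (2 * Real.pi) * H) := by
    intro n
    have hk := kap_pos n
    have hw := wgt_nonneg hL hk
    have hw' := wgt_le hL n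
    have he : Real.exp (-kap n * s) ≤ 1 := Real.exp_le_one_iff.2 (by nlinarith)
    rw [norm_mul, norm_mul, norm_mul, ex_norm, mul_one, Complex.norm_real, Real.norm_eq_abs,
      abs_of_nonneg (by positivity), Complex.norm_real, Real.norm_eq_abs,
      abs_of_nonneg (by positivity)]
    gcongr
    · calc _ ≤ 1 * wgt L (2 * Real.pi) := by gcongr
        _ = _ := one_mul _
    · exact hb n
  have hsum2 := (kap_exp_summable (by positivity : 0 < 2 * L)).mul_right (wgt L (2 * Real.pi) * H)
  have hs2 := hsum2.of_norm_bounded hb2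
  have h3 : ‖∑' n, ((kap n * Real.exp (-kap n * (2 * L)) : ℝ) : ℂ) *
      ((Real.exp (-kap n * s) * wgt L (kap n) : ℝ) * (cf g n * ex n x))‖
      ≤ (∑' n, kap n * Real.exp (-kap n * (2 * L))) * (wgt L (2 * Real.pi) * H) := by
    rw [← tsum_mul_right]
    exact tsum_of_norm_bounded hsum2.hasSum hb2
  have h4 : 1 ≤ (3 * L) ^ (1 - a) * s ^ (a - 1) := by
    have : s ^ (a - 1) = (s ^ (1 - a))⁻¹ := by rw [← Real.rpow_neg h0.le, neg_sub]
    rw [this, ← div_eq_mul_inv, one_le_div (Real.rpow_pos_of_pos h0 _)]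
    exact Real.rpow_le_rpow h0.le h1 (by linarith [ha.2])
  have hR : 0 ≤ ∑' n, kap n * Real.exp (-kap n * (2 * L)) :=
    tsum_nonneg fun n => mul_nonneg (kap_pos n).le (Real.exp_pos _).le
  rw [GG]
  simp only [e]
  rw [hs1.tsum_add hs2]
  refine (norm_add_le _ _).trans ((add_le_add hd h3).trans ?_)
  have h5 : 0 ≤ (∑' n, kap n * Real.exp (-kap n * (2 * L))) * (wgt L (2 * Real.pi) * H) := by
    positivity
  have h6 := mul_le_mul_of_nonneg_left h4 h5
  calc _ ≤ 2 / (1 - a) * H * s ^ (a - 1) + (∑' n, kap n * Real.exp (-kap n * (2 * L))) *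
        (wgt L (2 * Real.pi) * H) * ((3 * L) ^ (1 - a) * s ^ (a - 1)) := by linarith
    _ = _ := by unfold CG; ring

theorem GG_diffOn (hL : 0 < L) (hb : ∀ n, ‖cf g n‖ ≤ H) {r : ℝ} (hr : 0 < r) :
    DifferentiableOn ℂ (GG L g) {z | r < z.im} := by
  refine Complex.differentiableOn_tsum_of_summable_norm
    ((kap_exp_summable hr).mul_right (wgt L (2 * Real.pi) * H)) (fun n => ?_)
    (isOpen_lt continuous_const Complex.continuous_im) (fun n z hz => ?_)
  · fun_prop
  · exact GG_term_le hL hb n (le_of_lt hz)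

theorem GG_diff_le (hL : 0 < L) (hc : Continuous g) (ha : a ∈ Ioo (0:ℝ) 1)
    (hp : ∀ x, g (x + 1) = g x)
    (hH0 : 0 ≤ H) (hH : ∀ x x', |g x - g x'| ≤ H * |x - x'| ^ a) {r : ℝ} (hr : 0 < r) {z w : ℂ}
    (hz : z.im ∈ Icc r (2 * L)) (hw : w.im ∈ Icc r (2 * L)) :
    ‖GG L g z - GG L g w‖ ≤ 4 * CG L a * H * r ^ (a - 2) * ‖z - w‖ := by
  have hb := cf_le_holder hc ha.1.le hp hH0 hH
  have hC := CG_nonneg hL ha.2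
  have hconv : Convex ℝ {z : ℂ | z.im ∈ Icc r (2 * L)} :=
    (convex_Icc r (2 * L)).linear_preimage Complex.imLm
  refine hconv.norm_image_sub_le_of_norm_deriv_le (𝕜 := ℂ) (f := GG L g) (fun z hz => ?_)
    (fun z hz => ?_) hw hz
  · have hz : z.im ∈ Icc r (2 * L) := hz
    refine (GG_diffOn hL hb (r := r / 2) (by positivity)).differentiableAt
      ((isOpen_lt continuous_const Complex.continuous_im).mem_nhds ?_)
    change r / 2 < z.im
    linarith [hz.1]
  · have hz : z.im ∈ Icc r (2 * L) := hz
    set s := z.im with hs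
    have hs0 : 0 < s := hr.trans_le hz.1
    have him : ∀ v ∈ Metric.closedBall z (s / 2), |v.im - s| ≤ s / 2 := fun v hv => by
      have := Complex.abs_im_le_norm (v - z)
      rw [Complex.sub_im] at this
      exact this.trans (by simpa [dist_eq_norm] using hv)
    have hd : DiffContOnCl ℂ (GG L g) (Metric.ball z (s / 2)) := by
      have : DifferentiableOn ℂ (GG L g) (Metric.closedBall z (s / 2)) := by
        refine (GG_diffOn hL hb (r := s / 4) (by positivity)).mono fun v hv => ?_
        have := abs_le.1 (him v hv)
        change s / 4 < v.im
        linarith [this.1]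
      exact this.diffContOnCl_ball subset_rfl
    have h1 := Complex.norm_deriv_le_of_forall_mem_sphere_norm_le (by positivity : 0 < s / 2) hd
      (C := CG L a * H * (s / 2) ^ (a - 1)) (fun v hv => by
        have := abs_le.1 (him v (Metric.sphere_subset_closedBall hv))
        refine (GG_le hL hc ha hp hH0 hH (z := v) (by linarith [this.1])
          (by linarith [this.2, hz.2])).trans ?_
        have h2 : v.im ^ (a - 1) ≤ (s / 2) ^ (a - 1) :=
          Real.rpow_le_rpow_of_nonpos (by positivity) (by linarith [this.1]) (by linarith [ha.2])
        gcongr)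
    refine h1.trans ?_
    have e : CG L a * H * (s / 2) ^ (a - 1) / (s / 2) = CG L a * H * (s / 2) ^ (a - 2) := by
      rw [mul_div_assoc]; congr 1
      rw [← Real.rpow_sub_one (by positivity)]; congr 1; ring
    rw [e]
    have h3 : (s / 2) ^ (a - 2) ≤ 4 * r ^ (a - 2) := by
      calc (s / 2) ^ (a - 2) ≤ (r / 2) ^ (a - 2) :=
            Real.rpow_le_rpow_of_nonpos (by positivity) (by linarith [hz.1]) (by linarith [ha.2])
        _ = r ^ (a - 2) * (2:ℝ) ^ (2 - a) := by
            rw [Real.div_rpow hr.le (by norm_num), div_eq_mul_inv,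
              ← Real.rpow_neg (by norm_num : (0:ℝ) ≤ 2), neg_sub]
        _ ≤ r ^ (a - 2) * (2:ℝ) ^ (2:ℝ) := by
            gcongr
            · norm_num
            · linarith [ha.1]
        _ = _ := by norm_num; ring
    calc _ ≤ CG L a * H * (4 * r ^ (a - 2)) := by gcongr
      _ = _ := by ring

end GG

end

section
open MeasureTheory

/-- The singular integral with phase `j` and sign factor `sg`, as a Fourier series. -/
def WW (L : ℝ) (j : Fin 4) (sg : ℝ → ℝ) (f : ℝ → ℝ → ℝ) (x y : ℝ) : ℂ :=
  ∑' n, (kap n * wgt L (kap n) : ℝ) *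
    (ker L j sg (kap n) (fun t => cf (fun x => f x (clamp L t)) n) y * ex n x)

/-- The integrand of the singular integral. -/
def wint (L : ℝ) (j : Fin 4) (sg : ℝ → ℝ) (f : ℝ → ℝ → ℝ) (x y t : ℝ) (n : ℕ) : ℂ :=
  (sg (y - t) : ℂ) * (((kap n * wgt L (kap n) : ℝ) : ℂ) * (cf (fun x => f x (clamp L t)) n *
    Complex.exp (kap n * Complex.I * (x + phs L j y t * Complex.I))))

/-- `f` is jointly `a`-Hölder on the strip. -/
def JH (L a C : ℝ) (v : ℝ → ℝ → ℝ) : Prop := ∀ y ∈ Icc 0 L, ∀ t ∈ Icc 0 L, ∀ x s,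
  |v x y - v s t| ≤ C * (max |x - s| |y - t|) ^ a

/-- The constant of the singular integral estimate. -/
def CW (L a : ℝ) : ℝ := CG L a * (2 * (L ^ a / a)) + CG L a * (12 / a + 256 / (1 - a))

theorem CW_nonneg {L a : ℝ} (hL : 0 < L) (ha : a ∈ Ioo (0:ℝ) 1) : 0 ≤ CW L a := by
  have h1 := CG_nonneg hL ha.2
  have h2 : 0 < 1 - a := by linarith [ha.2]
  have h3 := ha.1
  unfold CW
  positivity

section WW
variable {L a H K : ℝ} {f : ℝ → ℝ → ℝ} {sg : ℝ → ℝ}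

theorem wint_eq (j : Fin 4) (x y t : ℝ) (n : ℕ) : wint L j sg f x y t n =
    ((kap n * wgt L (kap n) : ℝ) * ex n x) * ((sg (y - t) * Real.exp (-kap n * phs L j y t) : ℝ) *
      cf (fun x => f x (clamp L t)) n) := by
  rw [wint, mode_eq]; push_cast; ring

theorem wint_integral (hL : 0 ≤ L) (j : Fin 4) (x y : ℝ) (n : ℕ) :
    ∫ t in Ioc 0 L, wint L j sg f x y t n = (kap n * wgt L (kap n) : ℝ) *
    (ker L j sg (kap n) (fun t => cf (fun x => f x (clamp L t)) n) y * ex n x) := by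
  simp only [wint_eq]
  rw [integral_const_mul, ker, intervalIntegral.integral_of_le hL]; ring

theorem wint_integrable (hL : 0 ≤ L) (j : Fin 4) (hsg : SgOK sg)
    (hc : ∀ n, Continuous fun t => cf (fun x => f x (clamp L t)) n) (x y : ℝ) (n : ℕ) :
    Integrable (fun t => wint L j sg f x y t n) (volume.restrict (Ioc 0 L)) := by
  simp only [wint_eq]
  exact (((intervalIntegrable_iff_integrableOn_Ioc_of_le hL).1
    (ker_integrable j hsg (kap n) (hc n) y 0 L))).const_mul _

theorem wint_norm_integral (hL : 0 < L) (j : Fin 4) (hsg : SgOK sg)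
    (hc : ∀ n, Continuous fun t => cf (fun x => f x (clamp L t)) n) {A : ℕ → ℝ}
    (hA : ∀ n t, ‖cf (fun x => f x (clamp L t)) n‖ ≤ A n) (x : ℝ) {y : ℝ} (hy : y ∈ Icc 0 L) (n : ℕ) :
    ∫ t in Ioc 0 L, ‖wint L j sg f x y t n‖ ≤ 2 * wgt L (2 * Real.pi) * A n := by
  have hk := kap_pos n
  have hw := wgt_nonneg hL hk
  have hw' := wgt_le hL n
  have hA0 := (norm_nonneg _).trans (hA n 0)
  have h1 : ∀ t ∈ Ioc 0 L, ‖wint L j sg f x y t n‖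
      ≤ kap n * wgt L (kap n) * A n * Real.exp (-kap n * |y - t|) := by
    intro t ht
    have h2 := phs_ge j hy (Ioc_subset_Icc_self ht)
    have h3 := hsg.2.1 (y - t)
    rw [wint_eq, norm_mul, norm_mul, norm_mul, ex_norm, mul_one, Complex.norm_real,
      Complex.norm_real, Real.norm_eq_abs, Real.norm_eq_abs, abs_of_nonneg (by positivity),
      abs_mul, Real.abs_exp]
    have h4 : Real.exp (-kap n * phs L j y t) ≤ Real.exp (-kap n * |y - t|) :=
      Real.exp_le_exp.2 (by nlinarith)
    calc _ ≤ kap n * wgt L (kap n) * ((1 * Real.exp (-kap n * |y - t|)) * A n) := by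
          gcongr
          exact hA n t
      _ = _ := by ring
  have hi : Integrable (fun t => kap n * wgt L (kap n) * A n * Real.exp (-kap n * |y - t|))
      (volume.restrict (Ioc 0 L)) := by
    have : Continuous fun t => kap n * wgt L (kap n) * A n * Real.exp (-kap n * |y - t|) := by
      fun_prop
    exact (this.integrableOn_Icc (a := 0) (b := L)).mono_set Ioc_subset_Icc_self
  refine (integral_mono_ae (wint_integrable hL.le j hsg hc x y n).norm hi
    ((ae_restrict_iff' measurableSet_Ioc).2 (Filter.Eventually.of_forall h1))).trans ?_
  rw [integral_const_mul, ← intervalIntegral.integral_of_le hL.le]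
  calc _ ≤ kap n * wgt L (kap n) * A n * (2 / kap n) := by
        gcongr
        exact integral_exp_abs_le hk hy
    _ = 2 * wgt L (kap n) * A n := by field_simp
    _ ≤ _ := by gcongr

theorem wint_tsum (j : Fin 4) (x y t : ℝ) : ∑' n, wint L j sg f x y t n =
    (sg (y - t) : ℂ) * GG L (fun x => f x (clamp L t)) (x + phs L j y t * Complex.I) := by
  simp only [wint]; rw [tsum_mul_left]; rfl

theorem im_aux (x s : ℝ) : ((x : ℂ) + s * Complex.I).im = s := by simp

/-- The hypotheses on the right-hand side. -/
structure Rhs (L a H : ℝ) (f : ℝ → ℝ → ℝ) : Prop where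
  cont : ContinuousOn (fun z : ℝ × ℝ => f z.1 z.2) (strip L)
  per : ∀ y ∈ Icc 0 L, ∀ x, f (x + 1) y = f x y
  hb : ∀ y ∈ Icc 0 L, HB a H fun x => f x y
  lh : ∃ K, ∀ y ∈ Icc 0 L, LH a K fun x => f x y

theorem Rhs.H_nonneg (hL : 0 ≤ L) (h : Rhs L a H f) : 0 ≤ H := (h.hb 0 ⟨le_rfl, hL⟩).nonneg

theorem Rhs.coef (hL : 0 ≤ L) (ha : 0 < a) (h : Rhs L a H f) : ∃ A : ℕ → ℝ,
    Coef L f (fun y => ∫ x in (0:ℝ)..1, f x (clamp L y))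
      (fun n y => cf (fun x => f x (clamp L y)) n) A := by
  obtain ⟨K, hK⟩ := h.lh
  exact ⟨_, cf_coef hL ha h.cont h.per hK⟩

theorem wint_summable (hL : 0 < L) (ha : a ∈ Ioo (0:ℝ) 1) (h : Rhs L a H f) (j : Fin 4)
    (x : ℝ) {y t : ℝ} (hy : y ∈ Icc 0 L) (ht : t ∈ Icc 0 L) (hyt : y ≠ t) :
    Summable fun n => wint L j sg f x y t n := by
  have h0 : 0 < |y - t| := abs_pos.2 (sub_ne_zero.2 hyt)
  have hf := h.hb _ (clamp_mem hL.le t)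
  have hb := cf_le_holder (hf.continuous ha.1) ha.1.le (h.per _ (clamp_mem hL.le t))
    hf.nonneg hf.2
  refine Summable.mul_left _ (((kap_exp_summable h0).mul_right
    (wgt L (2 * Real.pi) * H)).of_norm_bounded fun n => ?_)
  exact GG_term_le hL hb n ((phs_ge j hy ht).trans (im_aux _ _).ge)

theorem wint_tsum_le (hL : 0 < L) (ha : a ∈ Ioo (0:ℝ) 1) (hsg : SgOK sg) (h : Rhs L a H f)
    (j : Fin 4) (x : ℝ) {y t : ℝ} (hy : y ∈ Icc 0 L) (ht : t ∈ Icc 0 L) (hyt : y ≠ t) :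
    ‖∑' n, wint L j sg f x y t n‖ ≤ CG L a * H * |y - t| ^ (a - 1) := by
  have h0 : 0 < |y - t| := abs_pos.2 (sub_ne_zero.2 hyt)
  have hf := h.hb _ (clamp_mem hL.le t)
  have hge := phs_ge j hy ht
  have hC := CG_nonneg hL ha.2
  have hH := hf.nonneg
  have h1 := GG_le hL (hf.continuous ha.1) ha (h.per _ (clamp_mem hL.le t)) hf.nonneg hf.2
    (z := x + phs L j y t * Complex.I) (by rw [im_aux]; linarith)
    (by rw [im_aux]; linarith [phs_le j hy ht])
  rw [im_aux] at h1
  rw [wint_tsum, norm_mul, Complex.norm_real, Real.norm_eq_abs]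
  calc _ ≤ 1 * (CG L a * H * phs L j y t ^ (a - 1)) :=
        mul_le_mul (hsg.2.1 _) h1 (norm_nonneg _) zero_le_one
    _ ≤ _ := by
      rw [one_mul]
      exact mul_le_mul_of_nonneg_left (Real.rpow_le_rpow_of_nonpos h0 hge (by linarith [ha.2]))
        (by positivity)

theorem WW_le (hL : 0 < L) (ha : a ∈ Ioo (0:ℝ) 1) (hsg : SgOK sg) (h : Rhs L a H f)
    (j : Fin 4) (x : ℝ) {y : ℝ} (hy : y ∈ Icc 0 L) : ‖WW L j sg f x y‖ ≤ CW L a * H := by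
  obtain ⟨A, hA⟩ := h.coef hL.le ha.1
  have hS := hasSum_integral_of_summable_integral_norm (μ := volume.restrict (Ioc 0 L))
    (F := fun n t => wint L j sg f x y t n) (wint_integrable hL.le j hsg hA.c_cont x y)
    (Summable.of_nonneg_of_le (fun n => integral_nonneg fun t => norm_nonneg _)
      (wint_norm_integral hL j hsg hA.c_cont hA.bd x hy) (hA.summ.mul_left _))
  have e : WW L j sg f x y = ∫ t in Ioc 0 L, ∑' n, wint L j sg f x y t n := by
    rw [← hS.tsum_eq]; simp only [wint_integral hL.le]; rfl
  obtain ⟨hn1, hn2⟩ := integrable_near ha.1 hL.le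
  have hC := CG_nonneg hL ha.2
  have hH := h.H_nonneg hL.le
  have hi := (hn1.comp_sub_left y).const_mul (CG L a * H)
  have hi2 : ∫ t, CG L a * H * (Icc (-L) L).indicator (fun t : ℝ => |t| ^ (a - 1)) (y - t)
      = CG L a * H * (2 * (L ^ a / a)) := by
    rw [integral_const_mul, integral_sub_left_eq_self
      ((Icc (-L) L).indicator fun t : ℝ => |t| ^ (a - 1)) volume y, hn2]
  rw [e]
  refine (norm_integral_le_of_norm_le (hi.restrict (s := Ioc 0 L)) ?_).trans ?_
  · rw [ae_restrict_iff' measurableSet_Ioc]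
    filter_upwards [compl_mem_ae_iff.2 (measure_singleton y)] with t ht ht'
    have ht'' := Ioc_subset_Icc_self ht'
    rw [indicator_of_mem (by constructor <;> linarith [hy.1, hy.2, ht''.1, ht''.2])]
    exact wint_tsum_le hL ha hsg h j x hy ht'' (fun h => ht h.symm)
  · refine (setIntegral_le_integral hi (Filter.Eventually.of_forall fun t => ?_)).trans ?_
    · refine mul_nonneg (by positivity) (indicator_nonneg (fun t _ => ?_) _)
      positivity
    · rw [hi2, CW]
      have h2 : 0 < 1 - a := by linarith [ha.2]
      have h3 := ha.1
      have : 0 ≤ CG L a * (12 / a + 256 / (1 - a)) * H := by positivity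
      nlinarith

theorem wint_diff_le (hL : 0 < L) (ha : a ∈ Ioo (0:ℝ) 1) (hsg : SgOK sg) (h : Rhs L a H f)
    (j : Fin 4) {x1 x2 y1 y2 t ρ : ℝ} (hy1 : y1 ∈ Icc 0 L) (hy2 : y2 ∈ Icc 0 L)
    (ht : t ∈ Icc 0 L) (h1 : y1 ≠ t) (h2 : y2 ≠ t) (hρ : 0 < ρ) (hx : |x1 - x2| ≤ ρ)
    (hyy : |y1 - y2| ≤ ρ) :
    ‖∑' n, wint L j sg f x1 y1 t n - ∑' n, wint L j sg f x2 y2 t n‖ ≤ CG L a * H *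
      ((Icc (-(3 * ρ)) (3 * ρ)).indicator (fun t : ℝ => |t| ^ (a - 1)) (y1 - t)
      + (Icc (-(3 * ρ)) (3 * ρ)).indicator (fun t : ℝ => |t| ^ (a - 1)) (y2 - t))
      + 128 * (CG L a * H) * ρ * (ρ + |y1 - t|) ^ (a - 2) := by
  have hC := CG_nonneg hL ha.2
  have hf := h.hb _ (clamp_mem hL.le t)
  have hH := hf.nonneg
  have hd1 : 0 < |y1 - t| := abs_pos.2 (sub_ne_zero.2 h1)
  have hd2 : 0 < |y2 - t| := abs_pos.2 (sub_ne_zero.2 h2)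
  have hd : |(y1 - t) - (y2 - t)| ≤ ρ := by convert hyy using 2; ring
  have hn0 : 0 ≤ 128 * (CG L a * H) * ρ * (ρ + |y1 - t|) ^ (a - 2) := by positivity
  have hind : ∀ s, 0 ≤ (Icc (-(3 * ρ)) (3 * ρ)).indicator (fun t : ℝ => |t| ^ (a - 1)) s :=
    fun s => indicator_nonneg (fun t _ => by positivity) _
  rcases le_or_gt |y1 - t| (2 * ρ) with hc | hc
  · have e1 : |y1 - t| ≤ 3 * ρ := by linarith
    have e2 : |y2 - t| ≤ 3 * ρ := by
      have := abs_sub_abs_le_abs_sub (y2 - t) (y1 - t)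
      rw [abs_sub_comm (y2 - t)] at this; linarith
    have m1 : y1 - t ∈ Icc (-(3 * ρ)) (3 * ρ) := abs_le.1 e1
    have m2 : y2 - t ∈ Icc (-(3 * ρ)) (3 * ρ) := abs_le.1 e2
    rw [indicator_of_mem m1, indicator_of_mem m2]
    have := norm_sub_le (∑' n, wint L j sg f x1 y1 t n) (∑' n, wint L j sg f x2 y2 t n)
    have g1 := wint_tsum_le hL ha hsg h j x1 hy1 ht h1
    have g2 := wint_tsum_le hL ha hsg h j x2 hy2 ht h2
    linarith
  · have es : sg (y1 - t) = sg (y2 - t) := by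
      rw [abs_le] at hd
      rcases le_total 0 (y1 - t) with hs | hs
      · rw [abs_of_nonneg hs] at hc
        exact hsg.2.2.1 _ _ (by linarith) (by linarith [hd.2])
      · rw [abs_of_nonpos hs] at hc
        exact hsg.2.2.2 _ _ (by linarith) (by linarith [hd.1])
    have e2 : |y1 - t| - ρ ≤ |y2 - t| := by
      have := abs_sub_abs_le_abs_sub (y1 - t) (y2 - t)
      linarith
    have p1 := phs_ge j hy1 ht
    have p2 := phs_ge j hy2 ht
    have hr : 0 < (ρ + |y1 - t|) / 4 := by positivity
    have key := GG_diff_le hL (hf.continuous ha.1) ha (h.per _ (clamp_mem hL.le t)) hf.nonneg hf.2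
      hr (z := x1 + phs L j y1 t * Complex.I) (w := x2 + phs L j y2 t * Complex.I)
      (by rw [im_aux]; exact ⟨by linarith, phs_le j hy1 ht⟩)
      (by rw [im_aux]; exact ⟨by linarith, phs_le j hy2 ht⟩)
    have hzw : ‖((x1 : ℂ) + phs L j y1 t * Complex.I) - (x2 + phs L j y2 t * Complex.I)‖
        ≤ 2 * ρ := by
      have : ((x1 : ℂ) + phs L j y1 t * Complex.I) - (x2 + phs L j y2 t * Complex.I)
          = ((x1 - x2 : ℝ) : ℂ) + ((phs L j y1 t - phs L j y2 t : ℝ) : ℂ) * Complex.I := by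
        push_cast; ring
      rw [this]
      refine (norm_add_le _ _).trans ?_
      rw [norm_mul, Complex.norm_I, mul_one, Complex.norm_real, Complex.norm_real,
        Real.norm_eq_abs, Real.norm_eq_abs]
      linarith [phs_lip (L := L) j y1 y2 t]
    have hpw : ((ρ + |y1 - t|) / 4) ^ (a - 2) ≤ 16 * (ρ + |y1 - t|) ^ (a - 2) := by
      have hp : 0 < ρ + |y1 - t| := by positivity
      calc ((ρ + |y1 - t|) / 4) ^ (a - 2)
          = (ρ + |y1 - t|) ^ (a - 2) * (4:ℝ) ^ (2 - a) := by
            rw [Real.div_rpow hp.le (by norm_num), div_eq_mul_inv,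
              ← Real.rpow_neg (by norm_num : (0:ℝ) ≤ 4), neg_sub]
        _ ≤ (ρ + |y1 - t|) ^ (a - 2) * (4:ℝ) ^ (2:ℝ) := by
            gcongr
            · norm_num
            · linarith [ha.1]
        _ = _ := by norm_num; ring
    rw [wint_tsum, wint_tsum, es, ← mul_sub, norm_mul, Complex.norm_real, Real.norm_eq_abs]
    have k2 : |sg (y2 - t)| * ‖GG L (fun x => f x (clamp L t)) (x1 + phs L j y1 t * Complex.I)
        - GG L (fun x => f x (clamp L t)) (x2 + phs L j y2 t * Complex.I)‖
        ≤ 1 * (4 * CG L a * H * (16 * (ρ + |y1 - t|) ^ (a - 2)) * (2 * ρ)) := by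
      refine mul_le_mul (hsg.2.1 _) (key.trans ?_) (norm_nonneg _) zero_le_one
      gcongr
    have i1 := hind (y1 - t)
    have i2 := hind (y2 - t)
    have : 0 ≤ CG L a * H *
      ((Icc (-(3 * ρ)) (3 * ρ)).indicator (fun t : ℝ => |t| ^ (a - 1)) (y1 - t)
      + (Icc (-(3 * ρ)) (3 * ρ)).indicator (fun t : ℝ => |t| ^ (a - 1)) (y2 - t)) := by positivity
    linarith

theorem WW_holder (hL : 0 < L) (ha : a ∈ Ioo (0:ℝ) 1) (hsg : SgOK sg) (h : Rhs L a H f)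
    (j : Fin 4) {x1 x2 y1 y2 ρ : ℝ} (hy1 : y1 ∈ Icc 0 L) (hy2 : y2 ∈ Icc 0 L)
    (hρ : 0 < ρ) (hx : |x1 - x2| ≤ ρ) (hyy : |y1 - y2| ≤ ρ) :
    ‖WW L j sg f x1 y1 - WW L j sg f x2 y2‖ ≤ CW L a * H * ρ ^ a := by
  obtain ⟨A, hA⟩ := h.coef hL.le ha.1
  have hC := CG_nonneg hL ha.2
  have hH := h.H_nonneg hL.le
  have s : ∀ x, ∀ y ∈ Icc 0 L, Summable fun n => ∫ t in Ioc 0 L, ‖wint L j sg f x y t n‖ :=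
    fun x y hy => Summable.of_nonneg_of_le (fun n => integral_nonneg fun t => norm_nonneg _)
      (wint_norm_integral hL j hsg hA.c_cont hA.bd x hy) (hA.summ.mul_left _)
  have i1 := wint_integrable hL.le j hsg hA.c_cont x1 y1
  have i2 := wint_integrable hL.le j hsg hA.c_cont x2 y2
  have hS := hasSum_integral_of_summable_integral_norm (μ := volume.restrict (Ioc 0 L))
    (F := fun n t => wint L j sg f x1 y1 t n - wint L j sg f x2 y2 t n)
    (fun n => (i1 n).sub (i2 n))
    (Summable.of_nonneg_of_le (fun n => integral_nonneg fun t => norm_nonneg _)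
      (fun n => by
        rw [← integral_add (i1 n).norm (i2 n).norm]
        exact integral_mono ((i1 n).sub (i2 n)).norm ((i1 n).norm.add (i2 n).norm)
          fun t => norm_sub_le _ _) ((s x1 y1 hy1).add (s x2 y2 hy2)))
  have s1 := (hasSum_integral_of_summable_integral_norm (μ := volume.restrict (Ioc 0 L))
    (F := fun n t => wint L j sg f x1 y1 t n) i1 (s x1 y1 hy1)).summable
  have s2 := (hasSum_integral_of_summable_integral_norm (μ := volume.restrict (Ioc 0 L))
    (F := fun n t => wint L j sg f x2 y2 t n) i2 (s x2 y2 hy2)).summable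
  have e : WW L j sg f x1 y1 - WW L j sg f x2 y2
      = ∫ t in Ioc 0 L, ∑' n, (wint L j sg f x1 y1 t n - wint L j sg f x2 y2 t n) := by
    rw [← hS.tsum_eq]
    simp only [integral_sub (i1 _) (i2 _)]
    rw [s1.tsum_sub s2]; simp only [wint_integral hL.le]; rfl
  obtain ⟨hn1, hn2⟩ := integrable_near ha.1 (by positivity : 0 ≤ 3 * ρ)
  obtain ⟨hf1, hf2⟩ := integrable_far ha.2 hρ
  have m1 := hn1.comp_sub_left y1
  have m2 := hn1.comp_sub_left y2
  have m3 := hf1.comp_sub_left y1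
  have m12 := (m1.add m2).const_mul (CG L a * H)
  have m33 := m3.const_mul (128 * (CG L a * H) * ρ)
  have hi := m12.add m33
  rw [e]
  refine (norm_integral_le_of_norm_le (hi.restrict (s := Ioc 0 L)) ?_).trans ?_
  · rw [ae_restrict_iff' measurableSet_Ioc]
    filter_upwards [compl_mem_ae_iff.2 (measure_singleton y1),
      compl_mem_ae_iff.2 (measure_singleton y2)] with t ht1 ht2 ht'
    have ht'' := Ioc_subset_Icc_self ht'
    have n1 : y1 ≠ t := fun h => ht1 h.symm
    have n2 : y2 ≠ t := fun h => ht2 h.symm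
    rw [(wint_summable hL ha h j x1 hy1 ht'' n1).tsum_sub (wint_summable hL ha h j x2 hy2 ht'' n2)]
    exact wint_diff_le hL ha hsg h j hy1 hy2 ht'' n1 n2 hρ hx hyy
  · refine (setIntegral_le_integral hi (Filter.Eventually.of_forall fun t => ?_)).trans ?_
    · have hind : ∀ s, 0 ≤ (Icc (-(3 * ρ)) (3 * ρ)).indicator (fun t : ℝ => |t| ^ (a - 1)) s :=
        fun s => indicator_nonneg (fun t _ => by positivity) _
      have j1 := hind (y1 - t)
      have j2 := hind (y2 - t)
      simp only [Pi.add_apply, Pi.zero_apply]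
      positivity
    · have e1 := integral_sub_left_eq_self
        ((Icc (-(3 * ρ)) (3 * ρ)).indicator fun t : ℝ => |t| ^ (a - 1)) volume y1
      have e2 := integral_sub_left_eq_self
        ((Icc (-(3 * ρ)) (3 * ρ)).indicator fun t : ℝ => |t| ^ (a - 1)) volume y2
      have e3 := integral_sub_left_eq_self (fun t : ℝ => (ρ + |t|) ^ (a - 2)) volume y1
      have E := integral_add m12 m33
      have E2 := integral_add m1 m2
      simp only [Pi.add_apply] at E E2 ⊢
      rw [E, integral_const_mul, integral_const_mul, E2, e1, e2, e3, hn2, hf2]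
      have h2 : 0 < 1 - a := by linarith [ha.2]
      have h3 := ha.1
      have hρa : 0 < ρ ^ a := Real.rpow_pos_of_pos hρ _
      have q1 : (3 * ρ) ^ a ≤ 3 * ρ ^ a := by
        rw [Real.mul_rpow (by norm_num) hρ.le]
        gcongr
        calc (3:ℝ) ^ a ≤ 3 ^ (1:ℝ) := Real.rpow_le_rpow_of_exponent_le (by norm_num) ha.2.le
          _ = 3 := Real.rpow_one _
      have q2 : ρ * ρ ^ (a - 1) = ρ ^ a := by
        rw [Real.rpow_sub_one hρ.ne']; field_simp
      have q3 : CG L a * H * (2 * ((3 * ρ) ^ a / a) + 2 * ((3 * ρ) ^ a / a))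
          ≤ CG L a * H * (2 * ((3 * ρ ^ a) / a) + 2 * ((3 * ρ ^ a) / a)) := by gcongr
      have q4 : 128 * (CG L a * H) * ρ * (2 * (ρ ^ (a - 1) / (1 - a)))
          = 256 * (CG L a * H) * (ρ ^ a / (1 - a)) := by rw [← q2]; ring
      have q5 : 0 ≤ CG L a * (2 * (L ^ a / a)) * H * ρ ^ a := by positivity
      have q6 : CW L a * H * ρ ^ a = CG L a * (2 * (L ^ a / a)) * H * ρ ^ a
        + (CG L a * H * (2 * ((3 * ρ ^ a) / a) + 2 * ((3 * ρ ^ a) / a))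
        + 256 * (CG L a * H) * (ρ ^ a / (1 - a))) := by unfold CW; ring
      rw [q6, q4]
      linarith

end WW

end

section
open MeasureTheory

theorem JH.mono {L a C D : ℝ} {v : ℝ → ℝ → ℝ} (h : JH L a C v) (hCD : C ≤ D) : JH L a D v :=
  fun y hy y' hy' x x' => (h y hy y' hy' x x').trans
    (mul_le_mul_of_nonneg_right hCD (Real.rpow_nonneg (le_max_of_le_left (abs_nonneg _)) _))

theorem JH.hb {L a C : ℝ} {v : ℝ → ℝ → ℝ} (h : JH L a C v)
    (hb : ∀ y ∈ Icc 0 L, ∀ x, |v x y| ≤ C) : ∀ y ∈ Icc 0 L, HB a C fun x => v x y :=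
  fun y hy => ⟨hb y hy, fun x x' => by simpa using h y hy y hy x x'⟩

theorem JH.add {L a C D : ℝ} {v w : ℝ → ℝ → ℝ} (h : JH L a C v) (h' : JH L a D w) :
    JH L a (C + D) fun x y => v x y + w x y := fun y hy y' hy' x x' => by
  have h1 := h y hy y' hy' x x'
  have h2 := h' y hy y' hy' x x'
  calc |v x y + w x y - (v x' y' + w x' y')| = |(v x y - v x' y') + (w x y - w x' y')| := by
        ring_nf
    _ ≤ _ := abs_add_le _ _
    _ ≤ _ := by linarith

/-- The bounds on the five fields of a solution. -/
structure Bds (L a C : ℝ) (S : Fin 5 → ℝ → ℝ → ℝ) : Prop where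
  hb : ∀ i, ∀ y ∈ Icc 0 L, HB a C fun x => S i x y
  j3 : JH L a C (S 3)
  j4 : JH L a C (S 4)

theorem Bds.mono {L a C D : ℝ} {S : Fin 5 → ℝ → ℝ → ℝ} (h : Bds L a C S) (hCD : C ≤ D) :
    Bds L a D S :=
  ⟨fun i y hy => (h.hb i y hy).mono hCD, h.j3.mono hCD, h.j4.mono hCD⟩

section zero
variable {L a H : ℝ} {f : ℝ → ℝ → ℝ} {sg : ℝ → ℝ}

theorem WW_summable (hL : 0 < L) (ha : a ∈ Ioo (0:ℝ) 1) (hsg : SgOK sg) (h : Rhs L a H f)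
    (j : Fin 4) (x : ℝ) {y : ℝ} (hy : y ∈ Icc 0 L) : HasSum (fun n =>
    ((kap n * wgt L (kap n) : ℝ) : ℂ) *
    (ker L j sg (kap n) (fun t => cf (fun x => f x (clamp L t)) n) y * ex n x))
    (WW L j sg f x y) := by
  obtain ⟨A, hA⟩ := h.coef hL.le ha.1
  have := (hasSum_integral_of_summable_integral_norm (μ := volume.restrict (Ioc 0 L))
    (F := fun n t => wint L j sg f x y t n) (wint_integrable hL.le j hsg hA.c_cont x y)
    (Summable.of_nonneg_of_le (fun n => integral_nonneg fun t => norm_nonneg _)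
      (wint_norm_integral hL j hsg hA.c_cont hA.bd x hy) (hA.summ.mul_left _))).summable
  simp only [wint_integral hL.le] at this
  exact this.hasSum

/-- The solution with zero boundary values. -/
def zsol (L : ℝ) (f : ℝ → ℝ → ℝ) : Fin 5 → ℝ → ℝ → ℝ :=
  fsol L (fun y => ∫ x in (0:ℝ)..1, f x (clamp L y)) (fun n y => cf (fun x => f x (clamp L y)) n)

theorem zsol3 (hL : 0 < L) (ha : a ∈ Ioo (0:ℝ) 1) (h : Rhs L a H f) (x : ℝ) {y : ℝ}
    (hy : y ∈ Icc 0 L) : zsol L f 3 x y = (WW L 0 (fun _ => 1) f x y + WW L 1 (fun _ => 1) f x y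
      - WW L 2 (fun _ => 1) f x y - WW L 3 (fun _ => 1) f x y).re := by
  have hs := fun j => WW_summable hL ha sgOK_one h j x hy
  have := Complex.reCLM.hasSum ((((hs 0).add (hs 1)).sub (hs 2)).sub (hs 3))
  have hm : zsol L f 3 x y = 0 + ∑' n, tm (amp L (fun n y => cf (fun x => f x (clamp L y)) n) 3 n y)
    n x := rfl
  rw [hm, zero_add]
  refine (tsum_congr fun n => ?_).trans this.tsum_eq
  have hk : (kap n : ℂ) ≠ 0 := by exact_mod_cast (kap_pos n).ne'
  rw [tm, ← Complex.re_ofReal_mul, Complex.reCLM_apply]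
  congr 1
  change ((2:ℝ):ℂ) * (-((kap n ^ 2 : ℝ) * modU L (kap n) _ y) * ex n x) = _
  rw [modU]
  push_cast
  field_simp

theorem zsol4 (hL : 0 < L) (ha : a ∈ Ioo (0:ℝ) 1) (h : Rhs L a H f) (x : ℝ) {y : ℝ}
    (hy : y ∈ Icc 0 L) : zsol L f 4 x y = (-Complex.I * (-WW L 0 Real.sign f x y +
      WW L 1 Real.sign f x y + WW L 2 (fun _ => 1) f x y - WW L 3 (fun _ => 1) f x y)).re := by
  have hs := fun j => WW_summable hL ha sgOK_one h j x hy
  have hs' := fun j => WW_summable hL ha sgOK_sign h j x hy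
  have := Complex.reCLM.hasSum
    (((((hs' 0).neg.add (hs' 1)).add (hs 2)).sub (hs 3)).mul_left (-Complex.I))
  have hm : zsol L f 4 x y = 0 + ∑' n, tm (amp L (fun n y => cf (fun x => f x (clamp L y)) n) 4 n y)
    n x := rfl
  rw [hm, zero_add]
  refine (tsum_congr fun n => ?_).trans this.tsum_eq
  rw [tm, ← Complex.re_ofReal_mul, Complex.reCLM_apply]
  congr 1
  change ((2:ℝ):ℂ) * ((kap n * Complex.I * modV L (kap n) _ y) * ex n x) = _
  rw [modV]
  push_cast
  ring

theorem re_bound {z0 z1 z2 z3 : ℂ} {C : ℝ} (h0 : ‖z0‖ ≤ C) (h1 : ‖z1‖ ≤ C) (h2 : ‖z2‖ ≤ C)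
    (h3 : ‖z3‖ ≤ C) : ‖z0 + z1 + z2 + z3‖ ≤ 4 * C := by
  have := norm_add₄_le (a := z0) (b := z1) (c := z2) (d := z3)
  linarith

theorem zsol34_le (hL : 0 < L) (ha : a ∈ Ioo (0:ℝ) 1) (h : Rhs L a H f) (x : ℝ) {y : ℝ}
    (hy : y ∈ Icc 0 L) :
    |zsol L f 3 x y| ≤ 4 * (CW L a * H) ∧ |zsol L f 4 x y| ≤ 4 * (CW L a * H) := by
  have b := fun j => WW_le hL ha sgOK_one h j x hy
  have b' := fun j => WW_le hL ha sgOK_sign h j x hy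
  constructor
  · rw [zsol3 hL ha h x hy]
    refine (Complex.abs_re_le_norm _).trans ?_
    rw [sub_eq_add_neg, sub_eq_add_neg]
    exact re_bound (b 0) (b 1) (by rw [norm_neg]; exact b 2) (by rw [norm_neg]; exact b 3)
  · rw [zsol4 hL ha h x hy]
    refine (Complex.abs_re_le_norm _).trans ?_
    rw [norm_mul, norm_neg, Complex.norm_I, one_mul, sub_eq_add_neg]
    exact re_bound (by rw [norm_neg]; exact b' 0) (b' 1) (b 2) (by rw [norm_neg]; exact b 3)

theorem zsol34_holder (hL : 0 < L) (ha : a ∈ Ioo (0:ℝ) 1) (h : Rhs L a H f) :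
    JH L a (4 * (CW L a * H)) (zsol L f 3) ∧ JH L a (4 * (CW L a * H)) (zsol L f 4) := by
  have key : ∀ y ∈ Icc 0 L, ∀ y' ∈ Icc 0 L, ∀ x x',
      |zsol L f 3 x y - zsol L f 3 x' y'| ≤ 4 * (CW L a * H) * (max |x - x'| |y - y'|) ^ a ∧
      |zsol L f 4 x y - zsol L f 4 x' y'| ≤ 4 * (CW L a * H) * (max |x - x'| |y - y'|) ^ a := by
    intro y hy y' hy' x x'
    set ρ := max |x - x'| |y - y'| with hρ
    have hρ0 : 0 ≤ ρ := le_max_of_le_left (abs_nonneg _)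
    have hH := h.H_nonneg hL.le
    have hC := CW_nonneg hL ha
    rcases hρ0.eq_or_lt with h0 | h0
    · have e1 : x = x' := by
        have : |x - x'| ≤ 0 := h0 ▸ le_max_left _ _
        exact sub_eq_zero.1 (abs_nonpos_iff.1 this)
      have e2 : y = y' := by
        have : |y - y'| ≤ 0 := h0 ▸ le_max_right _ _
        exact sub_eq_zero.1 (abs_nonpos_iff.1 this)
      subst e1 e2
      simp only [sub_self, abs_zero]
      exact ⟨by positivity, by positivity⟩
    · have b := fun j => WW_holder hL ha sgOK_one h j hy hy' h0 (le_max_left _ _) (le_max_right _ _)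
        (x1 := x) (x2 := x')
      have b' := fun j => WW_holder hL ha sgOK_sign h j hy hy' h0 (le_max_left _ _)
        (le_max_right _ _) (x1 := x) (x2 := x')
      have nb : ∀ {z w : ℂ} {C : ℝ}, ‖z - w‖ ≤ C → ‖-(z - w)‖ ≤ C := fun h => by rwa [norm_neg]
      rw [mul_assoc]
      constructor
      · rw [zsol3 hL ha h x hy, zsol3 hL ha h x' hy', ← Complex.sub_re]
        refine (Complex.abs_re_le_norm _).trans ?_
        have := re_bound (b 0) (b 1) (nb (b 2)) (nb (b 3))
        refine (le_of_eq ?_).trans this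
        congr 1
        ring
      · rw [zsol4 hL ha h x hy, zsol4 hL ha h x' hy', ← Complex.sub_re, ← mul_sub]
        refine (Complex.abs_re_le_norm _).trans ?_
        rw [norm_mul, norm_neg, Complex.norm_I, one_mul]
        have := re_bound (nb (b' 0)) (b' 1) (b 2) (nb (b 3))
        refine (le_of_eq ?_).trans this
        congr 1
        ring
  exact ⟨fun y hy y' hy' x x' => (key y hy y' hy' x x').1,
    fun y hy y' hy' x x' => (key y hy y' hy' x x').2⟩

theorem osc_y {u u' : ℝ → ℝ} {B : ℝ} (hu : ∀ y ∈ Icc 0 L, HasDerivWithinAt u (u' y) (Icc 0 L) y)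
    (hB : ∀ y ∈ Icc 0 L, |u' y| ≤ B) {y y' : ℝ} (hy : y ∈ Icc 0 L) (hy' : y' ∈ Icc 0 L) :
    |u y - u y'| ≤ B * |y - y'| :=
  (convex_Icc 0 L).norm_image_sub_le_of_norm_hasDerivWithin_le (f := u) (f' := u') (C := B)
    hu hB hy' hy

theorem osc_y' {u u' : ℝ → ℝ} {B : ℝ} (hu : ∀ y ∈ Icc 0 L, HasDerivWithinAt u (u' y) (Icc 0 L) y)
    (hB : ∀ y ∈ Icc 0 L, |u' y| ≤ B) {y y' : ℝ} (hy : y ∈ Icc 0 L) (hy' : y' ∈ Icc 0 L) :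
    |u y - u y'| ≤ L * B := by
  have hB0 := (abs_nonneg _).trans (hB y hy)
  have h1 : |y - y'| ≤ L := abs_le.2 ⟨by linarith [hy.1, hy'.2], by linarith [hy.2, hy'.1]⟩
  have := osc_y hu hB hy hy'
  nlinarith

/-- The constant of the Schauder estimate with zero boundary values. -/
def CZ (L a : ℝ) : ℝ := 2 * (4 * CW L a + L * (1 + 4 * CW L a) + L * (L * (1 + 4 * CW L a)) +
  L * (4 * CW L a))

theorem CZ_nonneg (hL : 0 < L) (ha : a ∈ Ioo (0:ℝ) 1) : 0 ≤ CZ L a := by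
  have hC := CW_nonneg hL ha
  unfold CZ
  positivity

theorem zsol_sol (hL : 0 < L) (ha : a ∈ Ioo (0:ℝ) 1) (h : Rhs L a H f) : Sol L (zsol L f) f := by
  obtain ⟨A, hA⟩ := h.coef hL.le ha.1
  exact fsol_sol hL hA

theorem zsol_bds (hL : 0 < L) (ha : a ∈ Ioo (0:ℝ) 1) (h : Rhs L a H f) :
    Bds L a (CZ L a * H) (zsol L f) := by
  have hS := zsol_sol hL ha h
  have hH := h.H_nonneg hL.le
  have hC := CW_nonneg hL ha
  obtain ⟨j3, j4⟩ := zsol34_holder hL ha h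
  have m : (0:ℝ) ∈ Icc 0 L := ⟨le_rfl, hL.le⟩
  have mL : L ∈ Icc 0 L := ⟨hL.le, le_rfl⟩
  have b0 : ∀ x, zsol L f 0 x 0 = 0 := fsol_bot hL
  have bL : ∀ x, zsol L f 0 x L = 0 := fsol_top hL
  have b1 : ∀ x, zsol L f 1 x 0 = 0 := fun x => by
    have h1 := hS.dx0 0 m x
    simp only [b0] at h1
    exact h1.unique (hasDerivAt_const x 0)
  set A := 4 * (CW L a * H) with hA
  have hA0 : 0 ≤ A := by positivity
  have n3 : ∀ y ∈ Icc 0 L, ∀ x, |zsol L f 3 x y| ≤ A := fun y hy x => (zsol34_le hL ha h x hy).1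
  have n4 : ∀ y ∈ Icc 0 L, ∀ x, |zsol L f 4 x y| ≤ A := fun y hy x => (zsol34_le hL ha h x hy).2
  have n1 : ∀ y ∈ Icc 0 L, ∀ x, |zsol L f 1 x y| ≤ L * A := fun y hy x => by
    have := osc_y' (fun y hy => hS.dy1 y hy x) (fun y hy => n4 y hy x) hy m
    rwa [b1, sub_zero] at this
  have n2 : ∀ y ∈ Icc 0 L, ∀ x, |zsol L f 2 x y| ≤ L * (H + A) := fun y hy x => by
    obtain ⟨η, hη, hη0⟩ := exists_hasDerivAt_eq_zero (f := fun t => zsol L f 0 x t)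
      (f' := fun t => zsol L f 2 x t) hL (fun y hy => (hS.dy0 y hy x).continuousWithinAt)
      (by rw [b0, bL]) (fun y hy => (hS.dy0 y (Ioo_subset_Icc_self hy) x).hasDerivAt
        (Icc_mem_nhds hy.1 hy.2))
    have := osc_y' (fun y hy => hS.dy2 y hy x) (B := H + A) (fun y hy =>
      (abs_sub _ _).trans (add_le_add ((h.hb y hy).1 x) (n3 y hy x))) hy (Ioo_subset_Icc_self hη)
    rwa [hη0, sub_zero] at this
  have n0 : ∀ y ∈ Icc 0 L, ∀ x, |zsol L f 0 x y| ≤ L * (L * (H + A)) := fun y hy x => by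
    have := osc_y' (fun y hy => hS.dy0 y hy x) (fun y hy => n2 y hy x) hy m
    rwa [b0, sub_zero] at this
  have hLA : 0 ≤ L * A := by positivity
  have hB2 : 0 ≤ L * (H + A) := by positivity
  have hB0 : 0 ≤ L * (L * (H + A)) := by positivity
  have e : CZ L a * H = 2 * (A + L * (H + A) + L * (L * (H + A)) + L * A) := by
    rw [hA, CZ]; ring
  set B := A + L * (H + A) + L * (L * (H + A)) + L * A with hBdef
  rw [e]
  refine ⟨fun i y hy => ?_, j3.mono (by linarith), j4.mono (by linarith)⟩
  fin_cases i
  · exact HB.of_deriv ha.1 ha.2.le (fun x => (n0 y hy x).trans (by linarith)) (hS.dx0 y hy)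
      (fun x => (n1 y hy x).trans (by linarith))
  · exact HB.of_deriv ha.1 ha.2.le (fun x => (n1 y hy x).trans (by linarith)) (hS.dx1 y hy)
      (fun x => (n3 y hy x).trans (by linarith))
  · exact HB.of_deriv ha.1 ha.2.le (fun x => (n2 y hy x).trans (by linarith)) (hS.dx2 y hy)
      (fun x => (n4 y hy x).trans (by linarith))
  · exact (j3.hb n3 y hy).mono (by linarith)
  · exact (j4.hb n4 y hy).mono (by linarith)

end zero

end

section
open MeasureTheory

/-- Bottom data: a periodic function with its first two derivatives. -/
structure Bot (a δ : ℝ) (b : Fin 3 → ℝ → ℝ) : Prop where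
  d0 : ∀ x, HasDerivAt (b 0) (b 1 x) x
  d1 : ∀ x, HasDerivAt (b 1) (b 2 x) x
  per : ∀ x, b 0 (x + 1) = b 0 x
  hb : ∀ i, HB a δ (b i)
  lh : ∃ K, LH a K (b 2)

/-- Top data: a periodic function of mean zero. -/
structure Top (a δ : ℝ) (r : ℝ → ℝ) : Prop where
  per : ∀ x, r (x + 1) = r x
  mean : ∫ x in (0:ℝ)..1, r x = 0
  hb : HB a δ r
  lh : ∃ K, LH a K r

theorem deriv_per {g g' : ℝ → ℝ} (hd : ∀ x, HasDerivAt g (g' x) x) (hp : ∀ x, g (x + 1) = g x)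
    (x : ℝ) : g' (x + 1) = g' x := by
  have h1 := (hd (x + 1)).comp_add_const x 1
  simp only [hp] at h1
  exact h1.unique (hd x)

/-- The primitive of mean zero. -/
def prim (r : ℝ → ℝ) (x : ℝ) : ℝ := (∫ t in (0:ℝ)..x, r t) - ∫ s in (0:ℝ)..1, ∫ t in (0:ℝ)..s, r t

theorem prim_deriv {r : ℝ → ℝ} (hr : Continuous r) (x : ℝ) : HasDerivAt (prim r) (r x) x :=
  (intervalIntegral.integral_hasDerivAt_right (hr.intervalIntegrable _ _)
    hr.stronglyMeasurable.stronglyMeasurableAtFilter hr.continuousAt).sub_const _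

theorem integral_per_step {r : ℝ → ℝ} (hr : Continuous r) (hp : ∀ x, r (x + 1) = r x)
    (hm : ∫ x in (0:ℝ)..1, r x = 0) (x : ℝ) : ∫ t in (0:ℝ)..(x + 1), r t = ∫ t in (0:ℝ)..x, r t := by
  have hp' : Function.Periodic r 1 := hp
  have h := hp'.intervalIntegral_add_eq x 0
  rw [zero_add, hm] at h
  rw [← intervalIntegral.integral_add_adjacent_intervals (hr.intervalIntegrable 0 x)
    (hr.intervalIntegrable x (x + 1)), h, add_zero]

theorem prim_per {r : ℝ → ℝ} (hr : Continuous r) (hp : ∀ x, r (x + 1) = r x)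
    (hm : ∫ x in (0:ℝ)..1, r x = 0) (x : ℝ) : prim r (x + 1) = prim r x := by
  rw [prim, prim, integral_per_step hr hp hm]

theorem prim_mean {r : ℝ → ℝ} (hr : Continuous r) : ∫ x in (0:ℝ)..1, prim r x = 0 := by
  have hc : Continuous fun x => ∫ t in (0:ℝ)..x, r t :=
    intervalIntegral.continuous_primitive (fun _ _ => hr.intervalIntegrable _ _) 0
  simp only [prim]
  rw [intervalIntegral.integral_sub (hc.intervalIntegrable _ _) (by simp)]
  simp

theorem abs_integral_per_le {r : ℝ → ℝ} {δ : ℝ} (hr : Continuous r) (hp : ∀ x, r (x + 1) = r x)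
    (hm : ∫ x in (0:ℝ)..1, r x = 0) (hb : ∀ x, |r x| ≤ δ) (x : ℝ) :
    |∫ t in (0:ℝ)..x, r t| ≤ δ := by
  have hper : Function.Periodic (fun x => ∫ t in (0:ℝ)..x, r t) 1 := integral_per_step hr hp hm
  have hδ := (abs_nonneg _).trans (hb 0)
  obtain ⟨y, hy, hxy⟩ := hper.exists_mem_Ico₀ one_pos x
  have e : ∫ t in (0:ℝ)..x, r t = ∫ t in (0:ℝ)..y, r t := hxy
  rw [e]
  have := intervalIntegral.norm_integral_le_of_norm_le_const (f := r) (a := 0) (b := y) (C := δ)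
    (fun t _ => hb t)
  rw [sub_zero, abs_of_nonneg hy.1, Real.norm_eq_abs] at this
  nlinarith [hy.2]

theorem prim_abs {r : ℝ → ℝ} {δ : ℝ} (hr : Continuous r) (hp : ∀ x, r (x + 1) = r x)
    (hm : ∫ x in (0:ℝ)..1, r x = 0) (hb : ∀ x, |r x| ≤ δ) (x : ℝ) : |prim r x| ≤ 2 * δ := by
  have h1 := abs_integral_per_le hr hp hm hb
  have h2 : |∫ s in (0:ℝ)..1, ∫ t in (0:ℝ)..s, r t| ≤ δ := by
    have := intervalIntegral.norm_integral_le_of_norm_le_const (a := 0) (b := 1) (C := δ)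
      (f := fun s => ∫ t in (0:ℝ)..s, r t) (fun t _ => h1 t)
    simpa using this
  rw [prim]
  exact (abs_sub _ _).trans (by linarith [h1 x])

section lift
variable {L a δ J : ℝ} {b : Fin 3 → ℝ → ℝ} {r : ℝ → ℝ} {f : ℝ → ℝ → ℝ}

theorem Bot.per' (hb : Bot a δ b) (i : Fin 3) (x : ℝ) : b i (x + 1) = b i x := by
  have h1 := deriv_per hb.d0 hb.per
  fin_cases i
  · exact hb.per x
  · exact h1 x
  · exact deriv_per hb.d1 h1 x

/-- The top trace of the solution and its derivatives. -/
def topf (J : ℝ) (r : ℝ → ℝ) : Fin 3 → ℝ → ℝ :=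
  ![fun x => J + ∫ t in (0:ℝ)..x, prim r t, prim r, r]

theorem topf_bot (ha : a ∈ Ioo (0:ℝ) 1) (hr : Top a δ r) (hJ : |J| ≤ δ) : Bot a (10 * δ) (topf J r) := by
  have hc := hr.hb.continuous ha.1
  have hδ := hr.hb.nonneg
  have hpc : Continuous (prim r) :=
    continuous_iff_continuousAt.2 fun x => (prim_deriv hc x).continuousAt
  have hp := prim_per hc hr.per hr.mean
  have n1 := prim_abs hc hr.per hr.mean hr.hb.1
  have n0 := abs_integral_per_le hpc hp (prim_mean hc) n1
  have d0 : ∀ x, HasDerivAt (fun x => J + ∫ t in (0:ℝ)..x, prim r t) (prim r x) x := fun x =>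
    (intervalIntegral.integral_hasDerivAt_right (hpc.intervalIntegrable _ _)
    hpc.stronglyMeasurable.stronglyMeasurableAtFilter hpc.continuousAt).const_add _
  refine ⟨d0, prim_deriv hc, fun x => ?_, fun i => ?_, hr.lh⟩
  · change J + _ = J + _
    rw [integral_per_step hpc hp (prim_mean hc)]
  · fin_cases i
    · refine (HB.of_deriv (C := 3 * δ) ha.1 ha.2.le (fun x => ?_) d0
        (fun x => (n1 x).trans (by linarith))).mono (by linarith)
      exact (abs_add_le _ _).trans (by linarith [n0 x])
    · exact (HB.of_deriv (C := 2 * δ) ha.1 ha.2.le n1 (prim_deriv hc)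
        (fun x => (hr.hb.1 x).trans (by linarith))).mono (by linarith)
    · exact hr.hb.mono (by linarith)

/-- Linear interpolation of the boundary values. -/
def lft (L : ℝ) (b t : Fin 3 → ℝ → ℝ) : Fin 5 → ℝ → ℝ → ℝ :=
  ![fun x y => (1 - y / L) * b 0 x + y / L * t 0 x, fun x y => (1 - y / L) * b 1 x + y / L * t 1 x,
    fun x _ => (t 0 x - b 0 x) / L, fun x y => (1 - y / L) * b 2 x + y / L * t 2 x,
    fun x _ => (t 1 x - b 1 x) / L]

theorem lft_cont {c d : ℝ → ℝ} (hc : Continuous c) (hd : Continuous d) :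
    Continuous fun z : ℝ × ℝ => (1 - z.2 / L) * c z.1 + z.2 / L * d z.1 := by
  fun_prop

theorem lft_dy {c d : ℝ} (y : ℝ) :
    HasDerivAt (fun y => (1 - y / L) * c + y / L * d) ((d - c) / L) y := by
  have h1 : HasDerivAt (fun y : ℝ => y / L) (1 / L) y := (hasDerivAt_id y).div_const L
  exact (((h1.const_sub 1).mul_const c).add (h1.mul_const d)).congr_deriv (by ring)

theorem lft_sol (ha : 0 < a) {b t : Fin 3 → ℝ → ℝ} {δ' : ℝ} (hb : Bot a δ b) (ht : Bot a δ' t) :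
    Sol L (lft L b t) (lft L b t 3) where
  dx0 y _ x := ((hb.d0 x).const_mul _).add ((ht.d0 x).const_mul _)
  dx1 y _ x := ((hb.d1 x).const_mul _).add ((ht.d1 x).const_mul _)
  dx2 y _ x := ((ht.d0 x).sub (hb.d0 x)).div_const L
  dy0 y _ x := (lft_dy y).hasDerivWithinAt
  dy1 y _ x := (lft_dy y).hasDerivWithinAt
  dy2 y _ x := by rw [sub_self]; exact (hasDerivAt_const _ _).hasDerivWithinAt
  per i y _ x := by
    have h1 := hb.per'
    have h2 := ht.per'
    fin_cases i <;> simp [lft, h1, h2]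
  cont i := by
    have c1 := fun i => (hb.hb i).continuous ha
    have c2 := fun i => (ht.hb i).continuous ha
    refine Continuous.continuousOn ?_
    fin_cases i
    · exact lft_cont (c1 0) (c2 0)
    · exact lft_cont (c1 1) (c2 1)
    · exact (((c2 0).sub (c1 0)).div_const L).comp continuous_fst
    · exact lft_cont (c1 2) (c2 2)
    · exact (((c2 1).sub (c1 1)).div_const L).comp continuous_fst

theorem lft_hb (hL : 0 < L) {c d : ℝ → ℝ} (hc : HB a δ c) (hd : HB a δ d) {y : ℝ}
    (hy : y ∈ Icc 0 L) : HB a δ fun x => (1 - y / L) * c x + y / L * d x := by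
  have h0 : 0 ≤ y / L := div_nonneg hy.1 hL.le
  have h1 : y / L ≤ 1 := (div_le_one hL).2 hy.2
  refine ((hc.const_mul (1 - y / L)).add (hd.const_mul (y / L))).mono (le_of_eq ?_)
  rw [abs_of_nonneg h0, abs_of_nonneg (by linarith)]; ring

theorem lft_jh (hL : 0 < L) (ha : a ∈ Ioo (0:ℝ) 1) {c d : ℝ → ℝ} (hc : HB a δ c) (hd : HB a δ d) :
    JH L a (δ * (1 + 2 / L ^ a)) fun x y => (1 - y / L) * c x + y / L * d x := by
  intro y hy y' hy' x x'
  have hδ := hc.nonneg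
  have h1 := (lft_hb hL hc hd hy).2 x x'
  have h2 : |(1 - y / L) * c x' + y / L * d x' - ((1 - y' / L) * c x' + y' / L * d x')|
      ≤ 2 * δ * (|y - y'| ^ a / L ^ a) := by
    have e : (1 - y / L) * c x' + y / L * d x' - ((1 - y' / L) * c x' + y' / L * d x')
        = ((y - y') / L) * (d x' - c x') := by ring
    have h3 : |d x' - c x'| ≤ 2 * δ := (abs_sub _ _).trans (by linarith [hc.1 x', hd.1 x'])
    have h4 : |(y - y') / L| ≤ |y - y'| ^ a / L ^ a := by
      rw [abs_div, abs_of_pos hL, ← Real.div_rpow (abs_nonneg _) hL.le]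
      have h5 : |y - y'| ≤ L := abs_le.2 ⟨by linarith [hy.1, hy'.2], by linarith [hy.2, hy'.1]⟩
      exact le_rpow_of_le_one ha.2.le (by positivity) ((div_le_one hL).2 h5) ha.1
    rw [e, abs_mul]
    calc _ ≤ (|y - y'| ^ a / L ^ a) * (2 * δ) := by gcongr
      _ = _ := by ring
  have m1 : |x - x'| ^ a ≤ (max |x - x'| |y - y'|) ^ a :=
    Real.rpow_le_rpow (abs_nonneg _) (le_max_left _ _) ha.1.le
  have m2 : |y - y'| ^ a ≤ (max |x - x'| |y - y'|) ^ a :=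
    Real.rpow_le_rpow (abs_nonneg _) (le_max_right _ _) ha.1.le
  refine (abs_sub_le _ ((1 - y / L) * c x' + y / L * d x') _).trans ((add_le_add h1 h2).trans ?_)
  calc _ ≤ δ * (max |x - x'| |y - y'|) ^ a + 2 * δ * ((max |x - x'| |y - y'|) ^ a / L ^ a) := by
        gcongr
    _ = _ := by ring

/-- The constant of the Schauder estimate. -/
def CL (L a : ℝ) : ℝ := CZ L a * 11 + 10 * (1 + 2 / L ^ a) + 20 / L

theorem CL_nonneg (hL : 0 < L) (ha : a ∈ Ioo (0:ℝ) 1) : 0 ≤ CL L a := by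
  have := CZ_nonneg hL ha
  unfold CL; positivity

theorem lin_exists (hL : 0 < L) (ha : a ∈ Ioo (0:ℝ) 1) (hb : Bot a δ b) (hr : Top a δ r)
    (hJ : |J| ≤ δ) (hf : Rhs L a δ f) : ∃ S, Sol L S f ∧ (∀ x, S 0 x 0 = b 0 x) ∧ S 0 0 L = J ∧
    (∀ x, S 3 x L = r x) ∧ (∀ x, S 0 x L = topf J r 0 x) ∧ Bds L a (CL L a * δ) S := by
  have ht := topf_bot ha hr hJ
  have hℓ := lft_sol (L := L) ha.1 hb ht
  have hδ := hr.hb.nonneg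
  have hb3 : ∀ y ∈ Icc 0 L, HB a (10 * δ) fun x => lft L b (topf J r) 3 x y := fun y hy =>
    lft_hb hL ((hb.hb 2).mono (by linarith)) (ht.hb 2) hy
  have hg : Rhs L a (11 * δ) fun x y => f x y - lft L b (topf J r) 3 x y := by
    refine ⟨hf.cont.sub (hℓ.cont 3), fun y hy x => by rw [hf.per y hy, hℓ.per 3 y hy],
      fun y hy => ((hf.hb y hy).sub (hb3 y hy)).mono (by linarith), ?_⟩
    obtain ⟨K1, hK1⟩ := hf.lh
    obtain ⟨K2, hK2⟩ := hb.lh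
    obtain ⟨K3, hK3⟩ := hr.lh
    refine ⟨K1 + (K2 + K3), fun y hy => (hK1 y hy).sub ?_⟩
    have h0 : 0 ≤ y / L := div_nonneg hy.1 hL.le
    have h1 : y / L ≤ 1 := (div_le_one hL).2 hy.2
    refine ((hK2.const_mul (1 - y / L)).add (hK3.const_mul (y / L))).mono ?_
    rw [abs_of_nonneg h0, abs_of_nonneg (by linarith)]
    have := hK2.nonneg
    have := hK3.nonneg
    nlinarith
  have hz := zsol_sol hL ha hg
  have hzb := zsol_bds hL ha hg
  set u := zsol L fun x y => f x y - lft L b (topf J r) 3 x y with hu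
  have u0 : ∀ x, u 0 x 0 = 0 := fsol_bot hL
  have uL : ∀ x, u 0 x L = 0 := fsol_top hL
  have mL : L ∈ Icc 0 L := ⟨hL.le, le_rfl⟩
  have u1 : ∀ x, u 1 x L = 0 := fun x => by
    have h1 := hz.dx0 L mL x
    simp only [uL] at h1
    exact h1.unique (hasDerivAt_const x 0)
  have u3 : ∀ x, u 3 x L = 0 := fun x => by
    have h1 := hz.dx1 L mL x
    simp only [u1] at h1
    exact h1.unique (hasDerivAt_const x 0)
  have hCZ := CZ_nonneg hL ha
  have hLL : L / L = 1 := div_self hL.ne'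
  have eL : ∀ x, lft L b (topf J r) 0 x L = topf J r 0 x := fun x => by simp [lft, hLL]
  have eC : CL L a * δ = 10 * δ * (1 + 2 / L ^ a) + 20 * δ / L + CZ L a * (11 * δ) := by
    unfold CL; ring
  have p1 : 0 ≤ 10 * δ * (2 / L ^ a) := by positivity
  have p2 : 0 ≤ 20 * δ / L := by positivity
  have b24 : ∀ i : Fin 3, HB a (20 * δ / L) fun x => (topf J r i x - b i x) / L := fun i =>
    ((((ht.hb i).sub (hb.hb i)).const_mul (1 / L)).mono (by
      rw [abs_of_pos (by positivity), one_div, inv_mul_eq_div]; gcongr; linarith)).congr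
      fun x => by ring
  refine ⟨fun i x y => lft L b (topf J r) i x y + u i x y, (hℓ.add hz).congr_rhs fun x y _ => by ring,
    fun x => ?_, ?_, fun x => ?_, fun x => ?_, fun i y hy => ?_, ?_, ?_⟩
  · change lft L b (topf J r) 0 x 0 + u 0 x 0 = b 0 x
    rw [u0]; simp [lft]
  · change lft L b (topf J r) 0 0 L + u 0 0 L = J
    rw [uL, eL]; simp [topf]
  · change lft L b (topf J r) 3 x L + u 3 x L = r x
    rw [u3]; simp [lft, hLL, topf]
  · change lft L b (topf J r) 0 x L + u 0 x L = topf J r 0 x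
    rw [uL, eL, add_zero]
  · refine HB.mono (HB.add (C := 10 * δ * (1 + 2 / L ^ a) + 20 * δ / L) ?_ (hzb.hb i y hy)) eC.ge
    have h1 : ∀ i : Fin 3, HB a (10 * δ * (1 + 2 / L ^ a) + 20 * δ / L)
        fun x => (1 - y / L) * b i x + y / L * topf J r i x := fun i =>
      (lft_hb hL ((hb.hb i).mono (by linarith : δ ≤ 10 * δ)) (ht.hb i) hy).mono (by linarith)
    have h2 : ∀ i : Fin 3, HB a (10 * δ * (1 + 2 / L ^ a) + 20 * δ / L)
        fun x => (topf J r i x - b i x) / L := fun i => (b24 i).mono (by linarith)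
    fin_cases i
    · exact h1 0
    · exact h1 1
    · exact h2 0
    · exact h1 2
    · exact h2 1
  · refine JH.mono (JH.add (C := 10 * δ * (1 + 2 / L ^ a) + 20 * δ / L) ?_ hzb.j3) eC.ge
    exact (lft_jh hL ha ((hb.hb 2).mono (by linarith : δ ≤ 10 * δ)) (ht.hb 2)).mono (by linarith)
  · refine JH.mono (JH.add (C := 10 * δ * (1 + 2 / L ^ a) + 20 * δ / L) ?_ hzb.j4) eC.ge
    intro y hy y' hy' x x'
    refine ((b24 1).2 x x').trans ?_
    have m1 : |x - x'| ^ a ≤ (max |x - x'| |y - y'|) ^ a :=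
      Real.rpow_le_rpow (abs_nonneg _) (le_max_left _ _) ha.1.le
    gcongr
    linarith

theorem eq_zero_of_per {v v1 : ℝ → ℝ} (h0 : ∀ x, HasDerivAt v (v1 x) x)
    (h1 : ∀ x, HasDerivAt v1 0 x) (hp : ∀ x, v (x + 1) = v x) (x : ℝ) : v x = v 0 := by
  have hc : ∀ x, v1 x = v1 0 := fun x => is_const_of_deriv_eq_zero
    (fun x => (h1 x).differentiableAt) (fun x => (h1 x).deriv) x 0
  have hv : ∀ x, v x - v1 0 * x = v 0 - v1 0 * 0 := fun x => is_const_of_deriv_eq_zero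
    (f := fun x => v x - v1 0 * x)
    (fun x => ((h0 x).sub ((hasDerivAt_id x).const_mul (v1 0))).differentiableAt)
    (fun x => by
      have := ((h0 x).sub ((hasDerivAt_id x).const_mul (v1 0))).deriv
      rw [hc x, mul_one, sub_self] at this
      exact this) x 0
  have e1 := hv 1
  have e2 := hp 0
  rw [zero_add] at e2
  have e3 := hv x
  have : v1 0 = 0 := by linarith
  rw [this] at e3
  linarith

/-- Uniqueness for the mixed boundary conditions. -/
theorem Sol.unique' (hL : 0 < L) {S T : Fin 5 → ℝ → ℝ → ℝ} (hS : Sol L S f) (hT : Sol L T f)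
    (h0 : ∀ x, S 0 x 0 = T 0 x 0) (h1 : ∀ x, S 3 x L = T 3 x L) (hJ : S 0 0 L = T 0 0 L)
    (i : Fin 5) (x : ℝ) {y : ℝ} (hy : y ∈ Icc 0 L) : S i x y = T i x y := by
  have mL : L ∈ Icc 0 L := ⟨hL.le, le_rfl⟩
  refine hS.unique hL hT h0 (fun x => ?_) i x y hy
  have hd := hS.sub hT
  have := eq_zero_of_per (v := fun x => S 0 x L - T 0 x L) (v1 := fun x => S 1 x L - T 1 x L)
    (hd.dx0 L mL) (fun x => (hd.dx1 L mL x).congr_deriv (by rw [h1, sub_self]))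
    (hd.per 0 L mL) x
  simp only [hJ, sub_self] at this
  linarith

/-- The a priori estimate. -/
theorem lin_apriori (hL : 0 < L) (ha : a ∈ Ioo (0:ℝ) 1) {T : Fin 5 → ℝ → ℝ → ℝ} (hT : Sol L T f)
    (hb : Bot a δ b) (h0 : ∀ x, T 0 x 0 = b 0 x) (hr : HB a δ fun x => T 3 x L)
    (hr' : ∃ K, LH a K fun x => T 3 x L) (hJ : |T 0 0 L| ≤ δ) (hf : Rhs L a δ f) :
    Bds L a (CL L a * δ) T := by
  have mL : L ∈ Icc 0 L := ⟨hL.le, le_rfl⟩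
  have hc := hr.continuous ha.1
  have hm : ∫ x in (0:ℝ)..1, T 3 x L = 0 := by
    rw [intervalIntegral.integral_eq_sub_of_hasDerivAt (fun x _ => hT.dx1 L mL x)
      (hc.intervalIntegrable _ _)]
    have := hT.per 1 L mL 0
    rw [zero_add] at this
    rw [this, sub_self]
  obtain ⟨S, hS, s0, sJ, s3, -, hB⟩ := lin_exists hL ha hb ⟨hT.per 3 L mL, hm, hr, hr'⟩ hJ hf
  have e := fun i x y hy => hS.unique' hL hT (fun x => by rw [s0, h0]) s3 sJ i x (y := y) hy
  refine ⟨fun i y hy => (hB.hb i y hy).congr fun x => e i x y hy, fun y hy y' hy' x x' => ?_,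
    fun y hy y' hy' x x' => ?_⟩
  · rw [← e 3 x y hy, ← e 3 x' y' hy']; exact hB.j3 y hy y' hy' x x'
  · rw [← e 4 x y hy, ← e 4 x' y' hy']; exact hB.j4 y hy y' hy' x x'

end lift

end

section
open MeasureTheory

theorem HB.absorb {a c δ : ℝ} {g : ℝ → ℝ} (h0 : HB a δ g)
    (h : ∀ δ', HB a δ' g → HB a (c + δ' / 2) g) : HB a (2 * c) g := by
  have h1 : ∀ n : ℕ, HB a (2 * c + (1 / 2 : ℝ) ^ n * (δ - 2 * c)) g := fun n => by
    induction n with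
    | zero => exact h0.mono (by simp)
    | succ n ih => exact (h _ ih).mono (by rw [pow_succ]; linarith)
  have h2 : Filter.Tendsto (fun n : ℕ => 2 * c + (1 / 2 : ℝ) ^ n * (δ - 2 * c)) Filter.atTop
      (nhds (2 * c + 0 * (δ - 2 * c))) :=
    ((tendsto_pow_atTop_nhds_zero_of_lt_one (by norm_num) (by norm_num)).mul_const _).const_add _
  rw [zero_mul, add_zero] at h2
  exact ⟨fun x => ge_of_tendsto' h2 fun n => (h1 n).1 x,
    fun x z => ge_of_tendsto' (h2.mul_const _) fun n => (h1 n).2 x z⟩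

/-- The data of the reduced problem: bottom values with two derivatives, the coefficients of the
current at the bottom, the pressure gradient at the top, the flux, and the inverse of `x + b x`. -/
structure Dat where
  b : Fin 3 → ℝ → ℝ
  k0 : ℝ → ℝ
  w : ℝ → ℝ
  q : ℝ → ℝ
  J : ℝ
  A : ℝ → ℝ

/-- Admissible data of size `R`. -/
structure DV (a R : ℝ) (D : Dat) : Prop where
  d0 : ∀ x, HasDerivAt (D.b 0) (D.b 1 x) x
  d1 : ∀ x, HasDerivAt (D.b 1) (D.b 2 x) x
  per : ∀ x, D.b 0 (x + 1) = D.b 0 x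
  perk : ∀ x, D.k0 (x + 1) = D.k0 x
  perw : ∀ x, D.w (x + 1) = D.w x
  perq : ∀ x, D.q (x + 1) = D.q x
  hb : ∀ i, HB a R (D.b i)
  hk : HB a R D.k0
  hw : HB a 2 D.w
  hq : HB a R D.q
  hJ : |D.J| ≤ R
  lb : ∀ i, LH a R (D.b i)
  lk : LH a R D.k0
  lw : LH a R D.w
  lq : LH a R D.q
  inv : ∀ t, D.A t + D.b 0 (D.A t) = t

/-- The data `D₁` and `D₂` are at distance at most `δ`. -/
structure DD (a δ : ℝ) (D1 D2 : Dat) : Prop where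
  b : ∀ i, HB a δ fun x => D1.b i x - D2.b i x
  k : HB a δ fun x => D1.k0 x - D2.k0 x
  w : HB a δ fun x => D1.w x - D2.w x
  q : HB a δ fun x => D1.q x - D2.q x
  J : |D1.J - D2.J| ≤ δ

/-- Translation of the data; the flux is prescribed separately. -/
def Dat.shift (D : Dat) (h J : ℝ) : Dat where
  b i x := D.b i (x + h)
  k0 x := D.k0 (x + h)
  w x := D.w (x + h)
  q x := D.q (x + h)
  J := J
  A x := D.A (x + h) - h

/-- Admissible states of size `R`. -/
structure St (L a R : ℝ) (s : Fin 5 → ℝ → ℝ → ℝ) : Prop where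
  per : ∀ i, ∀ y ∈ Icc 0 L, ∀ x, s i (x + 1) y = s i x y
  cont : ∀ i, ContinuousOn (fun z : ℝ × ℝ => s i z.1 z.2) (strip L)
  hb : ∀ i, ∀ y ∈ Icc 0 L, HB a R fun x => s i x y
  lh : ∀ i, ∀ y ∈ Icc 0 L, LH a R fun x => s i x y

/-- The states `s` and `t` are at distance at most `N`. -/
def SD (L a N : ℝ) (s t : Fin 5 → ℝ → ℝ → ℝ) : Prop :=
  ∀ i, ∀ y ∈ Icc 0 L, HB a N fun x => s i x y - t i x y

/-- The current along the bottom. -/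
def kf (D : Dat) (s : Fin 5 → ℝ → ℝ → ℝ) (x : ℝ) : ℝ := D.k0 x - D.w x * (s 2 x 0 * s 4 x 0)

/-- The foot point on the bottom of the field line through `(x, y)`. -/
def sig (D : Dat) (s : Fin 5 → ℝ → ℝ → ℝ) (x y : ℝ) : ℝ := D.A (x + s 0 x y)

/-- The current, transported along field lines. -/
def ff (D : Dat) (s : Fin 5 → ℝ → ℝ → ℝ) (x y : ℝ) : ℝ := kf D s (sig D s x y)

/-- The second derivative at the top, up to its mean. -/
def rho (L : ℝ) (D : Dat) (s : Fin 5 → ℝ → ℝ → ℝ) (x : ℝ) : ℝ :=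
  D.q x - (ff D s x L + (ff D s x L * s 1 x L + (s 2 x L * s 4 x L + s 1 x L * s 3 x L)))

/-- One step of the iteration. -/
structure Step (L : ℝ) (D : Dat) (s S : Fin 5 → ℝ → ℝ → ℝ) : Prop where
  sol : Sol L S (ff D s)
  bot : ∀ x, S 0 x 0 = D.b 0 x
  J : S 0 0 L = D.J
  top : ∀ x, S 3 x L = rho L D s x - ∫ t in (0:ℝ)..1, rho L D s t

variable {L a R N δ : ℝ} {D D1 D2 : Dat} {s s1 s2 S S1 S2 : Fin 5 → ℝ → ℝ → ℝ}

theorem DV.shift (hD : DV a R D) {J' : ℝ} (hJ : |J'| ≤ R) (h : ℝ) : DV a R (D.shift h J') where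
  d0 x := (hD.d0 (x + h)).comp_add_const x h
  d1 x := (hD.d1 (x + h)).comp_add_const x h
  per x := by change D.b 0 (x + 1 + h) = D.b 0 (x + h); rw [← hD.per (x + h)]; ring_nf
  perk x := by change D.k0 (x + 1 + h) = D.k0 (x + h); rw [← hD.perk (x + h)]; ring_nf
  perw x := by change D.w (x + 1 + h) = D.w (x + h); rw [← hD.perw (x + h)]; ring_nf
  perq x := by change D.q (x + 1 + h) = D.q (x + h); rw [← hD.perq (x + h)]; ring_nf
  hb i := (hD.hb i).shift h
  hk := hD.hk.shift h
  hw := hD.hw.shift h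
  hq := hD.hq.shift h
  hJ := hJ
  lb i t := (((hD.lb i) t).shift h).congr fun x => by simp only [Dat.shift]; ring_nf
  lk t := ((hD.lk t).shift h).congr fun x => by simp only [Dat.shift]; ring_nf
  lw t := ((hD.lw t).shift h).congr fun x => by simp only [Dat.shift]; ring_nf
  lq t := ((hD.lq t).shift h).congr fun x => by simp only [Dat.shift]; ring_nf
  inv t := by
    have := hD.inv (t + h)
    change D.A (t + h) - h + D.b 0 (D.A (t + h) - h + h) = t
    rw [sub_add_cancel]; linarith

theorem DV.dd_shift (hD : DV a R D) {J' : ℝ} {h : ℝ} (hJ : |J' - D.J| ≤ R * |h|) :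
    DD a (R * |h|) (D.shift h J') D :=
  ⟨fun i => hD.lb i h, hD.lk h, hD.lw h, hD.lq h, hJ⟩

theorem St.shift (hs : St L a R s) (h : ℝ) : St L a R (fun i x y => s i (x + h) y) where
  per i y hy x := by rw [← hs.per i y hy (x + h)]; ring_nf
  cont i := by
    have : (fun z : ℝ × ℝ => s i (z.1 + h) z.2) =
      (fun z : ℝ × ℝ => s i z.1 z.2) ∘ (fun z : ℝ × ℝ => (z.1 + h, z.2)) := rfl
    rw [this]
    exact (hs.cont i).comp (by fun_prop) fun z hz => ⟨trivial, hz.2⟩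
  hb i y hy := (hs.hb i y hy).shift h
  lh i y hy t := ((hs.lh i y hy t).shift h).congr fun x => by ring_nf

theorem St.sd_shift (hs : St L a R s) (h : ℝ) : SD L a (R * |h|) (fun i x y => s i (x + h) y) s :=
  fun i y hy => hs.lh i y hy h

theorem DV.R_nonneg (hD : DV a R D) : 0 ≤ R := (hD.hb 0).nonneg

theorem DV.sub_le (hD : DV a R D) (hR : R ≤ 1 / 16) (t t' : ℝ) : |D.A t - D.A t'| ≤ 2 * |t - t'| := by
  have h1 := hD.inv t
  have h2 := hD.inv t'
  have h3 := (hD.lb 0).lip (D.A t) (D.A t')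
  have h4 : |D.A t - D.A t'| ≤ |t - t'| + |D.b 0 (D.A t) - D.b 0 (D.A t')| := by
    rw [show D.A t - D.A t' = (t - t') - (D.b 0 (D.A t) - D.b 0 (D.A t')) by linarith]
    exact abs_sub _ _
  nlinarith [abs_nonneg (D.A t - D.A t')]

theorem DV.A_per (hD : DV a R D) (hR : R ≤ 1 / 16) (t : ℝ) : D.A (t + 1) = D.A t + 1 := by
  have h1 := hD.inv (t + 1)
  have h2 := hD.inv t
  have h3 := (hD.lb 0).lip (D.A (t + 1)) (D.A t + 1)
  rw [hD.per] at h3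
  rw [show D.b 0 (D.A (t + 1)) - D.b 0 (D.A t) = -(D.A (t + 1) - (D.A t + 1)) by linarith,
    abs_neg] at h3
  have : |D.A (t + 1) - (D.A t + 1)| = 0 := by
    nlinarith [abs_nonneg (D.A (t + 1) - (D.A t + 1))]
  linarith [abs_eq_zero.1 this]

theorem sig_lip (hD : DV a R D) (hR : R ≤ 1 / 16) (hs : St L a R s) {y : ℝ} (hy : y ∈ Icc 0 L)
    (x x' : ℝ) : |sig D s x y - sig D s x' y| ≤ 4 * |x - x'| := by
  have h1 := hD.sub_le hR (x + s 0 x y) (x' + s 0 x' y)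
  have h2 := (hs.lh 0 y hy).lip x x'
  have h3 : |x + s 0 x y - (x' + s 0 x' y)| ≤ |x - x'| + |s 0 x y - s 0 x' y| := by
    rw [show x + s 0 x y - (x' + s 0 x' y) = (x - x') + (s 0 x y - s 0 x' y) by ring]
    exact abs_add_le _ _
  have h4 : R * |x - x'| ≤ 1 / 16 * |x - x'| := by gcongr
  change |D.A _ - D.A _| ≤ _
  linarith [abs_nonneg (x - x')]

theorem sig_diff (ha : a ∈ Ioo (0:ℝ) 1) (hD1 : DV a R D1) (hD2 : DV a R D2) (hR : R ≤ 1 / 16)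
    (h1 : St L a R s1) (h2 : St L a R s2) (hd : DD a δ D1 D2) (hN : SD L a N s1 s2) {y : ℝ}
    (hy : y ∈ Icc 0 L) : HB a (2 * (N + 4 * δ)) fun x => sig D1 s1 x y - sig D2 s2 x y := by
  have hR0 := hD1.R_nonneg
  have e1 : ∀ x, sig D1 s1 x y + D1.b 0 (sig D1 s1 x y) = x + s1 0 x y := fun x => hD1.inv _
  have e2 : ∀ x, sig D2 s2 x y + D2.b 0 (sig D2 s2 x y) = x + s2 0 x y := fun x => hD2.inv _
  have l1 := sig_lip hD1 hR h1 hy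
  have l2 := sig_lip hD2 hR h2 hy
  have b1 : ∀ x, |sig D1 s1 x y - sig D2 s2 x y| ≤ 8 := fun x => by
    rw [show sig D1 s1 x y - sig D2 s2 x y = (s1 0 x y - s2 0 x y)
      - (D1.b 0 (sig D1 s1 x y) - D2.b 0 (sig D2 s2 x y)) by linarith [e1 x, e2 x]]
    refine (abs_sub _ _).trans ?_
    have i1 := abs_sub (s1 0 x y) (s2 0 x y)
    have i2 := abs_sub (D1.b 0 (sig D1 s1 x y)) (D2.b 0 (sig D2 s2 x y))
    linarith [(h1.hb 0 y hy).1 x, (h2.hb 0 y hy).1 x, (hD1.hb 0).1 (sig D1 s1 x y),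
      (hD2.hb 0).1 (sig D2 s2 x y)]
  have i0 : HB a (2 * 8) fun x => sig D1 s1 x y - sig D2 s2 x y :=
    HB.of_lipschitz ha.1 ha.2.le b1 fun x x' => by
      rw [show sig D1 s1 x y - sig D2 s2 x y - (sig D1 s1 x' y - sig D2 s2 x' y)
        = (sig D1 s1 x y - sig D1 s1 x' y) - (sig D2 s2 x y - sig D2 s2 x' y) by ring]
      exact (abs_sub _ _).trans (by linarith [l1 x x', l2 x x'])
  refine i0.absorb fun δ' hδ' => ?_
  have j1 := (hD1.lb 0).comp_diff ha.1 ha.2.le (by norm_num : (1:ℝ) ≤ 4) l2 hδ'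
  have j2 := (hd.b 0).comp ha.1 ha.2.le (by norm_num : (1:ℝ) ≤ 4) l2
  refine ((((hN 0 y hy).sub j2).sub j1).mono ?_).congr fun x => ?_
  · nlinarith [hδ'.nonneg]
  · linarith [e1 x, e2 x]

theorem kf_diff (hL : 0 < L) (hD1 : DV a R D1) (hD2 : DV a R D2) (hR : R ≤ 1 / 16)
    (h1 : St L a R s1) (h2 : St L a R s2) (hd : DD a δ D1 D2) (hN : SD L a N s1 s2) :
    HB a (2 * δ + 16 * R * N) fun x => kf D1 s1 x - kf D2 s2 x := by
  have hR0 := hD1.R_nonneg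
  have m0 : (0:ℝ) ∈ Icc 0 L := ⟨le_rfl, hL.le⟩
  have hδ := hd.k.nonneg
  have p1 := hd.w.mul ((h1.hb 2 0 m0).mul (h1.hb 4 0 m0))
  have p2 := hD2.hw.mul ((hN 2 0 m0).mul (h1.hb 4 0 m0))
  have p3 := hD2.hw.mul ((h2.hb 2 0 m0).mul (hN 4 0 m0))
  refine ((hd.k.sub (p1.add (p2.add p3))).mono ?_).congr fun x => by simp only [kf]; ring
  nlinarith [mul_nonneg hδ hR0]

theorem kf_hb (hL : 0 < L) (hD : DV a R D) (hR : R ≤ 1 / 16) (hs : St L a R s) :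
    HB a (3 * R) (kf D s) := by
  have m0 : (0:ℝ) ∈ Icc 0 L := ⟨le_rfl, hL.le⟩
  refine ((hD.hk.sub (hD.hw.mul ((hs.hb 2 0 m0).mul (hs.hb 4 0 m0)))).mono ?_).congr
    fun x => rfl
  nlinarith [hD.R_nonneg]

theorem kf_lh (hL : 0 < L) (hD : DV a R D) (hR : R ≤ 1 / 16) (hs : St L a R s) :
    LH a (6 * R) (kf D s) := fun h => by
  have hR0 := hD.R_nonneg
  refine (kf_diff hL (hD.shift hD.hJ h) hD hR (hs.shift h) hs (hD.dd_shift (h := h) (by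
    rw [sub_self, abs_zero]; positivity)) (hs.sd_shift h)).mono ?_
  nlinarith [mul_nonneg hR0 (abs_nonneg h)]

theorem ff_diff (hL : 0 < L) (ha : a ∈ Ioo (0:ℝ) 1) (hD1 : DV a R D1) (hD2 : DV a R D2)
    (hR : R ≤ 1 / 16) (h1 : St L a R s1) (h2 : St L a R s2) (hd : DD a δ D1 D2)
    (hN : SD L a N s1 s2) {y : ℝ} (hy : y ∈ Icc 0 L) :
    HB a (23 * δ + 124 * R * N) fun x => ff D1 s1 x y - ff D2 s2 x y := by
  have hR0 := hD1.R_nonneg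
  have hδ := hd.k.nonneg
  have j1 := (kf_diff hL hD1 hD2 hR h1 h2 hd hN).comp ha.1 ha.2.le (by norm_num : (1:ℝ) ≤ 4)
    (sig_lip hD1 hR h1 hy)
  have j2 := (kf_lh hL hD2 hR h2).comp_diff ha.1 ha.2.le (by norm_num : (1:ℝ) ≤ 4)
    (sig_lip hD2 hR h2 hy) (sig_diff ha hD1 hD2 hR h1 h2 hd hN hy)
  refine ((j1.add j2).mono ?_).congr fun x => by simp only [ff]; ring
  nlinarith [mul_nonneg hδ hR0]

theorem ff_hb (hL : 0 < L) (ha : a ∈ Ioo (0:ℝ) 1) (hD : DV a R D) (hR : R ≤ 1 / 16)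
    (hs : St L a R s) {y : ℝ} (hy : y ∈ Icc 0 L) : HB a (12 * R) fun x => ff D s x y :=
  ((kf_hb hL hD hR hs).comp ha.1 ha.2.le (by norm_num : (1:ℝ) ≤ 4) (sig_lip hD hR hs hy)).mono
    (by linarith)

theorem ff_shift (h J' x y : ℝ) :
    ff (D.shift h J') (fun i x y => s i (x + h) y) x y = ff D s (x + h) y := by
  have : sig (D.shift h J') (fun i x y => s i (x + h) y) x y + h = sig D s (x + h) y := by
    simp only [sig, Dat.shift]; rw [sub_add_cancel]; ring_nf
  simp only [ff]
  rw [← this]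
  rfl

theorem rho_shift (h J' x : ℝ) :
    rho L (D.shift h J') (fun i x y => s i (x + h) y) x = rho L D s (x + h) := by
  simp only [rho, ff_shift]
  rfl

theorem ff_lh (hL : 0 < L) (ha : a ∈ Ioo (0:ℝ) 1) (hD : DV a R D) (hR : R ≤ 1 / 16)
    (hs : St L a R s) {y : ℝ} (hy : y ∈ Icc 0 L) : LH a (31 * R) fun x => ff D s x y := fun h => by
  have hR0 := hD.R_nonneg
  refine ((ff_diff hL ha (hD.shift hD.hJ h) hD hR (hs.shift h) hs (hD.dd_shift (h := h) (by
    rw [sub_self, abs_zero]; positivity)) (hs.sd_shift h) hy).mono ?_).congr fun x => by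
      rw [ff_shift]
  nlinarith [mul_nonneg hR0 (abs_nonneg h)]

theorem ff_rhs (hL : 0 < L) (ha : a ∈ Ioo (0:ℝ) 1) (hD : DV a R D) (hR : R ≤ 1 / 16)
    (hs : St L a R s) : Rhs L a (12 * R) (ff D s) where
  cont := by
    have hA : Continuous D.A := (LipschitzWith.of_dist_le_mul (K := 2) fun t t' => by
      simpa [Real.dist_eq] using hD.sub_le hR t t').continuous
    have hk := (kf_hb hL hD hR hs).continuous ha.1
    exact (hk.comp hA).comp_continuousOn (continuous_fst.continuousOn.add (hs.cont 0))
  per y hy x := by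
    have h1 : sig D s (x + 1) y = sig D s x y + 1 := by
      simp only [sig]
      rw [hs.per 0 y hy, ← hD.A_per hR]; ring_nf
    have m0 : (0:ℝ) ∈ Icc 0 L := ⟨le_rfl, hL.le⟩
    simp only [ff, h1, kf]
    rw [hD.perk, hD.perw, hs.per 2 0 m0, hs.per 4 0 m0]
  hb y hy := ff_hb hL ha hD hR hs hy
  lh := ⟨31 * R, fun y hy => ff_lh hL ha hD hR hs hy⟩

theorem rho_diff (hL : 0 < L) (ha : a ∈ Ioo (0:ℝ) 1) (hD1 : DV a R D1) (hD2 : DV a R D2)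
    (hR : R ≤ 1 / 16) (h1 : St L a R s1) (h2 : St L a R s2) (hd : DD a δ D1 D2)
    (hN : SD L a N s1 s2) : HB a (47 * δ + 280 * R * N) fun x => rho L D1 s1 x - rho L D2 s2 x := by
  have hR0 := hD1.R_nonneg
  have hδ := hd.k.nonneg
  have mL : L ∈ Icc 0 L := ⟨hL.le, le_rfl⟩
  have hN0 := (hN 0 L mL).nonneg
  have f1 := ff_diff hL ha hD1 hD2 hR h1 h2 hd hN mL
  have p1 := f1.mul (h1.hb 1 L mL)
  have p2 := (ff_hb hL ha hD2 hR h2 mL).mul (hN 1 L mL)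
  have p3 := (hN 2 L mL).mul (h1.hb 4 L mL)
  have p4 := (h2.hb 2 L mL).mul (hN 4 L mL)
  have p5 := (hN 1 L mL).mul (h1.hb 3 L mL)
  have p6 := (h2.hb 1 L mL).mul (hN 3 L mL)
  refine ((hd.q.sub (f1.add ((p1.add p2).add ((p3.add p4).add (p5.add p6))))).mono ?_).congr
    fun x => by simp only [rho]; ring
  nlinarith [mul_nonneg hδ hR0, mul_nonneg hR0 hN0, mul_nonneg (mul_nonneg hR0 hN0) hR0]

theorem rho_hb (hL : 0 < L) (ha : a ∈ Ioo (0:ℝ) 1) (hD : DV a R D) (hR : R ≤ 1 / 16)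
    (hs : St L a R s) : HB a (15 * R) (rho L D s) := by
  have hR0 := hD.R_nonneg
  have mL : L ∈ Icc 0 L := ⟨hL.le, le_rfl⟩
  have f1 := ff_hb hL ha hD hR hs mL
  refine ((hD.hq.sub (f1.add ((f1.mul (hs.hb 1 L mL)).add (((hs.hb 2 L mL).mul (hs.hb 4 L mL)).add
    ((hs.hb 1 L mL).mul (hs.hb 3 L mL)))))).mono ?_).congr fun x => rfl
  nlinarith

theorem rho_lh (hL : 0 < L) (ha : a ∈ Ioo (0:ℝ) 1) (hD : DV a R D) (hR : R ≤ 1 / 16)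
    (hs : St L a R s) : LH a (65 * R) (rho L D s) := fun h => by
  have hR0 := hD.R_nonneg
  refine ((rho_diff hL ha (hD.shift hD.hJ h) hD hR (hs.shift h) hs (hD.dd_shift (h := h) (by
    rw [sub_self, abs_zero]; positivity)) (hs.sd_shift h)).mono ?_).congr fun x => by
      rw [rho_shift]
  nlinarith [mul_nonneg hR0 (abs_nonneg h)]

theorem rho_per (hL : 0 < L) (ha : a ∈ Ioo (0:ℝ) 1) (hD : DV a R D) (hR : R ≤ 1 / 16)
    (hs : St L a R s) (x : ℝ) : rho L D s (x + 1) = rho L D s x := by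
  have mL : L ∈ Icc 0 L := ⟨hL.le, le_rfl⟩
  simp only [rho]
  rw [hD.perq, (ff_rhs hL ha hD hR hs).per L mL, hs.per 1 L mL, hs.per 2 L mL, hs.per 3 L mL,
    hs.per 4 L mL]

end

section
open MeasureTheory

variable {L a R N δ η : ℝ} {D D1 D2 : Dat} {s s1 s2 S S1 S2 : Fin 5 → ℝ → ℝ → ℝ}

theorem HB.abs_integral {C : ℝ} {r : ℝ → ℝ} (h : HB a C r) : |∫ x in (0:ℝ)..1, r x| ≤ C := by
  have := intervalIntegral.norm_integral_le_of_norm_le_const (a := (0:ℝ)) (b := 1) (f := r)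
    (C := C) fun x _ => h.1 x
  simpa using this

theorem HB.zero (hC : 0 ≤ δ) : HB a δ fun _ => 0 := (HB.const 0).mono (by simpa)

theorem LH.const (hC : 0 ≤ δ) (c : ℝ) : LH a δ fun _ => c := fun h =>
  (HB.zero (by positivity)).congr fun x => by simp

theorem Rhs.sub {H : ℝ} {f g : ℝ → ℝ → ℝ} (hf : Rhs L a H f) (hg : Rhs L a H g)
    (h : ∀ y ∈ Icc 0 L, HB a δ fun x => f x y - g x y) : Rhs L a δ fun x y => f x y - g x y where
  cont := hf.cont.sub hg.cont
  per y hy x := by rw [hf.per y hy, hg.per y hy]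
  hb := h
  lh := by
    obtain ⟨K1, h1⟩ := hf.lh
    obtain ⟨K2, h2⟩ := hg.lh
    exact ⟨K1 + K2, fun y hy => (h1 y hy).sub (h2 y hy)⟩

theorem DV.mono (hD : DV a η D) (h : η ≤ R) : DV a R D :=
  { hD with
    hb := fun i => (hD.hb i).mono h
    hk := hD.hk.mono h
    hq := hD.hq.mono h
    hJ := hD.hJ.trans h
    lb := fun i => (hD.lb i).mono h
    lk := hD.lk.mono h
    lw := hD.lw.mono h
    lq := hD.lq.mono h }

theorem step_exists (hL : 0 < L) (ha : a ∈ Ioo (0:ℝ) 1) (hD : DV a R D) (hR : R ≤ 1 / 16)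
    (hs : St L a R s) : ∃ S, Step L D s S := by
  have hR0 := hD.R_nonneg
  have hr := rho_hb hL ha hD hR hs
  have hc := hr.continuous ha.1
  have hb : Bot a (30 * R) D.b :=
    ⟨hD.d0, hD.d1, hD.per, fun i => (hD.hb i).mono (by linarith), ⟨R, hD.lb 2⟩⟩
  have ht : Top a (30 * R) fun x => rho L D s x - ∫ t in (0:ℝ)..1, rho L D s t := by
    refine ⟨fun x => by rw [rho_per hL ha hD hR hs], ?_, ?_, ⟨65 * R + 0,
      (rho_lh hL ha hD hR hs).sub (LH.const le_rfl _)⟩⟩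
    · rw [intervalIntegral.integral_sub (hc.intervalIntegrable _ _) (by simp)]
      simp
    · exact (hr.sub (HB.const _)).mono (by linarith [hr.abs_integral])
  have hf := ff_rhs hL ha hD hR hs
  obtain ⟨S, h1, h2, h3, h4, -⟩ := lin_exists hL ha hb ht (hD.hJ.trans (by linarith))
    (⟨hf.cont, hf.per, fun y hy => (hf.hb y hy).mono (by linarith), hf.lh⟩ :
      Rhs L a (30 * R) (ff D s))
  exact ⟨S, h1, h2, h3, h4⟩

/-- The constant of the difference estimate. -/
def CB (L a : ℝ) : ℝ := 600 * (CL L a + 1)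

theorem one_le_CB (hL : 0 < L) (ha : a ∈ Ioo (0:ℝ) 1) : 600 ≤ CB L a := by
  have := CL_nonneg hL ha
  unfold CB; linarith

/-- The difference estimate. -/
theorem step_diff (hL : 0 < L) (ha : a ∈ Ioo (0:ℝ) 1) (hD1 : DV a R D1) (hD2 : DV a R D2)
    (hR : R ≤ 1 / 16) (h1 : St L a R s1) (h2 : St L a R s2) (hd : DD a δ D1 D2)
    (hN : SD L a N s1 s2) (hS1 : Step L D1 s1 S1) (hS2 : Step L D2 s2 S2) :
    Bds L a (CB L a * (δ + R * N)) fun i x y => S1 i x y - S2 i x y := by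
  have hR0 := hD1.R_nonneg
  have hδ := hd.k.nonneg
  have mL : L ∈ Icc 0 L := ⟨hL.le, le_rfl⟩
  have hN0 := (hN 0 L mL).nonneg
  have hRN := mul_nonneg hR0 hN0
  have hr := rho_diff hL ha hD1 hD2 hR h1 h2 hd hN
  have c1 := (rho_hb hL ha hD1 hR h1).continuous ha.1
  have c2 := (rho_hb hL ha hD2 hR h2).continuous ha.1
  have hi := hr.abs_integral
  rw [intervalIntegral.integral_sub (c1.intervalIntegrable _ _) (c2.intervalIntegrable _ _)] at hi
  have et : ∀ x, S1 3 x L - S2 3 x L = rho L D1 s1 x - rho L D2 s2 x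
      - ((∫ t in (0:ℝ)..1, rho L D1 s1 t) - ∫ t in (0:ℝ)..1, rho L D2 s2 t) := fun x => by
    rw [hS1.top, hS2.top]; ring
  have hCL := CL_nonneg hL ha
  refine (lin_apriori hL ha (T := fun i x y => S1 i x y - S2 i x y) (hS1.sol.sub hS2.sol)
    (δ := 94 * δ + 560 * (R * N)) (b := fun i x => D1.b i x - D2.b i x)
    ⟨fun x => (hD1.d0 x).sub (hD2.d0 x), fun x => (hD1.d1 x).sub (hD2.d1 x),
      fun x => by rw [hD1.per, hD2.per], fun i => (hd.b i).mono (by linarith),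
      ⟨R + R, (hD1.lb 2).sub (hD2.lb 2)⟩⟩ (fun x => by rw [hS1.bot, hS2.bot]) ?_ ?_ ?_
    ((ff_rhs hL ha hD1 hR h1).sub (ff_rhs hL ha hD2 hR h2) fun y hy =>
      (ff_diff hL ha hD1 hD2 hR h1 h2 hd hN hy).mono (by linarith))).mono ?_
  · exact ((hr.sub (HB.const _)).mono (by linarith)).congr fun x => (et x).symm
  · exact ⟨_, (((rho_lh hL ha hD1 hR h1).sub (rho_lh hL ha hD2 hR h2)).sub
      (LH.const le_rfl _)).congr fun x => (et x).symm⟩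
  · rw [hS1.J, hS2.J]; exact hd.J.trans (by linarith)
  · unfold CB; nlinarith [mul_nonneg hCL hδ, mul_nonneg hCL hRN]

theorem step_bds (hL : 0 < L) (ha : a ∈ Ioo (0:ℝ) 1) (hD : DV a η D) (hη : η ≤ R)
    (hR : R ≤ 1 / 16) (hs : St L a R s) (hS : Step L D s S) : Bds L a (CB L a * (η + R * R)) S := by
  have hη0 := hD.R_nonneg
  have hR0 : 0 ≤ R := hη0.trans hη
  let Z : Dat := ⟨fun _ _ => 0, fun _ => 0, D.w, fun _ => 0, 0, fun t => t⟩
  have hZ : DV a R Z :=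
    ⟨fun x => hasDerivAt_const _ _, fun x => hasDerivAt_const _ _, fun _ => rfl, fun _ => rfl,
      hD.perw, fun _ => rfl, fun _ => HB.zero hR0, HB.zero hR0, hD.hw, HB.zero hR0,
      by simpa [Z] using hR0, fun _ => LH.const hR0 0, LH.const hR0 0, (hD.mono hη).lw,
      LH.const hR0 0, fun t => by simp [Z]⟩
  have hz : St L a R fun _ _ _ => 0 :=
    ⟨fun _ _ _ _ => rfl, fun _ => continuousOn_const, fun _ _ _ => HB.zero hR0,
      fun _ _ _ => LH.const hR0 0⟩
  have f0 : ∀ x y, ff Z (fun _ _ _ => 0) x y = 0 := fun x y => by simp [ff, kf, Z]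
  have r0 : ∀ x, rho L Z (fun _ _ _ => 0) x = 0 := fun x => by simp [rho, f0, Z]
  have hstep : Step L Z (fun _ _ _ => 0) fun _ _ _ => 0 := by
    refine ⟨⟨fun _ _ _ => hasDerivAt_const _ _, fun _ _ _ => hasDerivAt_const _ _,
      fun _ _ _ => hasDerivAt_const _ _, fun _ _ _ => hasDerivWithinAt_const _ _ _,
      fun _ _ _ => hasDerivWithinAt_const _ _ _, fun _ _ _ => ?_, fun _ _ _ _ => rfl,
      fun _ => continuousOn_const⟩, fun _ => rfl, rfl, fun x => by simp [r0]⟩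
    rw [f0, sub_zero]; exact hasDerivWithinAt_const _ _ _
  have hd : DD a η D Z :=
    ⟨fun i => (hD.hb i).congr fun x => by simp [Z], hD.hk.congr fun x => by simp [Z],
      (HB.zero hη0).congr fun x => by simp [Z], hD.hq.congr fun x => by simp [Z],
      by simpa [Z] using hD.hJ⟩
  have := step_diff hL ha (hD.mono hη) hZ hR hs hz hd
    (N := R) (fun i y hy => (hs.hb i y hy).congr fun x => by simp) hS hstep
  simpa only [sub_zero] using this

theorem Step.shift (hS : Step L D s S) (hper : ∀ x, rho L D s (x + 1) = rho L D s x) (h : ℝ) :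
    Step L (D.shift h (S 0 h L)) (fun i x y => s i (x + h) y) fun i x y => S i (x + h) y where
  sol := (hS.sol.shift h).congr_rhs fun x y _ => (ff_shift h _ x y).symm
  bot x := hS.bot (x + h)
  J := by simp [Dat.shift]
  top x := by
    have hp : Function.Periodic (rho L D s) 1 := hper
    have := hp.intervalIntegral_add_eq h 0
    rw [zero_add] at this
    simp only [rho_shift]
    rw [intervalIntegral.integral_comp_add_right, zero_add, add_comm 1 h, this]
    exact hS.top (x + h)

theorem step_lh (hL : 0 < L) (ha : a ∈ Ioo (0:ℝ) 1) (hD : DV a η D) (hη : η ≤ R)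
    (hR : R ≤ 1 / 16) (hRC : CB L a * (η + R * R) ≤ R) (hs : St L a R s) (hS : Step L D s S)
    (h : ℝ) : Bds L a (2 * CB L a ^ 2 * (η + R * R) * |h|) fun i x y => S i (x + h) y - S i x y := by
  have hη0 := hD.R_nonneg
  have hR0 : 0 ≤ R := hη0.trans hη
  have hC := one_le_CB hL ha
  have mL : L ∈ Icc 0 L := ⟨hL.le, le_rfl⟩
  have hB := step_bds hL ha hD hη hR hs hS
  set E := CB L a * (η + R * R) with hE
  have hηE : η ≤ E := by nlinarith [mul_nonneg hR0 hR0]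
  have hJ : |S 0 h L - D.J| ≤ E * |h| := by
    rw [← hS.J]
    have := (convex_univ (𝕜 := ℝ) (E := ℝ)).norm_image_sub_le_of_norm_hasDerivWithin_le
      (f := fun t => S 0 t L) (C := E) (fun x _ => (hS.sol.dx0 L mL x).hasDerivWithinAt)
      (fun x _ => (hB.hb 1 L mL).1 x) (mem_univ 0) (mem_univ h)
    simpa [Real.norm_eq_abs] using this
  have hDR := hD.mono hη
  have hJR : |S 0 h L| ≤ R := ((hB.hb 0 L mL).1 h).trans hRC
  have hd := (hD.mono hηE).dd_shift (h := h) hJ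
  refine (step_diff hL ha (hDR.shift hJR h) hDR hR (hs.shift h) hs hd (hs.sd_shift h)
    (hS.shift (rho_per hL ha hDR hR hs) h) hS).mono ?_
  rw [hE]
  have h1 : R * R ≤ CB L a * (η + R * R) := by nlinarith [mul_nonneg hR0 hR0]
  have h2 := mul_le_mul_of_nonneg_left (mul_le_mul_of_nonneg_right h1 (abs_nonneg h))
    (by linarith : 0 ≤ CB L a)
  calc _ = CB L a * (CB L a * (η + R * R) * |h|) + CB L a * (R * R * |h|) := by ring
    _ ≤ CB L a * (CB L a * (η + R * R) * |h|) + CB L a * (CB L a * (η + R * R) * |h|) := by gcongr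
    _ = _ := by ring

/-- The admissible size of states. -/
def Rmax (L a : ℝ) : ℝ := 1 / (4 * CB L a ^ 2)

theorem Rmax_pos (hL : 0 < L) (ha : a ∈ Ioo (0:ℝ) 1) : 0 < Rmax L a := by
  have hC := one_le_CB hL ha
  unfold Rmax; positivity

theorem Rmax_le (hL : 0 < L) (ha : a ∈ Ioo (0:ℝ) 1) : Rmax L a ≤ 1 / 16 := by
  have hC := one_le_CB hL ha
  unfold Rmax
  apply one_div_le_one_div_of_le (by norm_num)
  nlinarith

theorem CB_mul_Rmax (hL : 0 < L) (ha : a ∈ Ioo (0:ℝ) 1) : CB L a * Rmax L a ≤ 1 / 2 := by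
  have hC := one_le_CB hL ha
  unfold Rmax
  rw [mul_one_div, div_le_iff₀ (by positivity)]
  nlinarith

theorem size_le (hL : 0 < L) (ha : a ∈ Ioo (0:ℝ) 1) (hR0 : 0 ≤ R) (hR : R ≤ Rmax L a) :
    2 * CB L a ^ 2 * (R * Rmax L a + R * R) ≤ R := by
  have hC := one_le_CB hL ha
  have e : CB L a ^ 2 * Rmax L a = 1 / 4 := by
    unfold Rmax; field_simp
  have h1 : R * R ≤ R * Rmax L a := by gcongr
  have h2 : 2 * CB L a ^ 2 * (R * R) ≤ 2 * CB L a ^ 2 * (R * Rmax L a) := by gcongr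
  nlinarith

theorem step_st (hL : 0 < L) (ha : a ∈ Ioo (0:ℝ) 1) (hD : DV a (R * Rmax L a) D)
    (hR0 : 0 ≤ R) (hR : R ≤ Rmax L a) (hs : St L a R s) (hS : Step L D s S) :
    St L a R S ∧ ∀ h, Bds L a (R * |h|) fun i x y => S i (x + h) y - S i x y := by
  have hC := one_le_CB hL ha
  have h16 := Rmax_le hL ha
  have hp := Rmax_pos hL ha
  have hs1 := size_le hL ha hR0 hR
  have hη : R * Rmax L a ≤ R := by nlinarith
  have hRC : CB L a * (R * Rmax L a + R * R) ≤ R := by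
    refine le_trans ?_ hs1
    have : 0 ≤ R * Rmax L a + R * R := by positivity
    gcongr
    nlinarith
  have h1 := step_bds hL ha hD hη (hR.trans h16) hs hS
  have h2 : ∀ h, Bds L a (R * |h|) fun i x y => S i (x + h) y - S i x y := fun h =>
    (step_lh hL ha hD hη (hR.trans h16) hRC hs hS h).mono
      (mul_le_mul_of_nonneg_right hs1 (abs_nonneg h))
  exact ⟨⟨hS.sol.per, hS.sol.cont, fun i y hy => (h1.hb i y hy).mono hRC,
    fun i y hy h => (h2 h).hb i y hy⟩, h2⟩

theorem DD.refl (D : Dat) : DD a 0 D D :=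
  ⟨fun _ => (HB.zero le_rfl).congr (by simp), (HB.zero le_rfl).congr (by simp),
    (HB.zero le_rfl).congr (by simp), (HB.zero le_rfl).congr (by simp), by simp⟩

theorem step_contr (hL : 0 < L) (ha : a ∈ Ioo (0:ℝ) 1) (hD : DV a R D) (hR : R ≤ Rmax L a)
    (h1 : St L a R s1) (h2 : St L a R s2) (hN : SD L a N s1 s2) (hS1 : Step L D s1 S1)
    (hS2 : Step L D s2 S2) : SD L a (N / 2) S1 S2 := fun i y hy => by
  have h16 := Rmax_le hL ha
  have hC := one_le_CB hL ha
  refine ((step_diff hL ha hD hD (hR.trans h16) h1 h2 (DD.refl D) hN hS1 hS2).hb i y hy).mono ?_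
  have hN0 := (hN i y hy).nonneg
  calc CB L a * (0 + R * N) ≤ CB L a * (0 + Rmax L a * N) := by gcongr
    _ = CB L a * Rmax L a * N := by ring
    _ ≤ 1 / 2 * N := by gcongr; exact CB_mul_Rmax hL ha
    _ = _ := by ring

/-- Uniqueness of fixed points. -/
theorem step_unique (hL : 0 < L) (ha : a ∈ Ioo (0:ℝ) 1) (hD : DV a R D) (hR : R ≤ Rmax L a)
    (h1 : St L a R S1) (h2 : St L a R S2) (hS1 : Step L D S1 S1) (hS2 : Step L D S2 S2)
    (i : Fin 5) (x : ℝ) {y : ℝ} (hy : y ∈ Icc 0 L) : S1 i x y = S2 i x y := by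
  have h : ∀ n : ℕ, SD L a (2 * R * (1 / 2 : ℝ) ^ n) S1 S2 := fun n => by
    induction n with
    | zero => exact fun i y hy => ((h1.hb i y hy).sub (h2.hb i y hy)).mono (by simp; linarith)
    | succ n ih =>
      have := step_contr hL ha hD hR h1 h2 ih hS1 hS2
      rw [pow_succ, ← mul_assoc]
      simpa [div_eq_mul_inv] using this
  have ht : Filter.Tendsto (fun n : ℕ => 2 * R * (1 / 2 : ℝ) ^ n) Filter.atTop (nhds (2 * R * 0)) :=
    (tendsto_pow_atTop_nhds_zero_of_lt_one (by norm_num) (by norm_num)).const_mul _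
  rw [mul_zero] at ht
  have := ge_of_tendsto' ht fun n => (h n i y hy).1 x
  have := abs_nonpos_iff.1 this
  linarith

end

section
open MeasureTheory

variable {L a R N δ η : ℝ} {D D1 D2 : Dat} {s s1 s2 S S1 S2 : Fin 5 → ℝ → ℝ → ℝ}

theorem SD.trans {N' : ℝ} (h1 : SD L a N s1 s) (h2 : SD L a N' s s2) : SD L a (N + N') s1 s2 :=
  fun i y hy => ((h1 i y hy).add (h2 i y hy)).congr fun x => by ring

theorem ff_congr (hL : 0 < L) (h : ∀ i x, ∀ y ∈ Icc 0 L, s1 i x y = s2 i x y) {x y : ℝ}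
    (hy : y ∈ Icc 0 L) : ff D s1 x y = ff D s2 x y := by
  have m0 : (0:ℝ) ∈ Icc 0 L := ⟨le_rfl, hL.le⟩
  simp only [ff, sig, kf, h _ _ y hy, h _ _ 0 m0]

theorem rho_congr (hL : 0 < L) (h : ∀ i x, ∀ y ∈ Icc 0 L, s1 i x y = s2 i x y) (x : ℝ) :
    rho L D s1 x = rho L D s2 x := by
  have mL : L ∈ Icc 0 L := ⟨hL.le, le_rfl⟩
  simp only [rho, h _ _ L mL, ff_congr hL h mL]

theorem Step.congr (hL : 0 < L) (hS : Step L D s1 S)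
    (h : ∀ i x, ∀ y ∈ Icc 0 L, s1 i x y = s2 i x y) : Step L D s2 S :=
  ⟨hS.sol.congr_rhs fun _ _ hy => ff_congr hL h hy, hS.bot, hS.J, fun x => by
    rw [hS.top, rho_congr hL h, funext (rho_congr hL h)]⟩

theorem fixed_point_exists (hL : 0 < L) (ha : a ∈ Ioo (0:ℝ) 1) (hD : DV a (R * Rmax L a) D)
    (hR0 : 0 ≤ R) (hR : R ≤ Rmax L a) : ∃ S, Step L D S S ∧ St L a R S ∧
      ∀ h, Bds L a (R * |h|) fun i x y => S i (x + h) y - S i x y := by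
  have h16 := Rmax_le hL ha
  have hp := Rmax_pos hL ha
  have hη : R * Rmax L a ≤ R := by nlinarith
  have hDR := hD.mono hη
  have hex : ∀ s : {s // St L a R s}, ∃ S : {s // St L a R s}, Step L D s.1 S.1 := fun s => by
    obtain ⟨S, hS⟩ := step_exists hL ha hDR (hR.trans h16) s.2
    exact ⟨⟨S, (step_st hL ha hD hR0 hR s.2 hS).1⟩, hS⟩
  choose T hT using hex
  have hz : St L a R fun _ _ _ => 0 :=
    ⟨fun _ _ _ _ => rfl, fun _ => continuousOn_const, fun _ _ _ => HB.zero hR0,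
      fun _ _ _ => LH.const hR0 0⟩
  let u : ℕ → {s // St L a R s} := fun n => T^[n] ⟨_, hz⟩
  have hu : ∀ n, Step L D (u n).1 (u (n + 1)).1 := fun n => by
    simp only [u, Function.iterate_succ_apply']; exact hT _
  have h1 : ∀ n : ℕ, SD L a (2 * R * (1 / 2 : ℝ) ^ n) (u (n + 1)).1 (u n).1 := fun n => by
    induction n with
    | zero =>
      exact fun i y hy => (((u 1).2.hb i y hy).sub ((u 0).2.hb i y hy)).mono (by simp; linarith)
    | succ n ih =>
      have := step_contr hL ha hDR hR (u (n + 1)).2 (u n).2 ih (hu (n + 1)) (hu n)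
      rw [pow_succ, ← mul_assoc]
      simpa [div_eq_mul_inv] using this
  have h2 : ∀ n k : ℕ, SD L a (2 * R * (1 / 2 : ℝ) ^ n * (2 - 2 * (1 / 2 : ℝ) ^ k))
      (u (n + k)).1 (u n).1 := fun n k => by
    induction k with
    | zero => exact fun i y hy => (HB.zero (by simp)).congr fun x => by simp
    | succ k ih =>
      have := (h1 (n + k)).trans ih
      exact fun i y hy => (this i y hy).mono (by rw [pow_add, pow_succ]; linarith)
  have h3 : ∀ n k : ℕ, SD L a (4 * R * (1 / 2 : ℝ) ^ n) (u (n + k)).1 (u n).1 := fun n k i y hy =>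
    (h2 n k i y hy).mono (by
      have : 0 ≤ 2 * R * (1 / 2 : ℝ) ^ n * (2 * (1 / 2 : ℝ) ^ k) := by positivity
      linarith)
  have ht : Filter.Tendsto (fun n : ℕ => 4 * R * (1 / 2 : ℝ) ^ n) Filter.atTop (nhds 0) := by
    have := (tendsto_pow_atTop_nhds_zero_of_lt_one (r := (1/2:ℝ)) (by norm_num)
      (by norm_num)).const_mul (4 * R)
    rwa [mul_zero] at this
  have hlim : ∀ i x y, ∃ l, y ∈ Icc 0 L →
      Filter.Tendsto (fun n => (u n).1 i x y) Filter.atTop (nhds l) := fun i x y => by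
    by_cases hy : y ∈ Icc 0 L
    · have : CauchySeq fun n => (u n).1 i x y := by
        refine cauchySeq_of_le_tendsto_0 (fun n => 2 * (4 * R * (1 / 2 : ℝ) ^ n))
          (fun n m k hn hm => ?_) (by simpa using ht.const_mul 2)
        obtain ⟨n', rfl⟩ := Nat.exists_eq_add_of_le hn
        obtain ⟨m', rfl⟩ := Nat.exists_eq_add_of_le hm
        have e1 := (h3 k n' i y hy).1 x
        have e2 := (h3 k m' i y hy).1 x
        rw [Real.dist_eq]
        rw [abs_sub_comm] at e2
        exact (abs_sub_le _ ((u k).1 i x y) _).trans (by linarith)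
      obtain ⟨l, hl⟩ := cauchySeq_tendsto_of_complete this
      exact ⟨l, fun _ => hl⟩
    · exact ⟨0, fun h => absurd h hy⟩
  choose φ hφ using hlim
  have h4 : ∀ n : ℕ, SD L a (4 * R * (1 / 2 : ℝ) ^ n) φ (u n).1 := fun n i y hy =>
    HB.of_tendsto (fun k => h3 n k i y hy) fun x => by
      have := (hφ i x y hy).comp (Filter.tendsto_add_atTop_nat n)
      refine (this.congr fun k => ?_).sub_const _
      simp [add_comm]
  have hst : St L a R φ := by
    refine ⟨fun i y hy x => tendsto_nhds_unique (hφ i (x + 1) y hy)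
      ((hφ i x y hy).congr fun n => ((u n).2.per i y hy x).symm), fun i => ?_,
      fun i y hy => HB.of_tendsto (fun n => (u n).2.hb i y hy) fun x => hφ i x y hy,
      fun i y hy h => HB.of_tendsto (fun n => (u n).2.lh i y hy h) fun x =>
        (hφ i (x + h) y hy).sub (hφ i x y hy)⟩
    have hU : TendstoUniformlyOn (fun n (z : ℝ × ℝ) => (u n).1 i z.1 z.2)
        (fun z => φ i z.1 z.2) Filter.atTop (strip L) := by
      rw [Metric.tendstoUniformlyOn_iff]
      intro ε hε
      filter_upwards [ht.eventually_lt_const hε] with n hn z hz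
      exact ((h4 n i z.2 hz.2).1 z.1).trans_lt hn
    exact hU.continuousOn (Filter.Eventually.of_forall fun n => (u n).2.cont i).frequently
  obtain ⟨S, hS⟩ := step_exists hL ha hDR (hR.trans h16) hst
  have hSt := step_st hL ha hD hR0 hR hst hS
  have e : ∀ i x, ∀ y ∈ Icc 0 L, φ i x y = S i x y := fun i x y hy => by
    have g1 : ∀ n, |S i x y - (u (n + 1)).1 i x y| ≤ 4 * R * (1 / 2 : ℝ) ^ n := fun n =>
      ((step_contr hL ha hDR hR hst (u n).2 (h4 n) hS (hu n)) i y hy).1 x |>.trans (by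
        have : 0 ≤ 4 * R * (1 / 2 : ℝ) ^ n := by positivity
        linarith)
    have g2 : Filter.Tendsto (fun n => S i x y - (u (n + 1)).1 i x y) Filter.atTop (nhds 0) :=
      squeeze_zero_norm g1 ht
    have g3 := g2.const_sub (S i x y)
    simp only [sub_sub_cancel, sub_zero] at g3
    exact tendsto_nhds_unique ((hφ i x y hy).comp (Filter.tendsto_add_atTop_nat 1)) g3
  exact ⟨S, hS.congr hL e, hSt⟩

end

section
open MeasureTheory

variable {L a C D K : ℝ}

/-- Bounded and jointly Hölder on the strip. -/
structure JB (L a C : ℝ) (v : ℝ → ℝ → ℝ) : Prop where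
  bd : ∀ y ∈ Icc 0 L, ∀ x, |v x y| ≤ C
  jh : JH L a C v

namespace JB
variable {v w : ℝ → ℝ → ℝ}

theorem mono (h : JB L a C v) (hCD : C ≤ D) : JB L a D v :=
  ⟨fun y hy x => (h.bd y hy x).trans hCD, h.jh.mono hCD⟩

theorem add (h : JB L a C v) (h' : JB L a D w) : JB L a (C + D) fun x y => v x y + w x y :=
  ⟨fun y hy x => (abs_add_le _ _).trans (add_le_add (h.bd y hy x) (h'.bd y hy x)), h.jh.add h'.jh⟩

theorem neg (h : JB L a C v) : JB L a C fun x y => -v x y :=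
  ⟨fun y hy x => by rw [abs_neg]; exact h.bd y hy x, fun y hy y' hy' x x' => by
    rw [← abs_neg, neg_sub, sub_neg_eq_add, add_comm, ← sub_eq_add_neg]
    exact h.jh y hy y' hy' x x'⟩

theorem sub (h : JB L a C v) (h' : JB L a D w) : JB L a (C + D) fun x y => v x y - w x y := by
  simpa only [sub_eq_add_neg] using h.add h'.neg

theorem mul (h : JB L a C v) (h' : JB L a D w) : JB L a (2 * C * D) fun x y => v x y * w x y := by
  refine ⟨fun y hy x => ?_, fun y hy y' hy' x x' => ?_⟩
  · have h1 := h.bd y hy x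
    have h2 := h'.bd y hy x
    have hC := (abs_nonneg _).trans h1
    have hD := (abs_nonneg _).trans h2
    rw [abs_mul]
    calc _ ≤ C * D := by gcongr
      _ ≤ _ := by nlinarith [mul_nonneg hC hD]
  · have h1 := h.bd y hy x
    have h2 := h'.bd y' hy' x'
    have hC := (abs_nonneg _).trans h1
    have hD := (abs_nonneg _).trans h2
    have h3 := h.jh y hy y' hy' x x'
    have h4 := h'.jh y hy y' hy' x x'
    rw [show v x y * w x y - v x' y' * w x' y'
      = v x y * (w x y - w x' y') + (v x y - v x' y') * w x' y' by ring]
    refine (abs_add_le _ _).trans ?_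
    rw [abs_mul, abs_mul]
    set m := (max |x - x'| |y - y'|) ^ a
    have hm : 0 ≤ m := Real.rpow_nonneg (le_max_of_le_left (abs_nonneg _)) _
    calc _ ≤ C * (D * m) + C * m * D := by gcongr
      _ = _ := by ring

/-- Lipschitz functions are Hölder. -/
theorem of_lip (ha : a ∈ Ioo (0:ℝ) 1) (h0 : ∀ y ∈ Icc 0 L, ∀ x, |v x y| ≤ C)
    (h1 : ∀ y ∈ Icc 0 L, ∀ y' ∈ Icc 0 L, ∀ x x', |v x y - v x' y'| ≤ C * (|x - x'| + |y - y'|)) :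
    JB L a (2 * C) v := by
  refine ⟨fun y hy x => (h0 y hy x).trans ?_, fun y hy y' hy' x x' => ?_⟩
  · linarith [(abs_nonneg _).trans (h0 y hy x)]
  have hC := (abs_nonneg _).trans (h0 y hy x)
  have hm0 : 0 ≤ max |x - x'| |y - y'| := le_max_of_le_left (abs_nonneg _)
  rcases le_total (max |x - x'| |y - y'|) 1 with h | h
  · have := le_rpow_of_le_one ha.2.le hm0 h ha.1
    calc _ ≤ C * (|x - x'| + |y - y'|) := h1 y hy y' hy' x x'
      _ ≤ C * (max |x - x'| |y - y'| + max |x - x'| |y - y'|) := by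
        gcongr
        · exact le_max_left _ _
        · exact le_max_right _ _
      _ = 2 * C * max |x - x'| |y - y'| := by ring
      _ ≤ _ := by gcongr
  · have : 1 ≤ (max |x - x'| |y - y'|) ^ a := Real.one_le_rpow h ha.1.le
    calc _ ≤ |v x y| + |v x' y'| := abs_sub _ _
      _ ≤ 2 * C * 1 := by linarith [h0 y hy x, h0 y' hy' x']
      _ ≤ _ := by gcongr

end JB

/-- `v` has continuous partial derivatives `v₁, v₂`. -/
structure C1F (L : ℝ) (v v1 v2 : ℝ → ℝ → ℝ) : Prop where
  dx : ∀ y ∈ Icc 0 L, ∀ x, HasDerivAt (fun t => v t y) (v1 x y) x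
  dy : ∀ y ∈ Icc 0 L, ∀ x, HasDerivWithinAt (fun t => v x t) (v2 x y) (Icc 0 L) y

theorem C1F.lip {v v1 v2 : ℝ → ℝ → ℝ} (h : C1F L v v1 v2)
    (h1 : ∀ y ∈ Icc 0 L, ∀ x, |v1 x y| ≤ C) (h2 : ∀ y ∈ Icc 0 L, ∀ x, |v2 x y| ≤ C) :
    ∀ y ∈ Icc 0 L, ∀ y' ∈ Icc 0 L, ∀ x x', |v x y - v x' y'| ≤ C * (|x - x'| + |y - y'|) := by
  intro y hy y' hy' x x'
  have e1 := (convex_univ (𝕜 := ℝ) (E := ℝ)).norm_image_sub_le_of_norm_hasDerivWithin_le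
      (f := fun t => v t y) (C := C) (fun x _ => (h.dx y hy x).hasDerivWithinAt)
      (fun x _ => h1 y hy x) (mem_univ x') (mem_univ x)
  have e2 := (convex_Icc (0:ℝ) L).norm_image_sub_le_of_norm_hasDerivWithin_le
      (f := fun t => v x' t) (C := C) (fun y hy => h.dy y hy x') (fun y hy => h2 y hy x') hy' hy
  simp only [Real.norm_eq_abs] at e1 e2
  exact (abs_sub_le _ (v x' y) _).trans (by linarith)

theorem C1F.jb (ha : a ∈ Ioo (0:ℝ) 1) {v v1 v2 : ℝ → ℝ → ℝ} (h : C1F L v v1 v2)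
    (h0 : ∀ y ∈ Icc 0 L, ∀ x, |v x y| ≤ C)
    (h1 : ∀ y ∈ Icc 0 L, ∀ x, |v1 x y| ≤ C) (h2 : ∀ y ∈ Icc 0 L, ∀ x, |v2 x y| ≤ C) :
    JB L a (2 * C) v := JB.of_lip ha h0 (h.lip h1 h2)

/-- `v` together with its derivatives of order at most two, of size `C` in `C^{2,a}`. -/
structure C2F (L a C : ℝ) (v v1 v2 v11 v12 v22 : ℝ → ℝ → ℝ) : Prop where
  f0 : C1F L v v1 v2
  f1 : C1F L v1 v11 v12
  f2 : C1F L v2 v12 v22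
  b0 : ∀ y ∈ Icc 0 L, ∀ x, |v x y| ≤ C
  b1 : ∀ y ∈ Icc 0 L, ∀ x, |v1 x y| ≤ C
  b2 : ∀ y ∈ Icc 0 L, ∀ x, |v2 x y| ≤ C
  b11 : JB L a C v11
  b12 : JB L a C v12
  b22 : JB L a C v22

/-- Existence of the derivative in the second variable of a derivative in the first one. -/
theorem dy_of_mixed (ha : 0 < a) {g g1 g2 g12 : ℝ → ℝ → ℝ}
    (hx : ∀ y ∈ Icc 0 L, ∀ x, HasDerivAt (fun t => g t y) (g1 x y) x)
    (hy : ∀ y ∈ Icc 0 L, ∀ x, HasDerivWithinAt (fun t => g x t) (g2 x y) (Icc 0 L) y)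
    (hxy : ∀ y ∈ Icc 0 L, ∀ x, HasDerivAt (fun t => g2 t y) (g12 x y) x)
    (hH : JH L a K g12) : ∀ y ∈ Icc 0 L, ∀ x,
      HasDerivWithinAt (fun t => g1 x t) (g12 x y) (Icc 0 L) y := by
  intro y my x
  have key : ∀ y' ∈ Icc 0 L, |g1 x y' - g1 x y - (y' - y) * g12 x y| ≤ K * |y' - y| ^ a * |y' - y| := by
    intro y' my'
    have hK : 0 ≤ K * |y' - y| ^ a :=
      (abs_nonneg _).trans (by simpa using hH y' my' y my x x)
    have hseg : ∀ t ∈ uIcc y y', t ∈ Icc 0 L := fun t ht => uIcc_subset_Icc my my' ht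
    have h1 : HasDerivAt (fun s => g s y' - g s y - (y' - y) * g2 s y)
        (g1 x y' - g1 x y - (y' - y) * g12 x y) x :=
      ((hx y' my' x).sub (hx y my x)).sub ((hxy y my x).const_mul _)
    have h2 := deriv_sub_le_of_diff h1 (hasDerivAt_const x (0:ℝ))
      (B := K * |y' - y| ^ a * |y' - y|) fun h => ?_
    · simpa using h2
    have e2 : ∀ t ∈ uIcc y y', |g2 (x + h) t - g2 x t - (g2 (x + h) y - g2 x y)|
        ≤ K * |y' - y| ^ a * |h| := fun t ht => by
      have := (convex_univ (𝕜 := ℝ) (E := ℝ)).norm_image_sub_le_of_norm_hasDerivWithin_le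
        (f := fun s => g2 s t - g2 s y) (f' := fun s => g12 s t - g12 s y) (C := K * |y' - y| ^ a)
        (fun s _ => ((hxy t (hseg t ht) s).sub (hxy y my s)).hasDerivWithinAt)
        (fun s _ => by
          refine (by simpa using hH t (hseg t ht) y my s s :
            |g12 s t - g12 s y| ≤ K * |t - y| ^ a).trans ?_
          have hK' : 0 ≤ K ∨ |t - y| ^ a = 0 := by
            by_contra! hc
            have : 0 < |y' - y| ^ a := by
              have h3 : t ≠ y := fun h => hc.2 (by rw [h, sub_self, abs_zero, Real.zero_rpow ha.ne'])
              have h4 : y' ≠ y := fun h => by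
                rw [h, uIcc_self] at ht; exact h3 ht
              exact Real.rpow_pos_of_pos (abs_pos.2 (sub_ne_zero.2 h4)) _
            nlinarith [hc.1]
          rcases hK' with hK' | hK'
          · have : |t - y| ≤ |y' - y| := abs_sub_left_of_mem_uIcc ht
            gcongr
          · rw [hK', mul_zero]; exact hK) (mem_univ x) (mem_univ (x + h))
      simp only [Real.norm_eq_abs, add_sub_cancel_left] at this
      rw [show g2 (x + h) t - g2 x t - (g2 (x + h) y - g2 x y)
        = g2 (x + h) t - g2 (x + h) y - (g2 x t - g2 x y) by ring]
      exact this
    have e3 := (convex_uIcc y y').norm_image_sub_le_of_norm_hasDerivWithin_le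
        (f := fun t => g (x + h) t - g x t - t * (g2 (x + h) y - g2 x y))
        (f' := fun t => g2 (x + h) t - g2 x t - (g2 (x + h) y - g2 x y))
        (C := K * |y' - y| ^ a * |h|)
        (fun t ht => ((((hy t (hseg t ht) (x + h)).sub (hy t (hseg t ht) x)).sub
          ((hasDerivAt_id t).hasDerivWithinAt.mul_const _)).congr_deriv
            (by rw [one_mul])).mono hseg) e2 left_mem_uIcc right_mem_uIcc
    simp only [Real.norm_eq_abs] at e3
    rw [show g (x + h) y' - g (x + h) y - (y' - y) * g2 (x + h) y
      - (g x y' - g x y - (y' - y) * g2 x y) - (0 - 0)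
      = g (x + h) y' - g x y' - y' * (g2 (x + h) y - g2 x y)
        - (g (x + h) y - g x y - y * (g2 (x + h) y - g2 x y)) by ring]
    exact e3.trans (le_of_eq (by ring))
  rw [hasDerivWithinAt_iff_isLittleO, Asymptotics.isLittleO_iff]
  intro c hc
  have ht : Filter.Tendsto (fun y' => K * |y' - y| ^ a) (nhdsWithin y (Icc 0 L)) (nhds 0) := by
    have : Continuous fun y' => K * |y' - y| ^ a :=
      continuous_const.mul ((continuous_abs.comp (continuous_id.sub continuous_const)).rpow_const
        (fun _ => Or.inr ha.le))
    have h3 := this.tendsto y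
    rw [sub_self, abs_zero, Real.zero_rpow ha.ne', mul_zero] at h3
    exact h3.mono_left nhdsWithin_le_nhds
  filter_upwards [ht.eventually_le_const hc, self_mem_nhdsWithin] with y' h1 h2
  rw [smul_eq_mul, Real.norm_eq_abs, Real.norm_eq_abs]
  exact (key y' h2).trans (mul_le_mul_of_nonneg_right h1 (abs_nonneg _))

end

section
open MeasureTheory

variable {L a R : ℝ} {D : Dat} {S : Fin 5 → ℝ → ℝ → ℝ}

theorem DV.A_deriv (hD : DV a R D) (hR : R ≤ 1 / 16) (hw : ∀ x, D.w x * (1 + D.b 1 x) = 1)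
    (t : ℝ) : HasDerivAt D.A (D.w (D.A t)) t := by
  have hA : Continuous D.A := (LipschitzWith.of_dist_le_mul (K := 2) fun t t' => by
      simpa [Real.dist_eq] using hD.sub_le hR t t').continuous
  have h0 : 1 + D.b 1 (D.A t) ≠ 0 := fun h => by
    have := hw (D.A t); rw [h, mul_zero] at this; exact zero_ne_one this
  have := HasDerivAt.of_local_left_inverse (f := fun x => x + D.b 0 x) (g := D.A)
    hA.continuousAt ((hasDerivAt_id _).add (hD.d0 (D.A t))) h0
    (Filter.Eventually.of_forall fun t => hD.inv t)
  rwa [← eq_inv_of_mul_eq_one_left (hw (D.A t))] at this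

theorem exists_third (ha : a ∈ Ioo (0:ℝ) 1) {v : ℝ → ℝ → ℝ} (hl : ∀ y ∈ Icc 0 L, LH a R fun x => v x y)
    (hj : ∀ h, JH L a (R * |h|) fun x y => v (x + h) y - v x y) :
    ∃ T : ℝ → ℝ → ℝ, (∀ y ∈ Icc 0 L, ∀ x, HasDerivAt (fun t => v t y) (T x y) x) ∧ JB L a R T := by
  have : ∀ y, ∃ T : ℝ → ℝ, y ∈ Icc 0 L → ∀ x, HasDerivAt (fun t => v t y) (T x) x := fun y => by
    by_cases hy : y ∈ Icc 0 L
    · obtain ⟨T, hT⟩ := (hl y hy).exists_deriv ha.1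
      exact ⟨T, fun _ => hT⟩
    · exact ⟨0, fun h => absurd h hy⟩
  choose T hT using this
  refine ⟨fun x y => T y x, fun y hy x => hT y hy x, fun y hy x =>
    ((hl y hy).deriv_HB (hT y hy)).1 x, fun y hy y' hy' x x' =>
      deriv_sub_le_of_diff (hT y hy x) (hT y' hy' x') fun h => ?_⟩
  exact (hj h y hy y' hy' x x').trans (le_of_eq (by ring))

theorem reconstruct (hL : 0 < L) (ha : a ∈ Ioo (0:ℝ) 1) (hD : DV a R D) (hR : R ≤ 1 / 16)
    (hs : St L a R S) (hS : Step L D S S)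
    (hT : ∀ h, Bds L a (R * |h|) fun i x y => S i (x + h) y - S i x y)
    (hw : ∀ x, D.w x * (1 + D.b 1 x) = 1) {qb qm qt : ℝ → ℝ} {Cq : ℝ}
    (hk : ∀ x, D.k0 x = qm x * D.w x - D.b 2 x) (hqm : ∀ x, HasDerivAt qb (qm x) x)
    (hqp : ∀ x, qb (x + 1) = qb x) (hqB : ∀ x, |qb x| ≤ Cq)
    (hqt : ∀ x, HasDerivAt qt (D.q x) x) (hqtp : ∀ x, qt (x + 1) = qt x) :
    ∃ (T3 T4 fx fy P : ℝ → ℝ → ℝ) (C : ℝ),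
      C2F L a (2000 * R) (S 1) (S 3) (S 4) T3 T4 (fun x y => fx x y - T3 x y) ∧
      C2F L a (2000 * R) (S 2) (S 4) (fun x y => ff D S x y - S 3 x y) T4
        (fun x y => fx x y - T3 x y) (fun x y => fy x y - T4 x y) ∧
      C2F L a C P (fun x y => ff D S x y * (1 + S 1 x y)) (fun x y => ff D S x y * S 2 x y)
        (fun x y => fx x y * (1 + S 1 x y) + ff D S x y * S 3 x y)
        (fun x y => fx x y * S 2 x y + ff D S x y * S 4 x y)
        (fun x y => fy x y * S 2 x y + ff D S x y * (ff D S x y - S 3 x y)) ∧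
      (∀ y ∈ Icc 0 L, ∀ x, P (x + 1) y = P x y) ∧
      (∀ x, P x 0 + (S 2 x 0 ^ 2 + (1 + S 1 x 0) ^ 2) / 2 = qb x) ∧
      (∀ x, ff D S x L * (1 + S 1 x L) + S 2 x L * S 4 x L + (1 + S 1 x L) * S 3 x L = D.q x) := by
  have hR0 := hD.R_nonneg
  have m0 : (0:ℝ) ∈ Icc 0 L := ⟨le_rfl, hL.le⟩
  have mL : L ∈ Icc 0 L := ⟨hL.le, le_rfl⟩
  have hSol := hS.sol
  obtain ⟨T3, hT3, jT3⟩ := exists_third ha (hs.lh 3) fun h => (hT h).j3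
  obtain ⟨T4, hT4, jT4⟩ := exists_third ha (hs.lh 4) fun h => (hT h).j4
  have hkl := kf_lh hL hD hR hs
  obtain ⟨k', hk'⟩ := hkl.exists_deriv ha.1
  have hk'B := hkl.deriv_HB hk'
  let Fd : ℝ → ℝ := fun t => k' (D.A t) * D.w (D.A t)
  have hFd : ∀ t, HasDerivAt (fun t => kf D S (D.A t)) (Fd t) t := fun t =>
    (hk' (D.A t)).comp t (hD.A_deriv hR hw t)
  have hFdB : HB a (48 * R) Fd :=
    ((hk'B.mul hD.hw).comp ha.1 ha.2.le (by norm_num : (1:ℝ) ≤ 2) (hD.sub_le hR)).mono (by linarith)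
  have hψx : ∀ y ∈ Icc 0 L, ∀ x, HasDerivAt (fun t => t + S 0 t y) (1 + S 1 x y) x := fun y hy x =>
    (hasDerivAt_id x).add (hSol.dx0 y hy x)
  have hψy : ∀ y ∈ Icc 0 L, ∀ x,
      HasDerivWithinAt (fun t => x + S 0 x t) (S 2 x y) (Icc 0 L) y := fun y hy x =>
    (hSol.dy0 y hy x).const_add _
  let G : ℝ → ℝ → ℝ := fun x y => Fd (x + S 0 x y)
  have hfx : ∀ y ∈ Icc 0 L, ∀ x, HasDerivAt (fun t => ff D S t y) (G x y * (1 + S 1 x y)) x :=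
    fun y hy x => HasDerivAt.comp (h₂ := fun t => kf D S (D.A t)) (h := fun t => t + S 0 t y) x
      (hFd (x + S 0 x y)) (hψx y hy x)
  have hfy : ∀ y ∈ Icc 0 L, ∀ x,
      HasDerivWithinAt (fun t => ff D S x t) (G x y * S 2 x y) (Icc 0 L) y := fun y hy x =>
    HasDerivAt.comp_hasDerivWithinAt (h₂ := fun t => kf D S (D.A t)) (h := fun t => x + S 0 x t) y
      (hFd (x + S 0 x y)) (hψy y hy x)
  have bS : ∀ i, ∀ y ∈ Icc 0 L, ∀ x, |S i x y| ≤ R := fun i y hy => (hs.hb i y hy).1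
  have bf : ∀ y ∈ Icc 0 L, ∀ x, |ff D S x y| ≤ 12 * R := fun y hy => (ff_hb hL ha hD hR hs hy).1
  have bfS : ∀ y ∈ Icc 0 L, ∀ x, |ff D S x y - S 3 x y| ≤ 14 * R := fun y hy x =>
    (abs_sub _ _).trans (by linarith [bf y hy x, bS 3 y hy x])
  have c0 : C1F L (S 0) (S 1) (S 2) := ⟨hSol.dx0, hSol.dy0⟩
  have c1 : C1F L (S 1) (S 3) (S 4) := ⟨hSol.dx1, hSol.dy1⟩
  have c2 : C1F L (S 2) (S 4) fun x y => ff D S x y - S 3 x y := ⟨hSol.dx2, hSol.dy2⟩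
  have c3 : C1F L (S 3) T3 T4 := ⟨hT3, dy_of_mixed ha.1 hSol.dx1 hSol.dy1 hT4 jT4.jh⟩
  have jG : JB L a (144 * R) G := by
    refine ⟨fun y hy x => (hFdB.1 _).trans (by linarith), fun y hy y' hy' x x' =>
      (hFdB.2 _ _).trans ?_⟩
    have h1 := c0.lip (bS 1) (bS 2) y hy y' hy' x x'
    have h2 : |x + S 0 x y - (x' + S 0 x' y')| ≤ 3 * max |x - x'| |y - y'| := by
      rw [show x + S 0 x y - (x' + S 0 x' y') = (x - x') + (S 0 x y - S 0 x' y') by ring]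
      refine (abs_add_le _ _).trans ?_
      have := le_max_left |x - x'| |y - y'|
      have := le_max_right |x - x'| |y - y'|
      nlinarith [abs_nonneg (x - x'), abs_nonneg (y - y')]
    have hm0 : 0 ≤ max |x - x'| |y - y'| := le_max_of_le_left (abs_nonneg _)
    have h3 : |x + S 0 x y - (x' + S 0 x' y')| ^ a ≤ 3 * max |x - x'| |y - y'| ^ a := by
      calc _ ≤ (3 * max |x - x'| |y - y'|) ^ a :=
            Real.rpow_le_rpow (abs_nonneg _) h2 ha.1.le
        _ = 3 ^ a * max |x - x'| |y - y'| ^ a := Real.mul_rpow (by norm_num) hm0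
        _ ≤ 3 ^ (1:ℝ) * max |x - x'| |y - y'| ^ a := by
            have := ha.2.le
            have : 0 ≤ max |x - x'| |y - y'| ^ a := Real.rpow_nonneg hm0 a
            gcongr
            norm_num
        _ = _ := by rw [Real.rpow_one]
    calc _ ≤ 48 * R * (3 * max |x - x'| |y - y'| ^ a) := by gcongr
      _ = _ := by ring
  have j1 : JB L a (2 * R) (S 1) := c1.jb ha (bS 1) (bS 3) (bS 4)
  have j2 : JB L a (28 * R) (S 2) := (c2.jb (C := 14 * R) ha
    (fun y hy x => (bS 2 y hy x).trans (by linarith))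
    (fun y hy x => (bS 4 y hy x).trans (by linarith)) bfS).mono (by linarith)
  have jc : JB L a (1:ℝ) fun _ _ => 1 := ⟨fun _ _ _ => by simp, fun _ _ _ _ x x' => by
    rw [sub_self, abs_zero, one_mul]
    exact Real.rpow_nonneg (le_max_of_le_left (abs_nonneg _)) _⟩
  have jfx : JB L a (600 * R) fun x y => G x y * (1 + S 1 x y) :=
    (jG.mul (jc.add j1)).mono (by nlinarith)
  have jfy : JB L a (600 * R) fun x y => G x y * S 2 x y := (jG.mul j2).mono (by nlinarith)
  have cf : C1F L (ff D S) (fun x y => G x y * (1 + S 1 x y)) fun x y => G x y * S 2 x y :=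
    ⟨hfx, hfy⟩
  have jf : JB L a (1200 * R) (ff D S) :=
    (cf.jb (C := 600 * R) ha (fun y hy x => (bf y hy x).trans (by linarith)) jfx.bd jfy.bd).mono
      (by linarith)
  have cf3 : C1F L (fun x y => ff D S x y - S 3 x y) (fun x y => G x y * (1 + S 1 x y) - T3 x y)
      fun x y => G x y * S 2 x y - T4 x y :=
    ⟨fun y hy x => (hfx y hy x).sub (hT3 y hy x), fun y hy x => (hfy y hy x).sub (c3.dy y hy x)⟩
  have jfxT : JB L a (601 * R) fun x y => G x y * (1 + S 1 x y) - T3 x y :=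
    (jfx.sub jT3).mono (by linarith)
  have c4 : C1F L (S 4) T4 fun x y => G x y * (1 + S 1 x y) - T3 x y :=
    ⟨hT4, dy_of_mixed ha.1 hSol.dx2 hSol.dy2 cf3.dx jfxT.jh⟩
  have h1 : C2F L a (2000 * R) (S 1) (S 3) (S 4) T3 T4 fun x y => G x y * (1 + S 1 x y) - T3 x y :=
    ⟨c1, c3, c4, fun y hy x => (bS 1 y hy x).trans (by linarith),
      fun y hy x => (bS 3 y hy x).trans (by linarith),
      fun y hy x => (bS 4 y hy x).trans (by linarith), jT3.mono (by linarith),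
      jT4.mono (by linarith), jfxT.mono (by linarith)⟩
  have h2 : C2F L a (2000 * R) (S 2) (S 4) (fun x y => ff D S x y - S 3 x y) T4
      (fun x y => G x y * (1 + S 1 x y) - T3 x y) fun x y => G x y * S 2 x y - T4 x y :=
    ⟨c2, c4, cf3, fun y hy x => (bS 2 y hy x).trans (by linarith),
      fun y hy x => (bS 4 y hy x).trans (by linarith),
      fun y hy x => (bfS y hy x).trans (by linarith), jT4.mono (by linarith),
      jfxT.mono (by linarith), (jfy.sub jT4).mono (by linarith)⟩
  have hb1 : ∀ x, S 1 x 0 = D.b 1 x := fun x => by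
    have h := hSol.dx0 0 m0 x
    simp only [hS.bot] at h
    exact h.unique (hD.d0 x)
  let Q : ℝ → ℝ := fun x => qb x - S 2 x 0 ^ 2 / 2 - (1 + D.b 1 x) ^ 2 / 2
  have hQ : ∀ x, HasDerivAt Q (kf D S x * (1 + D.b 1 x)) x := fun x => by
    have h := ((hqm x).sub (((hSol.dx2 0 m0 x).pow 2).div_const 2)).sub
      ((((hD.d1 x).const_add 1).pow 2).div_const 2)
    refine h.congr_deriv ?_
    simp only [kf, hk, Nat.cast_ofNat, Nat.add_one_sub_one, pow_one]
    linear_combination (S 2 x 0 * S 4 x 0 - qm x) * hw x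
  have hQA : ∀ t, HasDerivAt (fun t => Q (D.A t)) (kf D S (D.A t)) t := fun t =>
    ((hQ (D.A t)).comp t (hD.A_deriv hR hw t)).congr_deriv (by
      linear_combination kf D S (D.A t) * hw (D.A t))
  let P : ℝ → ℝ → ℝ := fun x y => Q (D.A (x + S 0 x y))
  have cP : C1F L P (fun x y => ff D S x y * (1 + S 1 x y)) fun x y => ff D S x y * S 2 x y :=
    ⟨fun y hy x => HasDerivAt.comp (h₂ := fun t => Q (D.A t)) (h := fun t => t + S 0 t y) x
      (hQA (x + S 0 x y)) (hψx y hy x),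
      fun y hy x => HasDerivAt.comp_hasDerivWithinAt (h₂ := fun t => Q (D.A t))
        (h := fun t => x + S 0 x t) y (hQA (x + S 0 x y)) (hψy y hy x)⟩
  have bP : ∀ y ∈ Icc 0 L, ∀ x, |P x y| ≤ Cq + 3 := fun y hy x => by
    have e1 := hqB (D.A (x + S 0 x y))
    have e2 : S 2 (D.A (x + S 0 x y)) 0 ^ 2 ≤ 1 := by
      rw [sq_le_one_iff_abs_le_one]; linarith [bS 2 0 m0 (D.A (x + S 0 x y))]
    have e3 : (1 + D.b 1 (D.A (x + S 0 x y))) ^ 2 ≤ 4 := by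
      have := abs_le.1 ((hD.hb 1).1 (D.A (x + S 0 x y)))
      nlinarith
    have e1' := abs_le.1 e1
    have e4 := sq_nonneg (S 2 (D.A (x + S 0 x y)) 0)
    have e5 := sq_nonneg (1 + D.b 1 (D.A (x + S 0 x y)))
    exact abs_le.2 ⟨by simp only [P, Q]; linarith, by simp only [P, Q]; linarith⟩
  have j3 : JB L a (2 * R) (S 3) := c3.jb ha (bS 3) jT3.bd jT4.bd
  have j4 : JB L a (2 * (601 * R)) (S 4) := c4.jb ha (fun y hy x => (bS 4 y hy x).trans (by linarith))
    (fun y hy x => (jT4.bd y hy x).trans (by linarith)) jfxT.bd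
  have j1' := jc.add j1
  have q1 := jf.mul j1'
  have q2 := jf.mul j2
  have q11 := (jfx.mul j1').add (jf.mul j3)
  have q12 := (jfx.mul j2).add (jf.mul j4)
  have q22 := (jfy.mul j2).add (jf.mul (jf.sub j3))
  obtain ⟨C, hC⟩ : ∃ C, ∀ t ∈ ({Cq + 3, 2 * (1200 * R) * (1 + 2 * R), 2 * (1200 * R) * (28 * R),
      2 * (600 * R) * (1 + 2 * R) + 2 * (1200 * R) * (2 * R),
      2 * (600 * R) * (28 * R) + 2 * (1200 * R) * (2 * (601 * R)),
      2 * (600 * R) * (28 * R) + 2 * (1200 * R) * (1200 * R + 2 * R)} : Set ℝ), t ≤ C := by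
    exact (Set.toFinite _).bddAbove
  simp only [mem_insert_iff, mem_singleton_iff, forall_eq_or_imp, forall_eq] at hC
  obtain ⟨g0, g1, g2, g11, g12, g22⟩ := hC
  refine ⟨T3, T4, _, _, P, C, h1, h2, ⟨cP, ?_, ?_, fun y hy x => (bP y hy x).trans g0,
    (q1.mono g1).bd, (q2.mono g2).bd, q11.mono g11, q12.mono g12, q22.mono g22⟩, ?_, ?_, ?_⟩
  · refine ⟨fun y hy x => ((hfx y hy x).mul ((hSol.dx1 y hy x).const_add 1)), fun y hy x =>
      ((hfy y hy x).mul ((hSol.dy1 y hy x).const_add 1)).congr_deriv (by ring)⟩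
  · refine ⟨fun y hy x => (hfx y hy x).mul (hSol.dx2 y hy x), fun y hy x =>
      (hfy y hy x).mul (hSol.dy2 y hy x)⟩
  · intro y hy x
    have e1 : D.A (x + 1 + S 0 (x + 1) y) = D.A (x + S 0 x y) + 1 := by
      rw [hSol.per 0 y hy, ← hD.A_per hR]; ring_nf
    have e2 := deriv_per hD.d0 hD.per
    simp only [P, Q, e1, hqp, hSol.per 2 0 m0, e2]
  · intro x
    have e1 : D.A (x + S 0 x 0) = x := by
      have h3 := hD.inv (x + S 0 x 0)
      rw [hS.bot] at h3 ⊢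
      have h4 := (hD.lb 0).lip (D.A (x + D.b 0 x)) x
      rw [show D.b 0 (D.A (x + D.b 0 x)) - D.b 0 x = -(D.A (x + D.b 0 x) - x) by linarith,
        abs_neg] at h4
      have : |D.A (x + D.b 0 x) - x| = 0 := by nlinarith [abs_nonneg (D.A (x + D.b 0 x) - x)]
      linarith [abs_eq_zero.1 this]
    simp only [P, Q, e1, hb1]; ring
  · have et : ∀ x, ff D S x L * (1 + S 1 x L) + S 2 x L * S 4 x L + (1 + S 1 x L) * S 3 x L
        = D.q x - ∫ t in (0:ℝ)..1, rho L D S t := fun x => by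
      have := hS.top x
      simp only [rho] at this ⊢
      linarith
    have hd : ∀ x, HasDerivAt (fun x => P x L + S 2 x L ^ 2 / 2 + (1 + S 1 x L) ^ 2 / 2 - qt x)
        (-∫ t in (0:ℝ)..1, rho L D S t) x := fun x => by
      refine ((((cP.dx L mL x).add (((hSol.dx2 L mL x).pow 2).div_const 2)).add
        ((((hSol.dx1 L mL x).const_add 1).pow 2).div_const 2)).sub (hqt x)).congr_deriv ?_
      have := et x
      simp only [Nat.cast_ofNat, Nat.add_one_sub_one, pow_one]
      linarith
    have hmean : ∫ t in (0:ℝ)..1, rho L D S t = 0 := by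
      have h := intervalIntegral.integral_eq_sub_of_hasDerivAt (a := 0) (b := 1)
        (fun x _ => hd x) (by simp)
      have e1 : D.A (1 + S 0 1 L) = D.A (S 0 0 L) + 1 := by
        have := hSol.per 0 L mL 0
        rw [zero_add] at this
        rw [this, ← hD.A_per hR]; ring_nf
      have e2 := deriv_per hD.d0 hD.per
      have p2 := hSol.per 2 L mL 0
      have p1 := hSol.per 1 L mL 0
      have pq := hqtp 0
      rw [zero_add] at p1 p2 pq
      simp only [P, Q, e1, hqp, hSol.per 2 0 m0, e2, p1, p2, pq, zero_add] at h
      simp at h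
      exact h
    intro x
    rw [et, hmean, sub_zero]

end

section
open MeasureTheory
variable {L a r C : ℝ}

theorem JB.continuousOn (ha : 0 < a) {v : ℝ → ℝ → ℝ} (h : JB L a C v) :
    ContinuousOn (fun z : ℝ × ℝ => v z.1 z.2) (strip L) := by
  intro z hz
  have hc : Continuous fun z' : ℝ × ℝ => C * max |z'.1 - z.1| |z'.2 - z.2| ^ a :=
    continuous_const.mul (Continuous.rpow_const (by fun_prop) fun _ => Or.inr ha.le)
  have h0 := hc.tendsto z
  simp only [sub_self, abs_zero, max_self, Real.zero_rpow ha.ne', mul_zero] at h0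
  refine tendsto_iff_dist_tendsto_zero.2 (squeeze_zero' (Filter.Eventually.of_forall fun _ =>
    dist_nonneg) ?_ (h0.mono_left nhdsWithin_le_nhds))
  filter_upwards [self_mem_nhdsWithin] with z' hz'
  rw [Real.dist_eq]
  exact h.jh _ hz'.2 _ hz.2 _ _

theorem C1F.add {v v1 v2 w w1 w2 : ℝ → ℝ → ℝ} (h : C1F L v v1 v2) (h' : C1F L w w1 w2) :
    C1F L (fun x y => v x y + w x y) (fun x y => v1 x y + w1 x y) fun x y => v2 x y + w2 x y :=
  ⟨fun y hy x => (h.dx y hy x).add (h'.dx y hy x), fun y hy x => (h.dy y hy x).add (h'.dy y hy x)⟩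

theorem C1F.neg {v v1 v2 : ℝ → ℝ → ℝ} (h : C1F L v v1 v2) :
    C1F L (fun x y => -v x y) (fun x y => -v1 x y) fun x y => -v2 x y :=
  ⟨fun y hy x => (h.dx y hy x).neg, fun y hy x => (h.dy y hy x).neg⟩

theorem C1F.sub {v v1 v2 w w1 w2 : ℝ → ℝ → ℝ} (h : C1F L v v1 v2) (hw : C1F L w w1 w2) :
    C1F L (fun x y => v x y - w x y) (fun x y => v1 x y - w1 x y) fun x y => v2 x y - w2 x y := by
  simpa only [sub_eq_add_neg] using h.add hw.neg

/-- A solution of a transport equation which vanishes at the bottom is nonpositive. -/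
theorem transport_nonpos (hL : 0 < L) {g g1 g2 u v : ℝ → ℝ → ℝ} (hg : C1F L g g1 g2)
    (hc : ContinuousOn (fun z : ℝ × ℝ => g z.1 z.2) (strip L))
    (hp : ∀ y ∈ Icc 0 L, ∀ x, g (x + 1) y = g x y) (hv : ∀ y ∈ Icc 0 L, ∀ x, v x y ≠ 0)
    (ht : ∀ y ∈ Icc 0 L, ∀ x, v x y * g2 x y + u x y * g1 x y = 0) (h0 : ∀ x, g x 0 = 0)
    {y : ℝ} (hy : y ∈ Icc 0 L) (x : ℝ) : g x y ≤ 0 := by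
  have key : ∀ ε > 0, g x y ≤ ε * y := by
    intro ε hε
    by_contra! hlt
    let G : ℝ × ℝ → ℝ := fun z => g z.1 z.2 - ε * z.2
    have hGc : ContinuousOn G (strip L) := hc.sub (by fun_prop)
    have hcomp : IsCompact (Icc (0:ℝ) 1 ×ˢ Icc (0:ℝ) L) := isCompact_Icc.prod isCompact_Icc
    have hsub : Icc (0:ℝ) 1 ×ˢ Icc (0:ℝ) L ⊆ strip L := fun z hz => ⟨mem_univ _, hz.2⟩
    obtain ⟨⟨xs, ys⟩, hz, hmax⟩ := hcomp.exists_isMaxOn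
      ⟨(0, 0), ⟨⟨le_rfl, zero_le_one⟩, ⟨le_rfl, hL.le⟩⟩⟩ (hGc.mono hsub)
    have hmax' : ∀ x', ∀ y' ∈ Icc 0 L, G (x', y') ≤ G (xs, ys) := by
      intro x' y' hy'
      have h2 := hmax (show (Int.fract x', y') ∈ Icc (0:ℝ) 1 ×ˢ Icc (0:ℝ) L from
        ⟨⟨Int.fract_nonneg _, (Int.fract_lt_one _).le⟩, hy'⟩)
      have h3 := fract_of_per (S := fun t => g t y') (fun t => hp y' hy' t) x'
      change g x' y' - ε * y' ≤ _
      rw [← h3]; exact h2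
    have hys : ys ∈ Icc 0 L := hz.2
    have hpos : 0 < G (xs, ys) := lt_of_lt_of_le (by simp only [G]; linarith) (hmax' x y hy)
    have hys0 : 0 < ys := by
      rcases hys.1.eq_or_lt with h | h
      · exfalso; simp [G, ← h, h0] at hpos
      · exact h
    have e1 : g1 xs ys = 0 := IsLocalMax.hasDerivAt_eq_zero
      (Filter.Eventually.of_forall fun s => by
        have := hmax' s ys hys
        simp only [G] at this
        linarith) (hg.dx ys hys xs)
    have e2 : g2 xs ys = 0 := by
      have := ht ys hys xs
      rw [e1, mul_zero, add_zero] at this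
      exact (mul_eq_zero.1 this).resolve_left (hv ys hys xs)
    have hd : HasDerivWithinAt (fun t => g xs t - ε * t) (0 - ε * 1) (Ioo 0 ys) ys :=
      ((e2 ▸ hg.dy ys hys xs).sub ((hasDerivAt_id ys).hasDerivWithinAt.const_mul ε)).mono
        fun t ht => ⟨ht.1.le, ht.2.le.trans hys.2⟩
    rw [hasDerivWithinAt_iff_tendsto_slope' (by simp)] at hd
    have hne : (nhdsWithin ys (Ioo 0 ys)).NeBot := right_nhdsWithin_Ioo_neBot hys0
    have := ge_of_tendsto hd (b := 0) (by
      filter_upwards [self_mem_nhdsWithin] with t ht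
      rw [slope_def_field]
      have := hmax' xs t ⟨ht.1.le, ht.2.le.trans hys.2⟩
      exact div_nonneg_of_nonpos (sub_nonpos.2 this) (sub_nonpos.2 ht.2.le))
    linarith
  refine le_of_forall_pos_le_add fun ε hε => ?_
  rcases hy.1.eq_or_lt with h | h
  · rw [← h, h0]; linarith
  · have := key (ε / y) (by positivity)
    rwa [div_mul_cancel₀ _ h.ne', ← zero_add ε] at this

theorem transport_zero (hL : 0 < L) {g g1 g2 u v : ℝ → ℝ → ℝ} (hg : C1F L g g1 g2)
    (hc : ContinuousOn (fun z : ℝ × ℝ => g z.1 z.2) (strip L))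
    (hp : ∀ y ∈ Icc 0 L, ∀ x, g (x + 1) y = g x y) (hv : ∀ y ∈ Icc 0 L, ∀ x, v x y ≠ 0)
    (ht : ∀ y ∈ Icc 0 L, ∀ x, v x y * g2 x y + u x y * g1 x y = 0) (h0 : ∀ x, g x 0 = 0)
    {y : ℝ} (hy : y ∈ Icc 0 L) (x : ℝ) : g x y = 0 := by
  refine le_antisymm (transport_nonpos hL hg hc hp hv ht h0 hy x) ?_
  have := transport_nonpos (u := u) (v := v) hL hg.neg hc.neg (fun y hy x => by rw [hp y hy x]) hv
    (fun y hy x => by linear_combination -ht y hy x) (fun x => by rw [h0, neg_zero]) hy x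
  linarith

/-- A primitive in the second variable. -/
theorem exists_primitive {u u1 u2 : ℝ → ℝ → ℝ} (hL : 0 ≤ L) (hu : C1F L u u1 u2)
    (hc : ContinuousOn (fun z : ℝ × ℝ => u1 z.1 z.2) (strip L))
    (hB : ∀ y ∈ Icc 0 L, ∀ x, |u1 x y| ≤ C) :
    C1F L (fun x y => ∫ t in (0:ℝ)..y, u x (clamp L t))
      (fun x y => ∫ t in (0:ℝ)..y, u1 x (clamp L t)) u := by
  have hm := fun t => clamp_mem hL t
  have hu2 : ∀ x, Continuous fun t => u x (clamp L t) := fun x =>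
    ContinuousOn.comp_continuous (s := Icc 0 L) (f := clamp L) (g := fun t => u x t)
      (fun y hy => (hu.dy y hy x).continuousWithinAt) (clamp_cont L) hm
  have hu1 : ∀ x, Continuous fun t => u1 x (clamp L t) := fun x =>
    ContinuousOn.comp_continuous (s := strip L) (f := fun t => (x, clamp L t))
      (g := fun z : ℝ × ℝ => u1 z.1 z.2) hc
      (continuous_const.prodMk (clamp_cont L)) fun t => ⟨mem_univ _, hm t⟩
  refine ⟨fun y hy x => ?_, fun y hy x => ?_⟩
  · exact (intervalIntegral.hasDerivAt_integral_of_dominated_loc_of_deriv_le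
      (F := fun x t => u x (clamp L t)) (F' := fun x t => u1 x (clamp L t)) (s := univ)
      (bound := fun _ => C) Filter.univ_mem
      (Filter.Eventually.of_forall fun x => (hu2 x).aestronglyMeasurable)
      ((hu2 x).intervalIntegrable _ _) (hu1 x).aestronglyMeasurable
      (Filter.Eventually.of_forall fun t _ x _ => hB _ (hm t) x) intervalIntegrable_const
      (Filter.Eventually.of_forall fun t _ x _ => hu.dx _ (hm t) x)).2
  · have := ((hu2 x).integral_hasStrictDerivAt 0 y).hasDerivAt.hasDerivWithinAt (s := Icc 0 L)
    rwa [clamp_of_mem hy] at this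

end

section
open MeasureTheory
variable {L a r R C : ℝ} {D : Dat}

/-- The state of a field `(u, 1 + V)`, written in terms of its stream function. -/
def stOf (D : Dat) (L : ℝ) (u V V1 V2 : ℝ → ℝ → ℝ) : Fin 5 → ℝ → ℝ → ℝ :=
  ![fun x y => D.b 0 x - ∫ t in (0:ℝ)..y, u x (clamp L t), V, fun x y => -u x y, V1, V2]

theorem stOf_C1F (hL : 0 < L) (ha : a ∈ Ioo (0:ℝ) 1) (hD : DV a R D)
    {u u1 u2 u11 u12 u22 V V1 V2 V11 V12 V22 : ℝ → ℝ → ℝ}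
    (hu : C2F L a r u u1 u2 u11 u12 u22) (hV : C2F L a r V V1 V2 V11 V12 V22)
    (hdiv : ∀ y ∈ Icc 0 L, ∀ x, u1 x y + V2 x y = 0) (hb : ∀ x, V x 0 = D.b 1 x) :
    C1F L (stOf D L u V V1 V2 0) V fun x y => -u x y := by
  have m0 : (0:ℝ) ∈ Icc 0 L := ⟨le_rfl, hL.le⟩
  have j1 := hu.f1.jb ha hu.b1 hu.b11.bd hu.b12.bd
  have h := exists_primitive hL.le hu.f0 (j1.continuousOn ha.1) hu.b1
  refine ⟨fun y hy x => ((hD.d0 x).sub (h.dx y hy x)).congr_deriv ?_, fun y hy x =>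
    ((h.dy y hy x).const_sub _)⟩
  have hprim : ∫ t in (0:ℝ)..y, u1 x (clamp L t) = -(V x y - V x 0) := by
    have e1 : ∫ t in (0:ℝ)..y, u1 x (clamp L t) = ∫ t in (0:ℝ)..y, -V2 x t := by
      refine intervalIntegral.integral_congr fun t ht => ?_
      rw [uIcc_of_le hy.1] at ht
      have ht' : t ∈ Icc 0 L := ⟨ht.1, ht.2.trans hy.2⟩
      simp only [clamp_of_mem ht']
      linarith [hdiv t ht' x]
    rw [e1, intervalIntegral.integral_neg, intervalIntegral.integral_eq_sub_of_hasDeriv_right_of_le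
      (f := fun t => V x t) hy.1
      (fun t ht => ((hV.f0.dy t ⟨ht.1, ht.2.trans hy.2⟩ x).continuousWithinAt).mono
        (Icc_subset_Icc_right hy.2))
      (fun t ht => (hV.f0.dy t ⟨ht.1.le, ht.2.le.trans hy.2⟩ x).mono_of_mem_nhdsWithin
        (mem_nhdsWithin_of_mem_nhds (Icc_mem_nhds ht.1 (ht.2.trans_le hy.2))))]
    refine ContinuousOn.intervalIntegrable_of_Icc hy.1 fun t ht =>
      ((hV.f2.dy t ⟨ht.1, ht.2.trans hy.2⟩ x).continuousWithinAt).mono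
        (Icc_subset_Icc_right hy.2)
  rw [hprim, ← hb]
  ring

theorem stOf_st (hL : 0 < L) (ha : a ∈ Ioo (0:ℝ) 1) (hD : DV a R D) (hR : 4 * r * (1 + L) ≤ R)
    (hr : 0 ≤ r) (hbr : ∀ x, |D.b 0 x| ≤ r)
    {u u1 u2 u11 u12 u22 V V1 V2 V11 V12 V22 : ℝ → ℝ → ℝ}
    (hu : C2F L a r u u1 u2 u11 u12 u22) (hV : C2F L a r V V1 V2 V11 V12 V22)
    (hdiv : ∀ y ∈ Icc 0 L, ∀ x, u1 x y + V2 x y = 0) (hb : ∀ x, V x 0 = D.b 1 x)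
    (hup : ∀ y ∈ Icc 0 L, ∀ x, u (x + 1) y = u x y)
    (hVp : ∀ y ∈ Icc 0 L, ∀ x, V (x + 1) y = V x y) :
    St L a R (stOf D L u V V1 V2) := by
  have h0 := stOf_C1F hL ha hD hu hV hdiv hb
  have hu1p := fun y hy => deriv_per (hu.f0.dx y hy) (hup y hy)
  have hV1p := fun y hy => deriv_per (hV.f0.dx y hy) (hVp y hy)
  have hV2 : ∀ y ∈ Icc 0 L, ∀ x, V2 x y = -u1 x y := fun y hy x => by linarith [hdiv y hy x]
  have hrL : 0 ≤ r * L := mul_nonneg hr hL.le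
  have hrR : 4 * r ≤ R := by nlinarith
  have hb0 : ∀ y ∈ Icc 0 L, ∀ x, |stOf D L u V V1 V2 0 x y| ≤ r * (1 + L) := fun y hy x => by
    change |D.b 0 x - ∫ t in (0:ℝ)..y, u x (clamp L t)| ≤ _
    have e1 := intervalIntegral.norm_integral_le_of_norm_le_const (a := (0:ℝ)) (b := y)
      (f := fun t => u x (clamp L t)) (C := r) fun t _ => hu.b0 _ (clamp_mem hL.le t) x
    rw [Real.norm_eq_abs, sub_zero, abs_of_nonneg hy.1] at e1
    have := abs_sub (D.b 0 x) (∫ t in (0:ℝ)..y, u x (clamp L t))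
    have := mul_le_mul_of_nonneg_left hy.2 hr
    linarith [hbr x]
  have rL : r ≤ r * (1 + L) := by linarith
  have j0 := h0.jb ha hb0 (fun y hy x => (hV.b0 y hy x).trans rL)
    (fun y hy x => by rw [abs_neg]; exact (hu.b0 y hy x).trans rL)
  have hbV : ∀ y ∈ Icc 0 L, HB a (2 * r) fun x => V x y := fun y hy =>
    HB.of_deriv ha.1 ha.2.le (hV.b0 y hy) (hV.f0.dx y hy) (hV.b1 y hy)
  have hbV1 : ∀ y ∈ Icc 0 L, HB a (2 * r) fun x => V1 x y := fun y hy =>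
    HB.of_deriv ha.1 ha.2.le (hV.b1 y hy) (hV.f1.dx y hy) (hV.b11.bd y hy)
  have hbV2 : ∀ y ∈ Icc 0 L, HB a (2 * r) fun x => V2 x y := fun y hy =>
    HB.of_deriv ha.1 ha.2.le (hV.b2 y hy) (hV.f2.dx y hy) (hV.b12.bd y hy)
  have hbu : ∀ y ∈ Icc 0 L, HB a (2 * r) fun x => u x y := fun y hy =>
    HB.of_deriv ha.1 ha.2.le (hu.b0 y hy) (hu.f0.dx y hy) (hu.b1 y hy)
  have hbu1 : ∀ y ∈ Icc 0 L, HB a (2 * r) fun x => u1 x y := fun y hy =>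
    HB.of_deriv ha.1 ha.2.le (hu.b1 y hy) (hu.f1.dx y hy) (hu.b11.bd y hy)
  refine ⟨fun i y hy x => ?_, fun i => ?_, fun i y hy => ?_, fun i y hy => ?_⟩
  · fin_cases i
    · change D.b 0 (x + 1) - _ = D.b 0 x - _
      rw [hD.per]
      simp only [hup _ (clamp_mem hL.le _)]
    · exact hVp y hy x
    · change -_ = -_
      rw [hup y hy]
    · exact hV1p y hy x
    · change V2 _ _ = V2 _ _
      rw [hV2 y hy, hV2 y hy, hu1p y hy]
  · fin_cases i
    · exact j0.continuousOn ha.1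
    · exact (hV.f0.jb ha hV.b0 hV.b1 hV.b2).continuousOn ha.1
    · exact ((hu.f0.jb ha hu.b0 hu.b1 hu.b2).neg).continuousOn ha.1
    · exact (hV.f1.jb ha hV.b1 hV.b11.bd hV.b12.bd).continuousOn ha.1
    · exact (hV.f2.jb ha hV.b2 hV.b12.bd hV.b22.bd).continuousOn ha.1
  · fin_cases i
    · exact (HB.of_deriv ha.1 ha.2.le (hb0 y hy) (h0.dx y hy)
        fun x => (hV.b0 y hy x).trans rL).mono (by linarith)
    · exact (hbV y hy).mono (by linarith)
    · exact (hbu y hy).neg.mono (by linarith)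
    · exact (hbV1 y hy).mono (by linarith)
    · exact (hbV2 y hy).mono (by linarith)
  · fin_cases i
    · exact (LH.of_deriv (h0.dx y hy) (hbV y hy)).mono (by linarith)
    · exact (LH.of_deriv (hV.f0.dx y hy) (hbV1 y hy)).mono (by linarith)
    · exact (LH.of_deriv (fun x => (hu.f0.dx y hy x).neg) (hbu1 y hy).neg).mono (by linarith)
    · exact (LH.of_deriv (hV.f1.dx y hy) ((hV.b11.jh).hb (hV.b11.bd) y hy)).mono (by linarith)
    · exact (LH.of_deriv (hV.f2.dx y hy) ((hV.b12.jh).hb (hV.b12.bd) y hy)).mono (by linarith)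

end

section
open MeasureTheory
variable {L a r R C : ℝ} {D : Dat}

/-- Solutions of the normalised boundary value problem are fixed points of the iteration. -/
theorem stOf_step (hL : 0 < L) (ha : a ∈ Ioo (0:ℝ) 1) (hD : DV a R D) (hR16 : R ≤ 1 / 16)
    (hR : 4 * r * (1 + L) ≤ R) (hr : 0 ≤ r) (hbr : ∀ x, |D.b 0 x| ≤ r) (hD0 : D.b 0 0 = 0)
    (hw : ∀ x, D.w x * (1 + D.b 1 x) = 1) {qb qm : ℝ → ℝ}
    (hk : ∀ x, D.k0 x = qm x * D.w x - D.b 2 x) (hqm : ∀ x, HasDerivAt qb (qm x) x)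
    {u u1 u2 u11 u12 u22 V V1 V2 V11 V12 V22 p p1 p2 p11 p12 p22 : ℝ → ℝ → ℝ}
    (hu : C2F L a r u u1 u2 u11 u12 u22) (hV : C2F L a r V V1 V2 V11 V12 V22)
    (hp : C2F L a C p p1 p2 p11 p12 p22)
    (hup : ∀ y ∈ Icc 0 L, ∀ x, u (x + 1) y = u x y)
    (hVp : ∀ y ∈ Icc 0 L, ∀ x, V (x + 1) y = V x y)
    (hdiv : ∀ y ∈ Icc 0 L, ∀ x, u1 x y + V2 x y = 0)
    (e1 : ∀ y ∈ Icc 0 L, ∀ x, (1 + V x y) * (V1 x y - u2 x y) = p1 x y)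
    (e2 : ∀ y ∈ Icc 0 L, ∀ x, u x y * (V1 x y - u2 x y) = -p2 x y)
    (hb : ∀ x, V x 0 = D.b 1 x)
    (hbot : ∀ x, p x 0 + (u x 0 ^ 2 + (1 + V x 0) ^ 2) / 2 = qb x)
    (htop : ∀ x, p1 x L + u x L * u1 x L + (1 + V x L) * V1 x L = D.q x)
    (hJ : -∫ y in (0:ℝ)..L, u 0 y = D.J) :
    Step L D (stOf D L u V V1 V2) (stOf D L u V V1 V2) ∧
      ∀ y ∈ Icc 0 L, ∀ x, ff D (stOf D L u V V1 V2) x y = V1 x y - u2 x y := by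
  have m0 : (0:ℝ) ∈ Icc 0 L := ⟨le_rfl, hL.le⟩
  have mL : L ∈ Icc 0 L := ⟨hL.le, le_rfl⟩
  have hst := stOf_st hL ha hD hR hr hbr hu hV hdiv hb hup hVp
  have h0 := stOf_C1F hL ha hD hu hV hdiv hb
  set S := stOf D L u V V1 V2 with hS
  have hrL : 0 ≤ r * L := mul_nonneg hr hL.le
  let j : ℝ → ℝ → ℝ := fun x y => V1 x y - u2 x y
  have hj : C1F L j (fun x y => V11 x y - u12 x y) fun x y => V12 x y - u22 x y := hV.f1.sub hu.f2
  have hV1b : ∀ x, V1 x 0 = D.b 2 x := fun x =>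
    (hV.f0.dx 0 m0 x).unique (by simpa only [hb] using hD.d1 x)
  have hpos : ∀ y ∈ Icc 0 L, ∀ x, 1 + V x y ≠ 0 := fun y hy x h => by
    have := abs_le.1 (hV.b0 y hy x)
    nlinarith
  have hV1p := fun y hy => deriv_per (hV.f0.dx y hy) (hVp y hy)
  -- the current is transported by the field
  have htr : ∀ y ∈ Icc 0 L, ∀ x,
      (1 + V x y) * (V12 x y - u22 x y) + u x y * (V11 x y - u12 x y) = 0 := fun y hy x => by
    have f1 : V2 x y * j x y + (1 + V x y) * (V12 x y - u22 x y) = p12 x y :=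
      (uniqueDiffOn_Icc hL y hy).eq_deriv _
        ((((hV.f0.dy y hy x).const_add 1).mul (hj.dy y hy x)).congr (f₁ := fun t => p1 x t)
          (fun t ht => (e1 t ht x).symm) (e1 y hy x).symm) (hp.f1.dy y hy x)
    have f2 : u1 x y * j x y + u x y * (V11 x y - u12 x y) = -p12 x y := by
      have h1 := (hu.f0.dx y hy x).mul (hj.dx y hy x)
      have h2 : (fun t => u t y) * (fun t => j t y) = fun t => -p2 t y := funext fun t => e2 y hy t
      rw [h2] at h1
      exact h1.unique (hp.f2.dx y hy x).neg
    linear_combination f1 + f2 - j x y * hdiv y hy x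
  have hA : Continuous D.A := (LipschitzWith.of_dist_le_mul (K := 2) fun t t' => by
      simpa [Real.dist_eq] using hD.sub_le hR16 t t').continuous
  have hAb : ∀ x, D.A (x + D.b 0 x) = x := fun x => by
    have h3 := hD.inv (x + D.b 0 x)
    have h4 := (hD.lb 0).lip (D.A (x + D.b 0 x)) x
    rw [show D.b 0 (D.A (x + D.b 0 x)) - D.b 0 x = -(D.A (x + D.b 0 x) - x) by linarith,
      abs_neg] at h4
    have : |D.A (x + D.b 0 x) - x| = 0 := by nlinarith [abs_nonneg (D.A (x + D.b 0 x) - x)]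
    linarith [abs_eq_zero.1 this]
  have hS0 : ∀ x, S 0 x 0 = D.b 0 x := fun x => by
    change D.b 0 x - ∫ t in (0:ℝ)..0, u x (clamp L t) = _
    rw [intervalIntegral.integral_same, sub_zero]
  let K : ℝ → ℝ := fun t => j (D.A t) 0
  let K' : ℝ → ℝ := fun t => (V11 (D.A t) 0 - u12 (D.A t) 0) * D.w (D.A t)
  have hK : ∀ t, HasDerivAt K (K' t) t := fun t =>
    HasDerivAt.comp (h₂ := fun x => j x 0) (h := D.A) t (hj.dx 0 m0 (D.A t))
      (hD.A_deriv hR16 hw t)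
  have hKψ : C1F L (fun x y => K (x + S 0 x y)) (fun x y => K' (x + S 0 x y) * (1 + V x y))
      fun x y => K' (x + S 0 x y) * -u x y :=
    ⟨fun y hy x => HasDerivAt.comp (h₂ := K) (h := fun t => t + S 0 t y) x (hK _)
      ((hasDerivAt_id x).add (h0.dx y hy x)), fun y hy x =>
      HasDerivAt.comp_hasDerivWithinAt (h₂ := K) (h := fun t => x + S 0 x t) y (hK _)
        ((h0.dy y hy x).const_add _)⟩
  have hjc : ContinuousOn (fun z : ℝ × ℝ => j z.1 z.2) (strip L) :=
    ((hV.f1.jb ha hV.b1 hV.b11.bd hV.b12.bd).sub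
      (hu.f2.jb ha hu.b2 hu.b12.bd hu.b22.bd)).continuousOn ha.1
  have hKc : Continuous K := continuous_iff_continuousAt.2 fun t => (hK t).continuousAt
  have hjp : ∀ y ∈ Icc 0 L, ∀ x, j (x + 1) y = j x y := fun y hy x => by
    have h1 : u2 (x + 1) y = u2 x y := (uniqueDiffOn_Icc hL y hy).eq_deriv _
      ((hu.f0.dy y hy (x + 1)).congr (f₁ := fun t => u x t) (fun t ht => (hup t ht x).symm)
        (hup y hy x).symm) (hu.f0.dy y hy x)
    change V1 (x + 1) y - u2 (x + 1) y = _
    rw [h1, hV1p y hy x]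
  have hjK : ∀ y ∈ Icc 0 L, ∀ x, j x y = K (x + S 0 x y) := fun y hy x => by
    refine sub_eq_zero.1 (transport_zero (v := fun x y => 1 + V x y) (u := u) hL (hj.sub hKψ)
      (hjc.sub (hKc.comp_continuousOn (continuousOn_fst.add (hst.cont 0)))) (fun y hy x => ?_)
      hpos (fun y hy x => ?_) (fun x => ?_) hy x)
    · simp only [K]
      rw [hjp y hy, hst.per 0 y hy, show x + 1 + S 0 x y = x + S 0 x y + 1 by ring,
        hD.A_per hR16, hjp 0 m0]
    · linear_combination htr y hy x
    · simp only [K]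
      rw [hS0, hAb, sub_self]
  have hjk : ∀ x, j x 0 = kf D S x := fun x => by
    have h1 := (hp.f0.dx 0 m0 x).add ((((hu.f0.dx 0 m0 x).pow 2).add
      (((hV.f0.dx 0 m0 x).const_add 1).pow 2)).div_const 2)
    have h2 := h1.unique (by
      have := hqm x
      rwa [show qb = _ from funext fun x => (hbot x).symm] at this)
    simp only [Nat.cast_ofNat, Nat.add_one_sub_one, pow_one] at h2
    have h3 : kf D S x = D.k0 x - D.w x * (-u x 0 * V2 x 0) := rfl
    have h4 := e1 0 m0 x
    have h5 := hw x
    have h6 := hdiv 0 m0 x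
    have h7 := hb x
    have h8 := hV1b x
    rw [h3, hk]
    change V1 x 0 - u2 x 0 = _
    rw [← h2, ← h8]
    rw [← h7] at h5
    linear_combination (-(V1 x 0 - u2 x 0) - V1 x 0) * h5 + D.w x * h4 - D.w x * u x 0 * h6
  have hff : ∀ y ∈ Icc 0 L, ∀ x, ff D S x y = j x y := fun y hy x => by
    rw [hjK y hy x]
    exact (hjk _).symm
  refine ⟨⟨?_, hS0, ?_, fun x => ?_⟩, hff⟩
  · refine ⟨h0.dx, hV.f0.dx, fun y hy x => ((hu.f0.dx y hy x).neg).congr_deriv ?_, h0.dy,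
      hV.f0.dy, fun y hy x => ((hu.f0.dy y hy x).neg).congr_deriv ?_, hst.per, hst.cont⟩
    · change -u1 x y = V2 x y
      linarith [hdiv y hy x]
    · rw [hff y hy x]
      change -u2 x y = V1 x y - u2 x y - V1 x y
      ring
  · change D.b 0 0 - ∫ t in (0:ℝ)..L, u 0 (clamp L t) = _
    rw [hD0, zero_sub, ← hJ]
    congr 1
    refine intervalIntegral.integral_congr fun t ht => ?_
    rw [uIcc_of_le hL.le] at ht
    simp only [clamp_of_mem ht]
  · have hrho : ∀ x, rho L D S x = V1 x L := fun x => by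
      have h1 := htop x
      have h2 := e1 L mL x
      have h3 := hdiv L mL x
      have h4 : rho L D S x = D.q x - (ff D S x L + (ff D S x L * V x L
        + (-u x L * V2 x L + V x L * V1 x L))) := rfl
      rw [h4, hff L mL x]
      change D.q x - ((V1 x L - u2 x L) + ((V1 x L - u2 x L) * V x L
        + (-u x L * V2 x L + V x L * V1 x L))) = V1 x L
      linear_combination -h1 - h2 + u x L * h3
    have hc : Continuous fun x => V1 x L := (hst.hb 3 L mL).continuous ha.1
    have : ∫ t in (0:ℝ)..1, rho L D S t = 0 := by
      simp only [hrho]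
      rw [intervalIntegral.integral_eq_sub_of_hasDerivAt (fun x _ => hV.f0.dx L mL x)
        (hc.intervalIntegrable _ _)]
      have := hVp L mL 0
      rw [zero_add] at this
      rw [this, sub_self]
    rw [this, sub_zero, hrho]
    rfl

end

section
open MeasureTheory
variable {a δ η : ℝ}

/-- Functions on the line of size `δ` in `C^{2,a}`, with their derivatives. -/
structure H2 (a δ : ℝ) (f f1 f2 : ℝ → ℝ) : Prop where
  d0 : ∀ x, HasDerivAt f (f1 x) x
  d1 : ∀ x, HasDerivAt f1 (f2 x) x
  h0 : HB a δ f
  h1 : HB a δ f1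
  h2 : HB a δ f2

theorem H2.sub {f f1 f2 g g1 g2 : ℝ → ℝ} (hf : H2 a δ f f1 f2) (hg : H2 a η g g1 g2) :
    H2 a (δ + η) (fun x => f x - g x) (fun x => f1 x - g1 x) fun x => f2 x - g2 x :=
  ⟨fun x => (hf.d0 x).sub (hg.d0 x), fun x => (hf.d1 x).sub (hg.d1 x), hf.h0.sub hg.h0,
    hf.h1.sub hg.h1, hf.h2.sub hg.h2⟩

/-- The derivative of `(u² + (1 + v)²)/2 + h`. -/
def gq (u u1 v v1 h1 : ℝ → ℝ) (x : ℝ) : ℝ := u x * u1 x + (1 + v x) * v1 x + h1 x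

section
variable {u u1 u2 v v1 v2 h h1 h2 : ℝ → ℝ}

theorem gq_deriv (hu : H2 a δ u u1 u2) (hv : H2 a δ v v1 v2) (hh : H2 a δ h h1 h2) (x : ℝ) :
    HasDerivAt (gq u u1 v v1 h1)
      ((u1 x * u1 x + u x * u2 x) + (v1 x * v1 x + (1 + v x) * v2 x) + h2 x) x :=
  (((hu.d0 x).mul (hu.d1 x)).add (((hv.d0 x).const_add 1).mul (hv.d1 x))).add (hh.d1 x)

theorem gq_hb (hδ : δ ≤ 1 / 1000) (hu : H2 a δ u u1 u2) (hv : H2 a δ v v1 v2)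
    (hh : H2 a δ h h1 h2) : HB a (8 * δ) (gq u u1 v v1 h1) := by
  have h0 := hu.h0.nonneg
  refine (((hu.h0.mul hu.h1).add (((HB.const 1).add hv.h0).mul hv.h1)).add hh.h1).mono ?_
  rw [abs_one]; nlinarith

theorem gq_hb' (hδ : δ ≤ 1 / 1000) (hu : H2 a δ u u1 u2) (hv : H2 a δ v v1 v2)
    (hh : H2 a δ h h1 h2) : HB a (8 * δ) fun x =>
      (u1 x * u1 x + u x * u2 x) + (v1 x * v1 x + (1 + v x) * v2 x) + h2 x := by
  have h0 := hu.h0.nonneg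
  refine ((((hu.h1.mul hu.h1).add (hu.h0.mul hu.h2)).add ((hv.h1.mul hv.h1).add
    (((HB.const 1).add hv.h0).mul hv.h2))).add hh.h2).mono ?_
  rw [abs_one]; nlinarith

theorem gq_per (hu : ∀ x, HasDerivAt u (u1 x) x) (hv : ∀ x, HasDerivAt v (v1 x) x)
    (hh : ∀ x, HasDerivAt h (h1 x) x)
    (pu : ∀ x, u (x + 1) = u x) (pv : ∀ x, v (x + 1) = v x) (ph : ∀ x, h (x + 1) = h x) (x : ℝ) :
    gq u u1 v v1 h1 (x + 1) = gq u u1 v v1 h1 x := by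
  simp only [gq, pu, pv, deriv_per hu pu, deriv_per hv pv, deriv_per hh ph]

end

/-- Inverses of perturbations of the identity. -/
theorem exists_inverse {b : ℝ → ℝ} {C : ℝ} (hc : Continuous b) (hb : ∀ x, |b x| ≤ C) :
    ∃ A : ℝ → ℝ, ∀ t, A t + b (A t) = t := by
  have : ∀ t, ∃ x, x + b x = t := fun t => by
    refine mem_range_of_exists_le_of_exists_ge (f := fun x => x + b x) (continuous_id.add hc)
      ⟨t - C, ?_⟩ ⟨t + C, ?_⟩
    · have := (abs_le.1 (hb (t - C))).2; change t - C + _ ≤ t; linarith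
    · have := (abs_le.1 (hb (t + C))).1; change t ≤ t + C + _; linarith
  choose A hA using this
  exact ⟨A, hA⟩

theorem inv_hb {e e1 e2 : ℝ → ℝ} (hδ : δ ≤ 1 / 8) (he : H2 a δ e e1 e2) :
    HB a 2 (fun x => (1 + e x)⁻¹) ∧ LH a (16 * δ) (fun x => (1 + e x)⁻¹) ∧
      (∀ x, HasDerivAt (fun x => (1 + e x)⁻¹) (-(e1 x * ((1 + e x)⁻¹ * (1 + e x)⁻¹))) x) ∧
      HB a (16 * δ) (fun x => -(e1 x * ((1 + e x)⁻¹ * (1 + e x)⁻¹))) := by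
  have hδ0 := he.h0.nonneg
  have hp : ∀ x, 1 / 2 ≤ 1 + e x := fun x => by linarith [(abs_le.1 (he.h0.1 x)).1]
  have hd : ∀ x, HasDerivAt (fun x => (1 + e x)⁻¹) (-(e1 x * ((1 + e x)⁻¹ * (1 + e x)⁻¹))) x :=
    fun x => (((he.d0 x).const_add 1).inv (by linarith [hp x])).congr_deriv (by
      have := hp x
      field_simp)
  have hb : ∀ x, |(1 + e x)⁻¹| ≤ 2 := fun x => by
    have := hp x
    rw [abs_of_nonneg (by positivity)]
    exact inv_le_of_inv_le₀ (by norm_num) (by linarith)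
  have h2 : HB a 2 (fun x => (1 + e x)⁻¹) := by
    refine ⟨hb, fun x x' => ?_⟩
    have h3 := hp x
    have h4 := hp x'
    rw [show (1 + e x)⁻¹ - (1 + e x')⁻¹ = -((e x - e x') * ((1 + e x)⁻¹ * (1 + e x')⁻¹)) by
      field_simp; ring, abs_neg, abs_mul, abs_mul]
    have h5 := he.h0.2 x x'
    have hr : 0 ≤ |x - x'| ^ a := Real.rpow_nonneg (abs_nonneg _) _
    calc _ ≤ δ * |x - x'| ^ a * (2 * 2) := by
          gcongr
          · exact hb x
          · exact hb x'
      _ ≤ _ := by nlinarith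
  have h3 : HB a (16 * δ) (fun x => -(e1 x * ((1 + e x)⁻¹ * (1 + e x)⁻¹))) :=
    (he.h1.mul (h2.mul h2)).neg.mono (by linarith)
  exact ⟨h2, LH.of_deriv hd h3, hd, h3⟩

/-- The data of the reduced problem. -/
theorem data_exists (ha : a ∈ Ioo (0:ℝ) 1) (hδ : δ ≤ 1 / 1000)
    {u u1 u2 v v1 v2 h h1 h2 e e1 e2 U U1 U2 V V1 V2 H H1 H2' : ℝ → ℝ} {J : ℝ}
    (hu : H2 a δ u u1 u2) (hv : H2 a δ v v1 v2) (hh : H2 a δ h h1 h2)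
    (hU : H2 a δ U U1 U2) (hV : H2 a δ V V1 V2) (hH : H2 a δ H H1 H2')
    (he : H2 a (2 * δ) e e1 e2) (hJ : |J| ≤ δ)
    (pu : ∀ x, u (x + 1) = u x) (pv : ∀ x, v (x + 1) = v x) (ph : ∀ x, h (x + 1) = h x)
    (pU : ∀ x, U (x + 1) = U x) (pV : ∀ x, V (x + 1) = V x) (pH : ∀ x, H (x + 1) = H x)
    (pe : ∀ x, e (x + 1) = e x) (me : ∫ x in (0:ℝ)..1, e x = 0) :
    ∃ D : Dat, DV a (100 * δ) D ∧ D.b 0 0 = 0 ∧ (∀ x, |D.b 0 x| ≤ 2 * δ) ∧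
      (∀ x, D.b 1 x = e x) ∧ (∀ x, D.w x * (1 + D.b 1 x) = 1) ∧
      (∀ x, D.k0 x = gq u u1 v v1 h1 x * D.w x - D.b 2 x) ∧
      (∀ x, D.q x = gq U U1 V V1 H1 x) ∧ D.J = J := by
  have hδ0 := hu.h0.nonneg
  have hec : Continuous e := he.h0.continuous ha.1
  let B : ℝ → ℝ := fun x => ∫ t in (0:ℝ)..x, e t
  have hBd : ∀ x, HasDerivAt B (e x) x := fun x => (hec.integral_hasStrictDerivAt 0 x).hasDerivAt
  have hBc : Continuous B := continuous_iff_continuousAt.2 fun x => (hBd x).continuousAt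
  have hBp : ∀ x, B (x + 1) = B x := fun x => by
    have h1 := Function.Periodic.intervalIntegral_add_eq (f := e) (T := 1) pe x 0
    have h2 := intervalIntegral.integral_add_adjacent_intervals
      (hec.intervalIntegrable (μ := volume) 0 x) (hec.intervalIntegrable x (x + 1))
    rw [zero_add, me] at h1
    rw [h1, add_zero] at h2
    exact h2.symm
  have hBb : ∀ x, |B x| ≤ 2 * δ := fun x => by
    rw [← fract_of_per hBp x]
    have h1 := intervalIntegral.norm_integral_le_of_norm_le_const (a := (0:ℝ)) (b := Int.fract x)
      (f := e) (C := 2 * δ) fun t _ => he.h0.1 t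
    rw [Real.norm_eq_abs, sub_zero, abs_of_nonneg (Int.fract_nonneg x)] at h1
    refine h1.trans ?_
    have := (Int.fract_lt_one x).le
    nlinarith
  obtain ⟨A, hA⟩ := exists_inverse hBc hBb
  obtain ⟨w1, w2, w3, w4⟩ := inv_hb (by linarith) he
  have hq := gq_hb hδ hu hv hh
  have hq' := gq_hb' hδ hu hv hh
  have hqt := gq_hb hδ hU hV hH
  have hqt' := gq_hb' hδ hU hV hH
  have pe1 := deriv_per he.d0 pe
  have hk' : ∀ x, HasDerivAt (fun x => gq u u1 v v1 h1 x * (1 + e x)⁻¹ - e1 x) _ x := fun x =>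
    ((gq_deriv hu hv hh x).mul (w3 x)).sub (he.d1 x)
  refine ⟨⟨![B, e, e1], fun x => gq u u1 v v1 h1 x * (1 + e x)⁻¹ - e1 x, fun x => (1 + e x)⁻¹,
    gq U U1 V V1 H1, J, A⟩, ⟨hBd, he.d0, hBp, fun x => ?_, fun x => ?_,
    gq_per hU.d0 hV.d0 hH.d0 pU pV pH, fun i => ?_, ?_, w1, hqt.mono (by linarith),
    hJ.trans (by linarith), fun i => ?_, ?_, w2.mono (by linarith), ?_, hA⟩,
    intervalIntegral.integral_same, hBb, fun x => rfl, fun x => ?_, fun x => rfl, fun x => rfl,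
    rfl⟩
  · simp only [gq_per hu.d0 hv.d0 hh.d0 pu pv ph, pe, pe1]
  · simp only [pe]
  · fin_cases i
    · exact (HB.of_deriv ha.1 ha.2.le hBb hBd he.h0.1).mono (by linarith)
    · exact he.h0.mono (by linarith)
    · exact he.h1.mono (by linarith)
  · exact ((hq.mul w1).sub he.h1).mono (by linarith)
  · fin_cases i
    · exact (LH.of_deriv hBd he.h0).mono (by linarith)
    · exact (LH.of_deriv he.d0 he.h1).mono (by linarith)
    · exact (LH.of_deriv he.d1 he.h2).mono (by linarith)
  · refine (LH.of_deriv hk' (((hq'.mul w1).add (hq.mul w4)).sub he.h2)).mono ?_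
    nlinarith
  · exact (LH.of_deriv (gq_deriv hU hV hH) hqt').mono (by linarith)
  · change (1 + e x)⁻¹ * (1 + e x) = 1
    have := (abs_le.1 (he.h0.1 x)).1
    exact inv_mul_cancel₀ (by linarith)

end

section
open MeasureTheory

variable {E F G : Type*} [NormedAddCommGroup E] [NormedSpace ℝ E] [NormedAddCommGroup F]
  [NormedSpace ℝ F] [NormedAddCommGroup G] [NormedSpace ℝ G] {s : Set E} {a C D : ℝ}

/-- `C^{2,a}` bounds on `s`, with explicit first and second derivatives. -/
structure F2 (a C : ℝ) (s : Set E) (f : E → F) (f' : E → E →L[ℝ] F)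
    (f'' : E → E →L[ℝ] E →L[ℝ] F) : Prop where
  d1 : ∀ x ∈ s, HasFDerivWithinAt f (f' x) s x
  d2 : ∀ x ∈ s, HasFDerivWithinAt f' (f'' x) s x
  b0 : ∀ x ∈ s, ‖f x‖ ≤ C
  b1 : ∀ x ∈ s, ‖f' x‖ ≤ C
  b2 : ∀ x ∈ s, ‖f'' x‖ ≤ C
  h2 : ∀ x ∈ s, ∀ y ∈ s, ‖f'' x - f'' y‖ ≤ C * ‖x - y‖ ^ a

theorem norm_map_sub_map (e : F ≃ₗᵢ[ℝ] G) (x y : F) : ‖e x - e y‖ = ‖x - y‖ := by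
  rw [← map_sub, LinearIsometryEquiv.norm_map]

theorem norm_iteratedFDerivWithin_succ_sub (hs : UniqueDiffOn ℝ s) (n : ℕ) (f : E → F) {x y : E}
    (hx : x ∈ s) (hy : y ∈ s) :
    ‖iteratedFDerivWithin ℝ (n + 1) f s x - iteratedFDerivWithin ℝ (n + 1) f s y‖ =
      ‖iteratedFDerivWithin ℝ n (fderivWithin ℝ f s) s x -
        iteratedFDerivWithin ℝ n (fderivWithin ℝ f s) s y‖ := by
  rw [iteratedFDerivWithin_succ_eq_comp_right hs hx, iteratedFDerivWithin_succ_eq_comp_right hs hy,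
    Function.comp_apply, Function.comp_apply, ← LinearIsometryEquiv.map_sub,
    LinearIsometryEquiv.norm_map]

theorem norm_iteratedFDerivWithin_zero_sub (f : E → F) (x y : E) :
    ‖iteratedFDerivWithin ℝ 0 f s x - iteratedFDerivWithin ℝ 0 f s y‖ = ‖f x - f y‖ := by
  rw [iteratedFDerivWithin_zero_eq_comp]
  exact norm_map_sub_map (continuousMultilinearCurryFin0 ℝ E F).symm _ _

theorem norm_iteratedFDerivWithin_two_sub (hs : UniqueDiffOn ℝ s) {f : E → F} {x y : E}
    (hx : x ∈ s) (hy : y ∈ s) :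
    ‖iteratedFDerivWithin ℝ 2 f s x - iteratedFDerivWithin ℝ 2 f s y‖ =
      ‖fderivWithin ℝ (fderivWithin ℝ f s) s x - fderivWithin ℝ (fderivWithin ℝ f s) s y‖ :=
  (norm_iteratedFDerivWithin_succ_sub hs 1 f hx hy).trans
    ((norm_iteratedFDerivWithin_succ_sub hs 0 (fderivWithin ℝ f s) hx hy).trans
      (norm_iteratedFDerivWithin_zero_sub _ x y))

theorem norm_iteratedFDerivWithin_two (hs : UniqueDiffOn ℝ s) {f : E → F} {x : E}
    (hx : x ∈ s) : ‖iteratedFDerivWithin ℝ 2 f s x‖ =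
      ‖fderivWithin ℝ (fderivWithin ℝ f s) s x‖ := by
  rw [← norm_iteratedFDerivWithin_fderivWithin hs hx, norm_iteratedFDerivWithin_one _ (hs x hx)]

theorem hNorm_bounds {f : E → F} (hC : 0 ≤ C) (h : hNorm 2 a s f ≤ ENNReal.ofReal C) :
    (∀ i ≤ 2, ∀ x ∈ s, ‖iteratedFDerivWithin ℝ i f s x‖ ≤ C) ∧
      ∀ x ∈ s, ∀ y ∈ s, ‖iteratedFDerivWithin ℝ 2 f s x - iteratedFDerivWithin ℝ 2 f s y‖
        / ‖x - y‖ ^ a ≤ C := by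
  constructor
  · intro i hi x hx
    have h1 : (‖iteratedFDerivWithin ℝ i f s x‖₊ : ℝ≥0∞) ≤ ENNReal.ofReal C :=
      calc (‖iteratedFDerivWithin ℝ i f s x‖₊ : ℝ≥0∞)
          ≤ ⨆ x ∈ s, (‖iteratedFDerivWithin ℝ i f s x‖₊ : ℝ≥0∞) :=
            le_iSup₂ (f := fun x (_ : x ∈ s) => (‖iteratedFDerivWithin ℝ i f s x‖₊ : ℝ≥0∞)) x hx
        _ ≤ (Finset.range (2 + 1)).sum
              (fun i => ⨆ x ∈ s, (‖iteratedFDerivWithin ℝ i f s x‖₊ : ℝ≥0∞)) :=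
            Finset.single_le_sum (f := fun i => ⨆ x ∈ s, (‖iteratedFDerivWithin ℝ i f s x‖₊ : ℝ≥0∞))
              (fun _ _ => bot_le) (Finset.mem_range.2 (by omega))
        _ ≤ _ := le_self_add
        _ ≤ _ := h
    rw [ENNReal.ofReal, ENNReal.coe_le_coe] at h1
    have h2 : (‖iteratedFDerivWithin ℝ i f s x‖₊ : ℝ) ≤ (C.toNNReal : ℝ) := by exact_mod_cast h1
    rwa [Real.coe_toNNReal C hC, coe_nnnorm] at h2
  · intro x hx y hy
    have h1 : ENNReal.ofReal (‖iteratedFDerivWithin ℝ 2 f s x - iteratedFDerivWithin ℝ 2 f s y‖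
        / ‖x - y‖ ^ a) ≤ ENNReal.ofReal C :=
      calc _ ≤ hSemi a s (iteratedFDerivWithin ℝ 2 f s) := by
            refine le_trans ?_ (le_iSup₂ (f := fun x (_ : x ∈ s) => ⨆ y ∈ s, ENNReal.ofReal
              (‖iteratedFDerivWithin ℝ 2 f s x - iteratedFDerivWithin ℝ 2 f s y‖ / ‖x - y‖ ^ a))
              x hx)
            exact le_iSup₂ (f := fun y (_ : y ∈ s) => ENNReal.ofReal
              (‖iteratedFDerivWithin ℝ 2 f s x - iteratedFDerivWithin ℝ 2 f s y‖ / ‖x - y‖ ^ a))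
              y hy
        _ ≤ hNorm 2 a s f := le_add_self
        _ ≤ _ := h
    exact (ENNReal.ofReal_le_ofReal_iff hC).1 h1

theorem F2.of_hNorm (hs : UniqueDiffOn ℝ s) {f : E → F} (hf : ContDiffOn ℝ 2 f s) (hC : 0 ≤ C)
    (h : hNorm 2 a s f ≤ ENNReal.ofReal C) :
    F2 a C s f (fderivWithin ℝ f s) (fderivWithin ℝ (fderivWithin ℝ f s) s) := by
  obtain ⟨h1, h2⟩ := hNorm_bounds hC h
  refine ⟨fun x hx => ?_, fun x hx => ?_, fun x hx => ?_, fun x hx => ?_, fun x hx => ?_,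
    fun x hx y hy => ?_⟩
  · exact (hf.differentiableOn (by norm_num) x hx).hasFDerivWithinAt
  · exact ((hf.fderivWithin (m := 1) hs (by norm_num)).differentiableOn (by norm_num) x
      hx).hasFDerivWithinAt
  · rw [← norm_iteratedFDerivWithin_zero (𝕜 := ℝ) (s := s)]; exact h1 0 (by norm_num) x hx
  · rw [← norm_iteratedFDerivWithin_one f (hs x hx)]; exact h1 1 (by norm_num) x hx
  · rw [← norm_iteratedFDerivWithin_two hs hx]; exact h1 2 le_rfl x hx
  · rcases eq_or_ne x y with rfl | hne
    · rw [sub_self]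
      exact (norm_zero (E := E →L[ℝ] E →L[ℝ] F)).trans_le (by positivity)
    · rw [← norm_iteratedFDerivWithin_two_sub hs hx hy]
      exact (div_le_iff₀ (Real.rpow_pos_of_pos (norm_pos_iff.2 (sub_ne_zero.2 hne)) _)).1
        (h2 x hx y hy)

theorem F2.of_memC (hs : UniqueDiffOn ℝ s) {f : E → F} (hf : MemC 2 a s f) :
    F2 a (hNorm 2 a s f).toReal s f (fderivWithin ℝ f s)
      (fderivWithin ℝ (fderivWithin ℝ f s) s) :=
  F2.of_hNorm hs hf.1 ENNReal.toReal_nonneg (ENNReal.ofReal_toReal hf.2.ne).ge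

namespace F2
variable {f g : E → F} {f' g' : E → E →L[ℝ] F} {f'' g'' : E → E →L[ℝ] E →L[ℝ] F}

theorem sub (hf : F2 a C s f f' f'') (hg : F2 a D s g g' g'') :
    F2 a (C + D) s (fun x => f x - g x) (fun x => f' x - g' x) (fun x => f'' x - g'' x) := by
  refine ⟨fun x hx => (hf.d1 x hx).sub (hg.d1 x hx), fun x hx => (hf.d2 x hx).sub (hg.d2 x hx),
    fun x hx => (norm_sub_le _ _).trans (add_le_add (hf.b0 x hx) (hg.b0 x hx)),
    fun x hx => (norm_sub_le _ _).trans (add_le_add (hf.b1 x hx) (hg.b1 x hx)),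
    fun x hx => (norm_sub_le (E := E →L[ℝ] E →L[ℝ] F) _ _).trans
      (add_le_add (hf.b2 x hx) (hg.b2 x hx)), fun x hx y hy => ?_⟩
  rw [sub_sub_sub_comm, add_mul]
  exact (norm_sub_le (E := E →L[ℝ] E →L[ℝ] F) _ _).trans
    (add_le_add (hf.h2 x hx y hy) (hg.h2 x hx y hy))

theorem comp_clm (hf : F2 a C s f f' f'') (ℓ : F →L[ℝ] G) (hℓ : ‖ℓ‖ ≤ D) :
    F2 a (D * C) s (fun x => ℓ (f x)) (fun x => ℓ.comp (f' x))
      (fun x => (ContinuousLinearMap.compL ℝ E F G ℓ).comp (f'' x)) := by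
  have hD := (norm_nonneg ℓ).trans hℓ
  have hc : ‖ContinuousLinearMap.compL ℝ E F G ℓ‖ ≤ D :=
    (ContinuousLinearMap.opNorm_le_bound _ (norm_nonneg _) fun q =>
      ContinuousLinearMap.opNorm_comp_le _ _).trans hℓ
  refine ⟨fun x hx => ℓ.hasFDerivAt.comp_hasFDerivWithinAt x (hf.d1 x hx), fun x hx =>
    (ContinuousLinearMap.compL ℝ E F G ℓ).hasFDerivAt.comp_hasFDerivWithinAt x (hf.d2 x hx),
    fun x hx => ?_, fun x hx => ?_, fun x hx => ?_, fun x hx y hy => ?_⟩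
  · exact (ℓ.le_opNorm _).trans (mul_le_mul hℓ (hf.b0 x hx) (norm_nonneg _) hD)
  · exact (ContinuousLinearMap.opNorm_comp_le _ _).trans
      (mul_le_mul hℓ (hf.b1 x hx) (norm_nonneg _) hD)
  · exact (ContinuousLinearMap.opNorm_comp_le _ _).trans
      (mul_le_mul hc (hf.b2 x hx) (norm_nonneg _) hD)
  · rw [← ContinuousLinearMap.comp_sub, mul_assoc]
    exact (ContinuousLinearMap.opNorm_comp_le _ _).trans
      (mul_le_mul hc (hf.h2 x hx y hy) (norm_nonneg _) hD)

theorem contDiffOn (ha : 0 < a) (hs : UniqueDiffOn ℝ s) (h : F2 a C s f f' f'') :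
    ContDiffOn ℝ 2 f s := by
  have hc : ContinuousOn f'' s := by
    intro x hx
    refine (tendsto_iff_norm_sub_tendsto_zero (E := E →L[ℝ] E →L[ℝ] F)).2 ?_
    have h1 : Filter.Tendsto (fun y => C * ‖y - x‖ ^ a) (nhdsWithin x s) (nhds 0) := by
      have : Filter.Tendsto (fun y => C * ‖y - x‖ ^ a) (nhds x) (nhds (C * ‖x - x‖ ^ a)) :=
        (Continuous.tendsto (by
          exact continuous_const.mul ((continuous_id.sub continuous_const).norm.rpow_const
            fun _ => Or.inr ha.le)) x)
      rw [sub_self, norm_zero, Real.zero_rpow ha.ne', mul_zero] at this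
      exact this.mono_left nhdsWithin_le_nhds
    refine squeeze_zero' (Filter.Eventually.of_forall fun _ =>
      norm_nonneg (E := E →L[ℝ] E →L[ℝ] F) _) ?_ h1
    filter_upwards [self_mem_nhdsWithin] with y hy using h.h2 y hy x hx
  have h1 : ContDiffOn ℝ 1 f' s := by
    rw [show (1 : WithTop ℕ∞) = 0 + 1 from by norm_num,
      contDiffOn_succ_iff_hasFDerivWithinAt_of_uniqueDiffOn hs]
    exact ⟨by simp, f'', contDiffOn_zero.2 hc, h.d2⟩
  rw [show (2 : WithTop ℕ∞) = 1 + 1 from by norm_num,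
    contDiffOn_succ_iff_hasFDerivWithinAt_of_uniqueDiffOn hs]
  exact ⟨by simp, f', h1, h.d1⟩

theorem hNorm_le (hs : UniqueDiffOn ℝ s) (hC : 0 ≤ C) (h : F2 a C s f f' f'') :
    hNorm 2 a s f ≤ ENNReal.ofReal (4 * C) := by
  have e1 : ∀ x ∈ s, fderivWithin ℝ f s x = f' x := fun x hx => (h.d1 x hx).fderivWithin (hs x hx)
  have e2 : ∀ x ∈ s, fderivWithin ℝ (fderivWithin ℝ f s) s x = f'' x := fun x hx =>
    ((h.d2 x hx).congr e1 (e1 x hx)).fderivWithin (hs x hx)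
  have hn : ∀ i : ℕ, (∀ x ∈ s, ‖iteratedFDerivWithin ℝ i f s x‖ ≤ C) →
      ⨆ x ∈ s, (‖iteratedFDerivWithin ℝ i f s x‖₊ : ℝ≥0∞) ≤ ENNReal.ofReal C := fun i hi => by
    refine iSup₂_le fun x hx => ?_
    change ‖iteratedFDerivWithin ℝ i f s x‖ₑ ≤ _
    rw [← ofReal_norm]
    exact ENNReal.ofReal_le_ofReal (hi x hx)
  have h0 := hn 0 fun x hx => by rw [norm_iteratedFDerivWithin_zero]; exact h.b0 x hx
  have h1 := hn 1 fun x hx => by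
    rw [norm_iteratedFDerivWithin_one _ (hs x hx), e1 x hx]; exact h.b1 x hx
  have h2 := hn 2 fun x hx => by
    rw [norm_iteratedFDerivWithin_two hs hx, e2 x hx]; exact h.b2 x hx
  have h3 : hSemi a s (iteratedFDerivWithin ℝ 2 f s) ≤ ENNReal.ofReal C := by
    refine iSup₂_le fun x hx => iSup₂_le fun y hy => ENNReal.ofReal_le_ofReal ?_
    rw [norm_iteratedFDerivWithin_two_sub hs hx hy, e2 x hx, e2 y hy]
    rcases (Real.rpow_nonneg (norm_nonneg (x - y)) a).eq_or_lt with h0 | h0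
    · rw [← h0, div_zero]; exact hC
    · exact (div_le_iff₀ h0).2 (h.h2 x hx y hy)
  rw [hNorm, Finset.sum_range_succ, Finset.sum_range_succ, Finset.sum_range_succ,
    Finset.sum_range_zero, zero_add, show 4 * C = C + C + C + C by ring,
    ENNReal.ofReal_add (by positivity) hC, ENNReal.ofReal_add (by positivity) hC,
    ENNReal.ofReal_add hC hC]
  exact add_le_add (add_le_add (add_le_add h0 h1) h2) h3

end F2
end

section
open MeasureTheory

variable {L a C : ℝ}

theorem uniqueDiffOn_strip (hL : 0 < L) : UniqueDiffOn ℝ (strip L) :=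
  uniqueDiffOn_univ.prod (uniqueDiffOn_Icc hL)

theorem mem_strip {x y : ℝ} : (x, y) ∈ strip L ↔ y ∈ Icc 0 L := by
  simp [strip]

section
variable {F : Type*} [NormedAddCommGroup F] [NormedSpace ℝ F] {f : ℝ × ℝ → F}
  {T : ℝ × ℝ →L[ℝ] F} {x y : ℝ}

theorem hasDerivAt_slice_x (hy : y ∈ Icc 0 L) (h : HasFDerivWithinAt f T (strip L) (x, y)) :
    HasDerivAt (fun t => f (t, y)) (T (1, 0)) x := by
  have h1 : HasDerivAt (fun t : ℝ => (t, y)) ((1 : ℝ), (0 : ℝ)) x :=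
    (hasDerivAt_id x).prodMk (hasDerivAt_const x y)
  have := HasFDerivWithinAt.comp_hasDerivWithinAt (s := univ) x h h1.hasDerivWithinAt
    fun t _ => mem_strip.2 hy
  exact hasDerivWithinAt_univ.1 this

theorem hasDerivWithinAt_slice_y (h : HasFDerivWithinAt f T (strip L) (x, y)) :
    HasDerivWithinAt (fun t => f (x, t)) (T (0, 1)) (Icc 0 L) y := by
  have h1 : HasDerivAt (fun t : ℝ => (x, t)) ((0 : ℝ), (1 : ℝ)) y :=
    (hasDerivAt_const y x).prodMk (hasDerivAt_id y)
  exact HasFDerivWithinAt.comp_hasDerivWithinAt (s := Icc 0 L) y h h1.hasDerivWithinAt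
    fun t ht => mem_strip.2 ht

end

theorem norm_one_zero : ‖((1 : ℝ), (0 : ℝ))‖ = 1 := by simp [Prod.norm_def]

theorem norm_zero_one : ‖((0 : ℝ), (1 : ℝ))‖ = 1 := by simp [Prod.norm_def]

theorem F2.c2f (ha : 0 < a) {f : ℝ × ℝ → ℝ} {f' f''} (h : F2 a C (strip L) f f' f'') :
    C2F L a C (fun x y => f (x, y)) (fun x y => f' (x, y) (1, 0)) (fun x y => f' (x, y) (0, 1))
      (fun x y => f'' (x, y) (1, 0) (1, 0)) (fun x y => f'' (x, y) (1, 0) (0, 1))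
      (fun x y => f'' (x, y) (0, 1) (0, 1)) := by
  have happ : ∀ (T : ℝ × ℝ →L[ℝ] ℝ) (e : ℝ × ℝ), ‖e‖ = 1 → |T e| ≤ ‖T‖ := fun T e he => by
    have := T.le_opNorm e
    rwa [he, mul_one, Real.norm_eq_abs] at this
  have happ2 : ∀ (T : ℝ × ℝ →L[ℝ] ℝ × ℝ →L[ℝ] ℝ) (e e' : ℝ × ℝ), ‖e‖ = 1 → ‖e'‖ = 1 →
      |T e e'| ≤ ‖T‖ := fun T e e' he he' => by
    have := T.le_opNorm e
    rw [he, mul_one] at this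
    exact (happ _ _ he').trans this
  have hJ : ∀ e e' : ℝ × ℝ, ‖e‖ = 1 → ‖e'‖ = 1 → JB L a C fun x y => f'' (x, y) e e' := by
    intro e e' he he'
    refine ⟨fun y hy x => (happ2 _ _ _ he he').trans (h.b2 _ (mem_strip.2 hy)),
      fun y hy y' hy' x x' => ?_⟩
    have h1 := happ2 (f'' (x, y) - f'' (x', y')) e e' he he'
    have h2 := h.h2 (x, y) (mem_strip.2 hy) (x', y') (mem_strip.2 hy')
    rw [Prod.mk_sub_mk, Prod.norm_mk, Real.norm_eq_abs, Real.norm_eq_abs] at h2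
    exact h1.trans h2
  have d1 : ∀ (e : ℝ × ℝ), ∀ y ∈ Icc 0 L, ∀ x,
      HasDerivAt (fun t => f' (t, y) e) (f'' (x, y) (1, 0) e) x := fun e y hy x => by
    exact (hasDerivAt_slice_x hy (h.d2 _ (mem_strip.2 hy))).clm_apply (hasDerivAt_const x e) |>.congr_deriv (by simp)
  have d2 : ∀ (e : ℝ × ℝ), ∀ y ∈ Icc 0 L, ∀ x,
      HasDerivWithinAt (fun t => f' (x, t) e) (f'' (x, y) (0, 1) e) (Icc 0 L) y :=
    fun e y hy x => by
    exact (hasDerivWithinAt_slice_y (h.d2 _ (mem_strip.2 hy))).clm_apply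
      (hasDerivWithinAt_const y _ e) |>.congr_deriv (by simp)
  have f0 : C1F L (fun x y => f (x, y)) (fun x y => f' (x, y) (1, 0))
      (fun x y => f' (x, y) (0, 1)) :=
    ⟨fun y hy x => hasDerivAt_slice_x hy (h.d1 _ (mem_strip.2 hy)),
      fun y hy x => hasDerivWithinAt_slice_y (h.d1 _ (mem_strip.2 hy))⟩
  exact ⟨f0, ⟨d1 _, dy_of_mixed ha f0.dx f0.dy (d1 _) (hJ _ _ norm_one_zero norm_zero_one).jh⟩,
    ⟨d1 _, d2 _⟩, fun y hy x => h.b0 _ (mem_strip.2 hy),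
    fun y hy x => (happ _ _ norm_one_zero).trans (h.b1 _ (mem_strip.2 hy)),
    fun y hy x => (happ _ _ norm_zero_one).trans (h.b1 _ (mem_strip.2 hy)),
    hJ _ _ norm_one_zero norm_one_zero, hJ _ _ norm_one_zero norm_zero_one,
    hJ _ _ norm_zero_one norm_zero_one⟩

theorem pdx_eq (hL : 0 < L) {f : ℝ × ℝ → ℝ} {v v1 v2 : ℝ → ℝ → ℝ} {x y : ℝ}
    (hf : DifferentiableWithinAt ℝ f (strip L) (x, y)) (hv : C1F L v v1 v2)
    (hfv : ∀ x, ∀ y ∈ Icc 0 L, f (x, y) = v x y) (hy : y ∈ Icc 0 L) :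
    pdx L f (x, y) = v1 x y ∧ pdy L f (x, y) = v2 x y := by
  constructor
  · have h1 := hasDerivAt_slice_x hy hf.hasFDerivWithinAt
    simp only [fun x => hfv x y hy] at h1
    exact h1.unique (hv.dx y hy x)
  · have h1 := hasDerivWithinAt_slice_y hf.hasFDerivWithinAt
    exact (uniqueDiffOn_Icc hL y hy).eq_deriv _ h1
      ((hv.dy y hy x).congr (fun t ht => hfv x t ht) (hfv x y hy))

theorem abs_sub_linear_le {g g' : ℝ → ℝ} {s : Set ℝ} (hs : Convex ℝ s) {x x' c K : ℝ}
    (hx : x ∈ s) (hx' : x' ∈ s) (hg : ∀ t ∈ uIcc x x', HasDerivWithinAt g (g' t) s t)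
    (hb : ∀ t ∈ uIcc x x', |g' t - c| ≤ K) : |g x' - g x - c * (x' - x)| ≤ K * |x' - x| := by
  have hsub : uIcc x x' ⊆ s := hs.ordConnected.uIcc_subset hx hx'
  have := (convex_uIcc x x').norm_image_sub_le_of_norm_hasDerivWithin_le
    (f := fun t => g t - c * t) (f' := fun t => g' t - c) (C := K)
    (fun t ht => (((hg t ht).mono hsub).sub
      ((hasDerivWithinAt_id t _).const_mul c)).congr_deriv (by simp))
    hb left_mem_uIcc right_mem_uIcc
  rw [Real.norm_eq_abs, Real.norm_eq_abs] at this
  convert this using 2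
  ring

/-- A function with Hölder continuous partial derivatives is differentiable. -/
theorem C1F.hasFDerivWithinAt (ha : 0 < a) {v v1 v2 : ℝ → ℝ → ℝ} (h : C1F L v v1 v2)
    (h1 : JH L a C v1) (h2 : JH L a C v2) {z : ℝ × ℝ} (hz : z ∈ strip L) :
    HasFDerivWithinAt (fun z => v z.1 z.2)
      (v1 z.1 z.2 • ContinuousLinearMap.fst ℝ ℝ ℝ + v2 z.1 z.2 • ContinuousLinearMap.snd ℝ ℝ ℝ)
      (strip L) z := by
  obtain ⟨x, y⟩ := z
  have hy := mem_strip.1 hz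
  have hC : 0 ≤ C := by
    have := (abs_nonneg _).trans (h1 y hy y hy (x + 1) x)
    simpa using this
  have key : ∀ w ∈ strip L, |v w.1 w.2 - v x y - (v1 x y * (w.1 - x) + v2 x y * (w.2 - y))|
      ≤ 2 * C * ‖w - (x, y)‖ ^ a * ‖w - (x, y)‖ := by
    rintro ⟨x', y'⟩ hw
    have hy' := mem_strip.1 hw
    set n := ‖((x', y') : ℝ × ℝ) - (x, y)‖ with hn
    have hnm : n = max |x' - x| |y' - y| := by
      rw [hn, Prod.mk_sub_mk, Prod.norm_mk, Real.norm_eq_abs, Real.norm_eq_abs]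
    have nx : |x' - x| ≤ n := hnm ▸ le_max_left _ _
    have ny : |y' - y| ≤ n := hnm ▸ le_max_right _ _
    have n0 : 0 ≤ n := norm_nonneg _
    have e1 := abs_sub_linear_le (g := fun t => v t y') (K := C * n ^ a) (c := v1 x y) convex_univ
      (mem_univ x) (mem_univ x') (fun t _ => (h.dx y' hy' t).hasDerivWithinAt) fun t ht => by
        refine (h1 y' hy' y hy t x).trans ?_
        have : |t - x| ≤ |x' - x| := abs_sub_left_of_mem_uIcc ht
        gcongr
        exact max_le (this.trans nx) ny
    have e2 := abs_sub_linear_le (g := fun t => v x t) (K := C * n ^ a) (c := v2 x y)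
      (convex_Icc 0 L) hy hy' (fun t ht => h.dy t (uIcc_subset_Icc hy hy' ht) x) fun t ht => by
        refine (h2 t (uIcc_subset_Icc hy hy' ht) y hy x x).trans ?_
        have : |t - y| ≤ |y' - y| := abs_sub_left_of_mem_uIcc ht
        gcongr
        exact max_le (by simpa using n0) (this.trans ny)
    have hK : 0 ≤ C * n ^ a := by positivity
    calc _ = |(v x' y' - v x y' - v1 x y * (x' - x)) + (v x y' - v x y - v2 x y * (y' - y))| := by
          congr 1; ring
      _ ≤ C * n ^ a * |x' - x| + C * n ^ a * |y' - y| :=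
          (abs_add_le _ _).trans (add_le_add e1 e2)
      _ ≤ C * n ^ a * n + C * n ^ a * n := by gcongr
      _ = _ := by ring
  refine HasFDerivWithinAt.of_isLittleO (Asymptotics.isLittleO_iff.2 fun c hc => ?_)
  have ht : Filter.Tendsto (fun w : ℝ × ℝ => 2 * C * ‖w - (x, y)‖ ^ a)
      (nhdsWithin (x, y) (strip L)) (nhds 0) := by
    have : Filter.Tendsto (fun w : ℝ × ℝ => 2 * C * ‖w - (x, y)‖ ^ a) (nhds (x, y))
        (nhds (2 * C * ‖((x, y) : ℝ × ℝ) - (x, y)‖ ^ a)) :=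
      Continuous.tendsto (continuous_const.mul
        ((continuous_id.sub continuous_const).norm.rpow_const fun _ => Or.inr ha.le)) _
    rw [sub_self, norm_zero, Real.zero_rpow ha.ne', mul_zero] at this
    exact this.mono_left nhdsWithin_le_nhds
  filter_upwards [self_mem_nhdsWithin, ht.eventually (gt_mem_nhds hc)] with w hw hwc
  have := key w hw
  rw [Real.norm_eq_abs]
  refine le_trans (le_of_eq ?_) (this.trans (by gcongr))
  simp

theorem norm_fst_smul_add_snd_smul_le (p q : ℝ) :
    ‖p • ContinuousLinearMap.fst ℝ ℝ ℝ + q • ContinuousLinearMap.snd ℝ ℝ ℝ‖ ≤ |p| + |q| := by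
  refine ContinuousLinearMap.opNorm_le_bound _ (by positivity) fun z => ?_
  have h1 : |z.1| ≤ ‖z‖ := norm_fst_le z
  have h2 : |z.2| ≤ ‖z‖ := norm_snd_le z
  calc _ = |p * z.1 + q * z.2| := by simp
    _ ≤ |p| * |z.1| + |q| * |z.2| := (abs_add_le _ _).trans (by rw [abs_mul, abs_mul])
    _ ≤ |p| * ‖z‖ + |q| * ‖z‖ := by gcongr
    _ = _ := by ring

theorem C2F.exists_f2 (ha : a ∈ Ioo (0:ℝ) 1) {v v1 v2 v11 v12 v22 : ℝ → ℝ → ℝ}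
    (h : C2F L a C v v1 v2 v11 v12 v22) :
    ∃ f' f'', F2 a (4 * C) (strip L) (fun z => v z.1 z.2) f' f'' := by
  let ℓ₁ := ContinuousLinearMap.fst ℝ ℝ ℝ
  let ℓ₂ := ContinuousLinearMap.snd ℝ ℝ ℝ
  have hℓ₁ : ‖ℓ₁‖ ≤ 1 := ContinuousLinearMap.norm_fst_le ..
  have hℓ₂ : ‖ℓ₂‖ ≤ 1 := ContinuousLinearMap.norm_snd_le ..
  have hT : ∀ p q r s : ℝ, ‖(p • ℓ₁ + q • ℓ₂).smulRight ℓ₁ + (r • ℓ₁ + s • ℓ₂).smulRight ℓ₂‖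
      ≤ |p| + |q| + (|r| + |s|) := fun p q r s => by
    refine (norm_add_le (E := ℝ × ℝ →L[ℝ] ℝ × ℝ →L[ℝ] ℝ) _ _).trans ?_
    rw [ContinuousLinearMap.norm_smulRight_apply, ContinuousLinearMap.norm_smulRight_apply]
    have h1 := norm_fst_smul_add_snd_smul_le p q
    have h2 := norm_fst_smul_add_snd_smul_le r s
    exact add_le_add ((mul_le_of_le_one_right (norm_nonneg _) hℓ₁).trans h1)
      ((mul_le_of_le_one_right (norm_nonneg _) hℓ₂).trans h2)
  have j1 := h.f1.jb ha h.b1 h.b11.bd h.b12.bd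
  have j2 := h.f2.jb ha h.b2 h.b12.bd h.b22.bd
  refine ⟨fun z => v1 z.1 z.2 • ℓ₁ + v2 z.1 z.2 • ℓ₂, fun z =>
    (v11 z.1 z.2 • ℓ₁ + v12 z.1 z.2 • ℓ₂).smulRight ℓ₁ +
      (v12 z.1 z.2 • ℓ₁ + v22 z.1 z.2 • ℓ₂).smulRight ℓ₂,
    fun z hz => h.f0.hasFDerivWithinAt ha.1 j1.jh j2.jh hz, fun z hz => ?_, fun z hz => ?_,
    fun z hz => ?_, fun z hz => ?_, fun z hz w hw => ?_⟩
  · exact ((h.f1.hasFDerivWithinAt ha.1 h.b11.jh h.b12.jh hz).smul_const ℓ₁).add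
      ((h.f2.hasFDerivWithinAt ha.1 h.b12.jh h.b22.jh hz).smul_const ℓ₂)
  · have := h.b0 z.2 hz.2 z.1
    have := abs_nonneg (v z.1 z.2)
    rw [Real.norm_eq_abs]; linarith
  · refine (norm_fst_smul_add_snd_smul_le _ _).trans ?_
    linarith [h.b1 z.2 hz.2 z.1, h.b2 z.2 hz.2 z.1, abs_nonneg (v1 z.1 z.2)]
  · refine (hT _ _ _ _).trans ?_
    linarith [h.b11.bd z.2 hz.2 z.1, h.b12.bd z.2 hz.2 z.1, h.b22.bd z.2 hz.2 z.1]
  · have e : ∀ p q s p' q' s' : ℝ,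
        (p • ℓ₁ + q • ℓ₂).smulRight ℓ₁ + (q • ℓ₁ + s • ℓ₂).smulRight ℓ₂ -
        ((p' • ℓ₁ + q' • ℓ₂).smulRight ℓ₁ + (q' • ℓ₁ + s' • ℓ₂).smulRight ℓ₂) =
        ((p - p') • ℓ₁ + (q - q') • ℓ₂).smulRight ℓ₁ +
          ((q - q') • ℓ₁ + (s - s') • ℓ₂).smulRight ℓ₂ := fun p q s p' q' s' => by
      ext <;> simp [ℓ₁, ℓ₂]
    rw [e]
    refine (hT _ _ _ _).trans ?_
    have hn : ‖z - w‖ = max |z.1 - w.1| |z.2 - w.2| := rfl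
    have k1 := h.b11.jh z.2 hz.2 w.2 hw.2 z.1 w.1
    have k2 := h.b12.jh z.2 hz.2 w.2 hw.2 z.1 w.1
    have k3 := h.b22.jh z.2 hz.2 w.2 hw.2 z.1 w.1
    rw [hn]
    linarith

theorem C2F.trace (ha : a ∈ Ioo (0:ℝ) 1) {v v1 v2 v11 v12 v22 : ℝ → ℝ → ℝ}
    (h : C2F L a C v v1 v2 v11 v12 v22) {y : ℝ} (hy : y ∈ Icc 0 L) :
    H2 a (2 * C) (fun x => v x y) (fun x => v1 x y) (fun x => v11 x y) := by
  have hC : 0 ≤ C := (abs_nonneg _).trans (h.b0 y hy 0)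
  have h2 : HB a C fun x => v11 x y := ⟨h.b11.bd y hy, fun x x' => by
    simpa using h.b11.jh y hy y hy x x'⟩
  exact ⟨h.f0.dx y hy, h.f1.dx y hy, HB.of_deriv ha.1 ha.2.le (h.b0 y hy) (h.f0.dx y hy) (h.b1 y hy),
    HB.of_deriv ha.1 ha.2.le (h.b1 y hy) (h.f1.dx y hy) (h.b11.bd y hy), h2.mono (by linarith)⟩

theorem F2.h2_real (ha : a ∈ Ioo (0:ℝ) 1) {f : ℝ → ℝ} {f' f''} (h : F2 a C univ f f' f'') :
    H2 a (2 * C) f (fun x => f' x 1) (fun x => f'' x 1 1) := by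
  have hC : 0 ≤ C := (norm_nonneg _).trans (h.b0 0 (mem_univ _))
  have n1 : ‖(1 : ℝ)‖ = 1 := norm_one
  have happ2 : ∀ T : ℝ →L[ℝ] ℝ →L[ℝ] ℝ, |T 1 1| ≤ ‖T‖ := fun T => by
    have e1 := T.le_opNorm 1
    have e2 := (T 1).le_opNorm 1
    rw [n1, mul_one] at e1 e2
    exact e2.trans e1
  have d0 : ∀ x, HasDerivAt f (f' x 1) x := fun x =>
    (hasFDerivWithinAt_univ.1 (h.d1 x (mem_univ x))).hasDerivAt
  have d1 : ∀ x, HasDerivAt (fun x => f' x 1) (f'' x 1 1) x := fun x =>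
    ((hasFDerivWithinAt_univ.1 (h.d2 x (mem_univ x))).hasDerivAt.clm_apply
      (hasDerivAt_const x 1)).congr_deriv (by simp)
  have b1 : ∀ x, |f' x 1| ≤ C := fun x => by
    have e2 := (f' x).le_opNorm 1
    rw [n1, mul_one] at e2
    exact e2.trans (h.b1 x (mem_univ x))
  have h2 : HB a C fun x => f'' x 1 1 := ⟨fun x => (happ2 _).trans (h.b2 x (mem_univ x)),
    fun x x' => (happ2 (f'' x - f'' x')).trans (h.h2 x (mem_univ x) x' (mem_univ x'))⟩
  exact ⟨d0, d1, HB.of_deriv ha.1 ha.2.le (fun x => h.b0 x (mem_univ x)) d0 b1,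
    HB.of_deriv ha.1 ha.2.le b1 d1 h2.1, h2.mono (by linarith)⟩

end

section
open MeasureTheory

variable {L a C C' η : ℝ}

theorem JB.const_mul {v : ℝ → ℝ → ℝ} (h : JB L a C v) (c : ℝ) :
    JB L a (|c| * C) fun x y => c * v x y :=
  ⟨fun y hy x => by
    rw [abs_mul]; exact mul_le_mul_of_nonneg_left (h.bd y hy x) (abs_nonneg _),
    fun y hy y' hy' x x' => by
    rw [← mul_sub, abs_mul, mul_assoc]
    exact mul_le_mul_of_nonneg_left (h.jh y hy y' hy' x x') (abs_nonneg _)⟩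

theorem C1F.const_mul {v v1 v2 : ℝ → ℝ → ℝ} (h : C1F L v v1 v2) (c : ℝ) :
    C1F L (fun x y => c * v x y) (fun x y => c * v1 x y) fun x y => c * v2 x y :=
  ⟨fun y hy x => (h.dx y hy x).const_mul c, fun y hy x => (h.dy y hy x).const_mul c⟩

theorem C1F.congr {v w v1 v2 : ℝ → ℝ → ℝ} (h : C1F L v v1 v2)
    (hw : ∀ y ∈ Icc 0 L, ∀ x, w x y = v x y) : C1F L w v1 v2 :=
  ⟨fun y hy x => by simpa only [hw y hy] using h.dx y hy x,
    fun y hy x => (h.dy y hy x).congr (fun t ht => hw t ht x) (hw y hy x)⟩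

namespace C2F
variable {v v1 v2 v11 v12 v22 w w1 w2 w11 w12 w22 : ℝ → ℝ → ℝ}

theorem add (h : C2F L a C v v1 v2 v11 v12 v22) (h' : C2F L a C' w w1 w2 w11 w12 w22) :
    C2F L a (C + C') (fun x y => v x y + w x y) (fun x y => v1 x y + w1 x y)
      (fun x y => v2 x y + w2 x y) (fun x y => v11 x y + w11 x y)
      (fun x y => v12 x y + w12 x y) (fun x y => v22 x y + w22 x y) :=
  ⟨h.f0.add h'.f0, h.f1.add h'.f1, h.f2.add h'.f2,
    fun y hy x => (abs_add_le _ _).trans (add_le_add (h.b0 y hy x) (h'.b0 y hy x)),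
    fun y hy x => (abs_add_le _ _).trans (add_le_add (h.b1 y hy x) (h'.b1 y hy x)),
    fun y hy x => (abs_add_le _ _).trans (add_le_add (h.b2 y hy x) (h'.b2 y hy x)),
    h.b11.add h'.b11, h.b12.add h'.b12, h.b22.add h'.b22⟩

theorem const_mul (h : C2F L a C v v1 v2 v11 v12 v22) (c : ℝ) :
    C2F L a (|c| * C) (fun x y => c * v x y) (fun x y => c * v1 x y) (fun x y => c * v2 x y)
      (fun x y => c * v11 x y) (fun x y => c * v12 x y) (fun x y => c * v22 x y) := by
  have hc : ∀ {t K : ℝ}, |t| ≤ K → |c * t| ≤ |c| * K := fun ht => by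
    rw [abs_mul]; exact mul_le_mul_of_nonneg_left ht (abs_nonneg _)
  exact ⟨h.f0.const_mul c, h.f1.const_mul c, h.f2.const_mul c, fun y hy x => hc (h.b0 y hy x),
    fun y hy x => hc (h.b1 y hy x), fun y hy x => hc (h.b2 y hy x), h.b11.const_mul c,
    h.b12.const_mul c, h.b22.const_mul c⟩

theorem congr (h : C2F L a C v v1 v2 v11 v12 v22) (hw : ∀ y ∈ Icc 0 L, ∀ x, w x y = v x y) :
    C2F L a C w v1 v2 v11 v12 v22 :=
  ⟨h.f0.congr hw, h.f1, h.f2, fun y hy x => by rw [hw y hy]; exact h.b0 y hy x, h.b1, h.b2, h.b11,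
    h.b12, h.b22⟩

theorem mono (h : C2F L a C v v1 v2 v11 v12 v22) (hC : C ≤ C') :
    C2F L a C' v v1 v2 v11 v12 v22 :=
  ⟨h.f0, h.f1, h.f2, fun y hy x => (h.b0 y hy x).trans hC, fun y hy x => (h.b1 y hy x).trans hC,
    fun y hy x => (h.b2 y hy x).trans hC, h.b11.mono hC, h.b12.mono hC, h.b22.mono hC⟩

end C2F

/-- `f` is of class `C^{2,a}` on the strip, of size `C`. -/
def E2 (L a C : ℝ) (f : ℝ → ℝ → ℝ) : Prop :=
  ∃ v1 v2 v11 v12 v22, C2F L a C f v1 v2 v11 v12 v22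

theorem norm_fst_clm_le : ‖ContinuousLinearMap.fst ℝ ℝ ℝ‖ ≤ 1 := ContinuousLinearMap.norm_fst_le ..

theorem norm_snd_clm_le : ‖ContinuousLinearMap.snd ℝ ℝ ℝ‖ ≤ 1 := ContinuousLinearMap.norm_snd_le ..

theorem F2.e2_components (ha : 0 < a) {f : ℝ × ℝ → ℝ × ℝ} {f' f''}
    (h : F2 a C (strip L) f f' f'') :
    E2 L a C (fun x y => (f (x, y)).1) ∧ E2 L a C (fun x y => (f (x, y)).2) := by
  have h1 := (h.comp_clm _ norm_fst_clm_le).c2f ha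
  have h2 := (h.comp_clm _ norm_snd_clm_le).c2f ha
  rw [one_mul] at h1 h2
  exact ⟨⟨_, _, _, _, _, h1⟩, ⟨_, _, _, _, _, h2⟩⟩

theorem MemC.differentiableOn {f : ℝ × ℝ → ℝ × ℝ} (h : MemC 2 a (strip L) f) :
    DifferentiableOn ℝ (c1 f) (strip L) ∧ DifferentiableOn ℝ (c2 f) (strip L) := by
  have := h.1.differentiableOn (by norm_num)
  exact ⟨fun z hz => (this z hz).fst, fun z hz => (this z hz).snd⟩

theorem MemC.e2 (hL : 0 < L) (ha : 0 < a) {f : ℝ × ℝ → ℝ} (h : MemC 2 a (strip L) f) :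
    ∃ C, E2 L a C fun x y => f (x, y) :=
  ⟨_, _, _, _, _, _, (F2.of_memC (uniqueDiffOn_strip hL) h).c2f ha⟩

theorem contDiffOn_c1 {f : ℝ × ℝ → ℝ × ℝ} (h : MemC 2 a (strip L) f) :
    ContDiffOn ℝ 2 (c1 f) (strip L) :=
  contDiff_fst.comp_contDiffOn h.1

/-- The curl, in terms of partial derivatives of the components. -/
theorem curl_div_eq (hL : 0 < L) {B : ℝ × ℝ → ℝ × ℝ} (hB : MemC 2 a (strip L) B)
    {u1 u2 v1 v2 : ℝ → ℝ → ℝ} (h1 : C1F L (fun x y => (B (x, y)).1) u1 u2)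
    (h2 : C1F L (fun x y => (B (x, y)).2) v1 v2) {x y : ℝ} (hy : y ∈ Icc 0 L) :
    curlF L B (x, y) = v1 x y - u2 x y ∧ divF L B (x, y) = u1 x y + v2 x y := by
  obtain ⟨e1, e2⟩ := pdx_eq hL (hB.differentiableOn.1 _ (mem_strip.2 hy)) h1 (fun _ _ _ => rfl) hy
  obtain ⟨e3, e4⟩ := pdx_eq hL (hB.differentiableOn.2 _ (mem_strip.2 hy)) h2 (fun _ _ _ => rfl) hy
  exact ⟨by rw [curlF, e3, e2], by rw [divF, e1, e4]⟩

theorem const_of_C1F_zero {v v1 v2 : ℝ → ℝ → ℝ} (h : C1F L v v1 v2)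
    (h1 : ∀ y ∈ Icc 0 L, ∀ x, v1 x y = 0) (h2 : ∀ y ∈ Icc 0 L, ∀ x, v2 x y = 0) {x x' y y' : ℝ}
    (hy : y ∈ Icc 0 L) (hy' : y' ∈ Icc 0 L) : v x y = v x' y' := by
  have := h.lip (C := 0) (fun y hy x => by rw [h1 y hy, abs_zero])
    (fun y hy x => by rw [h2 y hy, abs_zero]) y hy y' hy' x x'
  rw [zero_mul] at this
  exact sub_eq_zero.1 (abs_eq_zero.1 (le_antisymm this (abs_nonneg _)))

/-- A current-free field with small first component is close to a constant vertical field. -/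
theorem background (hL : 0 < L) (ha : a ∈ Ioo (0:ℝ) 1) {B₀ : ℝ × ℝ → ℝ × ℝ} {p₀ : ℝ × ℝ → ℝ}
    (hB : BP L 2 a B₀ p₀) (hM : MHS L B₀ p₀) (hc : ∀ z ∈ strip L, curlF L B₀ z = 0)
    (hη : 0 ≤ η) (hb : hNorm 2 a (strip L) (c1 B₀) ≤ ENNReal.ofReal η) {f : ℝ → ℝ}
    (hf : ∀ x, |f x| ≤ η) (hfc : Continuous f) :
    E2 L a η (fun x y => (B₀ (x, y)).1) ∧
    E2 L a (η * (2 + L)) (fun x y => (B₀ (x, y)).2 - ∫ t in (0:ℝ)..1, ((B₀ (t, 0)).2 - f t)) ∧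
    ∀ y ∈ Icc 0 L, ∀ x, p₀ (x, y) = p₀ (0, 0) := by
  have m0 : (0:ℝ) ∈ Icc 0 L := ⟨le_rfl, hL.le⟩
  obtain ⟨hPx, hPp, hBm, hpm⟩ := hB
  have hs := uniqueDiffOn_strip hL
  obtain ⟨u1, u2, u11, u12, u22, hu⟩ : E2 L a η (fun x y => (B₀ (x, y)).1) :=
    ⟨_, _, _, _, _, (F2.of_hNorm hs (contDiffOn_c1 hBm) hη hb).c2f ha.1⟩
  obtain ⟨v1, v2, v11, v12, v22, hv⟩ := ((F2.of_memC hs hBm).e2_components ha.1).2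
  have hcd := fun {x y : ℝ} (hy : y ∈ Icc 0 L) => curl_div_eq hL hBm hu.f0 hv.f0 (x := x) hy
  have e1 : ∀ y ∈ Icc 0 L, ∀ x, v1 x y = u2 x y := fun y hy x => by
    have := (hcd (x := x) hy).1
    rw [hc _ (mem_strip.2 hy)] at this
    linarith
  have e2 : ∀ y ∈ Icc 0 L, ∀ x, v2 x y = -u1 x y := fun y hy x => by
    have := (hcd (x := x) hy).2
    rw [(hM _ (mem_strip.2 hy)).2.2] at this
    linarith
  have f0 : C1F L (fun x y => (B₀ (x, y)).2) u2 (fun x y => -u1 x y) :=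
    ⟨fun y hy x => e1 y hy x ▸ hv.f0.dx y hy x, fun y hy x => e2 y hy x ▸ hv.f0.dy y hy x⟩
  have hL0 : η ≤ η * (2 + L) := by nlinarith
  refine ⟨⟨_, _, _, _, _, hu⟩, ⟨u2, fun x y => -u1 x y, u12, fun x y => -u11 x y,
    fun x y => -u12 x y, ⟨⟨fun y hy x => (f0.dx y hy x).sub_const _,
      fun y hy x => (f0.dy y hy x).sub_const _⟩,
    ⟨hu.f2.dx, fun y hy x => ?_⟩, hu.f1.neg, fun y hy x => ?_,
    fun y hy x => (hu.b2 y hy x).trans hL0,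
    fun y hy x => by rw [abs_neg]; exact (hu.b1 y hy x).trans hL0, hu.b12.mono hL0,
    (hu.b11.mono hL0).neg, (hu.b12.mono hL0).neg⟩⟩, fun y hy x => ?_⟩
  · refine dy_of_mixed (K := η) ha.1 f0.dx f0.dy hu.f1.neg.dx hu.b11.neg.jh y hy x
  · have hv0c : Continuous fun t => (B₀ (t, 0)).2 :=
      continuous_iff_continuousAt.2 fun t => (f0.dx 0 m0 t).continuousAt
    have hper : ∀ t, (B₀ (t + 1, y)).2 = (B₀ (t, y)).2 := fun t => by rw [hPx]
    rw [← fract_of_per (S := fun t => (B₀ (t, y)).2) hper x]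
    set ξ := Int.fract x
    have hξ0 : 0 ≤ ξ := Int.fract_nonneg x
    have hξ1 : ξ ≤ 1 := (Int.fract_lt_one x).le
    have key := intervalIntegral.norm_integral_le_of_norm_le_const (a := (0:ℝ)) (b := 1)
      (f := fun t => (B₀ (ξ, y)).2 - ((B₀ (t, 0)).2 - f t)) (C := η * (2 + L)) fun t ht => by
        rw [uIoc_of_le zero_le_one] at ht
        have h1 := f0.lip (C := η) hu.b2 (fun y hy x => by rw [abs_neg]; exact hu.b1 y hy x)
          y hy 0 m0 ξ t
        have h2 : |ξ - t| ≤ 1 := abs_le.2 ⟨by linarith [ht.2], by linarith [ht.1]⟩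
        have h3 : |y - 0| ≤ L := by rw [sub_zero, abs_of_nonneg hy.1]; exact hy.2
        rw [Real.norm_eq_abs, ← sub_add]
        refine (abs_add_le _ _).trans ?_
        have h4 : η * (|ξ - t| + |y - 0|) ≤ η * (1 + L) := by gcongr
        linarith [hf t]
    have hgc : Continuous fun t => (B₀ (t, 0)).2 - f t := hv0c.sub hfc
    rw [intervalIntegral.integral_sub (f := fun _ => (B₀ (ξ, y)).2)
      (continuous_const.intervalIntegrable _ _) (hgc.intervalIntegrable _ _)] at key
    simpa using key
  · obtain ⟨C, p1, p2, p11, p12, p22, hp⟩ := hpm.e2 hL ha.1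
    have hd := hpm.1.differentiableOn (by norm_num)
    have hpp := fun {x y : ℝ} (hy : y ∈ Icc 0 L) => pdx_eq hL (hd _ (mem_strip.2 hy)) hp.f0
      (fun _ _ _ => rfl) (x := x) hy
    refine const_of_C1F_zero hp.f0 (fun y hy x => ?_) (fun y hy x => ?_) hy m0
    · rw [← (hpp hy).1, ← neg_eq_zero, ← (hM _ (mem_strip.2 hy)).1, hc _ (mem_strip.2 hy), mul_zero]
    · rw [← (hpp hy).2, ← neg_eq_zero, ← (hM _ (mem_strip.2 hy)).2.1, hc _ (mem_strip.2 hy),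
        mul_zero]

end

section
open MeasureTheory

variable {L a C C' R r κ m P₀ : ℝ} {D : Dat} {qb qm qt : ℝ → ℝ}

theorem C2F.sub_const {v v1 v2 v11 v12 v22 : ℝ → ℝ → ℝ} (h : C2F L a C v v1 v2 v11 v12 v22)
    (c : ℝ) : C2F L a (C + |c|) (fun x y => v x y - c) v1 v2 v11 v12 v22 :=
  have hC : C ≤ C + |c| := le_add_of_nonneg_right (abs_nonneg c)
  ⟨⟨fun y hy x => (h.f0.dx y hy x).sub_const c, fun y hy x => (h.f0.dy y hy x).sub_const c⟩,
    h.f1, h.f2, fun y hy x => (abs_sub _ _).trans (add_le_add_left (h.b0 y hy x) _),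
    fun y hy x => (h.b1 y hy x).trans hC, fun y hy x => (h.b2 y hy x).trans hC, h.b11.mono hC,
    h.b12.mono hC, h.b22.mono hC⟩

theorem E2.f2 (ha : a ∈ Ioo (0:ℝ) 1) {f : ℝ × ℝ → ℝ} (h : E2 L a C fun x y => f (x, y)) :
    ∃ f' f'', F2 a (4 * C) (strip L) f f' f'' := by
  obtain ⟨_, _, _, _, _, h⟩ := h
  exact h.exists_f2 ha

theorem E2.hNorm_le (hL : 0 < L) (ha : a ∈ Ioo (0:ℝ) 1) {f : ℝ × ℝ → ℝ × ℝ} (hC : 0 ≤ C)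
    (h1 : E2 L a C fun x y => (f (x, y)).1) (h2 : E2 L a C fun x y => (f (x, y)).2) :
    ContDiffOn ℝ 2 f (strip L) ∧ hNorm 2 a (strip L) f ≤ ENNReal.ofReal (32 * C) := by
  obtain ⟨f', f'', hf⟩ := E2.f2 (f := fun z => (f z).1) ha h1
  obtain ⟨g', g'', hg⟩ := E2.f2 (f := fun z => (f z).2) ha h2
  have n1 : ‖ContinuousLinearMap.inl ℝ ℝ ℝ‖ ≤ 1 := ContinuousLinearMap.norm_inl_le_one ..
  have n2 : ‖-ContinuousLinearMap.inr ℝ ℝ ℝ‖ ≤ 1 := by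
    rw [norm_neg]; exact ContinuousLinearMap.norm_inr_le_one ..
  have h := (hf.comp_clm _ n1).sub (hg.comp_clm _ n2)
  have e : (fun z => ContinuousLinearMap.inl ℝ ℝ ℝ (f z).1 -
      (-ContinuousLinearMap.inr ℝ ℝ ℝ) (f z).2) = f := by
    funext z
    ext <;> simp
  rw [e] at h
  have hs := uniqueDiffOn_strip hL
  refine ⟨h.contDiffOn ha.1 hs, (h.hNorm_le hs (by positivity)).trans
    (ENNReal.ofReal_le_ofReal (by linarith))⟩

theorem E2.memC_real (hL : 0 < L) (ha : a ∈ Ioo (0:ℝ) 1) {f : ℝ × ℝ → ℝ} (hC : 0 ≤ C)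
    (h : E2 L a C fun x y => f (x, y)) : MemC 2 a (strip L) f := by
  obtain ⟨f', f'', hf⟩ := h.f2 ha
  have hs := uniqueDiffOn_strip hL
  exact ⟨hf.contDiffOn ha.1 hs, (hf.hNorm_le hs (by positivity)).trans_lt ENNReal.ofReal_lt_top⟩

theorem C1F.components (hκ : κ ≠ 0) {B : ℝ × ℝ → ℝ × ℝ} {u1 u2 V1 V2 : ℝ → ℝ → ℝ}
    (hu : C1F L (fun x y => κ * (B (x, y)).1) u1 u2)
    (hV : C1F L (fun x y => κ * (B (x, y)).2 - 1) V1 V2) :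
    C1F L (fun x y => (B (x, y)).1) (fun x y => κ⁻¹ * u1 x y) (fun x y => κ⁻¹ * u2 x y) ∧
      C1F L (fun x y => (B (x, y)).2) (fun x y => κ⁻¹ * V1 x y) (fun x y => κ⁻¹ * V2 x y) := by
  refine ⟨(hu.const_mul κ⁻¹).congr fun y hy x => ?_, ?_⟩
  · field_simp
  · have h : C1F L (fun x y => κ * (B (x, y)).2) V1 V2 :=
      ⟨fun y hy x => by simpa using (hV.dx y hy x).add_const 1,
        fun y hy x => by simpa using (hV.dy y hy x).add_const 1⟩
    exact (h.const_mul κ⁻¹).congr fun y hy x => by field_simp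

theorem bernoulli_deriv (hκ : κ ≠ 0) {B : ℝ × ℝ → ℝ × ℝ} {p : ℝ × ℝ → ℝ}
    {u1 u2 V1 V2 p1 p2 : ℝ → ℝ → ℝ} (hu : C1F L (fun x y => κ * (B (x, y)).1) u1 u2)
    (hV : C1F L (fun x y => κ * (B (x, y)).2 - 1) V1 V2)
    (hp : C1F L (fun x y => κ ^ 2 * (p (x, y) - P₀)) p1 p2) {x y : ℝ} (hy : y ∈ Icc 0 L) :
    κ ^ 2 * deriv (fun t => p (t, y) + sq B (t, y) / 2) x = p1 x y + κ * (B (x, y)).1 * u1 x y +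
      (1 + (κ * (B (x, y)).2 - 1)) * V1 x y ∧
    DifferentiableAt ℝ (fun t => p (t, y) + sq B (t, y) / 2) x := by
  have h := ((hp.dx y hy x).add ((((hu.dx y hy x).pow 2).add
    (((hV.dx y hy x).const_add 1).pow 2)).div_const 2))
  have h' : HasDerivAt (fun t => p (t, y) + sq B (t, y) / 2) _ x :=
    ((h.const_mul (κ ^ 2)⁻¹).add_const P₀).congr_of_eventuallyEq
      (Filter.Eventually.of_forall fun t => by
        simp only [sq, Pi.add_apply, Pi.pow_apply]
        field_simp
        ring)
  refine ⟨?_, h'.differentiableAt⟩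
  rw [h'.deriv]
  field_simp
  ring

/-- A solution, suitably normalised, is a fixed point of the solution operator. -/
theorem state_of_solution (hL : 0 < L) (ha : a ∈ Ioo (0:ℝ) 1) (hD : DV a R D) (hR16 : R ≤ 1 / 16)
    (hR : 4 * r * (1 + L) ≤ R) (hr : 0 ≤ r) (hbr : ∀ x, |D.b 0 x| ≤ r) (hD0 : D.b 0 0 = 0)
    (hw : ∀ x, D.w x * (1 + D.b 1 x) = 1)
    (hk : ∀ x, D.k0 x = qm x * D.w x - D.b 2 x) (hqm : ∀ x, HasDerivAt qb (qm x) x)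
    (hκ : κ ≠ 0) {B : ℝ × ℝ → ℝ × ℝ} {p : ℝ × ℝ → ℝ} (hB : BP L 2 a B p) (hM : MHS L B p)
    (hu : E2 L a r fun x y => κ * (B (x, y)).1) (hV : E2 L a r fun x y => κ * (B (x, y)).2 - 1)
    (hb : ∀ x, κ * (B (x, 0)).2 - 1 = D.b 1 x)
    (hbot : ∀ x, κ ^ 2 * (p (x, 0) + sq B (x, 0) / 2 - P₀) = qb x)
    (htop : ∀ x, κ ^ 2 * deriv (fun t => p (t, L) + sq B (t, L) / 2) x = D.q x)
    (hJ : κ * fluxC L B = D.J) :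
    ∃ S, Step L D S S ∧ St L a R S ∧
      (∀ y ∈ Icc 0 L, ∀ x, κ * (B (x, y)).2 - 1 = S 1 x y) ∧
      ∀ y ∈ Icc 0 L, ∀ x, -(κ * (B (x, y)).1) = S 2 x y := by
  have mL : L ∈ Icc 0 L := ⟨hL.le, le_rfl⟩
  obtain ⟨hPB, hPp, hBm, hpm⟩ := hB
  obtain ⟨u1, u2, u11, u12, u22, hu⟩ := hu
  obtain ⟨V1, V2, V11, V12, V22, hV⟩ := hV
  obtain ⟨C, p1, p2, p11, p12, p22, hp⟩ := hpm.e2 hL ha.1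
  have hp' := (hp.sub_const P₀).const_mul (κ ^ 2)
  obtain ⟨b1, b2⟩ := hu.f0.components hκ hV.f0
  have hcd := fun {x y : ℝ} (hy : y ∈ Icc 0 L) => curl_div_eq hL hBm b1 b2 (x := x) hy
  have hd := hpm.1.differentiableOn (by norm_num)
  have hpp := fun {x y : ℝ} (hy : y ∈ Icc 0 L) => pdx_eq hL (hd _ (mem_strip.2 hy)) hp.f0
    (fun _ _ _ => rfl) (x := x) hy
  have hup : ∀ y ∈ Icc 0 L, ∀ x, κ * (B (x + 1, y)).1 = κ * (B (x, y)).1 := fun y _ x => by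
    rw [hPB]
  have hVp : ∀ y ∈ Icc 0 L, ∀ x, κ * (B (x + 1, y)).2 - 1 = κ * (B (x, y)).2 - 1 :=
    fun y _ x => by rw [hPB]
  have hdiv : ∀ y ∈ Icc 0 L, ∀ x, u1 x y + V2 x y = 0 := fun y hy x => by
    have := (hM (x, y) (mem_strip.2 hy)).2.2
    rw [(hcd hy).2, ← mul_add] at this
    exact (mul_eq_zero.1 this).resolve_left (inv_ne_zero hκ)
  refine ⟨stOf D L (fun x y => κ * (B (x, y)).1) (fun x y => κ * (B (x, y)).2 - 1) V1 V2,
    (stOf_step hL ha hD hR16 hR hr hbr hD0 hw hk hqm hu hV hp' hup hVp hdiv (fun y hy x => ?_)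
      (fun y hy x => ?_) hb (fun x => ?_) (fun x => ?_) ?_).1,
    stOf_st hL ha hD hR hr hbr hu hV hdiv hb hup hVp, fun y hy x => rfl, fun y hy x => rfl⟩
  · have := (hM (x, y) (mem_strip.2 hy)).1
    rw [(hcd hy).1, (hpp hy).1] at this
    field_simp at this
    linear_combination (-κ) * this
  · have := (hM (x, y) (mem_strip.2 hy)).2.1
    rw [(hcd hy).1, (hpp hy).2] at this
    field_simp at this
    linear_combination κ * this
  · rw [← hbot, sq]
    ring
  · rw [← htop, (bernoulli_deriv hκ hu.f0 hV.f0 hp'.f0 mL).1]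
  · rw [← hJ, fluxC, intervalIntegral.integral_const_mul]
    ring

/-- Every fixed point of the solution operator yields a solution. -/
theorem exists_solution (hL : 0 < L) (ha : a ∈ Ioo (0:ℝ) 1) (hD : DV a (R * Rmax L a) D)
    (hR0 : 0 ≤ R) (hR : R ≤ Rmax L a) (hD0 : D.b 0 0 = 0)
    (hw : ∀ x, D.w x * (1 + D.b 1 x) = 1) {Cq : ℝ}
    (hk : ∀ x, D.k0 x = qm x * D.w x - D.b 2 x) (hqm : ∀ x, HasDerivAt qb (qm x) x)
    (hqp : ∀ x, qb (x + 1) = qb x) (hqB : ∀ x, |qb x| ≤ Cq)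
    (hqt : ∀ x, HasDerivAt qt (D.q x) x) (hqtp : ∀ x, qt (x + 1) = qt x) (hm : κ * m = 1) :
    ∃ B p, BP L 2 a B p ∧ MHS L B p ∧ E2 L a (|m| * (2000 * R)) (fun x y => (B (x, y)).1) ∧
      E2 L a (|m| * (2000 * R)) (fun x y => (B (x, y)).2 - m) ∧
      (∀ x, κ * (B (x, 0)).2 - 1 = D.b 1 x) ∧
      (∀ x, κ ^ 2 * (p (x, 0) + sq B (x, 0) / 2 - P₀) = qb x) ∧
      (∀ x, κ ^ 2 * deriv (fun t => p (t, L) + sq B (t, L) / 2) x = D.q x) ∧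
      κ * fluxC L B = D.J := by
  have m0 : (0:ℝ) ∈ Icc 0 L := ⟨le_rfl, hL.le⟩
  have mL : L ∈ Icc 0 L := ⟨hL.le, le_rfl⟩
  have h16 := Rmax_le hL ha
  have hκ : κ ≠ 0 := left_ne_zero_of_mul_eq_one hm
  have hm0 : m ≠ 0 := right_ne_zero_of_mul_eq_one hm
  have hκm : κ = m⁻¹ := eq_inv_of_mul_eq_one_left hm
  obtain ⟨S, hS, hs, hT⟩ := fixed_point_exists hL ha hD hR0 hR
  have hDR := hD.mono (D := D) (show R * Rmax L a ≤ R by nlinarith)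
  obtain ⟨T3, T4, fx, fy, P, C, h1, h2, hP, hPp, hPb, hPt⟩ :=
    reconstruct hL ha hDR (hR.trans h16) hs hS hT hw hk hqm hqp hqB hqt hqtp
  have hcl := clamp_mem (L := L) hL.le
  let B : ℝ × ℝ → ℝ × ℝ := fun z => (-m * S 2 z.1 (clamp L z.2), m * (1 + S 1 z.1 (clamp L z.2)))
  let p : ℝ × ℝ → ℝ := fun z => m ^ 2 * P z.1 (clamp L z.2) + P₀
  have eB1 : ∀ y ∈ Icc 0 L, ∀ x, (B (x, y)).1 = -m * S 2 x y := fun y hy x => by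
    simp only [B, clamp_of_mem hy]
  have eB2 : ∀ y ∈ Icc 0 L, ∀ x, (B (x, y)).2 = m * (1 + S 1 x y) := fun y hy x => by
    simp only [B, clamp_of_mem hy]
  have ep : ∀ y ∈ Icc 0 L, ∀ x, p (x, y) = m ^ 2 * P x y + P₀ := fun y hy x => by
    simp only [p, clamp_of_mem hy]
  have hB1 := (h2.const_mul (-m)).congr eB1
  have hB2 := (h1.const_mul m).congr (w := fun x y => (B (x, y)).2 - m) fun y hy x => by
    rw [eB2 y hy]; ring
  rw [abs_neg] at hB1
  have hp2 := ((hP.const_mul (m ^ 2)).sub_const (-P₀)).congr (w := fun x y => p (x, y))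
    fun y hy x => by rw [ep y hy]; ring
  have hn1 : 0 ≤ |m| * (2000 * R) := by positivity
  have hB2' := (hB2.sub_const (-m)).congr (w := fun x y => (B (x, y)).2) fun y hy x => by ring
  have hn2 : |m| * (2000 * R) ≤ |m| * (2000 * R) + |(-m)| := le_add_of_nonneg_right (abs_nonneg _)
  obtain ⟨hBc, hBn⟩ := E2.hNorm_le (f := B) hL ha (hn1.trans hn2)
    ⟨_, _, _, _, _, hB1.mono hn2⟩ ⟨_, _, _, _, _, hB2'⟩
  have hBm : MemC 2 a (strip L) B := ⟨hBc, hBn.trans_lt ENNReal.ofReal_lt_top⟩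
  have hpC := (abs_nonneg _).trans (hp2.b0 0 m0 0)
  have hpm : MemC 2 a (strip L) p := E2.memC_real hL ha hpC ⟨_, _, _, _, _, hp2⟩
  have hd := hpm.1.differentiableOn (by norm_num)
  refine ⟨B, p, ⟨fun x y => ?_, fun x y => ?_, hBm, hpm⟩, ?_, ⟨_, _, _, _, _, hB1⟩,
    ⟨_, _, _, _, _, hB2⟩, fun x => ?_, fun x => ?_, fun x => ?_, ?_⟩
  · simp only [B, hs.per _ _ (hcl y)]
  · simp only [p, hPp _ (hcl y)]
  · rintro ⟨x, y⟩ hz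
    have hy := mem_strip.1 hz
    obtain ⟨e1, e2⟩ := curl_div_eq hL hBm hB1.f0 hB2'.f0 (x := x) hy
    obtain ⟨e3, e4⟩ := pdx_eq hL (hd _ hz) hp2.f0 (fun _ _ _ => rfl) hy
    rw [e1, e2, e3, e4, eB1 y hy, eB2 y hy]
    refine ⟨?_, ?_, ?_⟩ <;> ring
  · have h : S 1 x 0 = D.b 1 x :=
      (hS.sol.dx0 0 m0 x).unique (by simpa only [hS.bot] using hD.d0 x)
    rw [eB2 0 m0, h]
    linear_combination (1 + D.b 1 x) * hm
  · rw [sq, ep 0 m0, eB1 0 m0, eB2 0 m0, ← hPb x, hκm]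
    field_simp
    ring
  · have hu := (hB1.f0.const_mul κ)
    have hV : C1F L (fun x y => κ * (B (x, y)).2 - 1) _ _ :=
      (hB2.f0.const_mul κ).congr fun y hy x => by linear_combination hm
    have hpk : C1F L (fun x y => κ ^ 2 * (p (x, y) - P₀)) _ _ :=
      ((hP.f0.const_mul 1)).congr fun y hy x => by
        rw [ep y hy]
        linear_combination P x y * (κ * m + 1) * hm
    rw [(bernoulli_deriv hκ hu hV hpk mL).1, eB1 L mL, eB2 L mL, ← hPt x, hκm]
    field_simp
    ring
  · have hS2 : ∫ y in (0:ℝ)..L, S 2 0 y = S 0 0 L - S 0 0 0 :=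
      intervalIntegral.integral_eq_sub_of_hasDerivAt_of_le hL.le
        (fun y hy => (hS.sol.dy0 y hy 0).continuousWithinAt)
        (fun y hy => (hS.sol.dy0 y ⟨hy.1.le, hy.2.le⟩ 0).hasDerivAt (Icc_mem_nhds hy.1 hy.2))
        (ContinuousOn.intervalIntegrable_of_Icc hL.le
          fun y hy => (hS.sol.dy2 y hy 0).continuousWithinAt)
    rw [fluxC, intervalIntegral.integral_congr (g := fun y => -m * S 2 0 y) fun y hy => by
      rw [uIcc_of_le hL.le] at hy
      exact eB1 y hy 0, intervalIntegral.integral_const_mul, hS2, hS.J, hS.bot, hD0]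
    linear_combination D.J * hm

end

section
open MeasureTheory

variable {L a δ η κ m vb J : ℝ}

theorem H2.const_mul {f f1 f2 : ℝ → ℝ} (h : H2 a δ f f1 f2) (c : ℝ) :
    H2 a (|c| * δ) (fun x => c * f x) (fun x => c * f1 x) fun x => c * f2 x :=
  ⟨fun x => (h.d0 x).const_mul c, fun x => (h.d1 x).const_mul c, h.h0.const_mul c,
    h.h1.const_mul c, h.h2.const_mul c⟩

theorem H2.mono {f f1 f2 : ℝ → ℝ} (h : H2 a δ f f1 f2) (hδ : δ ≤ η) : H2 a η f f1 f2 :=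
  ⟨h.d0, h.d1, h.h0.mono hδ, h.h1.mono hδ, h.h2.mono hδ⟩

theorem BData.h2 (ha : a ∈ Ioo (0:ℝ) 1) (hη : 0 ≤ η) {f : ℝ → ℝ} (hf : BData 2 a f)
    (h : hNorm 2 a univ f ≤ ENNReal.ofReal η) :
    ∃ f1 f2, H2 a (2 * η) f f1 f2 ∧ ∀ x, |f x| ≤ η := by
  have := F2.of_hNorm uniqueDiffOn_univ hf.2.1 hη h
  exact ⟨_, _, this.h2_real ha, fun x => this.b0 x (mem_univ x)⟩

/-- The normalised problem. The mean of the prescribed vertical field at the bottom is scaled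
to `1`. -/
theorem exists_normalisation (hL : 0 < L) (ha : a ∈ Ioo (0:ℝ) 1) (hvb : 0 < vb) (hη : 0 ≤ η)
    (hηv : η * (2 + L) ≤ vb / 2) (hη1 : 2 / vb * (2 * (2 + L) + 4 / vb) * η ≤ 1 / 1000)
    {B₀ : ℝ × ℝ → ℝ × ℝ} {p₀ : ℝ × ℝ → ℝ} (hB : BP L 2 a B₀ p₀) (hM : MHS L B₀ p₀)
    (hc : ∀ z ∈ strip L, curlF L B₀ z = 0) (hv : ∀ z ∈ strip L, vb ≤ |(B₀ z).2|)
    (hb : hNorm 2 a (strip L) (c1 B₀) ≤ ENNReal.ofReal η) {hm hp fm : ℝ → ℝ}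
    (hhm : BData 2 a hm) (hhp : BData 2 a hp) (hfm : BData 2 a fm)
    (nhm : hNorm 2 a univ hm ≤ ENNReal.ofReal η) (nhp : hNorm 2 a univ hp ≤ ENNReal.ofReal η)
    (nfm : hNorm 2 a univ fm ≤ ENNReal.ofReal η) (hJ : |J - fluxC L B₀| ≤ η) :
    ∃ (κ m : ℝ) (D : Dat) (qb qm qt : ℝ → ℝ) (Cq : ℝ), κ * m = 1 ∧ |κ| ≤ 2 / vb ∧
      DV a (100 * (|κ| * ((2 * (2 + L) + 4 / vb) * η))) D ∧ D.b 0 0 = 0 ∧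
      (∀ x, |D.b 0 x| ≤ 2 * (|κ| * ((2 * (2 + L) + 4 / vb) * η))) ∧
      (∀ x, D.w x * (1 + D.b 1 x) = 1) ∧ (∀ x, D.k0 x = qm x * D.w x - D.b 2 x) ∧
      (∀ x, HasDerivAt qb (qm x) x) ∧ (∀ x, qb (x + 1) = qb x) ∧ (∀ x, |qb x| ≤ Cq) ∧
      (∀ x, HasDerivAt qt (D.q x) x) ∧ (∀ x, qt (x + 1) = qt x) ∧
      (∀ x, D.b 1 x = κ * ((B₀ (x, 0)).2 - fm x) - 1) ∧
      (∀ x, qb x = κ ^ 2 * (sq B₀ (x, 0) / 2 + hm x)) ∧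
      (∀ x, D.q x =
        κ ^ 2 * (deriv (fun t => p₀ (t, L) + sq B₀ (t, L) / 2) x + deriv hp x)) ∧
      D.J = κ * J ∧ E2 L a η (fun x y => (B₀ (x, y)).1) ∧
      E2 L a (η * (2 + L)) (fun x y => (B₀ (x, y)).2 - m) ∧
      ∀ y ∈ Icc 0 L, ∀ x, p₀ (x, y) = p₀ (0, 0) := by
  have m0 : (0:ℝ) ∈ Icc 0 L := ⟨le_rfl, hL.le⟩
  have mL : L ∈ Icc 0 L := ⟨hL.le, le_rfl⟩
  obtain ⟨g1, g2, hg, -⟩ := hhm.h2 ha hη nhm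
  obtain ⟨k1, k2, hk, -⟩ := hhp.h2 ha hη nhp
  obtain ⟨f1, f2, hf, hfb⟩ := hfm.h2 ha hη nfm
  have hfc := hf.h0.continuous ha.1
  obtain ⟨hu, hw, hp₀⟩ := background hL ha hB hM hc hη hb hfb hfc
  set m : ℝ := ∫ t in (0:ℝ)..1, ((B₀ (t, 0)).2 - fm t) with hmdef
  have hE1 := hu
  have hE2 := hw
  obtain ⟨u1, u2, u11, u12, u22, hu⟩ := hu
  obtain ⟨v1, v2, v11, v12, v22, hw⟩ := hw
  have hmv : vb / 2 ≤ |m| := by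
    have h1 := hv _ (mem_strip.2 m0 : ((0:ℝ), (0:ℝ)) ∈ strip L)
    have h2 := hw.b0 0 m0 0
    have h3 := abs_sub_abs_le_abs_sub (B₀ (0, 0)).2 m
    linarith
  have hm0 : m ≠ 0 := fun h => by rw [h, abs_zero] at hmv; linarith
  have hκm : m⁻¹ * m = 1 := inv_mul_cancel₀ hm0
  have hκ2 : |m⁻¹| ≤ 2 / vb := by
    rw [abs_inv, ← inv_div]
    exact inv_anti₀ (by positivity) hmv
  have hκ0 : m⁻¹ ≠ 0 := inv_ne_zero hm0
  generalize m⁻¹ = κ at hκm hκ2 hκ0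
  have hκn := abs_nonneg κ
  set c := 2 * (2 + L) + 4 / vb with hcdef
  have h4 : 0 < 4 / vb := by positivity
  set δ := |κ| * (c * η) with hδdef
  have hcη : 0 ≤ c * η := by positivity
  have hδ : δ ≤ 1 / 1000 := by
    refine le_trans ?_ hη1
    rw [mul_assoc]
    exact mul_le_mul_of_nonneg_right hκ2 hcη
  have hu' := hu.const_mul κ
  have hw' := (hw.const_mul κ).congr (w := fun x y => κ * (B₀ (x, y)).2 - 1) fun y hy x => by
    linear_combination hκm
  have s1 : 2 * (|κ| * η) ≤ δ := by
    rw [hδdef, mul_left_comm]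
    refine mul_le_mul_of_nonneg_left (mul_le_mul_of_nonneg_right ?_ hη) hκn
    linarith
  have s2 : 2 * (|κ| * (η * (2 + L))) ≤ δ := by
    rw [hδdef, mul_left_comm]
    refine mul_le_mul_of_nonneg_left ?_ hκn
    nlinarith
  have s3 : |κ ^ 2| * (2 * η) ≤ δ := by
    rw [hδdef, abs_pow, pow_two, mul_assoc]
    refine mul_le_mul_of_nonneg_left ?_ hκn
    calc |κ| * (2 * η) ≤ 2 / vb * (2 * η) := by gcongr
      _ = 4 / vb * η := by ring
      _ ≤ c * η := by gcongr; linarith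
  have s4 : |κ| * (2 * η) ≤ δ := by linarith
  have s5 : |κ * J| ≤ δ := by
    rw [abs_mul]
    refine mul_le_mul_of_nonneg_left ?_ hκn
    have h1 : |fluxC L B₀| ≤ η * L := by
      have := intervalIntegral.norm_integral_le_of_norm_le_const (a := (0:ℝ)) (b := L)
        (f := fun y => (B₀ (0, y)).1) (C := η) fun t ht => by
          rw [uIoc_of_le hL.le] at ht
          exact hu.b0 t ⟨ht.1.le, ht.2⟩ 0
      rwa [sub_zero, abs_of_pos hL, Real.norm_eq_abs, ← abs_neg] at this
    have h2 := abs_add_le (J - fluxC L B₀) (fluxC L B₀)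
    rw [sub_add_cancel] at h2
    nlinarith
  have ub := (hu'.trace ha m0).mono s1
  have ut := (hu'.trace ha mL).mono s1
  have vb' := (hw'.trace ha m0).mono s2
  have vt := (hw'.trace ha mL).mono s2
  have hb' := (hg.const_mul (κ ^ 2)).mono s3
  have ht := (hk.const_mul (κ ^ 2)).mono s3
  have he := (vb'.sub ((hf.const_mul κ).mono s4)).mono (two_mul δ).ge
  have pu : ∀ y x, κ * (B₀ (x + 1, y)).1 = κ * (B₀ (x, y)).1 := fun y x => by rw [hB.1]
  have pv : ∀ y x, κ * (B₀ (x + 1, y)).2 - 1 = κ * (B₀ (x, y)).2 - 1 := fun y x => by rw [hB.1]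
  have ph : ∀ x, κ ^ 2 * hm (x + 1) = κ ^ 2 * hm x := fun x => by rw [hhm.1]
  have pH : ∀ x, κ ^ 2 * hp (x + 1) = κ ^ 2 * hp x := fun x => by rw [hhp.1]
  have hcont : Continuous fun t => (B₀ (t, 0)).2 - fm t := by
    refine Continuous.sub (continuous_iff_continuousAt.2 fun t => ?_) hfc
    simpa using ((hw.f0.dx 0 m0 t).add_const m).continuousAt
  have me : ∫ x in (0:ℝ)..1, (κ * (B₀ (x, 0)).2 - 1 - κ * fm x) = 0 := by
    have : ∀ x, κ * (B₀ (x, 0)).2 - 1 - κ * fm x = κ * ((B₀ (x, 0)).2 - fm x) - 1 :=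
      fun x => by ring
    simp only [this]
    rw [intervalIntegral.integral_sub ((hcont.const_mul κ).intervalIntegrable _ _)
      (continuous_const.intervalIntegrable _ _), intervalIntegral.integral_const_mul, ← hmdef,
      hκm]
    simp
  obtain ⟨D, hD, hD0, hDb, hD1, hDw, hDk, hDq, hDJ⟩ := data_exists ha hδ ub vb' hb' ut vt ht he s5
    (pu 0) (pv 0) ph (pu L) (pv L) pH (fun x => by rw [hB.1, hfm.1]) me
  have hqd : ∀ {u u1 u2 v v1 v2 h h1 h2 : ℝ → ℝ}, H2 a δ u u1 u2 → H2 a δ v v1 v2 →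
      H2 a δ h h1 h2 → ∀ x, HasDerivAt (fun x => (u x ^ 2 + (1 + v x) ^ 2) / 2 + h x)
        (gq u u1 v v1 h1 x) x := fun hu hv hh x =>
    (((((hu.d0 x).pow 2).add (((hv.d0 x).const_add 1).pow 2)).div_const 2).add
      (hh.d0 x)).congr_deriv (by simp only [gq]; ring)
  have hqt := hqd ut vt ht
  simp only [← hDq] at hqt
  refine ⟨κ, m, D, _, _, _, 4, hκm, hκ2, hD, hD0, hDb, hDw, hDk, hqd ub vb' hb', fun x => ?_,
    fun x => ?_, hqt, fun x => ?_, fun x => ?_, fun x => ?_, fun x => ?_, hDJ, hE1, hE2, hp₀⟩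
  rotate_left 2
  · simp only [pu, pv, pH]
  · rw [hD1]
    ring
  · simp only [sq]
    ring
  · have hpC : C1F L (fun x y => κ ^ 2 * (p₀ (x, y) - p₀ (0, 0))) (fun _ _ => 0) fun _ _ => 0 :=
      C1F.congr (v := fun _ _ => 0) ⟨fun y hy x => hasDerivAt_const x 0,
        fun y hy x => hasDerivWithinAt_const y _ 0⟩ fun y hy x => by rw [hp₀ y hy, sub_self, mul_zero]
    rw [hDq, mul_add, (bernoulli_deriv hκ0 hu'.f0 hw'.f0 hpC mL).1, (hk.d0 x).deriv]
    simp only [gq]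
    ring
  · simp only [pu, pv, ph]
  · have h1 := abs_le.1 (ub.h0.1 x)
    have h2 := abs_le.1 (vb'.h0.1 x)
    have h3 := abs_le.1 (hb'.h0.1 x)
    refine abs_le.2 ⟨?_, ?_⟩ <;> nlinarith

end

section
open MeasureTheory

variable {L a C C' vb K M : ℝ}

theorem E2.mono {f : ℝ → ℝ → ℝ} (h : E2 L a C f) (hC : C ≤ C') : E2 L a C' f := by
  obtain ⟨_, _, _, _, _, h⟩ := h
  exact ⟨_, _, _, _, _, h.mono hC⟩

/-- Linear combinations. -/
theorem E2.comb {f g w : ℝ → ℝ → ℝ} (hf : E2 L a C f) (hg : E2 L a C' g) (c d : ℝ)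
    (hw : ∀ y ∈ Icc 0 L, ∀ x, w x y = c * f x y + d * g x y) :
    E2 L a (|c| * C + |d| * C') w := by
  obtain ⟨_, _, _, _, _, hf⟩ := hf
  obtain ⟨_, _, _, _, _, hg⟩ := hg
  exact ⟨_, _, _, _, _, ((hf.const_mul c).add (hg.const_mul d)).congr hw⟩

theorem curlF_congr {B B' : ℝ × ℝ → ℝ × ℝ} (h : EqOn B B' (strip L)) {z : ℝ × ℝ}
    (hz : z ∈ strip L) : curlF L B z = curlF L B' z := by
  have h1 : EqOn (c1 B) (c1 B') (strip L) := fun t ht => by simp only [c1, h ht]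
  have h2 : EqOn (c2 B) (c2 B') (strip L) := fun t ht => by simp only [c2, h ht]
  simp only [curlF, pdx, pdy, fderivWithin_congr h1 (h1 hz), fderivWithin_congr h2 (h2 hz)]

/-- The field determines the pressure up to a constant. -/
theorem pressure_unique (hL : 0 < L) (ha : 0 < a) {B B' : ℝ × ℝ → ℝ × ℝ} {p p' : ℝ × ℝ → ℝ}
    (hB : BP L 2 a B p) (hB' : BP L 2 a B' p') (hM : MHS L B p) (hM' : MHS L B' p')
    (h : EqOn B B' (strip L)) (h0 : p (0, 0) = p' (0, 0)) : EqOn p p' (strip L) := by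
  obtain ⟨C, p1, p2, _, _, _, hp⟩ := hB.2.2.2.e2 hL ha
  obtain ⟨C', q1, q2, _, _, _, hq⟩ := hB'.2.2.2.e2 hL ha
  have hd := hB.2.2.2.1.differentiableOn (by norm_num)
  have hd' := hB'.2.2.2.1.differentiableOn (by norm_num)
  have m0 : (0:ℝ) ∈ Icc 0 L := ⟨le_rfl, hL.le⟩
  have key : ∀ y ∈ Icc 0 L, ∀ x, p1 x y = q1 x y ∧ p2 x y = q2 x y := fun y hy x => by
    have hz : (x, y) ∈ strip L := mem_strip.2 hy
    obtain ⟨e1, e2⟩ := pdx_eq hL (hd _ hz) hp.f0 (fun _ _ _ => rfl) hy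
    obtain ⟨e3, e4⟩ := pdx_eq hL (hd' _ hz) hq.f0 (fun _ _ _ => rfl) hy
    have h1 := hM _ hz
    have h2 := hM' _ hz
    rw [← h hz, ← curlF_congr h hz] at h2
    rw [← e1, ← e2, ← e3, ← e4]
    exact ⟨neg_injective (h1.1.symm.trans h2.1), neg_injective (h1.2.1.symm.trans h2.2.1)⟩
  rintro ⟨x, y⟩ hz
  have hy := mem_strip.1 hz
  have := const_of_C1F_zero (v := fun x y => p (x, y) - p' (x, y))
    (v1 := fun x y => p1 x y - q1 x y) (v2 := fun x y => p2 x y - q2 x y)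
    ⟨fun y hy x => (hp.f0.dx y hy x).sub (hq.f0.dx y hy x),
      fun y hy x => (hp.f0.dy y hy x).sub (hq.f0.dy y hy x)⟩
    (fun y hy x => sub_eq_zero.2 (key y hy x).1) (fun y hy x => sub_eq_zero.2 (key y hy x).2)
    (x := x) (x' := 0) hy m0
  rw [h0, sub_self] at this
  exact sub_eq_zero.1 this

/-- The constants of the main theorem. -/
theorem exists_constants (hL : 0 < L) (ha : a ∈ Ioo (0:ℝ) 1) (hvb : 0 < vb) :
    ∃ M > (0:ℝ), ∃ K > (0:ℝ),
      32 * (200000 * (2 * (2 + L) + 4 / vb) * (K * M) / Rmax L a + K * M * (2 + L)) ≤ M ∧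
      K * M * (2 + L) ≤ vb / 2 ∧
      2 / vb * (2 * (2 + L) + 4 / vb) * (K * M) ≤ 1 / 1000 ∧
      100 * (2 / vb * ((2 * (2 + L) + 4 / vb) * (K * M))) ≤ Rmax L a ^ 2 ∧
      4 * (2 / vb * (M + K * M * (2 + L) + 2 * ((2 * (2 + L) + 4 / vb) * (K * M)))) * (1 + L) ≤
        Rmax L a := by
  have hR := Rmax_pos hL ha
  have hR1 := Rmax_le hL ha
  generalize Rmax L a = R at hR hR1
  have hc : 0 < 2 * (2 + L) + 4 / vb := by positivity
  generalize 2 * (2 + L) + 4 / vb = c at hc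
  obtain ⟨K, hKd⟩ : ∃ K, K = 1 / (32 * (200000 * c / R + (2 + L))) := ⟨_, rfl⟩
  have hK : 0 < K := by rw [hKd]; positivity
  have hq : 0 < 2 / vb := by positivity
  obtain ⟨q, hqd⟩ : ∃ q, q = 2 / vb := ⟨_, rfl⟩
  rw [← hqd] at hq ⊢
  have t1 : 0 < 4 * (q * (1 + K * (2 + L) + 2 * (c * K))) * (1 + L) := by positivity
  have t2 : 0 < 1000 * (q * (c * K)) := by positivity
  have t3 : 0 < q * (K * (2 + L)) := by positivity
  obtain ⟨A, hA⟩ : ∃ A, A = 4 * (q * (1 + K * (2 + L) + 2 * (c * K))) * (1 + L) +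
    1000 * (q * (c * K)) + q * (K * (2 + L)) := ⟨_, rfl⟩
  have hA0 : 0 < A := by rw [hA]; positivity
  have hM : 0 < R ^ 2 / A := by positivity
  have hAM : A * (R ^ 2 / A) = R ^ 2 := by field_simp
  generalize R ^ 2 / A = M at hM hAM
  have h1 : 4 * (q * (1 + K * (2 + L) + 2 * (c * K))) * (1 + L) * M ≤ R ^ 2 := by
    rw [← hAM]; gcongr; linarith
  have h2 : 1000 * (q * (c * K)) * M ≤ R ^ 2 := by
    rw [← hAM]; gcongr; linarith
  have h3 : q * (K * (2 + L)) * M ≤ R ^ 2 := by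
    rw [← hAM]; gcongr; linarith
  have hR2 : R ^ 2 ≤ R := by nlinarith
  refine ⟨M, hM, K, hK, le_of_eq ?_, ?_, ?_, ?_, ?_⟩
  · rw [hKd]; field_simp
  · have h4 : q * (K * M * (2 + L)) ≤ 1 := by linarith
    rw [hqd] at h4
    field_simp at h4 ⊢
    linarith
  · linarith
  · have : 0 ≤ q * (c * K) * M := by positivity
    linarith
  · linarith

end

theorem mhs_bvp_C_solvable (L a vb : ℝ) (hL : 0 < L) (ha : a ∈ Set.Ioo (0 : ℝ) 1)
    (hvb : 0 < vb) :
    ∃ ε > (0 : ℝ), ∃ M > (0 : ℝ), ∃ K > (0 : ℝ),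
      ∀ (B₀ : ℝ × ℝ → ℝ × ℝ) (p₀ : ℝ × ℝ → ℝ),
        BP L 2 a B₀ p₀ → MHS L B₀ p₀ →
        (∀ z ∈ strip L, curlF L B₀ z = 0) →
        (∀ z ∈ strip L, vb ≤ |(B₀ z).2|) →
        hNorm 2 a (strip L) (c1 B₀) ≤ ENNReal.ofReal ε →
        ∀ (hm hp fm : ℝ → ℝ) (J : ℝ),
          BData 2 a hm → BData 2 a hp → BData 2 a fm →
          hNorm 2 a (Set.univ : Set ℝ) hm + hNorm 2 a (Set.univ : Set ℝ) hp
              + hNorm 2 a (Set.univ : Set ℝ) fm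
              + ENNReal.ofReal |J - fluxC L B₀| ≤ ENNReal.ofReal (K * M) →
          ∃ B p, SolMCmod L a M B₀ p₀ hm hp fm J B p ∧
            ∀ B' p', SolMCmod L a M B₀ p₀ hm hp fm J B' p' →
              Set.EqOn B B' (strip L) ∧ Set.EqOn p p' (strip L) := by
  obtain ⟨M, hM0, K, hK, hC1, hC2, hC3, hC4, hC5⟩ := exists_constants hL ha hvb
  have hη : 0 < K * M := mul_pos hK hM0
  refine ⟨K * M, hη, M, hM0, K, hK, fun B₀ p₀ hB hMHS hc hv hb hm hp fm J hhm hhp hfm hsum => ?_⟩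
  generalize K * M = η at *
  have n1 := (le_add_right (le_add_right le_self_add)).trans hsum
  have n2 := (le_add_right (le_add_right le_add_self)).trans hsum
  have n3 := (le_add_right le_add_self).trans hsum
  have hJ : |J - fluxC L B₀| ≤ η :=
    (ENNReal.ofReal_le_ofReal_iff hη.le).1 (le_add_self.trans hsum)
  obtain ⟨κ, m, D, qb, qm, qt, Cq, hκm, hκ, hD, hD0, hDb, hDw, hDk, hqm, hqp, hqB, hqt, hqtp,
    hD1, hqb, hDq, hDJ, hu, hw, hp₀⟩ :=
    exists_normalisation hL ha hvb hη.le hC2 hC3 hB hMHS hc hv hb hhm hhp hfm n1 n2 n3 hJ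
  have hκ0 : κ ≠ 0 := left_ne_zero_of_mul_eq_one hκm
  have m0 : (0:ℝ) ∈ Icc 0 L := ⟨le_rfl, hL.le⟩
  have hR := Rmax_pos hL ha
  have hR16 := Rmax_le hL ha
  have hs := uniqueDiffOn_strip hL
  have hcη : 0 ≤ (2 * (2 + L) + 4 / vb) * η := by positivity
  have hδ : |κ| * ((2 * (2 + L) + 4 / vb) * η) ≤ 2 / vb * ((2 * (2 + L) + 4 / vb) * η) := by gcongr
  have hmκ : |m| * |κ| = 1 := by rw [← abs_mul, mul_comm, hκm, abs_one]
  set c := 2 * (2 + L) + 4 / vb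
  set δ := |κ| * (c * η) with hδdef
  have hδ0 : 0 ≤ δ := by positivity
  have hbdry : ∀ (B : ℝ × ℝ → ℝ × ℝ) (p : ℝ × ℝ → ℝ),
      ((∀ x, p (x, 0) + sq B (x, 0) / 2 = p₀ (x, 0) + sq B₀ (x, 0) / 2 + hm x) ∧
        (∀ x, deriv (fun t => p (t, L) + sq B (t, L) / 2) x
          = deriv (fun t => p₀ (t, L) + sq B₀ (t, L) / 2) x + deriv hp x) ∧
        (∀ x, -(B (x, 0)).2 = -(B₀ (x, 0)).2 + fm x) ∧ fluxC L B = J) ↔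
      ((∀ x, κ ^ 2 * (p (x, 0) + sq B (x, 0) / 2 - p₀ (0, 0)) = qb x) ∧
        (∀ x, κ ^ 2 * deriv (fun t => p (t, L) + sq B (t, L) / 2) x = D.q x) ∧
        (∀ x, κ * (B (x, 0)).2 - 1 = D.b 1 x) ∧ κ * fluxC L B = D.J) := fun B p => by
    refine and_congr (forall_congr' fun x => ?_) (and_congr (forall_congr' fun x => ?_)
      (and_congr (forall_congr' fun x => ?_) ?_))
    · rw [hqb, mul_right_inj' (pow_ne_zero 2 hκ0), hp₀ 0 m0 x]
      constructor <;> intro h <;> linarith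
    · rw [hDq, mul_right_inj' (pow_ne_zero 2 hκ0)]
    · rw [hD1, sub_left_inj, mul_right_inj' hκ0]
      constructor <;> intro h <;> linarith
    · rw [hDJ, mul_right_inj' hκ0]
  have hstate : ∀ B p, SolMCmod L a M B₀ p₀ hm hp fm J B p →
      ∃ S, Step L D S S ∧ St L a (Rmax L a) S ∧
        (∀ y ∈ Icc 0 L, ∀ x, κ * (B (x, y)).2 - 1 = S 1 x y) ∧
        ∀ y ∈ Icc 0 L, ∀ x, -(κ * (B (x, y)).1) = S 2 x y := by
    rintro B p ⟨hBP, hBM, hN, hbd⟩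
    obtain ⟨hbot, htop, hbv, hfl⟩ := (hbdry B p).1 hbd
    obtain ⟨e1, e2⟩ := (F2.of_hNorm hs (hBP.2.2.1.1.sub hB.2.2.1.1) hM0.le hN).e2_components ha.1
    have hr : ∀ {A}, 0 ≤ A → A ≤ η * (2 + L) →
        |κ| * M + |κ| * A ≤ 2 / vb * (M + η * (2 + L) + 2 * (c * η)) := fun {A} hA h => by
      rw [← mul_add]
      exact mul_le_mul hκ (by linarith) (by positivity) (by positivity)
    have d1 := (e1.comb (w := fun x y => κ * (B (x, y)).1) hu κ κ fun y hy x => by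
      simp only [Prod.fst_sub]; ring).mono (hr hη.le (by nlinarith))
    have d2 := (e2.comb (w := fun x y => κ * (B (x, y)).2 - 1) hw κ κ fun y hy x => by
      simp only [Prod.snd_sub]; linear_combination hκm).mono (hr (by positivity) le_rfl)
    refine state_of_solution hL ha (hD.mono (by nlinarith)) hR16 hC5 (by positivity)
      (fun x => (hDb x).trans ?_) hD0 hDw hDk hqm hκ0 hBP hBM d1 d2 hbv hbot htop hfl
    have h1 : 0 ≤ 2 / vb * M := by positivity
    have h2 : 0 ≤ 2 / vb * (η * (2 + L)) := by positivity
    linarith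
  have huniq : ∀ B p B' p', SolMCmod L a M B₀ p₀ hm hp fm J B p →
      SolMCmod L a M B₀ p₀ hm hp fm J B' p' → EqOn B B' (strip L) ∧ EqOn p p' (strip L) := by
    intro B p B' p' h h'
    obtain ⟨S, hS, hs, h1, h2⟩ := hstate B p h
    obtain ⟨S', hS', hs', h1', h2'⟩ := hstate B' p' h'
    have hDR := hD.mono (show 100 * δ ≤ Rmax L a by nlinarith)
    have hSS := fun i x {y : ℝ} (hy : y ∈ Icc 0 L) =>
      step_unique hL ha hDR le_rfl hs hs' hS hS' i x hy
    have hBB : EqOn B B' (strip L) := by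
      rintro ⟨x, y⟩ hz
      have hy := mem_strip.1 hz
      refine Prod.ext (mul_left_cancel₀ hκ0 ?_) (mul_left_cancel₀ hκ0 ?_)
      · linarith [h2 y hy x, h2' y hy x, hSS 2 x hy]
      · linarith [h1 y hy x, h1' y hy x, hSS 1 x hy]
    refine ⟨hBB, pressure_unique hL ha.1 h.1 h'.1 h.2.1 h'.2.1 hBB ?_⟩
    have e1 := h.2.2.2.1 0
    have e2 := h'.2.2.2.1 0
    rw [sq, hBB (mem_strip.2 m0), ← sq] at e1
    linarith
  have hRR : 100 * δ / Rmax L a * Rmax L a = 100 * δ := div_mul_cancel₀ _ hR.ne'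
  obtain ⟨B, p, hBP, hBM, e1, e2, hbv, hbot, htop, hfl⟩ :=
    exists_solution (P₀ := p₀ (0, 0)) hL ha (hRR.symm ▸ hD) (by positivity)
      ((div_le_iff₀ hR).2 (by nlinarith)) hD0 hDw hDk hqm hqp hqB hqt hqtp hκm
  have hC : |m| * (2000 * (100 * δ / Rmax L a)) = 200000 * c * η / Rmax L a := by
    rw [hδdef]
    linear_combination 200000 * c * η / Rmax L a * hmκ
  rw [hC] at e1 e2
  have hA : 0 ≤ 200000 * c * η / Rmax L a := by positivity
  have hN := (E2.hNorm_le (f := fun z => B z - B₀ z) hL ha (by positivity)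
    ((e1.comb hu 1 (-1) fun y hy x => by simp only [Prod.fst_sub]; ring).mono
      (C' := 200000 * c * η / Rmax L a + η * (2 + L)) (by norm_num; nlinarith))
    ((e2.comb hw 1 (-1) fun y hy x => by simp only [Prod.snd_sub]; ring).mono (by norm_num))).2
  have hsol : SolMCmod L a M B₀ p₀ hm hp fm J B p :=
    ⟨hBP, hBM, hN.trans (ENNReal.ofReal_le_ofReal hC1), (hbdry B p).2 ⟨hbot, htop, hbv, hfl⟩⟩
  exact ⟨B, p, hsol, fun B' p' h' => huniq B p B' p' hsol h'⟩
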